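/- Let −4 < ν < −2, A > 0, and let h₀ : ℝ → ℝ be bounded, measurable, nonnegative, not almost everywhere zero, with h₀(x) ~ A x^ν e^{−x} as x → ∞. Let a ∈ ℝ, η > 0, and let m : [0,∞) → ℝ be twice continuously differentiable of the form m(t) = 2t − (3/2) log(t+1) + a + r(t), where r(0) = −a, r(t) → 0 as t → ∞, and r''(t) = O(t^{−2−η}) as t → ∞. Set b := −(A e^{−a}/(2√π)) 2^{ν+1} Γ(ν/2 + 1); then b > 0 (since Γ(ν/2+1) < 0 for −4 < ν < −2), and there exists a constant α > 0 such that for every x ≥ 0: h(m(t)+x, t) = x e^{−x} [ α(1 − r(t) − 3√π/√t) − b t^{1+ν/2} + R(t) ], where the remainder R(t) satisfies: for every δ > 0 there exist C > 0 and t₀ such that |R(t)| ≤ δ t^{1+ν/2} + C (t^{−1/2−η} + r(t)²) for all t ≥ t₀. -/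

import Mathlib

open MeasureTheory ProbabilityTheory Filter Real Set Asymptotics

/-- A one-dimensional Brownian motion with normalization `E[B_t^2] = 2t`. -/
structure IsBrownianMotion {Ω : Type*} [MeasurableSpace Ω] (P : Measure Ω)
    (B : ℝ → Ω → ℝ) : Prop where
  cont : ∀ᵐ ω ∂P, Continuous fun s => B s ω
  init : ∀ᵐ ω ∂P, B 0 ω = 0
  meas : ∀ s, Measurable (B s)
  indep : ∀ (n : ℕ) (t : ℕ → ℝ), Monotone t →
    iIndepFun
      (fun i : Fin n => fun ω => B (t ((i : ℕ) + 1)) ω - B (t (i : ℕ)) ω) P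
  gauss : ∀ s t : ℝ, 0 ≤ s → s ≤ t →
    Measure.map (fun ω => B t ω - B s ω) P = gaussianReal 0 ((2 * (t - s)).toNNReal)

/-- Feynman–Kac representation of the solution of the linearised FKPP equation
`∂_t h = ∂_x² h + h` for `x > m t`, with absorbing boundary `h (m t) t = 0` and
initial condition `h₀`:
`h(x,t) = e^t E[h₀(x + B_t) 1{x + B_s > m(t-s) ∀ s ∈ [0,t]}]`. -/
noncomputable def fkppSol {Ω : Type*} [MeasurableSpace Ω] (P : Measure Ω)
    (B : ℝ → Ω → ℝ) (h₀ m : ℝ → ℝ) (x t : ℝ) : ℝ :=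
  Real.exp t *
    ∫ ω, ({ω : Ω | ∀ s ∈ Icc (0:ℝ) t, m (t - s) < x + B s ω}.indicator
      (fun ω => h₀ (x + B t ω)) ω) ∂P


noncomputable def gk (τ y : ℝ) : ℝ := (√(4 * π * τ))⁻¹ * Real.exp (-(y ^ 2 / (4 * τ)))
noncomputable def gk1 (τ y : ℝ) : ℝ := -(y / (2 * τ)) * gk τ y
noncomputable def gk2 (τ y : ℝ) : ℝ := (y ^ 2 / (4 * τ ^ 2) - 1 / (2 * τ)) * gk τ y
noncomputable def gk3 (τ y : ℝ) : ℝ := (-(y ^ 3 / (8 * τ ^ 3)) + 3 * y / (4 * τ ^ 2)) * gk τ y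
noncomputable def gk4 (τ y : ℝ) : ℝ :=
  (y ^ 4 / (16 * τ ^ 4) - 3 * y ^ 2 / (4 * τ ^ 3) + 3 / (4 * τ ^ 2)) * gk τ y
noncomputable def pk (τ x z : ℝ) : ℝ := gk τ (x - z) - gk τ (x + z)
noncomputable def Dk (τ x z : ℝ) : ℝ := -gk1 τ (x - z) - gk1 τ (x + z)
noncomputable def qk (τ x : ℝ) : ℝ := -2 * gk1 τ x

lemma gk_nonneg (τ y : ℝ) : 0 ≤ gk τ y := by unfold gk; positivity
lemma gk_pos {τ : ℝ} (hτ : 0 < τ) (y : ℝ) : 0 < gk τ y := by unfold gk; positivity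
lemma gk_neg (τ y : ℝ) : gk τ (-y) = gk τ y := by simp [gk]
lemma gk1_neg (τ y : ℝ) : gk1 τ (-y) = - gk1 τ y := by simp [gk1, gk_neg]; ring
lemma gk2_neg (τ y : ℝ) : gk2 τ (-y) = gk2 τ y := by simp [gk2, gk_neg]
lemma gk3_neg (τ y : ℝ) : gk3 τ (-y) = - gk3 τ y := by simp [gk3, gk_neg]; ring
lemma gk3_zero (τ : ℝ) : gk3 τ 0 = 0 := by simp [gk3]
lemma gk1_zero (τ : ℝ) : gk1 τ 0 = 0 := by simp [gk1]

lemma hasDerivAt_gk {τ : ℝ} (hτ : 0 < τ) (y : ℝ) : HasDerivAt (gk τ) (gk1 τ y) y := by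
  have h : HasDerivAt (fun y : ℝ => -(y ^ 2 / (4 * τ))) (-(2 * y / (4 * τ))) y := by
    exact (((hasDerivAt_pow 2 y).div_const (4 * τ)).neg).congr_deriv (by simp)
  have h2 := (h.exp).const_mul (√(4 * π * τ))⁻¹
  refine h2.congr_deriv ?_
  unfold gk1 gk; field_simp; ring

lemma hasDerivAt_gk1 {τ : ℝ} (hτ : 0 < τ) (y : ℝ) : HasDerivAt (gk1 τ) (gk2 τ y) y := by
  have h : HasDerivAt (fun y : ℝ => -(y / (2 * τ))) (-(1 / (2 * τ))) y :=
    ((hasDerivAt_id y).div_const (2 * τ)).neg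
  have h2 := h.mul (hasDerivAt_gk hτ y)
  refine h2.congr_deriv ?_
  unfold gk2 gk1; field_simp; ring

lemma hasDerivAt_gk2 {τ : ℝ} (hτ : 0 < τ) (y : ℝ) : HasDerivAt (gk2 τ) (gk3 τ y) y := by
  have h : HasDerivAt (fun y : ℝ => y ^ 2 / (4 * τ ^ 2) - 1 / (2 * τ)) (2 * y / (4 * τ ^ 2)) y := by
    simpa using ((hasDerivAt_pow 2 y).div_const (4 * τ ^ 2)).sub_const (1 / (2 * τ))
  have h2 := h.mul (hasDerivAt_gk hτ y)
  refine h2.congr_deriv ?_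
  unfold gk3 gk1; field_simp; ring

lemma hasDerivAt_gk3 {τ : ℝ} (hτ : 0 < τ) (y : ℝ) : HasDerivAt (gk3 τ) (gk4 τ y) y := by
  have h : HasDerivAt (fun y : ℝ => -(y ^ 3 / (8 * τ ^ 3)) + 3 * y / (4 * τ ^ 2))
      (-(3 * y ^ 2 / (8 * τ ^ 3)) + 3 / (4 * τ ^ 2)) y := by
    have a1 := ((hasDerivAt_pow 3 y).div_const (8 * τ ^ 3)).neg
    have a2 := ((hasDerivAt_id y).const_mul 3).div_const (4 * τ ^ 2)
    exact (a1.add a2).congr_deriv (by simp)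
  have h2 := h.mul (hasDerivAt_gk hτ y)
  refine h2.congr_deriv ?_
  unfold gk4 gk1; field_simp; ring

lemma gk_scale {τ : ℝ} (hτ : 0 < τ) (y : ℝ) :
    gk τ y = (2 * √π)⁻¹ * (√τ)⁻¹ * Real.exp (-((y / √τ) ^ 2 / 4)) := by
  unfold gk
  have h4 : √(4 * π * τ) = 2 * √π * √τ := by
    rw [Real.sqrt_mul (by positivity), Real.sqrt_mul (by norm_num)]
    congr 2
    rw [show (4:ℝ) = 2 ^ 2 by norm_num, Real.sqrt_sq (by norm_num)]
  rw [h4, mul_inv, div_pow, Real.sq_sqrt hτ.le]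
  congr 3; field_simp

/-- time derivative -/
lemma hasDerivAt_gk1_time {τ : ℝ} (hτ : 0 < τ) (y : ℝ) :
    HasDerivAt (fun τ => gk1 τ y) (gk3 τ y) τ := by
  have hs : 0 < √(4 * π * τ) := by positivity
  have e1 : HasDerivAt (fun τ : ℝ => √(4 * π * τ)) (4 * π / (2 * √(4 * π * τ))) τ := by
    have := ((hasDerivAt_id τ).const_mul (4 * π)).sqrt (by simp; positivity)
    simpa using this
  have e2 := e1.inv hs.ne'
  have e3 : HasDerivAt (fun τ : ℝ => -(y ^ 2 / (4 * τ))) (y ^ 2 / (4 * τ ^ 2)) τ := by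
    have a1 : HasDerivAt (fun τ : ℝ => 4 * τ) 4 τ := by
      simpa using (hasDerivAt_id τ).const_mul (4:ℝ)
    have := ((hasDerivAt_const τ (y ^ 2)).div a1 (by positivity)).neg
    refine this.congr_deriv ?_
    field_simp; ring
  have e4 := e2.mul e3.exp
  have e5 : HasDerivAt (fun τ : ℝ => -(y / (2 * τ))) (y / (2 * τ ^ 2)) τ := by
    have a1 : HasDerivAt (fun τ : ℝ => 2 * τ) 2 τ := by
      simpa using (hasDerivAt_id τ).const_mul (2:ℝ)
    have := ((hasDerivAt_const τ y).div a1 (by positivity)).neg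
    refine this.congr_deriv ?_
    field_simp; ring
  have e6 := e5.mul e4
  refine e6.congr_deriv ?_
  simp only [gk3, gk, Pi.mul_apply, Pi.inv_apply]
  have hsq : √(4 * π * τ) ^ 2 = 4 * π * τ := Real.sq_sqrt (by positivity)
  rw [hsq]
  generalize √(4 * π * τ) = S at *
  field_simp
  ring

lemma u_bound1 (u : ℝ) : u ^ 2 * Real.exp (-(u ^ 2 / 4)) ≤ 6 * Real.exp (-(u ^ 2 / 16)) := by
  have h : u ^ 2 ≤ 6 * Real.exp (3 * u ^ 2 / 16) := by
    have := Real.add_one_le_exp (3 * u ^ 2 / 16); nlinarith [sq_nonneg u]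
  calc u ^ 2 * Real.exp (-(u ^ 2 / 4)) ≤ 6 * Real.exp (3 * u ^ 2 / 16) * Real.exp (-(u ^ 2 / 4)) := by
        gcongr
    _ = 6 * Real.exp (-(u ^ 2 / 16)) := by
        rw [mul_assoc, ← Real.exp_add]; congr 2; ring

lemma u_bound2 (u : ℝ) : u ^ 4 * Real.exp (-(u ^ 2 / 4)) ≤ 60 * Real.exp (-(u ^ 2 / 16)) := by
  have h : u ^ 4 ≤ 60 * Real.exp (3 * u ^ 2 / 16) := by
    have := Real.quadratic_le_exp_of_nonneg (x := 3 * u ^ 2 / 16) (by positivity)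
    nlinarith [sq_nonneg u, sq_nonneg (u ^ 2)]
  calc u ^ 4 * Real.exp (-(u ^ 2 / 4)) ≤ 60 * Real.exp (3 * u ^ 2 / 16) * Real.exp (-(u ^ 2 / 4)) := by
        gcongr
    _ = 60 * Real.exp (-(u ^ 2 / 16)) := by
        rw [mul_assoc, ← Real.exp_add]; congr 2; ring

lemma u_bound0 (u : ℝ) : Real.exp (-(u ^ 2 / 4)) ≤ Real.exp (-(u ^ 2 / 16)) := by
  apply Real.exp_le_exp.2; nlinarith [sq_nonneg u]

lemma two_sqrt_pi_inv_le : (2 * √π)⁻¹ ≤ 1 / 3 := by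
  have : (3:ℝ) / 2 ≤ √π := by
    apply Real.le_sqrt_of_sq_le; nlinarith [Real.pi_gt_three]
  rw [inv_le_comm₀ (by positivity) (by norm_num)]; norm_num; linarith

lemma rpow_neg_half_nat {τ : ℝ} (hτ : 0 < τ) (n : ℕ) :
    τ ^ (-(n:ℝ) / 2) = ((√τ)⁻¹) ^ n := by
  rw [Real.sqrt_eq_rpow, ← Real.rpow_neg hτ.le, ← Real.rpow_natCast, ← Real.rpow_mul hτ.le]
  congr 1; ring

lemma gauss_poly_bound {τ : ℝ} (hτ : 0 < τ) (y Q c0 c2 c4 : ℝ) (n : ℕ) (hc0 : 0 ≤ c0) (hc2 : 0 ≤ c2)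
    (hc4 : 0 ≤ c4) (hc : c0 + 6 * c2 + 60 * c4 ≤ 30)
    (hQ : |Q| ≤ (c0 + c2 * (y / √τ) ^ 2 + c4 * (y / √τ) ^ 4) * ((√τ)⁻¹) ^ n) :
    |Q * gk τ y| ≤ 10 * τ ^ (-((n+1:ℕ):ℝ) / 2) * Real.exp (-(y ^ 2 / (16 * τ))) := by
  rw [rpow_neg_half_nat hτ, abs_mul, abs_of_nonneg (gk_nonneg _ _), gk_scale hτ]
  have hexp : Real.exp (-(y ^ 2 / (16 * τ))) = Real.exp (-((y / √τ) ^ 2 / 16)) := by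
    rw [div_pow, Real.sq_sqrt hτ.le]; congr 2; field_simp
  rw [hexp]
  set u := y / √τ
  have hs : 0 < (√τ)⁻¹ := by positivity
  have key : (c0 + c2 * u ^ 2 + c4 * u ^ 4) * Real.exp (-(u ^ 2 / 4)) ≤ 30 * Real.exp (-(u ^ 2 / 16)) := by
    have b0 := mul_le_mul_of_nonneg_left (u_bound0 u) hc0
    have b1 := mul_le_mul_of_nonneg_left (u_bound1 u) hc2
    have b2 := mul_le_mul_of_nonneg_left (u_bound2 u) hc4
    have b3 := mul_le_mul_of_nonneg_right hc (Real.exp_pos (-(u ^ 2 / 16))).le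
    linarith
  calc |Q| * ((2 * √π)⁻¹ * (√τ)⁻¹ * Real.exp (-(u ^ 2 / 4)))
      ≤ ((c0 + c2 * u ^ 2 + c4 * u ^ 4) * ((√τ)⁻¹) ^ n) *
        (1 / 3 * (√τ)⁻¹ * Real.exp (-(u ^ 2 / 4))) := by
        gcongr; exact two_sqrt_pi_inv_le
    _ = ((√τ)⁻¹) ^ (n + 1) * (1/3) * ((c0 + c2 * u ^ 2 + c4 * u ^ 4) * Real.exp (-(u ^ 2 / 4))) := by ring
    _ ≤ ((√τ)⁻¹) ^ (n + 1) * (1/3) * (30 * Real.exp (-(u ^ 2 / 16))) := by gcongr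
    _ = _ := by ring

lemma gk_bound {τ : ℝ} (hτ : 0 < τ) (y : ℝ) :
    |gk τ y| ≤ 10 * τ ^ (-1/2 : ℝ) * Real.exp (-(y ^ 2 / (16 * τ))) := by
  have := gauss_poly_bound hτ y 1 1 0 0 0 (by norm_num) (by norm_num) (by norm_num) (by norm_num)
    (by simp)
  simpa using this

lemma div_sqrt_aux {τ : ℝ} (hτ : 0 < τ) (y : ℝ) :
    ∃ u σ : ℝ, 0 < σ ∧ u = y / √τ ∧ σ = √τ ∧ τ = σ ^ 2 ∧ y = u * σ := by
  refine ⟨y / √τ, √τ, by positivity, rfl, rfl, (Real.sq_sqrt hτ.le).symm, ?_⟩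
  field_simp

lemma gk1_bound {τ : ℝ} (hτ : 0 < τ) (y : ℝ) :
    |gk1 τ y| ≤ 10 * τ ^ (-1 : ℝ) * Real.exp (-(y ^ 2 / (16 * τ))) := by
  have := gauss_poly_bound hτ y (-(y / (2 * τ))) 1 1 0 1 (by norm_num) (by norm_num) (by norm_num)
    (by norm_num) ?_
  · rw [show (-((1+1:ℕ):ℝ) / 2) = -1 by norm_num] at this; exact this
  · obtain ⟨u, σ, hσ, hu, hσ', h1, h2⟩ := div_sqrt_aux hτ y
    rw [← hu, ← hσ', h1, h2, show -(u * σ / (2 * σ ^ 2)) = (-u/2) * σ⁻¹ by field_simp, abs_mul,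
      abs_of_pos (inv_pos.2 hσ), pow_one]
    gcongr
    rw [abs_le]; constructor <;> nlinarith [sq_nonneg (u-1), sq_nonneg (u+1)]

lemma gk2_bound {τ : ℝ} (hτ : 0 < τ) (y : ℝ) :
    |gk2 τ y| ≤ 10 * τ ^ (-3/2 : ℝ) * Real.exp (-(y ^ 2 / (16 * τ))) := by
  have := gauss_poly_bound hτ y (y ^ 2 / (4 * τ ^ 2) - 1 / (2 * τ)) 1 1 0 2 (by norm_num)
    (by norm_num) (by norm_num) (by norm_num) ?_
  · rw [show (-((2+1:ℕ):ℝ) / 2) = -3/2 by norm_num] at this; exact this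
  · obtain ⟨u, σ, hσ, hu, hσ', h1, h2⟩ := div_sqrt_aux hτ y
    rw [← hu, ← hσ', h1, h2, show (u * σ) ^ 2 / (4 * (σ ^ 2) ^ 2) - 1 / (2 * σ ^ 2)
      = (u ^ 2 / 4 - 1 / 2) * σ⁻¹ ^ 2 by field_simp, abs_mul, abs_of_pos (pow_pos (inv_pos.2 hσ) 2)]
    gcongr
    rw [abs_le]; constructor <;> nlinarith [sq_nonneg u]

lemma gk3_bound {τ : ℝ} (hτ : 0 < τ) (y : ℝ) :
    |gk3 τ y| ≤ 10 * τ ^ (-2 : ℝ) * Real.exp (-(y ^ 2 / (16 * τ))) := by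
  have := gauss_poly_bound hτ y (-(y ^ 3 / (8 * τ ^ 3)) + 3 * y / (4 * τ ^ 2)) 1 1 (1/8) 3 (by norm_num)
    (by norm_num) (by norm_num) (by norm_num) ?_
  · rw [show (-((3+1:ℕ):ℝ) / 2) = -2 by norm_num] at this; exact this
  · obtain ⟨u, σ, hσ, hu, hσ', h1, h2⟩ := div_sqrt_aux hτ y
    rw [← hu, ← hσ', h1, h2, show -((u * σ) ^ 3 / (8 * (σ ^ 2) ^ 3)) + 3 * (u * σ) / (4 * (σ ^ 2) ^ 2)
      = (-u ^ 3 / 8 + 3 * u / 4) * σ⁻¹ ^ 3 by field_simp, abs_mul, abs_of_pos (pow_pos (inv_pos.2 hσ) 3)]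
    gcongr
    rw [abs_le]; constructor <;>
      nlinarith [sq_nonneg (u-1), sq_nonneg (u+1), sq_nonneg (u * (u-1)), sq_nonneg (u * (u+1))]

lemma gk4_bound {τ : ℝ} (hτ : 0 < τ) (y : ℝ) :
    |gk4 τ y| ≤ 10 * τ ^ (-5/2 : ℝ) * Real.exp (-(y ^ 2 / (16 * τ))) := by
  have := gauss_poly_bound hτ y (y ^ 4 / (16 * τ ^ 4) - 3 * y ^ 2 / (4 * τ ^ 3) + 3 / (4 * τ ^ 2)) 1 1
    (1/16) 4 (by norm_num) (by norm_num) (by norm_num) (by norm_num) ?_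
  · rw [show (-((4+1:ℕ):ℝ) / 2) = -5/2 by norm_num] at this; exact this
  · obtain ⟨u, σ, hσ, hu, hσ', h1, h2⟩ := div_sqrt_aux hτ y
    rw [← hu, ← hσ', h1, h2, show (u * σ) ^ 4 / (16 * (σ ^ 2) ^ 4) - 3 * (u * σ) ^ 2 / (4 * (σ ^ 2) ^ 3)
      + 3 / (4 * (σ ^ 2) ^ 2)
      = (u ^ 4 / 16 - 3 * u ^ 2 / 4 + 3 / 4) * σ⁻¹ ^ 4 by field_simp, abs_mul,
      abs_of_pos (pow_pos (inv_pos.2 hσ) 4)]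
    gcongr
    rw [abs_le]; constructor <;>
      nlinarith [sq_nonneg u, sq_nonneg (u^2)]

@[fun_prop] lemma measurable_gk : Measurable (fun p : ℝ × ℝ => gk p.1 p.2) := by unfold gk; fun_prop
@[fun_prop] lemma measurable_gk1 : Measurable (fun p : ℝ × ℝ => gk1 p.1 p.2) := by
  unfold gk1 gk; fun_prop
@[fun_prop] lemma measurable_gk2 : Measurable (fun p : ℝ × ℝ => gk2 p.1 p.2) := by
  unfold gk2 gk; fun_prop
@[fun_prop] lemma Measurable.gk' {α : Type*} [MeasurableSpace α] {f g : α → ℝ} (hf : Measurable f)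
    (hg : Measurable g) : Measurable (fun a => gk (f a) (g a)) := measurable_gk.comp (hf.prodMk hg)
@[fun_prop] lemma Measurable.gk1' {α : Type*} [MeasurableSpace α] {f g : α → ℝ} (hf : Measurable f)
    (hg : Measurable g) : Measurable (fun a => gk1 (f a) (g a)) := measurable_gk1.comp (hf.prodMk hg)
@[fun_prop] lemma Measurable.gk2' {α : Type*} [MeasurableSpace α] {f g : α → ℝ} (hf : Measurable f)
    (hg : Measurable g) : Measurable (fun a => gk2 (f a) (g a)) := measurable_gk2.comp (hf.prodMk hg)
@[fun_prop] lemma Measurable.pk' {α : Type*} [MeasurableSpace α] {f g h : α → ℝ} (hf : Measurable f)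
    (hg : Measurable g) (hh : Measurable h) : Measurable (fun a => pk (f a) (g a) (h a)) := by
  unfold pk; fun_prop
@[fun_prop] lemma Measurable.Dk' {α : Type*} [MeasurableSpace α] {f g h : α → ℝ} (hf : Measurable f)
    (hg : Measurable g) (hh : Measurable h) : Measurable (fun a => Dk (f a) (g a) (h a)) := by
  unfold Dk; fun_prop
@[fun_prop] lemma Measurable.qk' {α : Type*} [MeasurableSpace α] {f g : α → ℝ} (hf : Measurable f)
    (hg : Measurable g) : Measurable (fun a => qk (f a) (g a)) := by
  unfold qk; fun_prop

lemma gk_eq_pdf {τ : ℝ} (hτ : 0 < τ) (y : ℝ) : gk τ y = gaussianPDFReal 0 (2 * τ).toNNReal y := by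
  unfold gk gaussianPDFReal
  rw [Real.coe_toNNReal _ (by positivity)]
  congr 3
  · ring
  · field_simp; ring

lemma toNNReal_ne {τ : ℝ} (hτ : 0 < τ) : (2 * τ).toNNReal ≠ 0 := by
  simp; exact hτ

lemma integrable_gk {τ : ℝ} (hτ : 0 < τ) : Integrable (gk τ) := by
  rw [funext (gk_eq_pdf hτ)]; exact integrable_gaussianPDFReal _ _

lemma integral_gk {τ : ℝ} (hτ : 0 < τ) : ∫ y, gk τ y = 1 := by
  rw [funext (gk_eq_pdf hτ)]; exact integral_gaussianPDFReal_eq_one _ (toNNReal_ne hτ)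

lemma gk_le_rpow {τ : ℝ} (hτ : 0 < τ) (y : ℝ) : gk τ y ≤ τ ^ (-1/2 : ℝ) := by
  rw [gk_scale hτ]
  have h := rpow_neg_half_nat hτ 1
  simp at h
  rw [h]
  have h1 : Real.exp (-((y / √τ) ^ 2 / 4)) ≤ 1 := Real.exp_le_one_iff.2 (by
    have := sq_nonneg (y / √τ); linarith)
  have h2 := two_sqrt_pi_inv_le
  calc _ ≤ 1 * (√τ)⁻¹ * 1 := by gcongr; linarith
    _ = _ := by ring

/-- completing the square -/
lemma gk_mul_gk {τ σ : ℝ} (hτ : 0 < τ) (hσ : 0 < σ) (x y z : ℝ) :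
    gk τ (x - z) * gk σ (z - y) =
      gk (τ + σ) (x - y) * gk (τ * σ / (τ + σ)) (z - (σ * x + τ * y) / (τ + σ)) := by
  unfold gk
  have h1 : (√(4 * π * τ))⁻¹ * (√(4 * π * σ))⁻¹ =
      (√(4 * π * (τ + σ)))⁻¹ * (√(4 * π * (τ * σ / (τ + σ))))⁻¹ := by
    rw [← mul_inv, ← mul_inv, ← Real.sqrt_mul (by positivity), ← Real.sqrt_mul (by positivity)]
    congr 2; field_simp
  have h2 : Real.exp (-((x - z) ^ 2 / (4 * τ))) * Real.exp (-((z - y) ^ 2 / (4 * σ))) =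
      Real.exp (-((x - y) ^ 2 / (4 * (τ + σ)))) *
      Real.exp (-((z - (σ * x + τ * y) / (τ + σ)) ^ 2 / (4 * (τ * σ / (τ + σ))))) := by
    rw [← Real.exp_add, ← Real.exp_add]; congr 1
    field_simp; ring
  calc _ = ((√(4 * π * τ))⁻¹ * (√(4 * π * σ))⁻¹) *
      (Real.exp (-((x - z) ^ 2 / (4 * τ))) * Real.exp (-((z - y) ^ 2 / (4 * σ)))) := by ring
    _ = _ := by rw [h1, h2]; ring

lemma gk_conv {τ σ : ℝ} (hτ : 0 < τ) (hσ : 0 < σ) (x y : ℝ) :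
    ∫ z, gk τ (x - z) * gk σ (z - y) = gk (τ + σ) (x - y) := by
  simp_rw [gk_mul_gk hτ hσ]
  rw [integral_const_mul, integral_sub_right_eq_self (fun z => gk (τ * σ / (τ + σ)) z),
    integral_gk (by positivity), mul_one]

lemma integrable_gk_conv {τ σ : ℝ} (hτ : 0 < τ) (hσ : 0 < σ) (x y : ℝ) :
    Integrable (fun z => gk τ (x - z) * gk σ (z - y)) := by
  simp_rw [gk_mul_gk hτ hσ]
  exact ((integrable_gk (by positivity)).comp_sub_right _).const_mul _

lemma integrable_exp_gauss {c : ℝ} (hc : 0 < c) : Integrable (fun y : ℝ => Real.exp (-(y ^ 2 / c))) := by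
  have := integrable_exp_neg_mul_sq (b := 1 / c) (by positivity)
  convert this using 2; ring_nf

lemma integral_exp_gauss {c : ℝ} : ∫ y : ℝ, Real.exp (-(y ^ 2 / c)) = √(π * c) := by
  have := integral_gaussian (1 / c)
  simp at this
  rw [← this]; congr 1; ext y; ring_nf

lemma integrable_gk1 {τ : ℝ} (hτ : 0 < τ) : Integrable (gk1 τ) := by
  refine Integrable.mono' (((integrable_exp_gauss (c := 16 * τ) (by positivity))).const_mul
    (10 * τ ^ (-1 : ℝ))) ?_ (Eventually.of_forall fun y => gk1_bound hτ y)
  exact (by fun_prop : Measurable (fun y => gk1 τ y)).aestronglyMeasurable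

lemma integral_gk1 {τ : ℝ} : ∫ y, gk1 τ y = 0 := by
  have := integral_neg_eq_self (fun y => gk1 τ y) volume
  simp_rw [gk1_neg, integral_neg] at this
  linarith

lemma gk1_mul_gk {τ σ : ℝ} (hτ : 0 < τ) (hσ : 0 < σ) (x y z : ℝ) :
    gk1 τ (x - z) * gk σ (z - y) =
      gk1 (τ + σ) (x - y) * gk (τ * σ / (τ + σ)) (z - (σ * x + τ * y) / (τ + σ))
      - gk (τ + σ) (x - y) * (σ / (τ + σ)) *
        gk1 (τ * σ / (τ + σ)) (z - (σ * x + τ * y) / (τ + σ)) := by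
  have h := gk_mul_gk hτ hσ x y z
  unfold gk1
  rw [mul_assoc, h]
  field_simp
  ring

lemma gk1_conv {τ σ : ℝ} (hτ : 0 < τ) (hσ : 0 < σ) (x y : ℝ) :
    ∫ z, gk1 τ (x - z) * gk σ (z - y) = gk1 (τ + σ) (x - y) := by
  simp_rw [gk1_mul_gk hτ hσ]
  have hp : 0 < τ * σ / (τ + σ) := by positivity
  rw [integral_sub (((integrable_gk hp).comp_sub_right _).const_mul _)
    (((integrable_gk1 hp).comp_sub_right _).const_mul _), integral_const_mul, integral_const_mul,
    integral_sub_right_eq_self (fun z => gk (τ * σ / (τ + σ)) z),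
    integral_sub_right_eq_self (fun z => gk1 (τ * σ / (τ + σ)) z),
    integral_gk (by positivity), integral_gk1]
  ring

lemma integrable_gk1_conv {τ σ : ℝ} (hτ : 0 < τ) (hσ : 0 < σ) (x y : ℝ) :
    Integrable (fun z => gk1 τ (x - z) * gk σ (z - y)) := by
  simp_rw [gk1_mul_gk hτ hσ]
  have hp : 0 < τ * σ / (τ + σ) := by positivity
  exact (((integrable_gk hp).comp_sub_right _).const_mul _).sub
    (((integrable_gk1 hp).comp_sub_right _).const_mul _)

lemma pk_eq (τ x z : ℝ) : pk τ x z = gk τ (x - z) - gk τ (-x - z) := by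
  unfold pk; rw [← gk_neg τ (x + z)]; ring_nf
lemma Dk_eq (τ x z : ℝ) : Dk τ x z = -gk1 τ (x - z) + gk1 τ (-x - z) := by
  unfold Dk; rw [show -x - z = -(x+z) by ring, gk1_neg]; ring
lemma pk_neg (τ x z : ℝ) : pk τ x (-z) = - pk τ x z := by
  unfold pk; simp [sub_eq_add_neg]
lemma Dk_zero (τ x : ℝ) : Dk τ x 0 = qk τ x := by unfold Dk qk; simp; ring

/-- Chapman-Kolmogorov for the killed kernels -/
lemma pk_conv {τ σ : ℝ} (hτ : 0 < τ) (hσ : 0 < σ) (x c y : ℝ) :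
    ∫ z, pk τ x z * gk σ (z + c - y) = pk (τ + σ) x (y - c) := by
  have e : ∀ z, pk τ x z * gk σ (z + c - y) =
    gk τ (x - z) * gk σ (z - (y - c)) - gk τ (-x - z) * gk σ (z - (y - c)) := by
    intro z; rw [pk_eq, show z + c - y = z - (y - c) by ring]; ring
  simp_rw [e]
  rw [integral_sub (integrable_gk_conv hτ hσ _ _) (integrable_gk_conv hτ hσ _ _), gk_conv hτ hσ,
    gk_conv hτ hσ, pk_eq]

lemma Dk_conv {τ σ : ℝ} (hτ : 0 < τ) (hσ : 0 < σ) (x c y : ℝ) :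
    ∫ z, Dk τ x z * gk σ (z + c - y) = Dk (τ + σ) x (y - c) := by
  have e : ∀ z, Dk τ x z * gk σ (z + c - y) =
    gk1 τ (-x - z) * gk σ (z - (y - c)) - gk1 τ (x - z) * gk σ (z - (y - c)) := by
    intro z; rw [Dk_eq, show z + c - y = z - (y - c) by ring]; ring
  simp_rw [e]
  rw [integral_sub (integrable_gk1_conv hτ hσ _ _) (integrable_gk1_conv hτ hσ _ _), gk1_conv hτ hσ,
    gk1_conv hτ hσ, Dk_eq]; ring

lemma hasDerivAt_pk {τ : ℝ} (hτ : 0 < τ) (x z : ℝ) : HasDerivAt (fun z => pk τ x z) (Dk τ x z) z := by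
  have h1 : HasDerivAt (fun z => gk τ (x - z)) (gk1 τ (x - z) * (-1)) z :=
    (hasDerivAt_gk hτ (x - z)).comp z ((hasDerivAt_id z).const_sub x)
  have h2 : HasDerivAt (fun z => gk τ (x + z)) (gk1 τ (x + z) * 1) z :=
    (hasDerivAt_gk hτ (x + z)).comp z ((hasDerivAt_id z).const_add x)
  refine (h1.sub h2).congr_deriv ?_
  unfold Dk; ring

noncomputable def vk (l w0 : ℝ → ℝ) (dt : ℝ) : ℕ → ℝ → ℝ
  | 0 => w0
  | k + 1 => fun z => ∫ y in Ioi (0:ℝ),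
      gk (((k:ℝ) + 1) * dt - k * dt) (z + l (((k:ℝ) + 1) * dt) - l (k * dt) - y) * vk l w0 dt k y

noncomputable def Fk (l w0 : ℝ → ℝ) (dt : ℝ) (k : ℕ) (s z : ℝ) : ℝ :=
  ∫ y in Ioi (0:ℝ), gk (s - k * dt) (z + l s - l (k * dt) - y) * vk l w0 dt k y

lemma vk_succ (l w0 : ℝ → ℝ) (dt : ℝ) (k : ℕ) (z : ℝ) :
    vk l w0 dt (k + 1) z = Fk l w0 dt k (((k:ℝ) + 1) * dt) z := rfl

lemma indep_first {Ω : Type*} [MeasurableSpace Ω] {P : Measure Ω} {B : ℝ → Ω → ℝ}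
    (hB : IsBrownianMotion P B) (t : ℕ → ℝ) (ht : Monotone t) (N : ℕ) :
    IndepFun (fun ω => B (t 1) ω - B (t 0) ω)
      (fun ω (i : Fin N) => B (t ((i:ℕ) + 2)) ω - B (t 1) ω) P := by
  have h := hB.indep (N + 1) t ht
  have hm : ∀ i : Fin (N + 1), Measurable (fun ω => B (t ((i : ℕ) + 1)) ω - B (t (i : ℕ)) ω) :=
    fun i => (hB.meas _).sub (hB.meas _)
  have h2 := h.indepFun_finset ({0} : Finset (Fin (N + 1))) (Finset.univ \ {0})
    Finset.disjoint_sdiff hm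
  let φ : (({0} : Finset (Fin (N + 1))) → ℝ) → ℝ := fun v => v ⟨0, by simp⟩
  let ψ : ((Finset.univ \ {0} : Finset (Fin (N + 1))) → ℝ) → (Fin N → ℝ) := fun v i =>
    ∑ j ∈ Finset.range ((i:ℕ) + 1), if hj : j + 1 < N + 1 then
      v ⟨⟨j + 1, hj⟩, by simp [Fin.ext_iff]⟩ else 0
  have hφ : Measurable φ := measurable_pi_apply _
  have hψ : Measurable ψ := by
    refine measurable_pi_lambda _ fun i => Finset.measurable_sum _ fun j _ => ?_
    by_cases hj : j + 1 < N + 1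
    · simp only [hj, dite_true]; exact measurable_pi_apply _
    · simp only [hj, dite_false]; exact measurable_const
  have h3 := h2.comp hφ hψ
  suffices hψe : (fun ω (i : Fin N) => B (t ((i:ℕ) + 2)) ω - B (t 1) ω) = ψ ∘ (fun a i =>
      B (t (((i:Fin (N+1)) : ℕ) + 1)) a - B (t ((i:Fin (N+1)) : ℕ)) a) by
    rw [hψe]; exact h3
  funext ω i
  simp only [Function.comp, ψ]
  have e := Finset.sum_range_sub (fun j => B (t (j + 1)) ω) ((i:ℕ) + 1)
  simp only [zero_add] at e
  rw [show (i:ℕ) + 1 + 1 = i + 2 by ring] at e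
  rw [← e]
  refine Finset.sum_congr rfl fun j hj => ?_
  rw [dif_pos]
  have := Finset.mem_range.1 hj
  have := i.2
  omega

lemma indep_fubini {Ω : Type*} [MeasurableSpace Ω] {P : Measure Ω} [IsProbabilityMeasure P]
    {E : Type*} [MeasurableSpace E] {D : Ω → ℝ} {Y : Ω → E} (hD : Measurable D) (hY : Measurable Y)
    (hI : IndepFun D Y P) (Φ : ℝ × E → ℝ) (hΦ : Measurable Φ) (C : ℝ) (hC : ∀ p, |Φ p| ≤ C) :
    ∫ ω, Φ (D ω, Y ω) ∂P = ∫ d, (∫ ω, Φ (d, Y ω) ∂P) ∂(P.map D) := by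
  have h := (indepFun_iff_map_prod_eq_prod_map_map hD.aemeasurable hY.aemeasurable).1 hI
  have e1 : ∫ ω, Φ (D ω, Y ω) ∂P = ∫ p, Φ p ∂(P.map (fun ω => (D ω, Y ω))) := by
    rw [integral_map (hD.prodMk hY).aemeasurable hΦ.aestronglyMeasurable]
  haveI : IsProbabilityMeasure (P.map D) := Measure.isProbabilityMeasure_map hD.aemeasurable
  haveI : IsProbabilityMeasure (P.map Y) := Measure.isProbabilityMeasure_map hY.aemeasurable
  rw [e1, h, integral_prod]
  · refine integral_congr_ae (Eventually.of_forall fun d => ?_)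
    have hΦd : Measurable (fun y => Φ (d, y)) := hΦ.comp measurable_prodMk_left
    exact integral_map hY.aemeasurable hΦd.aestronglyMeasurable
  · exact Integrable.of_bound hΦ.aestronglyMeasurable C (Eventually.of_forall hC)

lemma gk_tilt {σ : ℝ} (hσ : 0 < σ) (y : ℝ) :
    Real.exp (y - σ) * gk σ y = gk σ (y - 2 * σ) := by
  unfold gk
  rw [mul_left_comm, ← Real.exp_add]; congr 2; field_simp; ring

lemma A1 {Ω : Type*} [MeasurableSpace Ω] {P : Measure Ω} [IsProbabilityMeasure P] {B : ℝ → Ω → ℝ}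
    (hB : IsBrownianMotion P B) (h0 m : ℝ → ℝ) (hm0 : m 0 = 0) (hmeas : Measurable h0) (C : ℝ)
    (hC : ∀ x, |h0 x| ≤ C) {dt : ℝ} (hdt : 0 < dt) (k : ℕ) : ∀ (T0 s X : ℝ), 0 ≤ T0 →
    (k:ℝ) * dt < s →
    Real.exp (X - s) * ∫ ω, {ω | ∀ j : Fin (k + 1), m (((j:ℕ):ℝ) * dt) <
      X + (B (T0 + s - ((j:ℕ):ℝ) * dt) ω - B T0 ω)}.indicator
        (fun ω => h0 (X + (B (T0 + s) ω - B T0 ω))) ω ∂P =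
    Fk (fun u => m u - 2 * u) (fun z => Real.exp z * h0 z) dt k s (X - m s) := by
  have hC0 : 0 ≤ C := le_trans (abs_nonneg _) (hC 0)
  have tr : ∀ (c : ℝ) (f : ℝ → ℝ), ∫ d, (Ioi c).indicator f d = ∫ y in Ioi (0:ℝ), f (y + c) := by
    intro c f
    rw [integral_indicator measurableSet_Ioi]
    have := (measurePreserving_add_right volume c).setIntegral_preimage_emb
      (MeasurableEquiv.addRight c).measurableEmbedding f (Ioi c)
    rw [← this]; simp
  induction k with
  | zero =>
    intro T0 s X hT hs
    simp only [Nat.cast_zero, zero_mul] at hs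
    have hg := hB.gauss T0 (T0 + s) hT (by linarith)
    rw [show T0 + s - T0 = s by ring] at hg
    have hD : Measurable (fun ω => B (T0 + s) ω - B T0 ω) := (hB.meas _).sub (hB.meas _)
    have e1 : ∀ ω, {ω | ∀ j : Fin (0 + 1), m (((j:ℕ):ℝ) * dt) <
      X + (B (T0 + s - ((j:ℕ):ℝ) * dt) ω - B T0 ω)}.indicator
        (fun ω => h0 (X + (B (T0 + s) ω - B T0 ω))) ω =
        (fun d => (Ioi (-X)).indicator (fun d => h0 (X + d)) d) (B (T0 + s) ω - B T0 ω) := by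
      intro ω
      have : (ω ∈ {ω | ∀ j : Fin (0 + 1), m (((j:ℕ):ℝ) * dt) <
          X + (B (T0 + s - ((j:ℕ):ℝ) * dt) ω - B T0 ω)}) ↔
          (B (T0 + s) ω - B T0 ω) ∈ Ioi (-X) := by
        simp only [Nat.reduceAdd, mem_setOf_eq, mem_Ioi, Fin.forall_fin_one, Fin.val_zero,
          Nat.cast_zero, zero_mul, hm0, sub_zero]
        constructor <;> intro h <;> linarith
      by_cases hx : (B (T0 + s) ω - B T0 ω) ∈ Ioi (-X)
      · rw [indicator_of_mem (this.2 hx)]; simp only; rw [indicator_of_mem hx]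
      · rw [indicator_of_notMem (fun h => hx (this.1 h))]; simp only; rw [indicator_of_notMem hx]
    simp_rw [e1]
    have hmf : Measurable (fun d => (Ioi (-X)).indicator (fun d => h0 (X + d)) d) :=
      (hmeas.comp (measurable_const.add measurable_id)).indicator measurableSet_Ioi
    rw [← integral_map (φ := fun ω => B (T0 + s) ω - B T0 ω) hD.aemeasurable hmf.aestronglyMeasurable,
      hg, integral_gaussianReal_eq_integral_smul (toNNReal_ne hs)]
    have e2 : ∀ d, gaussianPDFReal 0 (2 * s).toNNReal d • (Ioi (-X)).indicator (fun d => h0 (X + d)) d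
        = (Ioi (-X)).indicator (fun d => gk s d * h0 (X + d)) d := by
      intro d
      rw [← gk_eq_pdf hs]
      by_cases hx : d ∈ Ioi (-X)
      · rw [indicator_of_mem hx, indicator_of_mem hx]; rfl
      · rw [indicator_of_notMem hx, indicator_of_notMem hx]; simp
    simp_rw [e2]
    rw [tr, ← integral_const_mul]
    unfold Fk vk
    refine setIntegral_congr_fun measurableSet_Ioi fun y _ => ?_
    simp only [Nat.cast_zero, zero_mul, sub_zero, mul_zero, hm0]
    have e3 : gk s (y + -X) = gk s (X - y) := by rw [← gk_neg]; ring_nf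
    have e4 := gk_tilt hs (X - y)
    have e5 : X - m s + (m s - 2 * s) - y = X - y - 2 * s := by ring
    rw [e3, e5, ← e4, show X + (y + -X) = y by ring,
      show X - s = (X - y - s) + y by ring, Real.exp_add]
    ring
  | succ k ih =>
    intro T0 s X hT hs
    push_cast at hs
    set s' : ℝ := ((k:ℝ) + 1) * dt with hs'
    set σ : ℝ := s - s' with hσ
    have hσ0 : 0 < σ := by rw [hσ]; linarith
    let t : ℕ → ℝ := fun i => if i = 0 then T0 else T0 + σ + ((i:ℝ) - 1) * dt
    have ht : Monotone t := by
      refine monotone_nat_of_le_succ fun n => ?_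
      rcases Nat.eq_zero_or_pos n with rfl | hn
      · simp [t]; linarith
      · have : n ≠ 0 := by omega
        simp only [t, this, if_false]
        simp; linarith
    have hind := indep_first hB t ht (k + 1)
    have ht0 : t 0 = T0 := by simp [t]
    have ht1 : t 1 = T0 + σ := by simp [t]
    have ht2 : ∀ i : ℕ, t (i + 2) = T0 + σ + ((i:ℝ) + 1) * dt := by
      intro i; simp [t]; left; ring
    rw [ht0, ht1] at hind
    simp_rw [ht2] at hind
    set D : Ω → ℝ := fun ω => B (T0 + σ) ω - B T0 ω with hDdef
    set Y : Ω → (Fin (k + 1) → ℝ) := fun ω i => B (T0 + σ + (((i:ℕ):ℝ) + 1) * dt) ω - B (T0 + σ) ω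
      with hYdef
    have hD : Measurable D := (hB.meas _).sub (hB.meas _)
    have hY : Measurable Y := measurable_pi_lambda _ fun i => (hB.meas _).sub (hB.meas _)
    let S : Set (ℝ × (Fin (k + 1) → ℝ)) := {p | (∀ j : Fin (k + 1), m (((j:ℕ):ℝ) * dt) <
      X + p.1 + p.2 (Fin.rev j)) ∧ m s' < X + p.1}
    have hS : MeasurableSet S := by
      have : S = (⋂ j : Fin (k + 1), {p : ℝ × (Fin (k + 1) → ℝ) | m (((j:ℕ):ℝ) * dt) <
          X + p.1 + p.2 (Fin.rev j)}) ∩ {p | m s' < X + p.1} := by ext p; simp [S]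
      rw [this]
      apply MeasurableSet.inter
      · exact MeasurableSet.iInter fun j => measurableSet_lt measurable_const (by fun_prop)
      · exact measurableSet_lt measurable_const (by fun_prop)
    let Φ : ℝ × (Fin (k + 1) → ℝ) → ℝ := S.indicator (fun p => h0 (X + p.1 + p.2 (Fin.last k)))
    have hΦ : Measurable Φ := (hmeas.comp (by fun_prop)).indicator hS
    have hΦb : ∀ p, |Φ p| ≤ C := by
      intro p; by_cases hp : p ∈ S
      · simp only [Φ, indicator_of_mem hp]; exact hC _
      · simp only [Φ, indicator_of_notMem hp]; simpa using hC0
    have hrev : ∀ (ω) (j : Fin (k + 1)), D ω + Y ω (Fin.rev j) =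
        B (T0 + s - ((j:ℕ):ℝ) * dt) ω - B T0 ω := by
      intro ω j
      have hj : ((Fin.rev j : ℕ):ℝ) + 1 = (k:ℝ) + 1 - (j:ℕ) := by
        rw [Fin.val_rev]
        have := j.2
        rw [Nat.cast_sub (by omega)]; push_cast; ring
      simp only [hDdef, hYdef, hj]
      rw [show T0 + σ + ((k:ℝ) + 1 - (j:ℕ)) * dt = T0 + s - ((j:ℕ):ℝ) * dt by rw [hσ, hs']; ring]
      ring
    have hlast : ∀ ω, D ω + Y ω (Fin.last k) = B (T0 + s) ω - B T0 ω := by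
      intro ω
      have := hrev ω 0
      simpa using this
    have e1 : ∀ ω, {ω | ∀ j : Fin (k + 1 + 1), m (((j:ℕ):ℝ) * dt) <
      X + (B (T0 + s - ((j:ℕ):ℝ) * dt) ω - B T0 ω)}.indicator
        (fun ω => h0 (X + (B (T0 + s) ω - B T0 ω))) ω = Φ (D ω, Y ω) := by
      intro ω
      have : (ω ∈ {ω | ∀ j : Fin (k + 1 + 1), m (((j:ℕ):ℝ) * dt) <
          X + (B (T0 + s - ((j:ℕ):ℝ) * dt) ω - B T0 ω)}) ↔ (D ω, Y ω) ∈ S := by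
        simp only [mem_setOf_eq, S]
        rw [Fin.forall_fin_succ']
        refine and_congr (forall_congr' fun j => ?_) ?_
        · rw [add_assoc X, hrev]; simp
        · simp only [Fin.val_last]
          push_cast
          rw [← hs', show T0 + s - s' = T0 + σ by rw [hσ]; ring]
      by_cases hx : (D ω, Y ω) ∈ S
      · rw [indicator_of_mem (this.2 hx)]; simp only [Φ]; rw [indicator_of_mem hx]
        simp only; rw [add_assoc X, hlast]
      · rw [indicator_of_notMem (fun h => hx (this.1 h))]; simp only [Φ]; rw [indicator_of_notMem hx]
    simp_rw [e1]
    have hg := hB.gauss T0 (T0 + σ) hT (by linarith)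
    rw [show T0 + σ - T0 = σ by ring] at hg
    rw [indep_fubini hD hY hind Φ hΦ C hΦb, hDdef, hg,
      integral_gaussianReal_eq_integral_smul (toNNReal_ne hσ0)]
    have hks : (k:ℝ) * dt < s' := by rw [hs']; nlinarith
    have e2 : ∀ d, gaussianPDFReal 0 (2 * σ).toNNReal d • ∫ ω, Φ (d, Y ω) ∂P
        = (Ioi (m s' - X)).indicator (fun d => gk σ d * (Real.exp (-(X + d - s')) *
          vk (fun u => m u - 2 * u) (fun z => Real.exp z * h0 z) dt (k + 1) (X + d - m s'))) d := by
      intro d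
      rw [← gk_eq_pdf hσ0, smul_eq_mul]
      by_cases hx : d ∈ Ioi (m s' - X)
      · rw [indicator_of_mem hx]
        congr 1
        have h3 := ih (T0 + σ) s' (X + d) (by linarith) hks
        rw [vk_succ, ← hs', ← h3, ← mul_assoc, ← Real.exp_add, neg_add_cancel, Real.exp_zero, one_mul]
        congr 1; ext ω
        have hx' : m s' < X + d := by have := mem_Ioi.1 hx; linarith
        have hr2 : ∀ j : Fin (k + 1), Y ω (Fin.rev j) =
            B (T0 + σ + s' - ((j:ℕ):ℝ) * dt) ω - B (T0 + σ) ω := by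
          intro j
          have := hrev ω j
          rw [show T0 + σ + s' - ((j:ℕ):ℝ) * dt = T0 + s - ((j:ℕ):ℝ) * dt by rw [hσ]; ring]
          have h4 : D ω = B (T0 + σ) ω - B T0 ω := rfl
          linarith
        have this : (ω ∈ {ω | ∀ j : Fin (k + 1), m (((j:ℕ):ℝ) * dt) <
          X + d + (B (T0 + σ + s' - ((j:ℕ):ℝ) * dt) ω - B (T0 + σ) ω)}) ↔ (d, Y ω) ∈ S := by
          simp only [mem_setOf_eq, S, hx', and_true]
          refine forall_congr' fun j => ?_
          rw [hr2]
        by_cases hy : (d, Y ω) ∈ S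
        · rw [indicator_of_mem (this.2 hy)]; simp only [Φ]; rw [indicator_of_mem hy]
          simp only
          have := hr2 0
          simp at this
          rw [this]
        · rw [indicator_of_notMem (fun h => hy (this.1 h))]; simp only [Φ]; rw [indicator_of_notMem hy]
      · rw [indicator_of_notMem hx]
        have : ∀ ω, Φ (d, Y ω) = 0 := by
          intro ω
          simp only [Φ]; rw [indicator_of_notMem]
          rintro ⟨_, h5⟩
          exact hx (by simp only [mem_Ioi]; simp only at h5; linarith)
        simp [this]
    simp_rw [e2]
    rw [tr, ← integral_const_mul]
    unfold Fk
    refine setIntegral_congr_fun measurableSet_Ioi fun y _ => ?_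
    push_cast
    simp only [← hs', ← hσ]
    rw [show X + (y + (m s' - X)) - m s' = y by ring, show X + (y + (m s' - X)) = y + m s' by ring]
    have e3 : gk σ (y + (m s' - X)) = gk σ (X - m s' - y) := by rw [← gk_neg]; ring_nf
    have e4 := gk_tilt hσ0 (X - m s' - y)
    have e5 : X - m s + (m s - 2 * s) - (m s' - 2 * s') - y = X - m s' - y - 2 * σ := by
      rw [hσ]; ring
    rw [e3, e5, ← e4, show X - m s' - y - σ = (X - s) + -(y + m s' - s') by rw [hσ]; ring, Real.exp_add]
    ring

lemma indep_fubini' {Ω : Type*} [MeasurableSpace Ω] {P : Measure Ω} [IsProbabilityMeasure P]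
    {E : Type*} [MeasurableSpace E] {D : Ω → ℝ} {Y : Ω → E} (hD : Measurable D) (hY : Measurable Y)
    (hI : IndepFun D Y P) (S : Set (ℝ × E)) (hS : MeasurableSet S) (c : ENNReal)
    (hc : ∀ y, P.map D {d | (d, y) ∈ S} ≤ c) :
    P {ω | (D ω, Y ω) ∈ S} ≤ c := by
  have h := (indepFun_iff_map_prod_eq_prod_map_map hD.aemeasurable hY.aemeasurable).1 hI
  have hDp : IsProbabilityMeasure (P.map D) := Measure.isProbabilityMeasure_map hD.aemeasurable
  have hYp : IsProbabilityMeasure (P.map Y) := Measure.isProbabilityMeasure_map hY.aemeasurable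
  have e1 : P {ω | (D ω, Y ω) ∈ S} = P.map (fun ω => (D ω, Y ω)) S := by
    rw [Measure.map_apply (hD.prodMk hY) hS]; rfl
  rw [e1, h, Measure.prod_apply_symm hS]
  calc _ ≤ ∫⁻ y, c ∂(P.map Y) := lintegral_mono fun y => hc y
    _ = c := by simp

lemma grid_approx (f : ℝ → ℝ) (hf : Continuous f) {ε s σ κ : ℝ} (h1 : ε < s) (hσ : σ ∈ Icc ε s)
    (hκ : f σ < κ) : ∀ᶠ N : ℕ in atTop, ∃ i : Fin (N + 1),
      f (ε + (((i:ℕ):ℝ) + 1) * ((s - ε) / (N + 1))) < κ := by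
  have hnb : ∀ᶠ y in nhds σ, f y < κ := hf.continuousAt.eventually_lt continuousAt_const hκ
  obtain ⟨ρ, hρ, hρ'⟩ := Metric.eventually_nhds_iff.1 hnb
  have hlim : Tendsto (fun N : ℕ => (s - ε) / ((N:ℝ) + 1)) atTop (nhds 0) :=
    by
    simpa [div_eq_mul_inv] using (tendsto_one_div_add_atTop_nhds_zero_nat (𝕜 := ℝ)).const_mul (s - ε)
  filter_upwards [(hlim.eventually (gt_mem_nhds hρ))] with N hN
  set δ := (s - ε) / ((N:ℝ) + 1) with hδ
  have hδ0 : 0 < δ := by rw [hδ]; have : 0 < s - ε := by linarith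
                         positivity
  have hNδ : ((N:ℝ) + 1) * δ = s - ε := by rw [hδ]; field_simp
  have hx0 : 0 ≤ (σ - ε) / δ := div_nonneg (by linarith [hσ.1]) hδ0.le
  have ha := Nat.floor_le hx0
  have hb := Nat.lt_floor_add_one ((σ - ε) / δ)
  rw [le_div_iff₀ hδ0] at ha
  rw [div_lt_iff₀ hδ0] at hb
  by_cases hlt : ⌊(σ - ε) / δ⌋₊ < N + 1
  · refine ⟨⟨_, hlt⟩, hρ' ?_⟩
    rw [Real.dist_eq, abs_lt]; simp only
    constructor <;> linarith
  · refine ⟨Fin.last N, hρ' ?_⟩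
    have : ((N:ℝ) + 1) ≤ (⌊(σ - ε) / δ⌋₊ : ℝ) := by exact_mod_cast Nat.le_of_not_lt hlt
    have h3 : ((N:ℝ) + 1) * δ ≤ (⌊(σ - ε) / δ⌋₊ : ℝ) * δ := by gcongr
    have : σ = s := le_antisymm hσ.2 (by linarith)
    simp only [Fin.val_last]
    rw [hNδ, this]; simpa using hρ

lemma no_touch {Ω : Type*} [MeasurableSpace Ω] {P : Measure Ω} [IsProbabilityMeasure P]
    {B : ℝ → Ω → ℝ} (hB : IsBrownianMotion P B) (c : ℝ → ℝ) (hc : Continuous c) {ε s : ℝ}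
    (hε : 0 < ε) (hs : ε < s) :
    P {ω | Continuous (fun s => B s ω) ∧ (∀ σ ∈ Icc ε s, 0 ≤ c σ + (B σ ω - B 0 ω)) ∧
      ∃ σ ∈ Icc ε s, c σ + (B σ ω - B 0 ω) = 0} = 0 := by
  refine le_antisymm ?_ (zero_le)
  have key : ∀ κ : ℝ, 0 < κ → P {ω | Continuous (fun s => B s ω) ∧
      (∀ σ ∈ Icc ε s, 0 ≤ c σ + (B σ ω - B 0 ω)) ∧
      ∃ σ ∈ Icc ε s, c σ + (B σ ω - B 0 ω) = 0} ≤ ENNReal.ofReal (ε ^ (-1/2 : ℝ) * κ) := by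
    intro κ hκ
    let δ : ℕ → ℝ := fun N => (s - ε) / ((N:ℝ) + 1)
    have hδ0 : ∀ N, 0 ≤ δ N := fun N => div_nonneg (by linarith) (by positivity)
    let u : ∀ N, Fin (N + 1) → ℝ := fun N i => ε + (((i:ℕ):ℝ) + 1) * δ N
    let D : Ω → ℝ := fun ω => B ε ω - B 0 ω
    let Y : ∀ N, Ω → (Fin (N + 1) → ℝ) := fun N ω i => B (u N i) ω - B ε ω
    let S : ∀ N, Set (ℝ × (Fin (N + 1) → ℝ)) := fun N =>
      (⋂ i, {p | 0 ≤ c (u N i) + (p.1 + p.2 i)}) ∩ ⋃ i, {p | c (u N i) + (p.1 + p.2 i) < κ}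
    have hS : ∀ N, MeasurableSet (S N) := by
      intro N
      refine MeasurableSet.inter (MeasurableSet.iInter fun i => ?_) (MeasurableSet.iUnion fun i => ?_)
      · exact measurableSet_le measurable_const (by fun_prop)
      · exact measurableSet_lt (by fun_prop) measurable_const
    have hD : Measurable D := (hB.meas _).sub (hB.meas _)
    have hY : ∀ N, Measurable (Y N) := fun N =>
      measurable_pi_lambda _ fun i => (hB.meas _).sub (hB.meas _)
    have hg := hB.gauss 0 ε le_rfl hε.le
    rw [sub_zero] at hg
    have hind : ∀ N, IndepFun D (Y N) P := by
      intro N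
      let t : ℕ → ℝ := fun i => if i = 0 then 0 else ε + ((i:ℝ) - 1) * δ N
      have ht : Monotone t := by
        refine monotone_nat_of_le_succ fun n => ?_
        rcases Nat.eq_zero_or_pos n with rfl | hn
        · simp [t]; linarith
        · have : n ≠ 0 := by omega
          simp only [t, this, if_false]
          have := hδ0 N
          simp; nlinarith
      have h := indep_first hB t ht (N + 1)
      have ht0 : t 0 = 0 := by simp [t]
      have ht1 : t 1 = ε := by simp [t]
      have ht2 : ∀ i : ℕ, t (i + 2) = ε + ((i:ℝ) + 1) * δ N := by
        intro i; simp [t]; left; ring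
      rw [ht0, ht1] at h
      simp_rw [ht2] at h
      exact h
    have hA : ∀ N, P {ω | (D ω, Y N ω) ∈ S N} ≤ ENNReal.ofReal (ε ^ (-1/2 : ℝ) * κ) := by
      intro N
      refine indep_fubini' hD (hY N) (hind N) (S N) (hS N) _ fun y => ?_
      obtain ⟨i0, hi0⟩ := Finite.exists_min (fun i => c (u N i) + y i)
      have hsub : {d | (d, y) ∈ S N} ⊆ Ico (-(c (u N i0) + y i0)) (-(c (u N i0) + y i0) + κ) := by
        rintro d ⟨h1, h2⟩
        simp only [mem_iInter, mem_iUnion, mem_setOf_eq] at h1 h2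
        obtain ⟨i, hi⟩ := h2
        have := h1 i0
        have := hi0 i
        constructor <;> linarith
      refine (measure_mono hsub).trans ?_
      rw [hg, gaussianReal_apply _ (toNNReal_ne hε)]
      calc _ ≤ ∫⁻ x in Ico (-(c (u N i0) + y i0)) (-(c (u N i0) + y i0) + κ),
            ENNReal.ofReal (ε ^ (-1/2 : ℝ)) := by
            refine lintegral_mono fun x => ?_
            unfold gaussianPDF
            rw [← gk_eq_pdf hε]
            exact ENNReal.ofReal_le_ofReal (gk_le_rpow hε x)
        _ = _ := by
            rw [setLIntegral_const, Real.volume_Ico, ← ENNReal.ofReal_mul (by positivity)]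
            congr 2; ring
    let E : ℕ → Set Ω := fun M => ⋂ N ≥ M, {ω | (D ω, Y N ω) ∈ S N}
    have hE : Monotone E := by
      intro M M' h ω hω
      simp only [E, mem_iInter] at hω ⊢
      exact fun N hN => hω N (le_trans h hN)
    calc _ ≤ P (⋃ M, E M) := by
          refine measure_mono ?_
          rintro ω ⟨hcont, hpos, σ, hσ, hz⟩
          have hf : Continuous (fun σ => c σ + (B σ ω - B 0 ω)) := by fun_prop
          have := grid_approx _ hf hs hσ (κ := κ) (by rw [hz]; exact hκ)
          obtain ⟨M, hM⟩ := eventually_atTop.1 this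
          refine mem_iUnion.2 ⟨M, mem_iInter₂.2 fun N hN => ?_⟩
          obtain ⟨i, hi⟩ := hM N hN
          have hadd : ∀ i, D ω + Y N ω i = B (u N i) ω - B 0 ω := fun i => by simp only [D, Y]; ring
          refine ⟨mem_iInter.2 fun i => ?_, mem_iUnion.2 ⟨i, ?_⟩⟩
          · simp only [mem_setOf_eq]; rw [hadd]
            have hNδ : ((N:ℝ) + 1) * δ N = s - ε := by simp only [δ]; field_simp
            have hi2 : ((i:ℕ):ℝ) + 1 ≤ (N:ℝ) + 1 := by
              have := i.2; exact_mod_cast this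
            refine hpos _ ⟨?_, ?_⟩
            · simp only [u]; have := hδ0 N; have : 0 ≤ (((i:ℕ):ℝ) + 1) * δ N := by positivity
              linarith
            · simp only [u]; have := mul_le_mul_of_nonneg_right hi2 (hδ0 N); linarith
          · simp only [mem_setOf_eq]; rw [hadd]; exact hi
      _ = ⨆ M, P (E M) := hE.measure_iUnion
      _ ≤ _ := iSup_le fun M => (measure_mono (iInter₂_subset M le_rfl)).trans (hA M)
  refine ENNReal.le_of_forall_pos_le_add fun e he _ => ?_
  have := key (e / ε ^ (-1/2 : ℝ)) (by positivity)
  refine this.trans ?_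
  rw [zero_add, mul_div_cancel₀ _ (by positivity)]
  simp

noncomputable def wsol {Ω : Type*} [MeasurableSpace Ω] (P : Measure Ω)
    (B : ℝ → Ω → ℝ) (h0 m : ℝ → ℝ) (s z : ℝ) : ℝ :=
  Real.exp (z + m s - 2 * s) * fkppSol P B h0 m (m s + z) s

lemma neg_point_ae {Ω : Type*} [MeasurableSpace Ω] {P : Measure Ω} [IsProbabilityMeasure P]
    {B : ℝ → Ω → ℝ} (hB : IsBrownianMotion P B) (m : ℝ → ℝ) (hm : Continuous m)
    {s z : ℝ} (hs : 0 < s) (hz : z ≠ 0) :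
    ∀ᵐ ω ∂P, (∀ σ ∈ Icc (0:ℝ) s, m (s - σ) < m s + z + B σ ω) ∨
      ∃ σ ∈ Ioc 0 s, m s + z + (B σ ω - B 0 ω) < m (s - σ) := by
  let c : ℝ → ℝ := fun σ => m s + z - m (s - σ)
  have hc : Continuous c := by fun_prop
  have hn : ∀ᵐ ω ∂P, ∀ n : ℕ, ¬ (Continuous (fun s => B s ω) ∧
      (∀ σ ∈ Icc (s / (n + 2)) s, 0 ≤ c σ + (B σ ω - B 0 ω)) ∧
      ∃ σ ∈ Icc (s / (n + 2)) s, c σ + (B σ ω - B 0 ω) = 0) := by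
    rw [ae_all_iff]; intro n
    have h := no_touch hB c hc (ε := s / (n + 2)) (s := s) (by positivity) (by
      rw [div_lt_iff₀ (by positivity)]; nlinarith [(Nat.cast_nonneg n : (0:ℝ) ≤ n)])
    rw [ae_iff]; simp only [not_not]; exact h
  filter_upwards [hn, hB.cont, hB.init] with ω h1 h2 h3
  by_contra hcon
  push Not at hcon
  obtain ⟨⟨σ, hσ, hle⟩, hall⟩ := hcon
  rcases lt_or_gt_of_ne hz with hz | hz
  · have hf : Continuous (fun σ => c σ + (B σ ω - B 0 ω)) := by fun_prop
    have h0 : c 0 + (B 0 ω - B 0 ω) < 0 := by simp [c]; exact hz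
    have hev : ∀ᶠ y in nhds (0:ℝ), c y + (B y ω - B 0 ω) < 0 :=
      hf.continuousAt.eventually_lt continuousAt_const h0
    obtain ⟨ρ, hρ, hρ'⟩ := Metric.eventually_nhds_iff.1 hev
    have hmin : 0 < min (ρ / 2) s := by positivity
    have := @hρ' (min (ρ / 2) s) (by
      rw [Real.dist_eq, sub_zero, abs_of_pos hmin]
      exact lt_of_le_of_lt (min_le_left _ _) (by linarith))
    have h4 := hall (min (ρ / 2) s) ⟨hmin, min_le_right _ _⟩
    simp only [c] at this
    linarith
  · have hσ0 : 0 < σ := by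
      rcases hσ.1.lt_or_eq with h | h
      · exact h
      · rw [← h] at hle; simp [h3] at hle; linarith
    obtain ⟨n, hn⟩ := exists_nat_gt (s / σ)
    have hle' : s / ((n:ℝ) + 2) ≤ σ := by
      rw [div_le_iff₀ (by positivity)]; rw [div_lt_iff₀ hσ0] at hn; nlinarith
    have hsn : 0 < s / ((n:ℝ) + 2) := by positivity
    refine h1 n ⟨h2, fun σ' hσ' => ?_, σ, ⟨hle', hσ.2⟩, ?_⟩
    · have := hall σ' ⟨lt_of_lt_of_le hsn hσ'.1, hσ'.2⟩
      simp only [c]; linarith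
    · have := hall σ ⟨hσ0, hσ.2⟩
      simp only [c]; rw [h3] at *; linarith

lemma A3 {Ω : Type*} [MeasurableSpace Ω] {P : Measure Ω} [IsProbabilityMeasure P] {B : ℝ → Ω → ℝ}
    (hB : IsBrownianMotion P B) (h0 m : ℝ → ℝ) (hm0 : m 0 = 0) (hm : Continuous m)
    (hmeas : Measurable h0) (C : ℝ)
    (hC : ∀ x, |h0 x| ≤ C) {T s z : ℝ} (hT : 0 < T) (hs : 0 < s) (hz : z ≠ 0) (k : ℕ → ℕ)
    (hk1 : ∀ n, (k n : ℝ) * (T / (n + 1)) < s) (hk2 : ∀ n, s ≤ (k n + 1 : ℝ) * (T / (n + 1))) :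
    Tendsto (fun n : ℕ => Fk (fun u => m u - 2 * u) (fun z => Real.exp z * h0 z) (T / (n + 1)) (k n) s z)
      atTop (nhds (wsol P B h0 m s z)) := by
  have hC0 : 0 ≤ C := le_trans (abs_nonneg _) (hC 0)
  have hdt : ∀ n : ℕ, 0 < T / ((n:ℝ) + 1) := fun n => by positivity
  have e1 := fun n : ℕ => A1 hB h0 m hm0 hmeas C hC (hdt n) (k n) 0 s (m s + z) le_rfl (hk1 n)
  simp only [add_sub_cancel_left, zero_add] at e1
  simp_rw [← e1]
  unfold wsol fkppSol
  rw [← mul_assoc, ← Real.exp_add, show z + m s - 2 * s + s = m s + z - s by ring]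
  refine Tendsto.const_mul _ ?_
  refine tendsto_integral_of_dominated_convergence (fun _ => C) ?_ (integrable_const C) ?_ ?_
  · intro n
    have hmB := hB.meas
    refine (Measurable.indicator (hmeas.comp (by fun_prop)) ?_).aestronglyMeasurable
    have : {ω | ∀ j : Fin (k n + 1), m (((j:ℕ):ℝ) * (T / (n + 1))) <
        m s + z + (B (s - ((j:ℕ):ℝ) * (T / (n + 1))) ω - B 0 ω)} =
        ⋂ j : Fin (k n + 1), {ω | m (((j:ℕ):ℝ) * (T / (n + 1))) <
        m s + z + (B (s - ((j:ℕ):ℝ) * (T / (n + 1))) ω - B 0 ω)} := by ext; simp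
    rw [this]
    exact MeasurableSet.iInter fun j => measurableSet_lt measurable_const (by fun_prop)
  · intro n
    refine Eventually.of_forall fun ω => ?_
    refine (norm_indicator_le_norm_self _ _).trans ?_
    exact hC _
  · filter_upwards [neg_point_ae hB m hm hs hz, hB.cont, hB.init] with ω h1 h2 h3
    refine tendsto_const_nhds.congr' ?_
    simp only [Filter.EventuallyEq]
    rcases h1 with h1 | ⟨σ, hσ, hlt⟩
    · refine Eventually.of_forall fun n => ?_
      rw [indicator_of_mem (by exact h1), indicator_of_mem]
      · rw [h3, sub_zero]
      · intro j
        rw [h3, sub_zero]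
        have hj : ((j:ℕ):ℝ) ≤ k n := by have := j.2; exact_mod_cast Nat.lt_succ_iff.1 this
        have hj2 := mul_le_mul_of_nonneg_right hj (hdt n).le
        have hj3 : 0 ≤ ((j:ℕ):ℝ) * (T / (n + 1)) := mul_nonneg (Nat.cast_nonneg _) (hdt n).le
        have := h1 (s - ((j:ℕ):ℝ) * (T / (n + 1))) ⟨by linarith [hk1 n], by linarith⟩
        simpa using this
    · have hf : Continuous (fun σ => m s + z + (B σ ω - B 0 ω) - m (s - σ)) := by fun_prop
      have hev : ∀ᶠ y in nhds σ, m s + z + (B y ω - B 0 ω) - m (s - y) < 0 :=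
        hf.continuousAt.eventually_lt continuousAt_const (by linarith)
      obtain ⟨ρ, hρ, hρ'⟩ := Metric.eventually_nhds_iff.1 hev
      have hlim : Tendsto (fun N : ℕ => T / ((N:ℝ) + 1)) atTop (nhds 0) := by
        simpa [div_eq_mul_inv] using (tendsto_one_div_add_atTop_nhds_zero_nat (𝕜 := ℝ)).const_mul T
      filter_upwards [(hlim.eventually (gt_mem_nhds hρ))] with n hn
      rw [indicator_of_notMem, indicator_of_notMem]
      · intro hcon
        set dt := T / ((n:ℝ) + 1)
        have hx0 : 0 ≤ (s - σ) / dt := div_nonneg (by linarith [hσ.2]) (hdt n).le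
        have ha := Nat.floor_le hx0
        have hb := Nat.lt_floor_add_one ((s - σ) / dt)
        rw [le_div_iff₀ (hdt n)] at ha
        rw [div_lt_iff₀ (hdt n)] at hb
        have hlt2 : ⌊(s - σ) / dt⌋₊ < k n + 1 := by
          have : (⌊(s - σ) / dt⌋₊ : ℝ) * dt < (k n + 1 : ℝ) * dt := by linarith [hk2 n, hσ.1]
          exact_mod_cast lt_of_mul_lt_mul_right this (hdt n).le
        have h5 := hcon ⟨_, hlt2⟩
        have h6 := @hρ' (s - (⌊(s - σ) / dt⌋₊ : ℝ) * dt) (by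
          rw [Real.dist_eq, abs_lt]; constructor <;> linarith)
        simp only [sub_sub_cancel] at h6
        simp only at h5
        linarith
      · intro hcon
        have := hcon σ ⟨hσ.1.le, hσ.2⟩
        rw [h3] at hlt; linarith

/-- product integrability of the Gaussian convolution -/
lemma conv_integrable {τ : ℝ} (hτ : 0 < τ) (c : ℝ) {f : ℝ → ℝ} (hfm : Measurable f)
    (hf : IntegrableOn f (Ioi 0)) :
    Integrable (fun p : ℝ × ℝ => gk τ (p.1 + c - p.2) * f p.2)
      (volume.prod (volume.restrict (Ioi 0))) := by
  have hm : Measurable (fun p : ℝ × ℝ => gk τ (p.1 + c - p.2) * f p.2) := by fun_prop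
  rw [integrable_prod_iff' hm.aestronglyMeasurable]
  constructor
  · refine Eventually.of_forall fun y => ?_
    have := ((integrable_gk hτ).comp_sub_right (y - c)).mul_const (f y)
    refine this.congr (Eventually.of_forall fun z => ?_)
    simp only; congr 2; ring
  · have : ∀ y, ∫ z, ‖gk τ (z + c - y) * f y‖ = ‖f y‖ := by
      intro y
      simp_rw [norm_mul, Real.norm_of_nonneg (gk_nonneg _ _)]
      rw [integral_mul_const]
      have : ∫ z, gk τ (z + c - y) = 1 := by
        rw [← integral_gk hτ, ← integral_sub_right_eq_self (gk τ) (y - c)]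
        congr 1; ext z; congr 1; ring
      rw [this, one_mul]
    simp_rw [this]
    exact hf.norm

lemma conv_swap {τ : ℝ} (hτ : 0 < τ) (c : ℝ) {f K : ℝ → ℝ} (hfm : Measurable f)
    (hf : IntegrableOn f (Ioi 0)) (hK : Measurable K) (C : ℝ) (hKC : ∀ z, |K z| ≤ C) :
    ∫ z, K z * ∫ y in Ioi 0, gk τ (z + c - y) * f y =
      ∫ y in Ioi 0, (∫ z, K z * gk τ (z + c - y)) * f y := by
  have h := (conv_integrable hτ c hfm hf)
  have h2 : Integrable (fun p : ℝ × ℝ => K p.1 * (gk τ (p.1 + c - p.2) * f p.2))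
      (volume.prod (volume.restrict (Ioi 0))) :=
    h.bdd_mul (c := C) (hK.comp measurable_fst).aestronglyMeasurable (Eventually.of_forall fun p => hKC _)
  simp_rw [← integral_const_mul, ← integral_mul_const]
  rw [integral_integral_swap h2]
  simp_rw [mul_assoc]

lemma conv_int {τ : ℝ} (hτ : 0 < τ) (c : ℝ) {f : ℝ → ℝ} (hfm : Measurable f)
    (hf : IntegrableOn f (Ioi 0)) :
    Integrable (fun z => ∫ y in Ioi 0, gk τ (z + c - y) * f y) :=
  (conv_integrable hτ c hfm hf).integral_prod_left

lemma integral_gk_shift {τ : ℝ} (hτ : 0 < τ) (c y : ℝ) : ∫ z, gk τ (z + c - y) = 1 := by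
  rw [← integral_gk hτ, ← integral_sub_right_eq_self (gk τ) (y - c)]
  congr 1; ext z; congr 1; ring

lemma conv_mass {τ : ℝ} (hτ : 0 < τ) (c : ℝ) {f : ℝ → ℝ} (hfm : Measurable f)
    (hf : IntegrableOn f (Ioi 0)) :
    ∫ z, ∫ y in Ioi 0, gk τ (z + c - y) * f y = ∫ y in Ioi 0, f y := by
  have := conv_swap hτ c hfm hf (K := fun _ => 1) measurable_const 1 (by simp)
  simp only [one_mul] at this
  rw [this]
  simp_rw [integral_gk_shift hτ, one_mul]

section
variable {l w0 : ℝ → ℝ} {dt : ℝ}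

lemma measurable_conv {f : ℝ → ℝ} (hfm : Measurable f) (hl : Measurable l) (τ0 : ℝ) :
    Measurable (fun p : ℝ × ℝ => ∫ y in Ioi (0:ℝ), gk (p.1 - τ0) (p.2 + l p.1 - l τ0 - y) * f y) := by
  refine StronglyMeasurable.measurable ?_
  refine StronglyMeasurable.integral_prod_right (f := fun (p : ℝ × ℝ) y => gk (p.1 - τ0) (p.2 + l p.1 - l τ0 - y) * f y) ?_
  refine Measurable.stronglyMeasurable ?_
  simp only [Function.uncurry_def]
  fun_prop

lemma vk_meas (hl : Measurable l) (hw : Measurable w0) (k : ℕ) : Measurable (vk l w0 dt k) := by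
  induction k with
  | zero => exact hw
  | succ k ih =>
    have h := measurable_conv ih hl (k * dt)
    exact h.comp (measurable_const.prodMk measurable_id)

lemma Fk_meas (hl : Measurable l) (hw : Measurable w0) (k : ℕ) :
    Measurable (fun p : ℝ × ℝ => Fk l w0 dt k p.1 p.2) :=
  measurable_conv (vk_meas hl hw k) hl (k * dt)

lemma vk_nonneg (hw : ∀ z, 0 ≤ w0 z) (k : ℕ) : ∀ z, 0 ≤ vk l w0 dt k z := by
  induction k with
  | zero => exact hw
  | succ k ih =>
    intro z
    exact integral_nonneg fun y => mul_nonneg (gk_nonneg _ _) (ih y)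

lemma Fk_nonneg (hw : ∀ z, 0 ≤ w0 z) (k : ℕ) (s z : ℝ) : 0 ≤ Fk l w0 dt k s z :=
  integral_nonneg fun y => mul_nonneg (gk_nonneg _ _) (vk_nonneg hw k y)

lemma Fk_eq (k : ℕ) (s z : ℝ) : Fk l w0 dt k s z =
    ∫ y in Ioi (0:ℝ), gk (s - k * dt) (z + (l s - l (k * dt)) - y) * vk l w0 dt k y := by
  unfold Fk; congr 1; ext y; congr 2; ring

lemma step_pos (hdt : 0 < dt) (k : ℕ) : (k:ℝ) * dt < ((k:ℝ) + 1) * dt := by nlinarith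

lemma vk_intOn (hl : Measurable l) (hw : Measurable w0) (hi : IntegrableOn w0 (Ioi 0))
    (hdt : 0 < dt) (k : ℕ) : IntegrableOn (vk l w0 dt k) (Ioi 0) := by
  induction k with
  | zero => exact hi
  | succ k ih =>
    have := conv_int (sub_pos.2 (step_pos hdt k)) (l (((k:ℝ) + 1) * dt) - l (k * dt)) (vk_meas hl hw k) ih
    refine (this.congr (Eventually.of_forall fun z => ?_)).integrableOn
    rw [vk_succ, Fk_eq]

lemma Fk_int (hl : Measurable l) (hw : Measurable w0) (hi : IntegrableOn w0 (Ioi 0))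
    (hdt : 0 < dt) (k : ℕ) {s : ℝ} (hs : k * dt < s) : Integrable (Fk l w0 dt k s) := by
  have := conv_int (sub_pos.2 hs) (l s - l (k * dt)) (vk_meas hl hw k) (vk_intOn hl hw hi hdt k)
  refine (this.congr (Eventually.of_forall fun z => ?_))
  rw [Fk_eq]

lemma Fk_mass (hl : Measurable l) (hw : Measurable w0) (hi : IntegrableOn w0 (Ioi 0))
    (hdt : 0 < dt) (k : ℕ) {s : ℝ} (hs : k * dt < s) :
    ∫ z, Fk l w0 dt k s z = ∫ y in Ioi 0, vk l w0 dt k y := by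
  have := conv_mass (sub_pos.2 hs) (l s - l (k * dt)) (vk_meas hl hw k) (vk_intOn hl hw hi hdt k)
  rw [← this]; simp_rw [Fk_eq]

/-- free bound -/
lemma Fk_free (hl : Measurable l) (hw : Measurable w0) (hwn : ∀ z, 0 ≤ w0 z) (hi : IntegrableOn w0 (Ioi 0))
    (hdt : 0 < dt) (k : ℕ) : ∀ {s : ℝ} (hs : k * dt < s) (z : ℝ),
    Fk l w0 dt k s z ≤ ∫ y in Ioi (0:ℝ), gk s (z + (l s - l 0) - y) * w0 y := by
  induction k with
  | zero =>
    intro s hs z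
    rw [Fk_eq]; simp [vk]
  | succ k ih =>
    intro s hs z
    have hs' : ((k:ℝ) + 1) * dt < s := by simpa using hs
    set σ := ((k:ℝ) + 1) * dt with hσ
    have hσ0 : 0 < σ := by positivity
    rw [Fk_eq]
    simp only [Nat.cast_add, Nat.cast_one]
    rw [← hσ]
    have h1 := conv_swap hσ0 (l σ - l 0) hw hi (K := fun y => gk (s - σ) (z + (l s - l σ) - y))
      (by fun_prop) ((s - σ) ^ (-1/2:ℝ)) (fun y => by
        rw [abs_of_nonneg (gk_nonneg _ _)]; exact gk_le_rpow (by linarith) _)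
    have hIntg : Integrable (fun y => gk (s - σ) (z + (l s - l σ) - y) *
        ∫ y' in Ioi (0:ℝ), gk σ (y + (l σ - l 0) - y') * w0 y') :=
      (conv_int hσ0 (l σ - l 0) hw hi).bdd_mul (c := (s - σ) ^ (-1/2:ℝ)) (Measurable.aestronglyMeasurable (by fun_prop))
        (Eventually.of_forall fun y => by
          rw [Real.norm_of_nonneg (gk_nonneg _ _)]; exact gk_le_rpow (by linarith) _)
    have h2 : ∀ y', ∫ y, gk (s - σ) (z + (l s - l σ) - y) * gk σ (y + (l σ - l 0) - y') =
        gk s (z + (l s - l 0) - y') := by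
      intro y'
      have := gk_conv (sub_pos.2 hs') hσ0 (z + (l s - l σ)) (y' - (l σ - l 0))
      rw [sub_add_cancel] at this
      rw [show z + (l s - l 0) - y' = z + (l s - l σ) - (y' - (l σ - l 0)) by ring, ← this]
      congr 1; ext y; congr 2; ring
    simp_rw [h2] at h1
    rw [← h1]
    calc _ ≤ ∫ y in Ioi (0:ℝ), gk (s - σ) (z + (l s - l σ) - y) *
          ∫ y' in Ioi (0:ℝ), gk σ (y + (l σ - l 0) - y') * w0 y' := by
          refine integral_mono_of_nonneg ?_ hIntg.integrableOn ?_
          · exact Eventually.of_forall fun y => mul_nonneg (gk_nonneg _ _) (vk_nonneg hwn _ y)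
          · refine Eventually.of_forall fun y => mul_le_mul_of_nonneg_left ?_ (gk_nonneg _ _)
            rw [vk_succ]
            exact ih (step_pos hdt k) y
      _ ≤ _ := by
          refine setIntegral_le_integral hIntg (Eventually.of_forall fun y => ?_)
          exact mul_nonneg (gk_nonneg _ _) (integral_nonneg fun y' => mul_nonneg (gk_nonneg _ _) (hwn _))

lemma free_le {s : ℝ} (hs : 0 < s) (c : ℝ) (hw : Measurable w0) (hwn : ∀ z, 0 ≤ w0 z)
    (hi : IntegrableOn w0 (Ioi 0)) :
    ∫ y in Ioi (0:ℝ), gk s (c - y) * w0 y ≤ s ^ (-1/2:ℝ) * ∫ y in Ioi (0:ℝ), w0 y := by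
  rw [← integral_const_mul]
  refine integral_mono_of_nonneg (Eventually.of_forall fun y => mul_nonneg (gk_nonneg _ _) (hwn _)) (hi.const_mul _)
    (Eventually.of_forall fun y => mul_le_mul_of_nonneg_right (gk_le_rpow hs _) (hwn y))

lemma Fk_sup (hl : Measurable l) (hw : Measurable w0) (hwn : ∀ z, 0 ≤ w0 z) (hi : IntegrableOn w0 (Ioi 0))
    (hdt : 0 < dt) (k : ℕ) {s : ℝ} (hs : k * dt < s) (z : ℝ) :
    Fk l w0 dt k s z ≤ s ^ (-1/2:ℝ) * ∫ y in Ioi (0:ℝ), w0 y :=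
  (Fk_free hl hw hwn hi hdt k hs z).trans
    (free_le (lt_of_le_of_lt (by positivity) hs) _ hw hwn hi)

end

lemma exp_neg_div_le_one {a b : ℝ} (hb : 0 ≤ b) : Real.exp (-(a ^ 2 / b)) ≤ 1 := by
  rw [Real.exp_le_one_iff]; have : 0 ≤ a ^ 2 / b := by positivity
  linarith

lemma gk1_sup {τ : ℝ} (hτ : 0 < τ) (y : ℝ) : |gk1 τ y| ≤ 10 * τ ^ (-1:ℝ) :=
  (gk1_bound hτ y).trans (mul_le_of_le_one_right (by positivity) (exp_neg_div_le_one (by positivity)))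

lemma Dk_sup {τ : ℝ} (hτ : 0 < τ) (x z : ℝ) : |Dk τ x z| ≤ 20 * τ ^ (-1:ℝ) := by
  unfold Dk
  calc _ ≤ |gk1 τ (x - z)| + |gk1 τ (x + z)| := by
        rw [show -gk1 τ (x - z) - gk1 τ (x + z) = -(gk1 τ (x - z) + gk1 τ (x + z)) by ring, abs_neg]
        exact abs_add_le _ _
    _ ≤ _ := by linarith [gk1_sup hτ (x - z), gk1_sup hτ (x + z)]

lemma pk_sup {τ : ℝ} (hτ : 0 < τ) (x z : ℝ) : |pk τ x z| ≤ τ ^ (-1/2:ℝ) := by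
  unfold pk
  rw [abs_le]
  constructor <;> linarith [gk_le_rpow hτ (x - z), gk_le_rpow hτ (x + z), gk_nonneg τ (x - z), gk_nonneg τ (x + z)]

lemma continuous_gk {τ : ℝ} : Continuous (gk τ) := by unfold gk; fun_prop
lemma continuous_gk1 {τ : ℝ} (hτ : 0 < τ) : Continuous (gk1 τ) :=
  continuous_iff_continuousAt.2 fun y => (hasDerivAt_gk1 hτ y).continuousAt
lemma continuous_Dk {τ : ℝ} (hτ : 0 < τ) (x : ℝ) : Continuous (Dk τ x) := by
  unfold Dk
  have := continuous_gk1 hτ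
  fun_prop

section
variable {l w0 μ : ℝ → ℝ} {dt : ℝ}

lemma duh_step (hl : ∀ s, HasDerivAt l (-μ s) s) (hμ : Continuous μ)
    (hw : Measurable w0) (hi : IntegrableOn w0 (Ioi 0)) (hdt : 0 < dt) (k : ℕ) {t s1 : ℝ} (x : ℝ)
    (h1 : k * dt < s1) (h2 : s1 ≤ t) :
    ∫ y in Ioi (0:ℝ), pk (t - k * dt) x (y - (l s1 - l (k * dt))) * vk l w0 dt k y =
      (∫ y in Ioi (0:ℝ), pk (t - k * dt) x y * vk l w0 dt k y) +
      ∫ s in (k * dt)..s1, μ s * ∫ z, Dk (t - s) x z * Fk l w0 dt k s z := by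
  have hlc : Continuous l := continuous_iff_continuousAt.2 fun s => (hl s).continuousAt
  have hlm := hlc.measurable
  set s0 := (k:ℝ) * dt with hs0
  have hτ : 0 < t - s0 := by linarith
  set v := vk l w0 dt k with hv
  have hvm : Measurable v := vk_meas hlm hw k
  have hvi : IntegrableOn v (Ioi 0) := vk_intOn hlm hw hi hdt k
  have hDc := continuous_Dk hτ x
  have ftc : ∀ y, pk (t - s0) x (y - (l s1 - l s0)) = pk (t - s0) x y +
      ∫ s in Ioc s0 s1, μ s * Dk (t - s0) x (y - (l s - l s0)) := by
    intro y
    rw [← intervalIntegral.integral_of_le h1.le,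
      intervalIntegral.integral_eq_sub_of_hasDerivAt (f := fun s => pk (t - s0) x (y - (l s - l s0)))]
    · simp
    · intro s _
      have a := ((hl s).sub_const (l s0)).const_sub y
      exact ((hasDerivAt_pk hτ x _).comp s a).congr_deriv (by ring)
    · exact (by fun_prop : Continuous fun s => μ s * Dk (t - s0) x (y - (l s - l s0))).intervalIntegrable _ _
  obtain ⟨Cμ, hCμ⟩ := isCompact_Icc.exists_bound_of_continuousOn (hμ.continuousOn (s := Icc s0 s1))
  have hprod : Integrable (fun p : ℝ × ℝ => (μ p.1 * Dk (t - s0) x (p.2 - (l p.1 - l s0))) * (1 * v p.2))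
      ((volume.restrict (Ioc s0 s1)).prod (volume.restrict (Ioi 0))) := by
    have a : Integrable (fun p : ℝ × ℝ => (1:ℝ) * v p.2)
        ((volume.restrict (Ioc s0 s1)).prod (volume.restrict (Ioi 0))) :=
      (integrable_const (1:ℝ)).mul_prod hvi
    refine a.bdd_mul (c := Cμ * (20 * (t - s0) ^ (-1:ℝ))) (Measurable.aestronglyMeasurable (by fun_prop)) ?_
    rw [Measure.prod_restrict]
    refine (ae_restrict_mem (measurableSet_Ioc.prod measurableSet_Ioi)).mono fun p hp => ?_
    rw [norm_mul]
    exact mul_le_mul (hCμ _ (Ioc_subset_Icc_self hp.1)) (Dk_sup hτ _ _) (norm_nonneg _)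
      (le_trans (norm_nonneg _) (hCμ _ (Ioc_subset_Icc_self hp.1)))
  have hin : ∀ s ∈ Ioo s0 s1, ∫ z, Dk (t - s) x z * Fk l w0 dt k s z =
      ∫ y in Ioi (0:ℝ), Dk (t - s0) x (y - (l s - l s0)) * v y := by
    intro s hs
    have hts : 0 < t - s := by linarith [hs.2]
    have a := conv_swap (sub_pos.2 hs.1) (l s - l s0) hvm hvi (K := Dk (t - s) x) (by fun_prop)
      (20 * (t - s) ^ (-1:ℝ)) (Dk_sup hts x)
    simp_rw [Fk_eq]
    rw [a]
    simp_rw [Dk_conv hts (sub_pos.2 hs.1)]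
    congr 1; ext y; congr 2; ring
  have e1 : ∫ s in s0..s1, μ s * ∫ z, Dk (t - s) x z * Fk l w0 dt k s z =
      ∫ s in Ioc s0 s1, ∫ y in Ioi (0:ℝ), (μ s * Dk (t - s0) x (y - (l s - l s0))) * (1 * v y) := by
    rw [intervalIntegral.integral_of_le h1.le, integral_Ioc_eq_integral_Ioo, integral_Ioc_eq_integral_Ioo]
    refine setIntegral_congr_fun measurableSet_Ioo fun s hs => ?_
    rw [hin s hs, ← integral_const_mul]
    congr 1; ext y; ring
  rw [e1, integral_integral_swap hprod, ← integral_add]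
  · congr 1; ext y
    rw [ftc, add_mul, integral_mul_const, one_mul]
  · refine Integrable.bdd_mul hvi (c := (t - s0) ^ (-1/2:ℝ)) (Measurable.aestronglyMeasurable (by fun_prop)) ?_
    exact Eventually.of_forall fun y => pk_sup hτ x y
  · exact hprod.integral_prod_right

/-- jump contribution -/
noncomputable def jmp (l w0 : ℝ → ℝ) (dt t x : ℝ) (k : ℕ) : ℝ :=
  ∫ z in Ioi (0:ℝ), pk (t - k * dt) x z * vk l w0 dt k (-z)

noncomputable def Jk (l w0 : ℝ → ℝ) (dt t x : ℝ) (k : ℕ) : ℝ :=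
  ∫ z in Ioi (0:ℝ), pk (t - k * dt) x z * vk l w0 dt k z

noncomputable def Ek (l w0 μ : ℝ → ℝ) (dt t x : ℝ) (k : ℕ) : ℝ :=
  ∫ s in (k * dt)..((k+1:ℕ):ℝ) * dt, μ s * ∫ z, Dk (t - s) x z * Fk l w0 dt k s z

lemma duh_mid (hl : ∀ s, HasDerivAt l (-μ s) s) (hμ : Continuous μ)
    (hw : Measurable w0) (hi : IntegrableOn w0 (Ioi 0)) (hdt : 0 < dt) (k : ℕ) {t : ℝ} (x : ℝ)
    (h2 : ((k:ℝ) + 1) * dt < t) :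
    Jk l w0 dt t x (k + 1) - jmp l w0 dt t x (k + 1) = Jk l w0 dt t x k + Ek l w0 μ dt t x k := by
  have hlc : Continuous l := continuous_iff_continuousAt.2 fun s => (hl s).continuousAt
  have hlm := hlc.measurable
  have h := duh_step hl hμ hw hi hdt k x (step_pos hdt k) h2.le
  unfold Ek
  push_cast
  unfold Jk at *
  rw [← h]
  set s1 := ((k:ℝ) + 1) * dt with hs1
  have hτ : 0 < t - s1 := by linarith
  have hσ : 0 < s1 - k * dt := by have := step_pos hdt k; linarith
  have a := conv_swap hσ (l s1 - l (k * dt)) (vk_meas hlm hw k) (vk_intOn hlm hw hi hdt k) (K := pk (t - s1) x)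
    (by fun_prop) _ (pk_sup hτ x)
  simp_rw [pk_conv hτ hσ] at a
  rw [show t - s1 + (s1 - k * dt) = t - k * dt by ring] at a
  rw [← a]
  have hv : ∀ z, ∫ y in Ioi (0:ℝ), gk (s1 - k * dt) (z + (l s1 - l (k * dt)) - y) * vk l w0 dt k y =
    vk l w0 dt (k + 1) z := fun z => by rw [vk_succ, Fk_eq]
  simp_rw [hv]
  have hvi : Integrable (vk l w0 dt (k + 1)) := by
    have := Fk_int hlm hw hi hdt k (step_pos hdt k)
    exact this
  have hvi2 : Integrable (fun z => pk (t - s1) x z * vk l w0 dt (k + 1) z) :=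
    hvi.bdd_mul (c := (t - s1) ^ (-1/2:ℝ)) (Measurable.aestronglyMeasurable (by fun_prop))
      (Eventually.of_forall fun y => pk_sup hτ x y)
  rw [← integral_add_compl measurableSet_Ioi hvi2 (s := Ioi 0)]
  unfold jmp
  push_cast
  rw [sub_eq_add_neg, ← integral_neg]
  congr 1
  rw [compl_Ioi, ← neg_zero, ← integral_comp_neg_Ioi]
  simp only [neg_zero]
  simp_rw [pk_neg]
  congr 1; ext z; rw [hs1]; ring

lemma duh_last (hl : ∀ s, HasDerivAt l (-μ s) s) (hμ : Continuous μ)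
    (hw : Measurable w0) (hi : IntegrableOn w0 (Ioi 0)) (hdt : 0 < dt) (k : ℕ) {t : ℝ} (x : ℝ)
    (h2 : ((k:ℝ) + 1) * dt = t) :
    vk l w0 dt (k + 1) x - vk l w0 dt (k + 1) (-x) = Jk l w0 dt t x k + Ek l w0 μ dt t x k := by
  have hlc : Continuous l := continuous_iff_continuousAt.2 fun s => (hl s).continuousAt
  have hlm := hlc.measurable
  have h := duh_step hl hμ hw hi hdt k x (step_pos hdt k) h2.le
  unfold Ek
  push_cast
  unfold Jk at *
  rw [← h]
  set s1 := ((k:ℝ) + 1) * dt with hs1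
  have hτ : 0 < t - k * dt := by have := step_pos hdt k; linarith
  rw [vk_succ, vk_succ, Fk_eq, Fk_eq, ← hs1, h2, ← integral_sub]
  · congr 1; ext y
    rw [← sub_mul, pk_eq]; congr 3 <;> ring_nf
  · refine (vk_intOn hlm hw hi hdt k).bdd_mul (c := (t - k * dt) ^ (-1/2:ℝ)) (Measurable.aestronglyMeasurable (by fun_prop)) ?_
    exact Eventually.of_forall fun y => by
      rw [Real.norm_of_nonneg (gk_nonneg _ _)]; exact gk_le_rpow hτ _
  · refine (vk_intOn hlm hw hi hdt k).bdd_mul (c := (t - k * dt) ^ (-1/2:ℝ)) (Measurable.aestronglyMeasurable (by fun_prop)) ?_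
    exact Eventually.of_forall fun y => by
      rw [Real.norm_of_nonneg (gk_nonneg _ _)]; exact gk_le_rpow hτ _

lemma duh_sum (hl : ∀ s, HasDerivAt l (-μ s) s) (hμ : Continuous μ)
    (hw : Measurable w0) (hi : IntegrableOn w0 (Ioi 0)) (hdt : 0 < dt) (n : ℕ) {t : ℝ} (x : ℝ)
    (h2 : ((n:ℝ) + 1) * dt = t) :
    vk l w0 dt (n + 1) x - vk l w0 dt (n + 1) (-x) =
      (∫ z in Ioi (0:ℝ), pk t x z * w0 z) + ∑ k ∈ Finset.range (n + 1), Ek l w0 μ dt t x k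
       + ∑ k ∈ Finset.range n, jmp l w0 dt t x (k + 1) := by
  have key : ∀ j ≤ n, Jk l w0 dt t x j = (∫ z in Ioi (0:ℝ), pk t x z * w0 z) +
      ∑ k ∈ Finset.range j, Ek l w0 μ dt t x k + ∑ k ∈ Finset.range j, jmp l w0 dt t x (k + 1) := by
    intro j
    induction j with
    | zero => intro _; simp [Jk, vk]
    | succ j ih =>
      intro hj
      have h1 : (j:ℝ) + 1 ≤ n := by exact_mod_cast hj
      have := duh_mid hl hμ hw hi hdt j x (t := t) (by nlinarith)
      rw [ih (by omega)] at this
      rw [Finset.sum_range_succ, Finset.sum_range_succ]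
      linarith
  rw [duh_last hl hμ hw hi hdt n x h2, key n le_rfl, Finset.sum_range_succ]
  ring

end

lemma pk_small {x : ℝ} (hx : 0 < x) {τ z : ℝ} (hτ : 0 < τ) (hz : 0 < z) :
    |pk τ x z| ≤ 1280 / x ^ 2 * (z + z ^ 2 * τ ^ (-1/2:ℝ)) := by
  by_cases h : z ≤ x / 2
  · have hb : ∀ ξ ∈ Icc (x - z) (x + z), ‖gk1 τ ξ‖ ≤ 640 / x ^ 2 := by
      intro ξ hξ
      have h1 : x / 2 ≤ ξ := by linarith [hξ.1]
      have h2 : x ^ 2 / (64 * τ) ≤ ξ ^ 2 / (16 * τ) := by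
        rw [div_le_div_iff₀ (by positivity) (by positivity)]
        have : x ^ 2 / 4 ≤ ξ ^ 2 := by nlinarith
        nlinarith
      have h3 : Real.exp (-(ξ ^ 2 / (16 * τ))) ≤ 64 * τ / x ^ 2 := by
        calc _ ≤ Real.exp (-(x ^ 2 / (64 * τ))) := Real.exp_le_exp.2 (by linarith)
          _ ≤ _ := by
            rw [Real.exp_neg, inv_le_comm₀ (Real.exp_pos _) (by positivity), inv_div]
            linarith [Real.add_one_le_exp (x ^ 2 / (64 * τ))]
      calc _ ≤ 10 * τ ^ (-1:ℝ) * Real.exp (-(ξ ^ 2 / (16 * τ))) := gk1_bound hτ ξ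
        _ ≤ 10 * τ ^ (-1:ℝ) * (64 * τ / x ^ 2) := by gcongr
        _ = _ := by rw [Real.rpow_neg_one]; field_simp; norm_num
    have := (convex_Icc (x - z) (x + z)).norm_image_sub_le_of_norm_hasDerivWithin_le
      (f := gk τ) (f' := gk1 τ) (C := 640 / x ^ 2) (fun ξ _ => (hasDerivAt_gk hτ ξ).hasDerivWithinAt) hb
      (x := x + z) (y := x - z) ⟨by linarith, by linarith⟩ ⟨by linarith, by linarith⟩
    unfold pk
    rw [Real.norm_eq_abs, Real.norm_eq_abs] at this
    calc _ ≤ 640 / x ^ 2 * |x - z - (x + z)| := this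
      _ = 640 / x ^ 2 * (2 * z) := by
        rw [show x - z - (x + z) = -(2 * z) by ring, abs_neg, abs_of_pos (by positivity)]
      _ = 1280 / x ^ 2 * z := by ring
      _ ≤ _ := by gcongr; have : 0 ≤ z ^ 2 * τ ^ (-1/2:ℝ) := by positivity
                  linarith
  · push Not at h
    have h1 : 1 ≤ 1280 / x ^ 2 * z ^ 2 := by
      rw [div_mul_eq_mul_div, le_div_iff₀ (by positivity)]; nlinarith
    calc _ ≤ τ ^ (-1/2:ℝ) := pk_sup hτ x z
      _ ≤ (1280 / x ^ 2 * z ^ 2) * τ ^ (-1/2:ℝ) := le_mul_of_one_le_left (by positivity) h1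
      _ = 1280 / x ^ 2 * (z ^ 2 * τ ^ (-1/2:ℝ)) := by ring
      _ ≤ _ := by gcongr; linarith

lemma gk_mom_int {σ : ℝ} (hσ : 0 < σ) (a : ℝ) (n : ℕ) : Integrable (fun z => z ^ n * gk σ (z + a)) := by
  have h0 : ∀ k : ℕ, Integrable (fun y : ℝ => y ^ k * gk σ y) := by
    intro k
    have := (integrable_rpow_mul_exp_neg_mul_sq (b := (4 * σ)⁻¹) (by positivity) (s := k) (by
      have : (0:ℝ) ≤ k := Nat.cast_nonneg _
      linarith)).const_mul ((√(4 * π * σ))⁻¹)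
    refine this.congr (Eventually.of_forall fun y => ?_)
    simp only [Real.rpow_natCast, gk]
    rw [show -(4 * σ)⁻¹ * y ^ 2 = -(y ^ 2 / (4 * σ)) by rw [div_eq_mul_inv]; ring]; ring
  have h1 : Integrable (fun y : ℝ => (y - a) ^ n * gk σ y) := by
    have : (fun y : ℝ => (y - a) ^ n * gk σ y) = fun y => ∑ m ∈ Finset.range (n + 1),
        ((-a) ^ (n - m) * (n.choose m)) * (y ^ m * gk σ y) := by
      ext y
      rw [sub_eq_add_neg, add_pow, Finset.sum_mul]
      exact Finset.sum_congr rfl fun m _ => by ring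
    rw [this]
    exact integrable_finset_sum _ fun m _ => (h0 m).const_mul _
  have := h1.comp_add_right a
  simpa using this

lemma overshoot {σ a : ℝ} (hσ : 0 < σ) (ha : -√σ ≤ a) :
    ∫ z in Ioi (0:ℝ), (z + z ^ 2 * σ ^ (-1/2:ℝ)) * gk σ (z + a) ≤
      8 * √σ * ∫ z in Ioi (0:ℝ), gk σ (z + a) := by
  have i0 : IntegrableOn (fun z => gk σ (z + a)) (Ioi 0) := by
    simpa using (gk_mom_int hσ a 0).integrableOn (s := Ioi 0)
  have i1 : IntegrableOn (fun z => z * gk σ (z + a)) (Ioi 0) := by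
    simpa using (gk_mom_int hσ a 1).integrableOn (s := Ioi 0)
  have i2 : IntegrableOn (fun z => z ^ 2 * gk σ (z + a)) (Ioi 0) := (gk_mom_int hσ a 2).integrableOn
  have hsq : √σ * √σ = σ := Real.mul_self_sqrt hσ.le
  have hsp : 0 < √σ := Real.sqrt_pos.2 hσ
  have hder : ∀ z : ℝ, HasDerivAt (fun z => -2 * σ * (z * gk σ (z + a)))
      ((z ^ 2 * gk σ (z + a) + a * (z * gk σ (z + a))) - 2 * σ * gk σ (z + a)) z := by
    intro z
    have h1 := (hasDerivAt_gk hσ (z + a)).comp_add_const z a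
    have h2 := ((hasDerivAt_id z).mul h1).const_mul (-2 * σ)
    refine h2.congr_deriv ?_
    simp only [id]
    unfold gk1 gk
    field_simp; ring
  have hdi : IntegrableOn (fun z => (z ^ 2 * gk σ (z + a) + a * (z * gk σ (z + a))) - 2 * σ * gk σ (z + a)) (Ioi 0) :=
    (i2.add (i1.const_mul a)).sub (i0.const_mul (2 * σ))
  have hlim := tendsto_zero_of_hasDerivAt_of_integrableOn_Ioi (a := 0) (fun z _ => hder z) hdi
    (i1.const_mul (-2 * σ))
  have key := integral_Ioi_of_hasDerivAt_of_tendsto' (a := 0) (fun z _ => hder z) hdi hlim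
  have i21 : IntegrableOn (fun z => z ^ 2 * gk σ (z + a) + a * (z * gk σ (z + a))) (Ioi 0) :=
    i2.add (i1.const_mul a)
  rw [integral_sub i21 (i0.const_mul (2 * σ)), integral_add i2 (i1.const_mul a),
    integral_const_mul, integral_const_mul] at key
  simp only [zero_mul, mul_zero, sub_zero] at key
  set I0 := ∫ z in Ioi (0:ℝ), gk σ (z + a)
  set I1 := ∫ z in Ioi (0:ℝ), z * gk σ (z + a)
  set I2 := ∫ z in Ioi (0:ℝ), z ^ 2 * gk σ (z + a)
  have hI1 : 0 ≤ I1 := setIntegral_nonneg measurableSet_Ioi fun z hz =>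
    mul_nonneg (le_of_lt hz) (gk_nonneg _ _)
  have hc : 2 * √σ * I1 ≤ σ * I0 + I2 := by
    simp only [I1, I0, I2]
    rw [← integral_const_mul, ← integral_const_mul, ← integral_add (i0.const_mul _) i2]
    refine integral_mono (i1.const_mul _) ((i0.const_mul _).add i2) fun z => ?_
    have : 0 ≤ (z - √σ) ^ 2 * gk σ (z + a) := mul_nonneg (sq_nonneg _) (gk_nonneg _ _)
    have e : (z - √σ) ^ 2 * gk σ (z + a) = (σ * gk σ (z + a) + z ^ 2 * gk σ (z + a)) - 2 * √σ * (z * gk σ (z + a)) := by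
      linear_combination (gk σ (z + a)) * hsq
    simp only [Pi.add_apply]
    linarith
  have e : ∫ z in Ioi (0:ℝ), (z + z ^ 2 * σ ^ (-1/2:ℝ)) * gk σ (z + a) = I1 + σ ^ (-1/2:ℝ) * I2 := by
    simp only [I1, I2]
    rw [← integral_const_mul, ← integral_add i1 (i2.const_mul _)]
    congr 1; ext z; ring
  have hσh : σ ^ (-1/2:ℝ) = (√σ)⁻¹ := by
    rw [Real.sqrt_eq_rpow, ← Real.rpow_neg hσ.le]; norm_num
  rw [e, hσh]
  have h2 : I2 ≤ 5 * σ * I0 := by nlinarith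
  have h3 : (√σ)⁻¹ * I2 ≤ 5 * √σ * I0 := by
    rw [inv_mul_le_iff₀ hsp]
    calc I2 ≤ 5 * σ * I0 := h2
      _ = _ := by linear_combination (-5 * I0) * hsq
  have h4 : I1 ≤ 3 * √σ * I0 := by
    have : √σ * I1 ≤ √σ * (3 * √σ * I0) := by
      have : √σ * (3 * √σ * I0) = 3 * σ * I0 := by linear_combination (3 * I0) * hsq
      linarith
    exact le_of_mul_le_mul_left this hsp
  linarith

section
variable {l w0 : ℝ → ℝ} {dt : ℝ}

lemma jmp_bound (hlm : Measurable l) (hw : Measurable w0) (hwn : ∀ z, 0 ≤ w0 z)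
    (hi : IntegrableOn w0 (Ioi 0)) (hdt : 0 < dt) (k : ℕ) {t x : ℝ} (hx : 0 < x)
    (h2 : ((k:ℝ) + 2) * dt ≤ t) (hc : |l (((k:ℝ) + 1) * dt) - l (k * dt)| ≤ √dt) :
    |jmp l w0 dt t x (k + 1)| ≤ 10240 / x ^ 2 * √dt *
      ((∫ y in Ioi 0, vk l w0 dt k y) - ∫ y in Ioi 0, vk l w0 dt (k + 1) y) := by
  set s1 := ((k:ℝ) + 1) * dt with hs1
  set c := l s1 - l (k * dt) with hc'
  have hσ : s1 - k * dt = dt := by rw [hs1]; ring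
  have hτ : 0 < t - s1 := by rw [hs1]; linarith
  have hτ2 : dt ≤ t - s1 := by rw [hs1]; linarith
  have hvm := vk_meas (dt := dt) hlm hw k
  have hvi := vk_intOn hlm hw hi hdt k
  have hv : ∀ z, vk l w0 dt (k + 1) z = ∫ y in Ioi (0:ℝ), gk dt (z + c - y) * vk l w0 dt k y :=
    fun z => by rw [vk_succ, Fk_eq, ← hs1, hσ]
  have hvi1 : Integrable (vk l w0 dt (k + 1)) := Fk_int hlm hw hi hdt k (step_pos hdt k)
  have refl : ∀ f : ℝ → ℝ, ∫ z in Ioi (0:ℝ), f (-z) = ∫ z, (Iic (0:ℝ)).indicator f z := by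
    intro f
    rw [integral_indicator measurableSet_Iic, ← neg_zero, ← integral_comp_neg_Ioi, neg_zero]
  have hK : ∀ K : ℝ → ℝ, Measurable K → ∀ C, (∀ z, |K z| ≤ C) →
      ∫ z in Ioi (0:ℝ), K z * vk l w0 dt (k + 1) (-z) =
      ∫ y in Ioi (0:ℝ), (∫ z in Ioi (0:ℝ), K z * gk dt (z + (y - c))) * vk l w0 dt k y := by
    intro K hKm C hKC
    have hC0 : 0 ≤ C := (abs_nonneg _).trans (hKC 0)
    have a := conv_swap hdt c hvm hvi (K := (Iic (0:ℝ)).indicator (fun z => K (-z)))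
      ((hKm.comp measurable_neg).indicator measurableSet_Iic) C (fun z => by
        by_cases hz : z ∈ Iic (0:ℝ)
        · rw [indicator_of_mem hz]; exact hKC _
        · rw [indicator_of_notMem hz]; simpa using hC0)
    have b := refl (fun z => K (-z) * vk l w0 dt (k + 1) z)
    simp only [neg_neg] at b
    rw [b]
    simp_rw [← hv] at a
    have e1 : ∀ g : ℝ → ℝ, ∫ z, (Iic (0:ℝ)).indicator (fun z => K (-z)) z * g z =
      ∫ z, (Iic (0:ℝ)).indicator (fun z => K (-z) * g z) z := by
      intro g; congr 1; ext z
      by_cases hz : z ∈ Iic (0:ℝ)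
      · rw [indicator_of_mem hz, indicator_of_mem hz]
      · rw [indicator_of_notMem hz, indicator_of_notMem hz, zero_mul]
    rw [← e1, a]
    congr 1; ext y; congr 1
    rw [e1, ← refl]
    congr 1; ext z
    rw [neg_neg, ← gk_neg]; congr 2; ring
  have m1 : ∫ z in Ioi (0:ℝ), vk l w0 dt (k + 1) (-z) = (∫ y in Ioi 0, vk l w0 dt k y) - ∫ y in Ioi 0, vk l w0 dt (k + 1) y := by
    have a := Fk_mass hlm hw hi hdt k (step_pos hdt k)
    have e : ∫ z, Fk l w0 dt k (((k:ℝ) + 1) * dt) z = ∫ z, vk l w0 dt (k + 1) z := rfl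
    rw [e, ← integral_add_compl measurableSet_Ioi hvi1 (s := Ioi 0)] at a
    rw [← a, refl, integral_indicator measurableSet_Iic, compl_Ioi]; ring
  have m2 := hK (fun _ => 1) measurable_const 1 (by simp)
  simp only [one_mul] at m2
  rw [← m1, m2]
  have m3 := hK (pk (t - s1) x) (by fun_prop) _ (pk_sup hτ x)
  unfold jmp
  push_cast
  rw [m3, ← integral_const_mul, ← Real.norm_eq_abs]
  have hle1 : ∀ y, ∫ z in Ioi (0:ℝ), gk dt (z + (y - c)) ≤ 1 := by
    intro y
    have h := integral_gk_shift hdt (y - c) 0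
    simp only [sub_zero] at h
    rw [← h]
    refine setIntegral_le_integral (by simpa using gk_mom_int hdt (y - c) 0) (Eventually.of_forall fun z => gk_nonneg _ _)
  refine norm_integral_le_of_norm_le ?_ ?_
  · have : Integrable (fun y => (∫ z in Ioi (0:ℝ), gk dt (z + (y - c))) * vk l w0 dt k y) (volume.restrict (Ioi 0)) := by
      refine hvi.bdd_mul (c := 1) ?_ (Eventually.of_forall fun y => ?_)
      · refine (StronglyMeasurable.integral_prod_right (f := fun (y : ℝ) z => gk dt (z + (y - c))) ?_).aestronglyMeasurable
        refine Measurable.stronglyMeasurable ?_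
        simp only [Function.uncurry_def]
        fun_prop
      · rw [Real.norm_of_nonneg (integral_nonneg fun z => gk_nonneg _ _)]; exact hle1 y
    exact this.const_mul _
  · refine (ae_restrict_mem measurableSet_Ioi).mono fun y (hy : 0 < y) => ?_
    rw [norm_mul, Real.norm_of_nonneg (vk_nonneg hwn k y), ← mul_assoc]
    refine mul_le_mul_of_nonneg_right ?_ (vk_nonneg hwn k y)
    have ha : -√dt ≤ y - c := by have := (abs_le.1 hc).2; linarith
    have ov := overshoot hdt ha
    have i12 : IntegrableOn (fun z => (z + z ^ 2 * dt ^ (-1/2:ℝ)) * gk dt (z + (y - c))) (Ioi 0) := by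
      have i1 := (gk_mom_int hdt (y - c) 1)
      have i2 := (gk_mom_int hdt (y - c) 2).const_mul (dt ^ (-1/2:ℝ))
      refine ((i1.add i2).congr (Eventually.of_forall fun z => ?_)).integrableOn
      simp only [Pi.add_apply, pow_one]; ring
    calc _ ≤ ∫ z in Ioi (0:ℝ), 1280 / x ^ 2 * ((z + z ^ 2 * dt ^ (-1/2:ℝ)) * gk dt (z + (y - c))) := by
          refine norm_integral_le_of_norm_le (i12.const_mul _) ?_
          refine (ae_restrict_mem measurableSet_Ioi).mono fun z (hz : 0 < z) => ?_
          rw [norm_mul, Real.norm_of_nonneg (gk_nonneg _ _), ← mul_assoc]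
          refine mul_le_mul_of_nonneg_right ?_ (gk_nonneg _ _)
          refine (pk_small hx hτ hz).trans ?_
          gcongr 1280 / x ^ 2 * (z + z ^ 2 * ?_)
          exact Real.rpow_le_rpow_of_nonpos hdt hτ2 (by norm_num)
      _ ≤ 1280 / x ^ 2 * (8 * √dt * ∫ z in Ioi (0:ℝ), gk dt (z + (y - c))) := by
          rw [integral_const_mul]; gcongr
      _ = _ := by ring

lemma jmp_sum (hlm : Measurable l) (hw : Measurable w0) (hwn : ∀ z, 0 ≤ w0 z)
    (hi : IntegrableOn w0 (Ioi 0)) (hdt : 0 < dt) (n : ℕ) {t x : ℝ} (hx : 0 < x)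
    (h2 : ((n:ℝ) + 1) * dt = t)
    (hc : ∀ k < n, |l (((k:ℝ) + 1) * dt) - l (k * dt)| ≤ √dt) :
    |∑ k ∈ Finset.range n, jmp l w0 dt t x (k + 1)| ≤ 10240 / x ^ 2 * √dt * ∫ y in Ioi 0, w0 y := by
  calc _ ≤ ∑ k ∈ Finset.range n, |jmp l w0 dt t x (k + 1)| := Finset.abs_sum_le_sum_abs _ _
    _ ≤ ∑ k ∈ Finset.range n, 10240 / x ^ 2 * √dt *
      ((∫ y in Ioi 0, vk l w0 dt k y) - ∫ y in Ioi 0, vk l w0 dt (k + 1) y) := by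
        refine Finset.sum_le_sum fun k hk => ?_
        have hk' := Finset.mem_range.1 hk
        refine jmp_bound hlm hw hwn hi hdt k hx ?_ (hc k hk')
        have : (k:ℝ) + 1 ≤ n := by exact_mod_cast hk'
        nlinarith
    _ = 10240 / x ^ 2 * √dt * ((∫ y in Ioi 0, w0 y) - ∫ y in Ioi 0, vk l w0 dt n y) := by
        rw [← Finset.mul_sum, Finset.sum_range_sub' (fun k => ∫ y in Ioi 0, vk l w0 dt k y)]; rfl
    _ ≤ _ := by
        have : 0 ≤ ∫ y in Ioi 0, vk l w0 dt n y := integral_nonneg fun y => vk_nonneg hwn n y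
        gcongr; linarith
end

noncomputable def kidx (dt s : ℝ) : ℕ := ⌈s / dt⌉₊ - 1

lemma kidx_lt {dt s : ℝ} (hdt : 0 < dt) (hs : 0 < s) : (kidx dt s : ℝ) * dt < s := by
  have h1 : 0 < ⌈s / dt⌉₊ := Nat.ceil_pos.2 (by positivity)
  have h2 : ((⌈s / dt⌉₊ - 1 : ℕ) : ℝ) < s / dt := by
    rw [← Nat.lt_ceil]; omega
  rw [lt_div_iff₀ hdt] at h2
  exact h2

lemma kidx_ge {dt s : ℝ} (hdt : 0 < dt) (hs : 0 < s) : s ≤ ((kidx dt s : ℝ) + 1) * dt := by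
  have h1 : 0 < ⌈s / dt⌉₊ := Nat.ceil_pos.2 (by positivity)
  have h2 := Nat.le_ceil (s / dt)
  rw [div_le_iff₀ hdt] at h2
  have h3 : (kidx dt s : ℝ) + 1 = ⌈s / dt⌉₊ := by
    unfold kidx; rw [Nat.cast_sub h1]; simp
  rw [h3]; exact h2

lemma kidx_eq {dt s : ℝ} (hdt : 0 < dt) {k : ℕ} (hs : s ∈ Ioc ((k:ℝ) * dt) (((k + 1 : ℕ) : ℝ) * dt)) :
    kidx dt s = k := by
  have h0 : 0 < s := lt_of_le_of_lt (by positivity) hs.1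
  have h1 := kidx_lt hdt h0
  have h2 := kidx_ge hdt h0
  have a1 : (k:ℝ) < kidx dt s + 1 := by
    have := lt_of_lt_of_le hs.1 h2; exact lt_of_mul_lt_mul_right this hdt.le
  have a2 : (kidx dt s:ℝ) < k + 1 := by
    have := lt_of_lt_of_le h1 hs.2; push_cast at this; exact lt_of_mul_lt_mul_right this hdt.le
  have b1 : k < kidx dt s + 1 := by exact_mod_cast a1
  have b2 : kidx dt s < k + 1 := by exact_mod_cast a2
  omega

noncomputable def Wn (l w0 : ℝ → ℝ) (dt s z : ℝ) : ℝ := Fk l w0 dt (kidx dt s) s z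

lemma Wn_meas {l w0 : ℝ → ℝ} {dt : ℝ} (hl : Measurable l) (hw : Measurable w0) :
    Measurable (fun p : ℝ × ℝ => Wn l w0 dt p.1 p.2) := by
  have h1 : Measurable (fun q : ℕ × (ℝ × ℝ) => Fk l w0 dt q.1 q.2.1 q.2.2) :=
    measurable_from_prod_countable_right fun k => Fk_meas hl hw k
  have h2 : Measurable (fun p : ℝ × ℝ => (kidx dt p.1, p)) := by
    refine Measurable.prodMk ?_ measurable_id
    unfold kidx
    exact (measurable_from_top (f := fun n : ℕ => n - 1)).comp (Nat.measurable_ceil.comp (by fun_prop))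
  exact h1.comp h2

open Classical in
noncomputable def wI {Ω : Type*} [MeasurableSpace Ω] (P : Measure Ω)
    (B : ℝ → Ω → ℝ) (h0 m : ℝ → ℝ) (s z : ℝ) : ℝ :=
  if 0 < s ∧ 0 < z then wsol P B h0 m s z else 0

section
variable {Ω : Type*} [MeasurableSpace Ω] {P : Measure Ω} [IsProbabilityMeasure P] {B : ℝ → Ω → ℝ}
    (hB : IsBrownianMotion P B) {h0 m : ℝ → ℝ} (hm0 : m 0 = 0) (hm : Continuous m)
    (hmeas : Measurable h0) {C : ℝ} (hC : ∀ x, |h0 x| ≤ C)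

include hB hm0 hm hmeas hC

lemma Wn_tendsto {T s z : ℝ} (hT : 0 < T) (hs : 0 < s) (hz : z ≠ 0) :
    Tendsto (fun n : ℕ => Wn (fun u => m u - 2 * u) (fun z => Real.exp z * h0 z) (T / (n + 1)) s z)
      atTop (nhds (wsol P B h0 m s z)) :=
  A3 hB h0 m hm0 hm hmeas C hC hT hs hz (fun n => kidx (T / (n + 1)) s)
    (fun n => kidx_lt (by positivity) hs) (fun n => kidx_ge (by positivity) hs)

omit hm0 hm hmeas hC in
lemma fkpp_nonpos {s x : ℝ} (hs : 0 ≤ s) (hx : x ≤ 0) : fkppSol P B h0 m (m s + x) s = 0 := by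
  unfold fkppSol
  rw [integral_eq_zero_of_ae, mul_zero]
  filter_upwards [hB.init] with ω h
  rw [indicator_of_notMem]; · rfl
  intro hω
  have := hω 0 ⟨le_rfl, hs⟩
  simp [h] at this
  linarith

omit hm0 hm hmeas hC in
lemma wsol_nonpos {s z : ℝ} (hs : 0 ≤ s) (hz : z ≤ 0) : wsol P B h0 m s z = 0 := by
  unfold wsol; rw [fkpp_nonpos hB hs hz, mul_zero]

lemma wI_tendsto {s z : ℝ} (hs : 0 < s) {T : ℝ} (hT : 0 < T) (hz : z ≠ 0) :
    Tendsto (fun n : ℕ => Wn (fun u => m u - 2 * u) (fun z => Real.exp z * h0 z) (T / (n + 1)) s z)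
      atTop (nhds (wI P B h0 m s z)) := by
  have := Wn_tendsto hB hm0 hm hmeas hC hT hs hz
  unfold wI
  split_ifs with h
  · exact this
  · rwa [wsol_nonpos hB hs.le (by push Not at h; exact h hs)] at this

lemma wI_meas : Measurable (fun p : ℝ × ℝ => wI P B h0 m p.1 p.2) := by
  have hS : MeasurableSet {p : ℝ × ℝ | 0 < p.1 ∧ 0 < p.2} :=
    (measurableSet_lt measurable_const measurable_fst).inter (measurableSet_lt measurable_const measurable_snd)
  have hlm : Measurable (fun u => m u - 2 * u) := by have := hm.measurable; fun_prop
  have hwm : Measurable (fun z => Real.exp z * h0 z) := by fun_prop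
  refine measurable_of_tendsto_metrizable (f := fun n : ℕ => {p : ℝ × ℝ | 0 < p.1 ∧ 0 < p.2}.indicator
    (fun p => Wn (fun u => m u - 2 * u) (fun z => Real.exp z * h0 z) (1 / (n + 1)) p.1 p.2)) 
    (fun n => (Wn_meas hlm hwm).indicator hS) ?_
  rw [tendsto_pi_nhds]
  intro p
  by_cases hp : p ∈ {p : ℝ × ℝ | 0 < p.1 ∧ 0 < p.2}
  · simp_rw [indicator_of_mem hp]
    exact wI_tendsto hB hm0 hm hmeas hC hp.1 one_pos (ne_of_gt hp.2)
  · simp_rw [indicator_of_notMem hp]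
    have : wI P B h0 m p.1 p.2 = 0 := by unfold wI; exact if_neg hp
    rw [this]; exact tendsto_const_nhds

omit hm0 hm hmeas hC hB [IsProbabilityMeasure P] in
lemma wI_nonneg (hn : ∀ x, 0 ≤ h0 x) (s z : ℝ) : 0 ≤ wI P B h0 m s z := by
  unfold wI wsol fkppSol
  split_ifs
  · refine mul_nonneg (Real.exp_pos _).le (mul_nonneg (Real.exp_pos _).le (integral_nonneg fun ω => ?_))
    exact indicator_nonneg (fun _ _ => hn _) _
  · exact le_rfl

lemma wI_free (hn : ∀ x, 0 ≤ h0 x) (hi : IntegrableOn (fun z => Real.exp z * h0 z) (Ioi 0))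
    {s : ℝ} (hs : 0 < s) (z : ℝ) :
    wI P B h0 m s z ≤ ∫ y in Ioi (0:ℝ), gk s (z + (m s - 2 * s) - y) * (Real.exp y * h0 y) := by
  have hlm : Measurable (fun u => m u - 2 * u) := by have := hm.measurable; fun_prop
  have hwm : Measurable (fun z => Real.exp z * h0 z) := by fun_prop
  have hwn : ∀ z, 0 ≤ Real.exp z * h0 z := fun z => mul_nonneg (Real.exp_pos _).le (hn _)
  by_cases hz : z = 0
  · unfold wI; rw [if_neg (by simp [hz])]
    exact integral_nonneg fun y => mul_nonneg (gk_nonneg _ _) (hwn _)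
  refine le_of_tendsto (wI_tendsto hB hm0 hm hmeas hC hs one_pos hz) (Eventually.of_forall fun n => ?_)
  have := Fk_free hlm hwm hwn hi (dt := 1 / ((n:ℝ) + 1)) (by positivity) (kidx (1 / ((n:ℝ) + 1)) s)
    (kidx_lt (by positivity) hs) z
  simpa [hm0, Wn] using this
end

lemma abs_gk1_le_int {τ : ℝ} (hτ : 0 < τ) : ∫ y, |gk1 τ y| ≤ 80 * τ ^ (-1/2:ℝ) := by
  have hi := (integrable_exp_gauss (c := 16 * τ) (by positivity)).const_mul (10 * τ ^ (-1:ℝ))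
  calc _ ≤ ∫ y, 10 * τ ^ (-1:ℝ) * Real.exp (-(y ^ 2 / (16 * τ))) :=
        integral_mono (integrable_gk1 hτ).abs hi fun y => gk1_bound hτ y
    _ = 10 * τ ^ (-1:ℝ) * √(π * (16 * τ)) := by rw [integral_const_mul, integral_exp_gauss]
    _ = 10 * τ ^ (-1:ℝ) * (4 * √π * τ ^ (1/2:ℝ)) := by
        rw [show π * (16 * τ) = 4 ^ 2 * π * τ by ring, Real.sqrt_mul (by positivity),
          Real.sqrt_mul (by positivity), Real.sqrt_sq (by norm_num), Real.sqrt_eq_rpow τ]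
    _ = 40 * √π * (τ ^ (-1:ℝ) * τ ^ (1/2:ℝ)) := by ring
    _ = 40 * √π * τ ^ (-1/2:ℝ) := by rw [← Real.rpow_add hτ]; norm_num
    _ ≤ _ := by
        have : √π ≤ 2 := by
          rw [Real.sqrt_le_left (by norm_num)]; linarith [Real.pi_lt_four]
        gcongr; linarith

lemma integrable_Dk {τ : ℝ} (hτ : 0 < τ) (x : ℝ) : Integrable (Dk τ x) := by
  have h1 := ((integrable_gk1 hτ).comp_sub_left x).neg
  have h2 := ((integrable_gk1 hτ).comp_add_left x)
  exact h1.sub h2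

lemma int_abs_Dk {τ : ℝ} (hτ : 0 < τ) (x : ℝ) : ∫ z, |Dk τ x z| ≤ 160 * τ ^ (-1/2:ℝ) := by
  have h1 := ((integrable_gk1 hτ).abs.comp_sub_left x)
  have h2 := ((integrable_gk1 hτ).abs.comp_add_left x)
  calc _ ≤ ∫ z, (|gk1 τ (x - z)| + |gk1 τ (x + z)|) := by
        refine integral_mono (integrable_Dk hτ x).abs (h1.add h2) fun z => ?_
        unfold Dk
        simp only
        rw [show -gk1 τ (x - z) - gk1 τ (x + z) = -(gk1 τ (x - z) + gk1 τ (x + z)) by ring, abs_neg]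
        exact abs_add_le _ _
    _ = (∫ z, |gk1 τ z|) + ∫ z, |gk1 τ z| := by
        rw [integral_add h1 h2, integral_sub_left_eq_self (fun z => |gk1 τ z|),
          integral_add_left_eq_self (fun z => |gk1 τ z|)]
    _ ≤ _ := by linarith [abs_gk1_le_int hτ]

lemma beta_half_int {t : ℝ} (ht : 0 < t) :
    IntervalIntegrable (fun s => (t - s) ^ (-1/2:ℝ) * s ^ (-1/2:ℝ)) volume 0 t := by
  have h1 : IntervalIntegrable (fun s : ℝ => s ^ (-1/2:ℝ)) volume 0 t :=
    intervalIntegral.intervalIntegrable_rpow' (by norm_num)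
  have h2 : IntervalIntegrable (fun s : ℝ => (t - s) ^ (-1/2:ℝ)) volume 0 t := by
    have := (h1.comp_sub_left t).symm; simpa using this
  have h3 := (h1.add h2).const_mul ((t/2) ^ (-1/2:ℝ))
  refine h3.mono_fun' (Measurable.aestronglyMeasurable (by fun_prop)) ?_
  rw [uIoc_of_le ht.le]
  refine (ae_restrict_mem measurableSet_Ioc).mono fun s hs => ?_
  have a1 : 0 ≤ s ^ (-1/2:ℝ) := Real.rpow_nonneg hs.1.le _
  have a2 : 0 ≤ (t - s) ^ (-1/2:ℝ) := Real.rpow_nonneg (by linarith [hs.2]) _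
  have a3 : 0 ≤ (t / 2) ^ (-1/2:ℝ) := Real.rpow_nonneg (by linarith) _
  simp only
  rw [Real.norm_of_nonneg (mul_nonneg a2 a1)]
  rcases le_total s (t / 2) with h | h
  · have : (t - s) ^ (-1/2:ℝ) ≤ (t/2) ^ (-1/2:ℝ) := Real.rpow_le_rpow_of_nonpos (by linarith) (by linarith) (by norm_num)
    nlinarith [mul_le_mul_of_nonneg_right this a1, mul_nonneg a3 a2]
  · have : s ^ (-1/2:ℝ) ≤ (t/2) ^ (-1/2:ℝ) := Real.rpow_le_rpow_of_nonpos (by linarith) (by linarith) (by norm_num)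
    nlinarith [mul_le_mul_of_nonneg_left this a2, mul_nonneg a3 a1]

section
variable {l w0 μ : ℝ → ℝ} {dt : ℝ}

lemma Gn_meas {W : ℝ → ℝ → ℝ} (hW : Measurable (fun p : ℝ × ℝ => W p.1 p.2)) (t x : ℝ) :
    Measurable (fun s => ∫ z, Dk (t - s) x z * W s z) := by
  refine StronglyMeasurable.measurable ?_
  refine StronglyMeasurable.integral_prod_right (f := fun (s : ℝ) z => Dk (t - s) x z * W s z) ?_
  refine Measurable.stronglyMeasurable ?_
  simp only [Function.uncurry_def]
  have : Measurable (fun p : ℝ × ℝ => Dk (t - p.1) x p.2) := by fun_prop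
  exact this.mul hW

lemma Gn_bound {W : ℝ → ℝ → ℝ} {s t K : ℝ} (hst : s < t) (x : ℝ) (hW : ∀ z, |W s z| ≤ K) :
    |∫ z, Dk (t - s) x z * W s z| ≤ 160 * (t - s) ^ (-1/2:ℝ) * K := by
  have hK : 0 ≤ K := (abs_nonneg _).trans (hW 0)
  have hτ : 0 < t - s := by linarith
  have hi := (integrable_Dk hτ x).abs.mul_const K
  calc _ ≤ ∫ z, |Dk (t - s) x z| * K := by
        rw [← Real.norm_eq_abs]
        refine norm_integral_le_of_norm_le hi (Eventually.of_forall fun z => ?_)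
        rw [norm_mul]
        exact mul_le_mul_of_nonneg_left (hW z) (abs_nonneg _)
    _ ≤ _ := by
        rw [integral_mul_const]
        exact mul_le_mul_of_nonneg_right (int_abs_Dk hτ x) hK

lemma Ek_sum (hl : Measurable l) (hμ : Continuous μ)
    (hw : Measurable w0) (hwn : ∀ z, 0 ≤ w0 z) (hi : IntegrableOn w0 (Ioi 0)) (hdt : 0 < dt) (n : ℕ) {t : ℝ}
    (ht : 0 < t) (x : ℝ) (h2 : ((n:ℝ) + 1) * dt = t) :
    ∑ k ∈ Finset.range (n + 1), Ek l w0 μ dt t x k =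
      ∫ s in (0:ℝ)..t, μ s * ∫ z, Dk (t - s) x z * Wn l w0 dt s z := by
  have e : ∀ k : ℕ, Ek l w0 μ dt t x k = ∫ s in (k * dt)..((k+1:ℕ):ℝ) * dt,
      μ s * ∫ z, Dk (t - s) x z * Wn l w0 dt s z := by
    intro k
    have hk := step_pos hdt k
    unfold Ek
    rw [intervalIntegral.integral_of_le (by push_cast; exact hk.le),
      intervalIntegral.integral_of_le (by push_cast; exact hk.le)]
    refine setIntegral_congr_fun measurableSet_Ioc fun s hs => ?_
    simp only [Wn, kidx_eq hdt hs]
  simp_rw [e]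
  obtain ⟨Cμ, hCμ⟩ := isCompact_Icc.exists_bound_of_continuousOn (hμ.continuousOn (s := Icc 0 t))
  have hIntg : IntervalIntegrable (fun s => μ s * ∫ z, Dk (t - s) x z * Wn l w0 dt s z) volume 0 t := by
    refine ((beta_half_int ht).const_mul (Cμ * (160 * ∫ y in Ioi (0:ℝ), w0 y))).mono_fun'
      (hμ.measurable.mul (Gn_meas (Wn_meas hl hw) t x)).aestronglyMeasurable ?_
    rw [uIoc_of_le ht.le]
    have hne : ∀ᵐ s ∂(volume.restrict (Ioc 0 t)), s ≠ t :=
      ae_restrict_of_ae (Measure.ae_ne volume t)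
    filter_upwards [ae_restrict_mem measurableSet_Ioc, hne] with s hs hst
    have hst : s < t := lt_of_le_of_ne hs.2 hst
    rw [norm_mul]
    have a := Gn_bound (W := Wn l w0 dt) hst x (K := s ^ (-1/2:ℝ) * ∫ y in Ioi (0:ℝ), w0 y) (fun z => by
      rw [Wn, abs_of_nonneg (Fk_nonneg hwn _ _ _)]
      exact Fk_sup hl hw hwn hi hdt _ (kidx_lt hdt hs.1) z)
    calc _ ≤ Cμ * (160 * (t - s) ^ (-1/2:ℝ) * (s ^ (-1/2:ℝ) * ∫ y in Ioi (0:ℝ), w0 y)) :=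
          mul_le_mul (hCμ s ⟨hs.1.le, hs.2⟩) a (abs_nonneg _) ((norm_nonneg _).trans (hCμ s ⟨hs.1.le, hs.2⟩))
      _ = _ := by ring
  have := intervalIntegral.sum_integral_adjacent_intervals (f := fun s => μ s * ∫ z, Dk (t - s) x z * Wn l w0 dt s z)
    (μ := volume) (a := fun k : ℕ => (k:ℝ) * dt) (n := n + 1) (fun k hk => by
      refine hIntg.mono_set ?_
      have hk := step_pos hdt k
      have h3 : (k:ℝ) + 1 ≤ n + 1 := by exact_mod_cast ‹k < n + 1›
      rw [uIcc_of_le (by push_cast; exact hk.le), uIcc_of_le ht.le]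
      refine Icc_subset_Icc (by positivity) ?_
      push_cast
      rw [← h2]
      gcongr)
  rw [this]
  push_cast
  rw [zero_mul, h2]
end

theorem duhamel {Ω : Type*} [MeasurableSpace Ω] {P : Measure Ω} [IsProbabilityMeasure P] {B : ℝ → Ω → ℝ}
    (hB : IsBrownianMotion P B) {h0 m μ : ℝ → ℝ} (hm0 : m 0 = 0)
    (hmeas : Measurable h0) {C : ℝ} (hC : ∀ x, |h0 x| ≤ C) (hn : ∀ x, 0 ≤ h0 x)
    (hi : IntegrableOn (fun z => Real.exp z * h0 z) (Ioi 0))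
    (hl : ∀ s, HasDerivAt (fun u => m u - 2 * u) (-μ s) s) (hμ : Continuous μ) {t x : ℝ} (ht : 0 < t) (hx : 0 < x) :
    wI P B h0 m t x = (∫ z in Ioi (0:ℝ), pk t x z * (Real.exp z * h0 z)) +
      ∫ s in (0:ℝ)..t, μ s * ∫ z in Ioi (0:ℝ), Dk (t - s) x z * wI P B h0 m s z := by
  set l : ℝ → ℝ := fun u => m u - 2 * u with hldef
  set w0 : ℝ → ℝ := fun z => Real.exp z * h0 z with hw0
  have hlc : Continuous l := continuous_iff_continuousAt.2 fun s => (hl s).continuousAt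
  have hm : Continuous m := by
    have : m = fun u => l u + 2 * u := by ext u; simp [hldef]
    rw [this]; fun_prop
  have hlm := hlc.measurable
  have hwm : Measurable w0 := by fun_prop
  have hwn : ∀ z, 0 ≤ w0 z := fun z => mul_nonneg (Real.exp_pos _).le (hn _)
  have hdt : ∀ n : ℕ, 0 < t / ((n:ℝ) + 1) := fun n => by positivity
  have hnt : ∀ n : ℕ, ((n:ℝ) + 1) * (t / ((n:ℝ) + 1)) = t := fun n => by field_simp
  obtain ⟨Cμ, hCμ⟩ := isCompact_Icc.exists_bound_of_continuousOn (hμ.continuousOn (s := Icc 0 t))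
  have hCμ0 : 0 ≤ Cμ := (norm_nonneg _).trans (hCμ 0 ⟨le_rfl, ht.le⟩)
  have hdt0 : Tendsto (fun n : ℕ => t / ((n:ℝ) + 1)) atTop (nhds 0) := by
    have := (tendsto_one_div_add_atTop_nhds_zero_nat (𝕜 := ℝ)).const_mul t
    simpa [div_eq_mul_inv] using this
  have hwm2 := wI_meas hB hm0 hm hmeas hC
  have hwn2 := wI_nonneg (P := P) (B := B) (m := m) hn
  -- left side
  have L : Tendsto (fun n : ℕ => vk l w0 (t / (n + 1)) (n + 1) x - vk l w0 (t / (n + 1)) (n + 1) (-x)) atTop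
      (nhds (wI P B h0 m t x)) := by
    have hv : ∀ (n : ℕ) y, vk l w0 (t / (n + 1)) (n + 1) y = Fk l w0 (t / (n + 1)) n t y := by
      intro n y; rw [vk_succ, hnt]
    simp_rw [hv]
    have a1 := A3 hB h0 m hm0 hm hmeas C hC (T := t) ht ht hx.ne' (fun n => n)
      (fun n => by have := hdt n; have := hnt n; linarith) (fun n => (hnt n).ge)
    have a2 := A3 hB h0 m hm0 hm hmeas C hC (T := t) ht ht (neg_ne_zero.2 hx.ne') (fun n => n)
      (fun n => by have := hdt n; have := hnt n; linarith) (fun n => (hnt n).ge)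
    have a3 := a1.sub a2
    rw [wsol_nonpos hB ht.le (by linarith : -x ≤ 0), sub_zero] at a3
    have : wI P B h0 m t x = wsol P B h0 m t x := by unfold wI; rw [if_pos ⟨ht, hx⟩]
    rw [this]; exact a3
  -- jumps
  have Jm : Tendsto (fun n : ℕ => ∑ k ∈ Finset.range n, jmp l w0 (t / (n + 1)) t x (k + 1)) atTop (nhds 0) := by
    have hb : Tendsto (fun n : ℕ => 10240 / x ^ 2 * √(t / ((n:ℝ) + 1)) * ∫ y in Ioi 0, w0 y) atTop (nhds 0) := by
      have := ((hdt0.sqrt).const_mul (10240 / x ^ 2)).mul_const (∫ y in Ioi 0, w0 y)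
      simpa using this
    refine squeeze_zero_norm' ?_ hb
    have hev : ∀ᶠ n : ℕ in atTop, Cμ * √(t / ((n:ℝ) + 1)) < 1 := by
      have := (hdt0.sqrt).const_mul Cμ
      simp only [Real.sqrt_zero, mul_zero] at this
      exact this.eventually_lt_const one_pos
    filter_upwards [hev] with n hn1
    refine jmp_sum hlm hwm hwn hi (hdt n) n hx (hnt n) fun k hk => ?_
    have hs := step_pos (hdt n) k
    have hk1 : (k:ℝ) + 1 ≤ n + 1 := by have : (k:ℝ) + 1 ≤ n := by exact_mod_cast hk
                                       linarith
    have hle : ((k:ℝ) + 1) * (t / ((n:ℝ) + 1)) ≤ t := by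
      calc _ ≤ ((n:ℝ) + 1) * (t / ((n:ℝ) + 1)) := mul_le_mul_of_nonneg_right hk1 (hdt n).le
        _ = t := hnt n
    have hk0 : 0 ≤ (k:ℝ) * (t / ((n:ℝ) + 1)) := by positivity
    have := (convex_Icc (0:ℝ) t).norm_image_sub_le_of_norm_hasDerivWithin_le (f := l) (f' := fun s => -μ s) (C := Cμ)
      (fun s _ => (hl s).hasDerivWithinAt) (fun s hs => by rw [norm_neg]; exact hCμ s hs)
      (x := (k:ℝ) * (t / ((n:ℝ) + 1))) (y := ((k:ℝ) + 1) * (t / ((n:ℝ) + 1)))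
      ⟨hk0, by linarith⟩ ⟨by linarith, hle⟩
    refine this.trans ?_
    rw [show ((k:ℝ) + 1) * (t / ((n:ℝ) + 1)) - k * (t / ((n:ℝ) + 1)) = t / ((n:ℝ) + 1) by ring,
      Real.norm_of_nonneg (hdt n).le]
    nth_rewrite 1 [← Real.mul_self_sqrt (hdt n).le]
    nlinarith [Real.sqrt_nonneg (t / ((n:ℝ) + 1))]
  -- main
  have hsup : ∀ n : ℕ, ∀ s > 0, ∀ z, |Wn l w0 (t / (n + 1)) s z| ≤ s ^ (-1/2:ℝ) * ∫ y in Ioi (0:ℝ), w0 y := by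
    intro n s hs z
    rw [Wn, abs_of_nonneg (Fk_nonneg hwn _ _ _)]
    exact Fk_sup hlm hwm hwn hi (hdt n) _ (kidx_lt (hdt n) hs) z
  have M : Tendsto (fun n : ℕ => ∑ k ∈ Finset.range (n + 1), Ek l w0 μ (t / (n + 1)) t x k) atTop
      (nhds (∫ s in (0:ℝ)..t, μ s * ∫ z, Dk (t - s) x z * wI P B h0 m s z)) := by
    have e : ∀ n : ℕ, ∑ k ∈ Finset.range (n + 1), Ek l w0 μ (t / (n + 1)) t x k =
      ∫ s in (0:ℝ)..t, μ s * ∫ z, Dk (t - s) x z * Wn l w0 (t / (n + 1)) s z :=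
      fun n => Ek_sum hlm hμ hwm hwn hi (hdt n) n ht x (hnt n)
    simp_rw [e]
    refine intervalIntegral.tendsto_integral_filter_of_dominated_convergence
      (fun s => (Cμ * (160 * ∫ y in Ioi (0:ℝ), w0 y)) * ((t - s) ^ (-1/2:ℝ) * s ^ (-1/2:ℝ))) ?_ ?_
      ((beta_half_int ht).const_mul _) ?_
    · exact Eventually.of_forall fun n =>
        (hμ.measurable.mul (Gn_meas (Wn_meas hlm hwm) t x)).aestronglyMeasurable
    · refine Eventually.of_forall fun n => ?_
      filter_upwards [Measure.ae_ne volume t] with s hst hs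
      rw [uIoc_of_le ht.le] at hs
      have hst : s < t := lt_of_le_of_ne hs.2 hst
      rw [norm_mul]
      have a := Gn_bound (W := Wn l w0 (t / (n + 1))) hst x (hsup n s hs.1)
      calc _ ≤ Cμ * (160 * (t - s) ^ (-1/2:ℝ) * (s ^ (-1/2:ℝ) * ∫ y in Ioi (0:ℝ), w0 y)) :=
            mul_le_mul (hCμ s ⟨hs.1.le, hs.2⟩) a (abs_nonneg _) hCμ0
        _ = _ := by ring
    · filter_upwards [Measure.ae_ne volume t] with s hst hs
      rw [uIoc_of_le ht.le] at hs
      have hst : s < t := lt_of_le_of_ne hs.2 hst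
      refine Tendsto.const_mul _ ?_
      refine tendsto_integral_of_dominated_convergence
        (fun z => |Dk (t - s) x z| * (s ^ (-1/2:ℝ) * ∫ y in Ioi (0:ℝ), w0 y)) ?_
        ((integrable_Dk (by linarith) x).abs.mul_const _) ?_ ?_
      · intro n
        have h1 : Measurable (Dk (t - s) x) := by fun_prop
        have h2 : Measurable (fun z => Wn l w0 (t / (n + 1)) s z) :=
          (Wn_meas hlm hwm).comp (measurable_const.prodMk measurable_id)
        exact (h1.mul h2).aestronglyMeasurable
      · refine fun n => Eventually.of_forall fun z => ?_
        rw [norm_mul]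
        exact mul_le_mul_of_nonneg_left (hsup n s hs.1 z) (abs_nonneg _)
      · filter_upwards [Measure.ae_ne volume 0] with z hz
        exact (wI_tendsto hB hm0 hm hmeas hC hs.1 ht hz).const_mul _
  have R := ((tendsto_const_nhds (x := ∫ z in Ioi (0:ℝ), pk t x z * w0 z)).add M).add Jm
  rw [add_zero] at R
  have := tendsto_nhds_unique (L.congr fun n => duh_sum hl hμ hwm hi (hdt n) n x (hnt n)) R
  rw [this]
  congr 1
  refine intervalIntegral.integral_congr fun s _ => ?_
  congr 1
  rw [← integral_indicator measurableSet_Ioi]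
  congr 1; ext z
  by_cases hz : z ∈ Ioi (0:ℝ)
  · rw [indicator_of_mem hz]
  · rw [indicator_of_notMem hz]
    have : wI P B h0 m s z = 0 := by unfold wI; rw [if_neg]; rintro ⟨_, h⟩; exact hz h
    rw [this, mul_zero]

noncomputable def ge (τ y : ℝ) : ℝ := Real.exp (-(y ^ 2 / (32 * τ)))
noncomputable def EE (τ x z : ℝ) : ℝ := ge τ x + ge τ (x - z) + ge τ (x + z)

lemma ge_nonneg (τ y : ℝ) : 0 ≤ ge τ y := (Real.exp_pos _).le
lemma ge_le_one {τ : ℝ} (hτ : 0 < τ) (y : ℝ) : ge τ y ≤ 1 := by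
  unfold ge; rw [Real.exp_le_one_iff]; have : 0 ≤ y ^ 2 / (32 * τ) := by positivity
  linarith
lemma EE_nonneg (τ x z : ℝ) : 0 ≤ EE τ x z := by
  have := ge_nonneg τ x; have := ge_nonneg τ (x - z); have := ge_nonneg τ (x + z)
  unfold EE; linarith
lemma EE_le {τ : ℝ} (hτ : 0 < τ) (x z : ℝ) : EE τ x z ≤ 3 := by
  have := ge_le_one hτ x; have := ge_le_one hτ (x - z); have := ge_le_one hτ (x + z)
  unfold EE; linarith

lemma exp16_le_ge {τ : ℝ} (hτ : 0 < τ) (y : ℝ) : Real.exp (-(y ^ 2 / (16 * τ))) ≤ ge τ y := by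
  unfold ge; apply Real.exp_le_exp.2; apply neg_le_neg
  apply div_le_div_of_nonneg_left (by positivity) (by positivity) (by linarith)

lemma exp16_shift {τ : ℝ} (hτ : 0 < τ) {x y z : ℝ} (hz : z ^ 2 ≤ τ) (hz0 : 0 ≤ z) (h : |y - x| ≤ z) :
    Real.exp (-(y ^ 2 / (16 * τ))) ≤ 2 * ge τ x := by
  have h1 : (y - x) ^ 2 ≤ τ := by
    have := sq_abs (y - x); nlinarith [abs_nonneg (y - x)]
  have h2 : x ^ 2 ≤ 2 * y ^ 2 + 2 * τ := by nlinarith [sq_nonneg (y - (x - y))]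
  have h3 : -(y ^ 2 / (16 * τ)) ≤ 1 / 16 + -(x ^ 2 / (32 * τ)) := by
    have : x ^ 2 / (32 * τ) ≤ (2 * y ^ 2 + 2 * τ) / (32 * τ) := by gcongr
    have e : (2 * y ^ 2 + 2 * τ) / (32 * τ) = y ^ 2 / (16 * τ) + 1 / 16 := by field_simp; ring
    linarith
  have h4 : Real.exp (1 / 16) ≤ 2 := by
    have := Real.exp_one_lt_d9
    have h5 : Real.exp (1/16) ^ 16 ≤ 2 ^ 16 := by
      rw [← Real.exp_nat_mul]; norm_num; linarith
    exact le_of_pow_le_pow_left₀ (by norm_num) (by norm_num) h5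
  calc _ ≤ Real.exp (1 / 16 + -(x ^ 2 / (32 * τ))) := Real.exp_le_exp.2 h3
    _ = Real.exp (1/16) * ge τ x := by rw [Real.exp_add]; rfl
    _ ≤ _ := by gcongr; exact ge_nonneg _ _

lemma mvt_bound {f f' : ℝ → ℝ} {a b M : ℝ} (hab : a ≤ b) (hf : ∀ y ∈ Icc a b, HasDerivAt f (f' y) y)
    (hM : ∀ y ∈ Icc a b, |f' y| ≤ M) : |f b - f a| ≤ M * (b - a) := by
  have := (convex_Icc a b).norm_image_sub_le_of_norm_hasDerivWithin_le
    (f := f) (f' := f') (C := M) (fun y hy => (hf y hy).hasDerivWithinAt) hM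
    (left_mem_Icc.2 hab) (right_mem_Icc.2 hab)
  simpa [Real.norm_eq_abs, abs_of_nonneg (sub_nonneg.2 hab)] using this

/-- first difference -/
lemma diff1 {f f' : ℝ → ℝ} (hf : ∀ y, HasDerivAt f (f' y) y) {x z M : ℝ} (hz : 0 ≤ z)
    (hM : ∀ y, |y - x| ≤ z → |f' y| ≤ M) : |f (x - z) - f (x + z)| ≤ 2 * z * M := by
  have := mvt_bound (a := x - z) (b := x + z) (M := M) (by linarith) (fun y _ => hf y)
    (fun y hy => hM y (by rw [abs_le]; constructor <;> linarith [hy.1, hy.2]))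
  rw [abs_sub_comm]; linarith

/-- second difference -/
lemma diff2 {f f' f'' : ℝ → ℝ} (hf : ∀ y, HasDerivAt f (f' y) y) (hf' : ∀ y, HasDerivAt f' (f'' y) y)
    {x z M : ℝ} (hz : 0 ≤ z) 
    (hM : ∀ y, |y - x| ≤ z → |f'' y| ≤ M) : |f (x - z) + f (x + z) - 2 * f x| ≤ 2 * z ^ 2 * M := by
  have hM0 : 0 ≤ M := (abs_nonneg _).trans (hM x (by simpa using hz))
  have hd : ∀ y, HasDerivAt (fun ζ => f (x - ζ) + f (x + ζ)) (-f' (x - y) + f' (x + y)) y := by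
    intro y
    have h1 := (hf (x - y)).comp y ((hasDerivAt_id y).const_sub x)
    have h2 := (hf (x + y)).comp y ((hasDerivAt_id y).const_add x)
    exact (h1.add h2).congr_deriv (by simp)
  have := mvt_bound (a := 0) (b := z) (M := 2 * z * M) hz (fun y _ => hd y) (fun y hy => by
    have h := diff1 hf' (x := x) (z := y) (M := M) hy.1 (fun u hu => hM u (hu.trans hy.2))
    rw [show -f' (x - y) + f' (x + y) = -(f' (x - y) - f' (x + y)) by ring, abs_neg]
    refine h.trans ?_
    have := hy.2
    gcongr)
  simp only [sub_zero, add_zero] at this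
  rw [show f (x - z) + f (x + z) - 2 * f x = f (x - z) + f (x + z) - (f x + f x) by ring]
  refine this.trans (le_of_eq (by ring))

lemma gkb {τ : ℝ} (hτ : 0 < τ) (y : ℝ) : |gk τ y| ≤ 10 * τ ^ (-1/2 : ℝ) * ge τ y :=
  (gk_bound hτ y).trans (by gcongr; exact exp16_le_ge hτ y)
lemma gkb1 {τ : ℝ} (hτ : 0 < τ) (y : ℝ) : |gk1 τ y| ≤ 10 * τ ^ (-1 : ℝ) * ge τ y :=
  (gk1_bound hτ y).trans (by gcongr; exact exp16_le_ge hτ y)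
lemma gkb3 {τ : ℝ} (hτ : 0 < τ) (y : ℝ) : |gk3 τ y| ≤ 10 * τ ^ (-2 : ℝ) * ge τ y :=
  (gk3_bound hτ y).trans (by gcongr; exact exp16_le_ge hτ y)

noncomputable def K3 (τ x z : ℝ) : ℝ := Dk τ x z - qk τ x
noncomputable def K1 (τ x z : ℝ) : ℝ := pk τ x z - z * qk τ x

lemma ge_le_EE (τ x z : ℝ) : ge τ x ≤ EE τ x z := by
  have := ge_nonneg τ (x - z); have := ge_nonneg τ (x + z); unfold EE; linarith
lemma ge_le_EE' (τ x z : ℝ) : ge τ (x - z) + ge τ (x + z) ≤ EE τ x z := by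
  have := ge_nonneg τ x; unfold EE; linarith

lemma pk_b {τ : ℝ} (hτ : 0 < τ) (x z : ℝ) : |pk τ x z| ≤ 10 * τ ^ (-1/2 : ℝ) * (ge τ (x - z) + ge τ (x + z)) := by
  unfold pk; have := gkb hτ (x - z); have := gkb hτ (x + z)
  refine (abs_sub _ _).trans ?_; linarith
lemma Dk_b {τ : ℝ} (hτ : 0 < τ) (x z : ℝ) : |Dk τ x z| ≤ 10 * τ ^ (-1 : ℝ) * (ge τ (x - z) + ge τ (x + z)) := by
  unfold Dk; have := gkb1 hτ (x - z); have := gkb1 hτ (x + z)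
  refine (abs_sub _ _).trans ?_; rw [abs_neg]; linarith
lemma qk_b {τ : ℝ} (hτ : 0 < τ) (x : ℝ) : |qk τ x| ≤ 20 * τ ^ (-1 : ℝ) * ge τ x := by
  unfold qk; have := gkb1 hτ x; rw [abs_mul]; norm_num; linarith

lemma pk_b_near {τ : ℝ} (hτ : 0 < τ) (x : ℝ) {z : ℝ} (hz : 0 ≤ z) (hzτ : z ^ 2 ≤ τ) :
    |pk τ x z| ≤ 40 * z * τ ^ (-1 : ℝ) * ge τ x := by
  refine (diff1 (hasDerivAt_gk hτ) hz (M := 10 * τ ^ (-1 : ℝ) * (2 * ge τ x)) fun y hy => ?_).trans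
    (le_of_eq (by ring))
  exact (gk1_bound hτ y).trans (by gcongr; exact exp16_shift hτ hzτ hz hy)
lemma K3_b_near {τ : ℝ} (hτ : 0 < τ) (x : ℝ) {z : ℝ} (hz : 0 ≤ z) (hzτ : z ^ 2 ≤ τ) :
    |K3 τ x z| ≤ 40 * z ^ 2 * τ ^ (-2 : ℝ) * ge τ x := by
  have := (diff2 (hasDerivAt_gk1 hτ) (hasDerivAt_gk2 hτ) (x := x) hz (M := 10 * τ ^ (-2 : ℝ) * (2 * ge τ x)) fun y hy => 
    (gk3_bound hτ y).trans (by gcongr; exact exp16_shift hτ hzτ hz hy))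
  rw [show K3 τ x z = -(gk1 τ (x - z) + gk1 τ (x + z) - 2 * gk1 τ x) by unfold K3 Dk qk; ring, abs_neg]
  refine this.trans (le_of_eq (by ring))
lemma K1_b_near {τ : ℝ} (hτ : 0 < τ) (x : ℝ) {z : ℝ} (hz : 0 ≤ z) (hzτ : z ^ 2 ≤ τ) :
    |K1 τ x z| ≤ 40 * z ^ 3 * τ ^ (-2 : ℝ) * ge τ x := by
  have hd : ∀ y, HasDerivAt (fun z => K1 τ x z) (K3 τ x y) y := fun y =>
    ((hasDerivAt_pk hτ x y).sub ((hasDerivAt_id y).mul_const (qk τ x))).congr_deriv (by unfold K3; simp)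
  have := mvt_bound hz (fun y _ => hd y) (M := 40 * z ^ 2 * τ ^ (-2 : ℝ) * ge τ x) (fun y hy => by
    have h2 : y ^ 2 ≤ z ^ 2 := by have := hy.1; have := hy.2; gcongr
    refine (K3_b_near hτ x hy.1 (h2.trans hzτ)).trans ?_
    have := ge_nonneg τ x
    gcongr)
  have h0 : K1 τ x 0 = 0 := by simp [K1, pk]
  rw [h0] at this; simp only [sub_zero] at this
  exact this.trans (le_of_eq (by ring))
/-- far bounds -/
lemma K3_b_far {τ : ℝ} (hτ : 0 < τ) (x z : ℝ) : |K3 τ x z| ≤ 20 * τ ^ (-1 : ℝ) * EE τ x z := by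
  have h1 := Dk_b hτ x z; have h2 := qk_b hτ x
  have h3 : 0 ≤ τ ^ (-1 : ℝ) := by positivity
  have h4 := ge_nonneg τ (x - z); have h5 := ge_nonneg τ (x + z)
  unfold K3 EE; refine (abs_sub _ _).trans ?_; nlinarith [mul_nonneg h3 h4, mul_nonneg h3 h5]
lemma K1_b_far {τ : ℝ} (hτ : 0 < τ) (x : ℝ) {z : ℝ} (hz : 0 ≤ z) : |K1 τ x z| ≤
    10 * τ ^ (-1/2 : ℝ) * (ge τ (x - z) + ge τ (x + z)) + 20 * z * τ ^ (-1 : ℝ) * ge τ x := by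
  have h1 := pk_b hτ x z; have h2 := qk_b hτ x
  unfold K1; refine (abs_sub _ _).trans ?_; rw [abs_mul, abs_of_nonneg hz]
  have := mul_le_mul_of_nonneg_left h2 hz
  linarith

/-- fixed-x bounds (linear in x) -/
lemma exp16_le_one {τ : ℝ} (hτ : 0 < τ) (y : ℝ) : Real.exp (-(y ^ 2 / (16 * τ))) ≤ 1 :=
  (exp16_le_ge hτ y).trans (ge_le_one hτ y)
lemma gks2 {τ : ℝ} (hτ : 0 < τ) (y : ℝ) : |gk2 τ y| ≤ 10 * τ ^ (-3/2 : ℝ) :=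
  (gk2_bound hτ y).trans (mul_le_of_le_one_right (by positivity) (exp16_le_one hτ y))
lemma gks3 {τ : ℝ} (hτ : 0 < τ) (y : ℝ) : |gk3 τ y| ≤ 10 * τ ^ (-2 : ℝ) :=
  (gk3_bound hτ y).trans (mul_le_of_le_one_right (by positivity) (exp16_le_one hτ y))
lemma gks4 {τ : ℝ} (hτ : 0 < τ) (y : ℝ) : |gk4 τ y| ≤ 10 * τ ^ (-5/2 : ℝ) :=
  (gk4_bound hτ y).trans (mul_le_of_le_one_right (by positivity) (exp16_le_one hτ y))
lemma Dk_x {τ : ℝ} (hτ : 0 < τ) {x : ℝ} (hx : 0 ≤ x) (z : ℝ) : |Dk τ x z| ≤ 20 * x * τ ^ (-3/2 : ℝ) := by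
  have := mvt_bound (f := fun x => Dk τ x z) (f' := fun y => -gk2 τ (y - z) - gk2 τ (y + z)) hx
    (M := 20 * τ ^ (-3/2 : ℝ)) (fun y _ => ?_) (fun y _ => ?_)
  · have h0 : Dk τ 0 z = 0 := by simp [Dk, gk1_neg]
    simp only [h0, sub_zero] at this; linarith
  · have h1 := (hasDerivAt_gk1 hτ (y - z)).comp y ((hasDerivAt_id y).sub_const z)
    have h2 := (hasDerivAt_gk1 hτ (y + z)).comp y ((hasDerivAt_id y).add_const z)
    exact (h1.neg.sub h2).congr_deriv (by simp)
  · refine (abs_sub _ _).trans ?_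
    rw [abs_neg]; linarith [gks2 hτ (y - z), gks2 hτ (y + z)]
lemma K3_x {τ : ℝ} (hτ : 0 < τ) {x : ℝ} (hx : 0 ≤ x) {z : ℝ} (hz : 0 ≤ z) :
    |K3 τ x z| ≤ 40 * x * τ ^ (-3/2 : ℝ) ∧ |K3 τ x z| ≤ 20 * x * z ^ 2 * τ ^ (-5/2 : ℝ) := by
  have h0 : K3 τ 0 z = 0 := by simp [K3, Dk, qk, gk1_neg, gk1_zero]
  have hd : ∀ y, HasDerivAt (fun x => K3 τ x z) (-(gk2 τ (y - z) + gk2 τ (y + z) - 2 * gk2 τ y)) y := by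
    intro y
    have h1 := (hasDerivAt_gk1 hτ (y - z)).comp y ((hasDerivAt_id y).sub_const z)
    have h2 := (hasDerivAt_gk1 hτ (y + z)).comp y ((hasDerivAt_id y).add_const z)
    have h3 := (hasDerivAt_gk1 hτ y).const_mul (-2)
    exact ((h1.neg.sub h2).sub h3).congr_deriv (by simp; ring)
  constructor
  · have := mvt_bound hx (fun y _ => hd y) (M := 40 * τ ^ (-3/2 : ℝ)) (fun y _ => by
      rw [abs_neg]
      have h1 := abs_le.1 (gks2 hτ (y - z)); have h2 := abs_le.1 (gks2 hτ (y + z))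
      have h3 := abs_le.1 (gks2 hτ y); rw [abs_le]; constructor <;> linarith)
    simp only [h0, sub_zero] at this; linarith
  · have := mvt_bound hx (fun y _ => hd y) (M := 2 * z ^ 2 * (10 * τ ^ (-5/2 : ℝ))) (fun y _ => by
      rw [abs_neg]
      exact diff2 (hasDerivAt_gk2 hτ) (hasDerivAt_gk3 hτ) hz (fun u _ => gks4 hτ u))
    simp only [h0, sub_zero] at this; linarith
lemma gk3_x {τ : ℝ} (hτ : 0 < τ) {x : ℝ} (hx : 0 ≤ x) : |gk3 τ x| ≤ 10 * x * τ ^ (-5/2 : ℝ) := by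
  have := mvt_bound hx (fun y _ => hasDerivAt_gk3 hτ y) (fun y _ => gks4 hτ y)
  simp only [gk3_zero, sub_zero] at this; linarith

lemma half_rpow {t τ q : ℝ} (ht : 0 < t) (h : t / 2 ≤ τ) (hq : q ≤ 0) : τ ^ q ≤ 2 ^ (-q) * t ^ q := by
  calc τ ^ q ≤ (t / 2) ^ q := Real.rpow_le_rpow_of_nonpos (by positivity) h hq
    _ = _ := by rw [Real.div_rpow ht.le (by norm_num), Real.rpow_neg (by norm_num)]; field_simp

lemma qk_diff {t s x M : ℝ} (ht : 0 < t) (hs : 0 ≤ s) (hst : s ≤ t / 2)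
    (hM : ∀ τ ∈ Icc (t / 2) t, |gk3 τ x| ≤ M) : |qk (t - s) x - qk t x| ≤ 2 * s * M := by
  have := mvt_bound (f := fun τ => gk1 τ x) (f' := fun τ => gk3 τ x) (a := t - s) (b := t) (M := M) (by linarith)
    (fun τ hτ => hasDerivAt_gk1_time (by linarith [hτ.1]) x) (fun τ hτ => hM τ ⟨by linarith [hτ.1], hτ.2⟩)
  rw [show qk (t - s) x - qk t x = 2 * (gk1 t x - gk1 (t - s) x) by unfold qk; ring, abs_mul]
  norm_num; linarith
lemma qk_diff_b {t s : ℝ} (x : ℝ) (ht : 0 < t) (hs : 0 ≤ s) (hst : s ≤ t / 2) :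
    |qk (t - s) x - qk t x| ≤ 80 * s * t ^ (-2 : ℝ) * ge t x := by
  refine (qk_diff ht hs hst (M := 40 * t ^ (-2 : ℝ) * ge t x) fun τ hτ => ?_).trans (le_of_eq (by ring))
  have hτ0 : 0 < τ := by linarith [hτ.1]
  refine (gkb3 hτ0 x).trans ?_
  have h1 := half_rpow ht hτ.1 (q := -2) (by norm_num)
  norm_num at h1
  have h2 : ge τ x ≤ ge t x := by
    unfold ge; apply Real.exp_le_exp.2; apply neg_le_neg
    have := hτ.2
    apply div_le_div_of_nonneg_left (by positivity) (by positivity) (by linarith)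
  have h4 : (0:ℝ) ≤ ge τ x := ge_nonneg _ _
  calc 10 * τ ^ (-2 : ℝ) * ge τ x ≤ 10 * (4 * t ^ (-2:ℝ)) * ge t x := by
        gcongr; norm_num at h1 ⊢; exact h1
    _ = _ := by ring
lemma qk_diff_x {t s x : ℝ} (hx : 0 ≤ x) (ht : 0 < t) (hs : 0 ≤ s) (hst : s ≤ t / 2) :
    |qk (t - s) x - qk t x| ≤ 160 * s * x * t ^ (-5/2 : ℝ) := by
  refine (qk_diff ht hs hst (M := 80 * x * t ^ (-5/2 : ℝ)) fun τ hτ => ?_).trans (le_of_eq (by ring))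
  have hτ0 : 0 < τ := by linarith [hτ.1]
  refine (gk3_x hτ0 hx).trans ?_
  have h1 := half_rpow ht hτ.1 (q := -5/2) (by norm_num)
  have h2 : (2:ℝ) ^ (-(-5/2:ℝ)) ≤ 8 := by
    calc (2:ℝ) ^ (-(-5/2:ℝ)) ≤ 2 ^ (3:ℝ) := Real.rpow_le_rpow_of_exponent_le (by norm_num) (by norm_num)
      _ = 8 := by norm_num
  have h3 : (0:ℝ) ≤ t ^ (-5/2:ℝ) := by positivity
  have h4 := mul_le_mul_of_nonneg_right h2 h3
  calc 10 * x * τ ^ (-5/2 : ℝ) ≤ 10 * x * (8 * t ^ (-5/2:ℝ)) := by gcongr; linarith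
    _ = _ := by ring

@[fun_prop] lemma measurable_ge {f g : α → ℝ} [MeasurableSpace α] (hf : Measurable f) (hg : Measurable g) :
    Measurable (fun a => ge (f a) (g a)) := by unfold ge; fun_prop

lemma ge_neg (τ y : ℝ) : ge τ (-y) = ge τ y := by simp [ge]

noncomputable def cmom (p : ℝ) : ℝ := 32 ^ ((p+1)/2) * (1/2) * Real.Gamma ((p+1)/2)
lemma cmom_pos {p : ℝ} (hp : 0 ≤ p) : 0 < cmom p := by
  unfold cmom; have := Real.Gamma_pos_of_pos (s := (p+1)/2) (by linarith); positivity

lemma ge_mom_half {p τ : ℝ} (hp : 0 ≤ p) (hτ : 0 < τ) :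
    ∫⁻ y in Ioi (0:ℝ), ENNReal.ofReal (y ^ p * ge τ y) = ENNReal.ofReal (cmom p * τ ^ ((p+1)/2)) := by
  have e : ∀ y : ℝ, y ^ p * ge τ y = y ^ p * Real.exp (-(1/(32*τ)) * y ^ (2:ℝ)) := by
    intro y; unfold ge; congr 2; rw [Real.rpow_two]; field_simp
  have hb : 0 < 1 / (32 * τ) := by positivity
  have hi := integrableOn_rpow_mul_exp_neg_mul_rpow (p := 2) (s := p) (b := 1/(32*τ)) (by linarith) two_pos hb
  have hv := integral_rpow_mul_exp_neg_mul_rpow (p := 2) (q := p) (b := 1/(32*τ)) two_pos (by linarith) hb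
  simp_rw [e]
  rw [← ofReal_integral_eq_lintegral_ofReal hi, hv]
  · congr 1
    unfold cmom
    rw [one_div, Real.inv_rpow (by positivity), ← Real.rpow_neg (by positivity), Real.mul_rpow (by norm_num) hτ.le,
      show -(-(p+1)/2) = (p+1)/2 by ring]
    ring
  · filter_upwards [ae_restrict_mem measurableSet_Ioi] with y hy
    have : (0:ℝ) < y := hy
    simp only [Pi.zero_apply]; positivity

lemma ge_mom_abs {p τ : ℝ} (hp : 0 ≤ p) (hτ : 0 < τ) :
    ∫⁻ y : ℝ, ENNReal.ofReal (|y| ^ p * ge τ y) = ENNReal.ofReal (2 * cmom p * τ ^ ((p+1)/2)) := by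
  have hm : Measurable fun y : ℝ => ENNReal.ofReal (|y| ^ p * ge τ y) := by fun_prop
  have h1 : ∫⁻ y in Ioi (0:ℝ), ENNReal.ofReal (|y| ^ p * ge τ y) = ENNReal.ofReal (cmom p * τ ^ ((p+1)/2)) := by
    rw [← ge_mom_half hp hτ]
    refine setLIntegral_congr_fun measurableSet_Ioi fun y hy => ?_
    rw [abs_of_pos hy]
  have h2 : ∫⁻ y in Iio (0:ℝ), ENNReal.ofReal (|y| ^ p * ge τ y) = ENNReal.ofReal (cmom p * τ ^ ((p+1)/2)) := by
    rw [← h1]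
    have := (Measure.measurePreserving_neg (volume : Measure ℝ)).setLIntegral_comp_preimage
      (s := Iio 0) measurableSet_Iio hm
    rw [← this]
    simp [ge_neg]
  rw [← lintegral_add_compl _ (measurableSet_Ioi (a := (0:ℝ))), compl_Ioi, h1, setLIntegral_congr Iio_ae_eq_Iic.symm, h2,
    ← ENNReal.ofReal_add (by have := cmom_pos hp; positivity) (by have := cmom_pos hp; positivity)]
  congr 1; ring

lemma add_rpow_le {a b p : ℝ} (ha : 0 ≤ a) (hb : 0 ≤ b) (hp : 0 ≤ p) :
    (a + b) ^ p ≤ 2 ^ p * (a ^ p + b ^ p) := by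
  have h1 : a + b ≤ 2 * max a b := by linarith [le_max_left a b, le_max_right a b]
  have h2 : (a + b) ^ p ≤ (2 * max a b) ^ p := Real.rpow_le_rpow (by positivity) h1 hp
  rw [Real.mul_rpow (by norm_num) (le_max_of_le_left ha)] at h2
  refine h2.trans ?_
  gcongr
  rcases max_choice a b with h | h <;> rw [h]
  · linarith [Real.rpow_nonneg hb p]
  · linarith [Real.rpow_nonneg ha p]

lemma ge_mom_shift {p τ c z : ℝ} (hp : 0 ≤ p) (hτ : 0 < τ) (hz : |c| ≤ z) :
    ∫⁻ x in Ioi (0:ℝ), ENNReal.ofReal (x ^ p * ge τ (x - c)) ≤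
      ENNReal.ofReal (2 ^ p * (2 * cmom p + 2 * cmom 0) * (τ ^ ((p+1)/2) + z ^ p * τ ^ (1/2 : ℝ))) := by
  have hz0 : 0 ≤ z := (abs_nonneg _).trans hz
  have c1 := cmom_pos hp; have c0 := cmom_pos (le_refl (0:ℝ))
  calc _ ≤ ∫⁻ x in Ioi (0:ℝ), ENNReal.ofReal (2 ^ p * ((|x - c| ^ p * ge τ (x - c)) + z ^ p * (|x - c| ^ (0:ℝ) * ge τ (x - c)))) := by
        refine setLIntegral_mono (by fun_prop) fun x hx => ENNReal.ofReal_le_ofReal ?_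
        have hx0 : (0:ℝ) < x := hx
        have h1 : x ≤ |x - c| + z := by linarith [le_abs_self (x - c), (abs_le.1 hz).2]
        have h2 := (Real.rpow_le_rpow hx0.le h1 hp).trans (add_rpow_le (abs_nonneg _) hz0 hp)
        have := mul_le_mul_of_nonneg_right h2 (ge_nonneg τ (x - c))
        rw [Real.rpow_zero]; linarith
    _ ≤ ∫⁻ x, ENNReal.ofReal (2 ^ p * ((|x - c| ^ p * ge τ (x - c)) + z ^ p * (|x - c| ^ (0:ℝ) * ge τ (x - c)))) :=
        setLIntegral_le_lintegral _ _
    _ = ∫⁻ x, ENNReal.ofReal (2 ^ p * ((|x| ^ p * ge τ x) + z ^ p * (|x| ^ (0:ℝ) * ge τ x))) := 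
        lintegral_sub_right_eq_self (fun x => ENNReal.ofReal (2 ^ p * ((|x| ^ p * ge τ x) + z ^ p * (|x| ^ (0:ℝ) * ge τ x)))) c
    _ = ENNReal.ofReal (2 ^ p) * (ENNReal.ofReal (2 * cmom p * τ ^ ((p+1)/2)) + ENNReal.ofReal (z ^ p) * ENNReal.ofReal (2 * cmom 0 * τ ^ ((0+1)/2 : ℝ))) := by
        rw [← ge_mom_abs hp hτ, ← ge_mom_abs (le_refl 0) hτ, ← lintegral_const_mul _ (by fun_prop), ← lintegral_add_left (by fun_prop),
          ← lintegral_const_mul _ (by fun_prop)]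
        refine lintegral_congr fun x => ?_
        have := ge_nonneg τ x
        rw [← ENNReal.ofReal_mul (by positivity), ← ENNReal.ofReal_add (by positivity) (by positivity), ← ENNReal.ofReal_mul (by positivity)]
    _ ≤ _ := by
        rw [← ENNReal.ofReal_mul (by positivity), ← ENNReal.ofReal_add (by positivity) (by positivity), ← ENNReal.ofReal_mul (by positivity)]
        apply ENNReal.ofReal_le_ofReal
        have h1 : 0 ≤ τ ^ ((p+1)/2) := by positivity
        have h2 : 0 ≤ z ^ p * τ ^ (1/2 : ℝ) := by positivity
        rw [zero_add, mul_assoc (2 ^ p : ℝ)]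
        refine mul_le_mul_of_nonneg_left ?_ (by positivity)
        nlinarith [mul_nonneg c1.le h2, mul_nonneg c0.le h1]

noncomputable def cE (p : ℝ) : ℝ := 2 * (2 ^ p * (2 * cmom p + 2 * cmom 0))
lemma cE_pos {p : ℝ} (hp : 0 ≤ p) : 0 < cE p := by
  have c1 := cmom_pos hp; have c0 := cmom_pos (le_refl (0:ℝ)); unfold cE; positivity

lemma ge_mom0 {p τ : ℝ} (hp : 0 ≤ p) (hτ : 0 < τ) :
    ∫⁻ y in Ioi (0:ℝ), ENNReal.ofReal (y ^ p * ge τ y) ≤ ENNReal.ofReal (cE p * τ ^ ((p+1)/2)) := by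
  rw [ge_mom_half hp hτ]
  apply ENNReal.ofReal_le_ofReal
  have c1 := cmom_pos hp; have c0 := cmom_pos (le_refl (0:ℝ))
  have h : (1:ℝ) ≤ 2 ^ p := Real.one_le_rpow (by norm_num) hp
  gcongr
  unfold cE; nlinarith

lemma ge_mom2 {p τ z : ℝ} (hp : 0 ≤ p) (hτ : 0 < τ) (hz : 0 ≤ z) :
    ∫⁻ x in Ioi (0:ℝ), ENNReal.ofReal (x ^ p * (ge τ (x - z) + ge τ (x + z))) ≤
      ENNReal.ofReal (cE p * (τ ^ ((p+1)/2) + z ^ p * τ ^ (1/2 : ℝ))) := by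
  have h1 := ge_mom_shift (c := z) hp hτ (abs_of_nonneg hz).le
  have h2 := ge_mom_shift (c := -z) hp hτ (by rw [abs_neg, abs_of_nonneg hz] : |-z| ≤ z)
  have c1 := cmom_pos hp; have c0 := cmom_pos (le_refl (0:ℝ))
  calc _ = (∫⁻ x in Ioi (0:ℝ), ENNReal.ofReal (x ^ p * ge τ (x - z))) + ∫⁻ x in Ioi (0:ℝ), ENNReal.ofReal (x ^ p * ge τ (x - -z)) := by
        rw [← lintegral_add_left (by fun_prop)]
        refine setLIntegral_congr_fun measurableSet_Ioi fun x hx => ?_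
        have : (0:ℝ) < x := hx
        have := ge_nonneg τ (x - z); have := ge_nonneg τ (x + z)
        simp only [sub_neg_eq_add]
        rw [← ENNReal.ofReal_add (by positivity) (by positivity), mul_add]
    _ ≤ _ := add_le_add h1 h2
    _ = _ := by
        rw [← ENNReal.ofReal_add (by positivity) (by positivity)]; congr 1; unfold cE; ring

lemma rpa {τ : ℝ} (hτ : 0 < τ) {a b c : ℝ} (h : a + b = c) : τ ^ a * τ ^ b = τ ^ c := by
  rw [← Real.rpow_add hτ, h]

lemma scale_v {τ z : ℝ} (hτ : 0 < τ) (hz : 0 ≤ z) : ∃ v, 0 ≤ v ∧ z = v * τ ^ (1/2:ℝ) ∧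
    (z ^ 2 ≤ τ → v ≤ 1) ∧ (¬ z ^ 2 ≤ τ → 1 ≤ v) ∧ ∀ p : ℝ, z ^ p = v ^ p * τ ^ (p/2) := by
  have hh : τ ^ (1/2:ℝ) * τ ^ (1/2:ℝ) = τ := by rw [rpa hτ (c := 1) (by norm_num), Real.rpow_one]
  have hp : 0 < τ ^ (1/2:ℝ) := by positivity
  have e : z = z / τ ^ (1/2:ℝ) * τ ^ (1/2:ℝ) := by field_simp
  refine ⟨z / τ ^ (1/2:ℝ), by positivity, e, fun h => ?_, fun h => ?_, fun p => ?_⟩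
  · rw [div_le_one hp]; nlinarith
  · rw [one_le_div hp]; push Not at h; nlinarith
  · conv_lhs => rw [e]
    rw [Real.mul_rpow (by positivity) hp.le, ← Real.rpow_mul hτ.le]
    congr 2; ring

lemma lint_le {K G : ℝ → ℝ} {p c B : ℝ} (hc : 0 ≤ c) (hK : ∀ x > 0, |K x| ≤ c * G x)
    (hG : ∫⁻ x in Ioi (0:ℝ), ENNReal.ofReal (x ^ p * G x) ≤ ENNReal.ofReal B) :
    ∫⁻ x in Ioi (0:ℝ), ENNReal.ofReal (x ^ p * |K x|) ≤ ENNReal.ofReal (c * B) := by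
  calc _ ≤ ∫⁻ x in Ioi (0:ℝ), ENNReal.ofReal c * ENNReal.ofReal (x ^ p * G x) := by
        refine lintegral_mono_ae ?_
        filter_upwards [ae_restrict_mem measurableSet_Ioi] with x hx
        have hx0 : (0:ℝ) < x := hx
        rw [← ENNReal.ofReal_mul hc]
        apply ENNReal.ofReal_le_ofReal
        have := mul_le_mul_of_nonneg_left (hK x hx0) (Real.rpow_nonneg hx0.le p)
        linarith
    _ = ENNReal.ofReal c * ∫⁻ x in Ioi (0:ℝ), ENNReal.ofReal (x ^ p * G x) := lintegral_const_mul' _ _ ENNReal.ofReal_ne_top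
    _ ≤ _ := by rw [ENNReal.ofReal_mul hc]; gcongr

lemma EE_mom {p τ z : ℝ} (hp : 0 ≤ p) (hτ : 0 < τ) (hz : 0 ≤ z) :
    ∫⁻ x in Ioi (0:ℝ), ENNReal.ofReal (x ^ p * EE τ x z) ≤
      ENNReal.ofReal (2 * cE p * (τ ^ ((p+1)/2) + z ^ p * τ ^ (1/2 : ℝ))) := by
  have c1 := cE_pos hp
  calc _ ≤ (∫⁻ x in Ioi (0:ℝ), ENNReal.ofReal (x ^ p * ge τ x)) + ∫⁻ x in Ioi (0:ℝ), ENNReal.ofReal (x ^ p * (ge τ (x - z) + ge τ (x + z))) := by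
        rw [← lintegral_add_left (by fun_prop)]
        refine lintegral_mono_ae ?_
        filter_upwards [ae_restrict_mem measurableSet_Ioi] with x hx
        have : (0:ℝ) < x := hx
        have := ge_nonneg τ (x - z); have := ge_nonneg τ (x + z); have := ge_nonneg τ x
        rw [← ENNReal.ofReal_add (by positivity) (by positivity)]
        unfold EE; apply ENNReal.ofReal_le_ofReal; apply le_of_eq; ring
    _ ≤ _ := add_le_add (ge_mom0 hp hτ) (ge_mom2 hp hτ hz)
    _ ≤ _ := by
        rw [← ENNReal.ofReal_add (by positivity) (by positivity)]
        apply ENNReal.ofReal_le_ofReal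
        have : 0 ≤ cE p * (z ^ p * τ ^ (1/2:ℝ)) := by positivity
        nlinarith

lemma pk_L0 {τ z : ℝ} (hτ : 0 < τ) (hz : 0 ≤ z) :
    ∫⁻ x in Ioi (0:ℝ), ENNReal.ofReal (x ^ (0:ℝ) * |pk τ x z|) ≤ ENNReal.ofReal (40 * cE 0 * (z * τ ^ (-1/2:ℝ))) := by
  have c1 := cE_pos (le_refl (0:ℝ))
  by_cases h : z ^ 2 ≤ τ
  · refine (lint_le (p := 0) (c := 40 * z * τ ^ (-1:ℝ)) (by positivity) (fun x _ => pk_b_near hτ x hz h) (ge_mom0 le_rfl hτ)).trans ?_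
    apply ENNReal.ofReal_le_ofReal
    rw [← rpa hτ (show (-1:ℝ) + (0+1)/2 = -1/2 by norm_num)]; apply le_of_eq; ring
  · refine (lint_le (p := 0) (c := 10 * τ ^ (-1/2:ℝ)) (by positivity) (fun x _ => pk_b hτ x z) (ge_mom2 le_rfl hτ hz)).trans ?_
    apply ENNReal.ofReal_le_ofReal
    obtain ⟨v, hv0, e, -, hv, -⟩ := scale_v hτ hz
    have h1 := hv h
    have e1 : τ ^ (-1/2:ℝ) * τ ^ (1/2:ℝ) = 1 := by rw [rpa hτ (c := 0) (by norm_num), Real.rpow_zero]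
    rw [e, Real.rpow_zero, show ((0:ℝ)+1)/2 = 1/2 by norm_num]
    calc _ = 20 * cE 0 * (τ ^ (-1/2:ℝ) * τ ^ (1/2:ℝ)) := by ring
      _ ≤ 40 * cE 0 * (v * (τ ^ (-1/2:ℝ) * τ ^ (1/2:ℝ))) := by rw [e1]; nlinarith
      _ = _ := by ring

lemma pk_Lp {p τ z : ℝ} (hp : 1 ≤ p) (hτ : 0 < τ) (hz : 0 ≤ z) :
    ∫⁻ x in Ioi (0:ℝ), ENNReal.ofReal (x ^ p * |pk τ x z|) ≤ ENNReal.ofReal (40 * cE p * (z ^ p + z * τ ^ ((p-1)/2))) := by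
  have hp0 : 0 ≤ p := by linarith
  have c1 := cE_pos hp0
  by_cases h : z ^ 2 ≤ τ
  · refine (lint_le (p := p) (c := 40 * z * τ ^ (-1:ℝ)) (by positivity) (fun x _ => pk_b_near hτ x hz h) (ge_mom0 hp0 hτ)).trans ?_
    apply ENNReal.ofReal_le_ofReal
    rw [← rpa hτ (show (-1:ℝ) + (p+1)/2 = (p-1)/2 by ring)]
    have : 0 ≤ cE p * z ^ p := by positivity
    nlinarith
  · refine (lint_le (p := p) (c := 10 * τ ^ (-1/2:ℝ)) (by positivity) (fun x _ => pk_b hτ x z) (ge_mom2 hp0 hτ hz)).trans ?_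
    apply ENNReal.ofReal_le_ofReal
    obtain ⟨v, hv0, e, -, hv, e2⟩ := scale_v hτ hz
    have h1 := hv h
    have h2 : τ ^ (p/2) ≤ z ^ p := by
      rw [e2 p]; exact le_mul_of_one_le_left (by positivity) (Real.one_le_rpow h1 hp0)
    have e1 : τ ^ (-1/2:ℝ) * τ ^ (1/2:ℝ) = 1 := by rw [rpa hτ (c := 0) (by norm_num), Real.rpow_zero]
    have e3 : τ ^ (-1/2:ℝ) * τ ^ ((p+1)/2) = τ ^ (p/2) := rpa hτ (by ring)
    have h4 : 0 ≤ cE p * (z * τ ^ ((p-1)/2)) := by positivity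
    have h5 : 0 ≤ cE p * z ^ p := by positivity
    have h6 := mul_le_mul_of_nonneg_left h2 c1.le
    calc _ = 10 * cE p * (τ ^ (-1/2:ℝ) * τ ^ ((p+1)/2) + z ^ p * (τ ^ (-1/2:ℝ) * τ ^ (1/2:ℝ))) := by ring
      _ ≤ _ := by rw [e1, e3]; nlinarith

lemma Dk_Lp {p τ z : ℝ} (hp : 0 ≤ p) (hτ : 0 < τ) (hz : 0 ≤ z) :
    ∫⁻ x in Ioi (0:ℝ), ENNReal.ofReal (x ^ p * |Dk τ x z|) ≤ ENNReal.ofReal (10 * cE p * (τ ^ ((p-1)/2) + z ^ p * τ ^ (-1/2:ℝ))) := by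
  refine (lint_le (p := p) (c := 10 * τ ^ (-1:ℝ)) (by positivity) (fun x _ => Dk_b hτ x z) (ge_mom2 hp hτ hz)).trans ?_
  apply ENNReal.ofReal_le_ofReal
  rw [← rpa hτ (show (-1:ℝ) + (p+1)/2 = (p-1)/2 by ring), ← rpa hτ (show (-1:ℝ) + 1/2 = -1/2 by norm_num)]
  apply le_of_eq; ring

lemma qk_Lp {p τ : ℝ} (hp : 0 ≤ p) (hτ : 0 < τ) :
    ∫⁻ x in Ioi (0:ℝ), ENNReal.ofReal (x ^ p * |qk τ x|) ≤ ENNReal.ofReal (20 * cE p * τ ^ ((p-1)/2)) := by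
  refine (lint_le (p := p) (c := 20 * τ ^ (-1:ℝ)) (by positivity) (fun x _ => qk_b hτ x) (ge_mom0 hp hτ)).trans ?_
  apply ENNReal.ofReal_le_ofReal
  rw [← rpa hτ (show (-1:ℝ) + (p+1)/2 = (p-1)/2 by ring)]
  apply le_of_eq; ring

lemma qkdiff_Lp {p t s : ℝ} (hp : 0 ≤ p) (ht : 0 < t) (hs : 0 ≤ s) (hst : s ≤ t / 2) :
    ∫⁻ x in Ioi (0:ℝ), ENNReal.ofReal (x ^ p * |qk (t - s) x - qk t x|) ≤ ENNReal.ofReal (80 * cE p * (s * t ^ ((p-3)/2))) := by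
  refine (lint_le (p := p) (c := 80 * s * t ^ (-2:ℝ)) (by positivity) (fun x _ => qk_diff_b x ht hs hst) (ge_mom0 hp ht)).trans ?_
  apply ENNReal.ofReal_le_ofReal
  rw [← rpa ht (show (-2:ℝ) + (p+1)/2 = (p-3)/2 by ring)]
  apply le_of_eq; ring

/-- K3 envelope -/
lemma K3_env {p τ x z : ℝ} (hp0 : 0 ≤ p) (hp : p ≤ 2) (hτ : 0 < τ) (hz : 0 ≤ z) :
    |K3 τ x z| ≤ 40 * τ ^ (-1:ℝ) * min 1 (z ^ p * τ ^ (-p/2)) * EE τ x z := by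
  obtain ⟨v, hv0, e, hv1, hv2, e2⟩ := scale_v hτ hz
  have e3 : z ^ p * τ ^ (-p/2) = v ^ p := by
    rw [e2, mul_assoc, rpa hτ (c := 0) (by ring), Real.rpow_zero, mul_one]
  rw [e3]
  have hE := EE_nonneg τ x z
  by_cases h : z ^ 2 ≤ τ
  · have h1 := hv1 h
    have h2 : v ^ (2:ℝ) ≤ v ^ p := by
      rcases hv0.eq_or_lt with h0 | h0
      · rw [← h0, Real.zero_rpow (by norm_num)]; exact Real.rpow_nonneg le_rfl _
      · exact Real.rpow_le_rpow_of_exponent_ge h0 h1 hp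
    have h3 : v ^ p ≤ 1 := Real.rpow_le_one hv0 h1 hp0
    rw [min_eq_right h3]
    have h4 : z ^ 2 * τ ^ (-2:ℝ) = v ^ (2:ℝ) * τ ^ (-1:ℝ) := by
      rw [← Real.rpow_two, e2 2, mul_assoc, rpa hτ (c := -1) (by norm_num)]
    calc _ ≤ 40 * z ^ 2 * τ ^ (-2 : ℝ) * ge τ x := K3_b_near hτ x hz h
      _ = 40 * τ ^ (-1:ℝ) * v ^ (2:ℝ) * ge τ x := by linear_combination (40 * ge τ x) * h4
      _ ≤ _ := by
        have := ge_le_EE τ x z; have := ge_nonneg τ x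
        gcongr
  · have h1 := hv2 h
    rw [min_eq_left (Real.one_le_rpow h1 hp0)]
    have := K3_b_far hτ x z
    have h5 : 0 ≤ τ ^ (-1:ℝ) * EE τ x z := by positivity
    nlinarith

lemma K3_sup {p τ x z : ℝ} (hp0 : 0 ≤ p) (hp : p ≤ 2) (hτ : 0 < τ) (hz : 0 ≤ z) :
    |K3 τ x z| ≤ 120 * (τ ^ (-1-p/2) * z ^ p) := by
  refine (K3_env hp0 hp hτ hz).trans ?_
  have h := EE_le hτ x z
  have h0 := EE_nonneg τ x z
  have h2 : min 1 (z ^ p * τ ^ (-p/2)) ≤ z ^ p * τ ^ (-p/2) := min_le_right _ _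
  calc _ ≤ 40 * τ ^ (-1:ℝ) * (z ^ p * τ ^ (-p/2)) * 3 := by gcongr
    _ = _ := by rw [← rpa hτ (show (-1:ℝ) + -p/2 = -1-p/2 by ring)]; ring

lemma K3_Lp {p τ z : ℝ} (hp0 : 0 ≤ p) (hp : p ≤ 2) (hτ : 0 < τ) (hz : 0 ≤ z) :
    ∫⁻ x in Ioi (0:ℝ), ENNReal.ofReal (x ^ p * |K3 τ x z|) ≤ ENNReal.ofReal (160 * cE p * (z ^ p * τ ^ (-1/2:ℝ))) := by
  have c1 := cE_pos hp0
  refine (lint_le (p := p) (c := 40 * τ ^ (-1:ℝ) * min 1 (z ^ p * τ ^ (-p/2))) (by positivity) (fun x _ => K3_env hp0 hp hτ hz) (EE_mom hp0 hτ hz)).trans ?_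
  apply ENNReal.ofReal_le_ofReal
  have h2 : min 1 (z ^ p * τ ^ (-p/2)) ≤ z ^ p * τ ^ (-p/2) := min_le_right _ _
  have h1 : min 1 (z ^ p * τ ^ (-p/2)) ≤ 1 := min_le_left _ _
  calc _ = 80 * cE p * τ ^ (-1:ℝ) * (min 1 (z ^ p * τ ^ (-p/2)) * τ ^ ((p+1)/2) + min 1 (z ^ p * τ ^ (-p/2)) * (z ^ p * τ ^ (1/2 : ℝ))) := by ring
    _ ≤ 80 * cE p * τ ^ (-1:ℝ) * ((z ^ p * τ ^ (-p/2)) * τ ^ ((p+1)/2) + 1 * (z ^ p * τ ^ (1/2 : ℝ))) := by gcongr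
    _ = _ := by
      rw [mul_assoc (z ^ p), rpa hτ (show -p/2 + (p+1)/2 = 1/2 by ring), ← rpa hτ (show (-1:ℝ) + 1/2 = -1/2 by norm_num)]; ring

lemma K1_near' {p τ x z : ℝ} (hp : 1 ≤ p) (hp2 : p ≤ 2) (hτ : 0 < τ) (hz : 0 ≤ z) (h : z ^ 2 ≤ τ) :
    |K1 τ x z| ≤ 40 * (z ^ p * τ ^ (-1/2-p/2)) * ge τ x := by
  obtain ⟨v, hv0, e, hv1, hv2, e2⟩ := scale_v hτ hz
  have h1 := hv1 h
  have h2 : v ^ (3:ℝ) ≤ v ^ p := by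
    rcases hv0.eq_or_lt with h0 | h0
    · rw [← h0, Real.zero_rpow (by norm_num)]; exact Real.rpow_nonneg le_rfl _
    · exact Real.rpow_le_rpow_of_exponent_ge h0 h1 (by linarith)
  have h4 : z ^ 3 * τ ^ (-2:ℝ) = v ^ (3:ℝ) * τ ^ (-1/2:ℝ) := by
    rw [← Real.rpow_natCast z 3]; push_cast; rw [e2 3, mul_assoc, rpa hτ (c := -1/2) (by norm_num)]
  have h5 : z ^ p * τ ^ (-1/2-p/2) = v ^ p * τ ^ (-1/2:ℝ) := by
    rw [e2 p, mul_assoc, rpa hτ (c := -1/2) (by ring)]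
  refine (K1_b_near hτ x hz h).trans ?_
  have := ge_nonneg τ x
  calc _ = 40 * (v ^ (3:ℝ) * τ ^ (-1/2:ℝ)) * ge τ x := by rw [← h4]; ring
    _ ≤ _ := by rw [h5]; gcongr

lemma K1_sup {p τ x z : ℝ} (hp : 1 ≤ p) (hp2 : p ≤ 2) (hτ : 0 < τ) (hz : 0 ≤ z) :
    |K1 τ x z| ≤ 40 * (τ ^ (-1/2-p/2) * z ^ p) := by
  by_cases h : z ^ 2 ≤ τ
  · refine (K1_near' hp hp2 hτ hz h).trans ?_
    have h1 := ge_le_one hτ x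
    have : 0 ≤ z ^ p * τ ^ (-1/2-p/2) := by positivity
    nlinarith
  · obtain ⟨v, hv0, e, hv1, hv2, e2⟩ := scale_v hτ hz
    have h1 := hv2 h
    refine (K1_b_far hτ x hz).trans ?_
    have g1 := ge_le_one hτ x; have g2 := ge_le_one hτ (x-z); have g3 := ge_le_one hτ (x+z)
    have h5 : z ^ p * τ ^ (-1/2-p/2) = v ^ p * τ ^ (-1/2:ℝ) := by
      rw [e2 p, mul_assoc, rpa hτ (c := -1/2) (by ring)]
    have h6 : z * τ ^ (-1:ℝ) = v * τ ^ (-1/2:ℝ) := by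
      rw [e, mul_assoc, rpa hτ (c := -1/2) (by norm_num)]
    have h7 : v ≤ v ^ p := by
      conv_lhs => rw [← Real.rpow_one v]
      exact Real.rpow_le_rpow_of_exponent_le h1 hp
    rw [mul_comm (τ ^ (-1/2-p/2)), h5, mul_assoc 20 z, h6]
    have h8 : 0 ≤ τ ^ (-1/2:ℝ) := by positivity
    calc _ ≤ 10 * τ ^ (-1/2:ℝ) * (1 + 1) + 20 * (v * τ ^ (-1/2:ℝ)) * 1 := by gcongr
      _ ≤ _ := by nlinarith [mul_le_mul_of_nonneg_right h7 h8, mul_le_mul_of_nonneg_right h1 h8]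

lemma K1_Lp {p τ z : ℝ} (hp : 1 ≤ p) (hp2 : p ≤ 2) (hτ : 0 < τ) (hz : 0 ≤ z) :
    ∫⁻ x in Ioi (0:ℝ), ENNReal.ofReal (x ^ p * |K1 τ x z|) ≤ ENNReal.ofReal (40 * cE p * z ^ p) := by
  have hp0 : 0 ≤ p := by linarith
  have c1 := cE_pos hp0
  by_cases h : z ^ 2 ≤ τ
  · refine (lint_le (p := p) (c := 40 * (z ^ p * τ ^ (-1/2-p/2))) (by positivity) (fun x _ => K1_near' hp hp2 hτ hz h) (ge_mom0 hp0 hτ)).trans ?_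
    apply ENNReal.ofReal_le_ofReal
    apply le_of_eq
    have : τ ^ (-1/2-p/2) * τ ^ ((p+1)/2) = 1 := by rw [rpa hτ (c := 0) (by ring), Real.rpow_zero]
    linear_combination (40 * z ^ p * cE p) * this
  · obtain ⟨v, hv0, e, hv1, hv2, e2⟩ := scale_v hτ hz
    have h1 := hv2 h
    calc _ ≤ ∫⁻ x in Ioi (0:ℝ), (ENNReal.ofReal (x ^ p * |pk τ x z|) + ENNReal.ofReal z * ENNReal.ofReal (x ^ p * |qk τ x|)) := by
          refine lintegral_mono_ae ?_
          filter_upwards [ae_restrict_mem measurableSet_Ioi] with x hx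
          have hx0 : (0:ℝ) < x := hx
          rw [← ENNReal.ofReal_mul hz, ← ENNReal.ofReal_add (by positivity) (by positivity)]
          apply ENNReal.ofReal_le_ofReal
          have : |K1 τ x z| ≤ |pk τ x z| + z * |qk τ x| := by
            unfold K1; refine (abs_sub _ _).trans ?_; rw [abs_mul, abs_of_nonneg hz]
          have := mul_le_mul_of_nonneg_left this (Real.rpow_nonneg hx0.le p)
          linarith
      _ = (∫⁻ x in Ioi (0:ℝ), ENNReal.ofReal (x ^ p * |pk τ x z|)) + ENNReal.ofReal z * ∫⁻ x in Ioi (0:ℝ), ENNReal.ofReal (x ^ p * |qk τ x|) := by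
          rw [lintegral_add_left (by fun_prop), lintegral_const_mul' _ _ ENNReal.ofReal_ne_top]
      _ ≤ ENNReal.ofReal (10 * τ ^ (-1/2:ℝ) * (cE p * (τ ^ ((p+1)/2) + z ^ p * τ ^ (1/2 : ℝ)))) + ENNReal.ofReal z * ENNReal.ofReal (20 * cE p * τ ^ ((p-1)/2)) := by
          gcongr
          · exact lint_le (p := p) (c := 10 * τ ^ (-1/2:ℝ)) (by positivity) (fun x _ => pk_b hτ x z) (ge_mom2 hp0 hτ hz)
          · exact qk_Lp hp0 hτ
      _ ≤ _ := by
        rw [← ENNReal.ofReal_mul hz, ← ENNReal.ofReal_add (by positivity) (by positivity)]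
        apply ENNReal.ofReal_le_ofReal
        have h2 : τ ^ (p/2) ≤ z ^ p := by
          rw [e2 p]; exact le_mul_of_one_le_left (by positivity) (Real.one_le_rpow h1 hp0)
        have h7 : v ≤ v ^ p := by
          conv_lhs => rw [← Real.rpow_one v]
          exact Real.rpow_le_rpow_of_exponent_le h1 hp
        have h3 : z * τ ^ ((p-1)/2) ≤ z ^ p := by
          rw [e2 p]; conv_lhs => rw [e, mul_assoc, rpa hτ (show 1/2 + (p-1)/2 = p/2 by ring)]
          gcongr
        have e1 : τ ^ (-1/2:ℝ) * τ ^ (1/2:ℝ) = 1 := by rw [rpa hτ (c := 0) (by norm_num), Real.rpow_zero]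
        have e3 : τ ^ (-1/2:ℝ) * τ ^ ((p+1)/2) = τ ^ (p/2) := rpa hτ (by ring)
        have h8 := mul_le_mul_of_nonneg_left h2 c1.le
        have h9 := mul_le_mul_of_nonneg_left h3 c1.le
        calc _ = 10 * cE p * (τ ^ (-1/2:ℝ) * τ ^ ((p+1)/2) + z ^ p * (τ ^ (-1/2:ℝ) * τ ^ (1/2:ℝ))) + 20 * (cE p * (z * τ ^ ((p-1)/2))) := by ring
          _ ≤ _ := by rw [e1, e3]; nlinarith

lemma K3_xp {p τ x z : ℝ} (hp0 : 0 ≤ p) (hp : p ≤ 2) (hτ : 0 < τ) (hx : 0 ≤ x) (hz : 0 ≤ z) :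
    |K3 τ x z| ≤ 40 * x * (τ ^ (-3/2-p/2) * z ^ p) := by
  obtain ⟨v, hv0, e, hv1, hv2, e2⟩ := scale_v hτ hz
  have h5 : τ ^ (-3/2-p/2) * z ^ p = v ^ p * τ ^ (-3/2:ℝ) := by
    rw [mul_comm, e2 p, mul_assoc, rpa hτ (c := -3/2) (by ring)]
  rw [h5]
  by_cases h : z ^ 2 ≤ τ
  · have h1 := hv1 h
    have h2 : v ^ (2:ℝ) ≤ v ^ p := by
      rcases hv0.eq_or_lt with h0 | h0
      · rw [← h0, Real.zero_rpow (by norm_num)]; exact Real.rpow_nonneg le_rfl _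
      · exact Real.rpow_le_rpow_of_exponent_ge h0 h1 hp
    have h4 : z ^ 2 * τ ^ (-5/2:ℝ) = v ^ (2:ℝ) * τ ^ (-3/2:ℝ) := by
      rw [← Real.rpow_two, e2 2, mul_assoc, rpa hτ (c := -3/2) (by norm_num)]
    refine (K3_x hτ hx hz).2.trans ?_
    calc _ = 20 * x * (v ^ (2:ℝ) * τ ^ (-3/2:ℝ)) := by rw [← h4]; ring
      _ ≤ 40 * x * (v ^ p * τ ^ (-3/2:ℝ)) := by gcongr; norm_num
  · refine (K3_x hτ hx hz).1.trans ?_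
    have h1 := Real.one_le_rpow (hv2 h) hp0
    have : 0 ≤ x * τ ^ (-3/2:ℝ) := by positivity
    nlinarith

lemma pk_lin {τ x z : ℝ} (hτ : 0 < τ) (hz : 0 ≤ z) : |pk τ x z| ≤ 20 * z * τ ^ (-1:ℝ) :=
  (diff1 (hasDerivAt_gk hτ) hz (M := 10 * τ ^ (-1:ℝ)) fun y _ => gk1_sup hτ y).trans (le_of_eq (by ring))

/-- q-th absolute moment on the half line -/
noncomputable def mm (q : ℝ) (f : ℝ → ℝ) : ENNReal := ∫⁻ z in Ioi (0:ℝ), ENNReal.ofReal (z ^ q * |f z|)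

lemma mm_mono {q : ℝ} {f g : ℝ → ℝ} (h : ∀ z > 0, |f z| ≤ |g z|) : mm q f ≤ mm q g := by
  refine lintegral_mono_ae ?_
  filter_upwards [ae_restrict_mem measurableSet_Ioi] with z hz
  have hz0 : (0:ℝ) < z := hz
  exact ENNReal.ofReal_le_ofReal (mul_le_mul_of_nonneg_left (h z hz0) (by positivity))

lemma mm_congr {q : ℝ} {f g : ℝ → ℝ} (h : ∀ z > 0, f z = g z) : mm q f = mm q g :=
  le_antisymm (mm_mono fun z hz => by rw [h z hz]) (mm_mono fun z hz => by rw [h z hz])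

lemma mm_add_le {q : ℝ} {f g : ℝ → ℝ} (hf : Measurable f) : mm q (fun z => f z + g z) ≤ mm q f + mm q g := by
  unfold mm
  rw [← lintegral_add_left (by fun_prop)]
  refine lintegral_mono_ae ?_
  filter_upwards [ae_restrict_mem measurableSet_Ioi] with z hz
  have hz0 : (0:ℝ) < z := hz
  rw [← ENNReal.ofReal_add (by positivity) (by positivity), ← mul_add]
  exact ENNReal.ofReal_le_ofReal (mul_le_mul_of_nonneg_left (abs_add_le _ _) (by positivity))

lemma mm_sub_le {q : ℝ} {f g : ℝ → ℝ} (hf : Measurable f) : mm q (fun z => f z - g z) ≤ mm q f + mm q g := by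
  have h1 := mm_add_le (q := q) (f := f) (g := fun z => - g z) hf
  have h2 : mm q (fun z => - g z) = mm q g := by unfold mm; simp
  rw [h2] at h1; simpa [sub_eq_add_neg] using h1

lemma mm_const_mul {q c : ℝ} {f : ℝ → ℝ} : mm q (fun z => c * f z) = ENNReal.ofReal |c| * mm q f := by
  unfold mm
  rw [← lintegral_const_mul' _ _ ENNReal.ofReal_ne_top]
  refine lintegral_congr fun z => ?_
  rw [← ENNReal.ofReal_mul (abs_nonneg c), abs_mul]; congr 1; ring

/-- pointwise master bound -/
lemma ker_sup {K f : ℝ → ℝ} {k1 q1 k2 q2 : ℝ} (hf : Measurable f) (h1 : 0 ≤ k1) (h2 : 0 ≤ k2)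
    (hK : ∀ z > 0, |K z| ≤ k1 * z ^ q1 + k2 * z ^ q2) :
    ENNReal.ofReal |∫ z in Ioi (0:ℝ), K z * f z| ≤ ENNReal.ofReal k1 * mm q1 f + ENNReal.ofReal k2 * mm q2 f := by
  unfold mm
  rw [← lintegral_const_mul' _ _ ENNReal.ofReal_ne_top, ← lintegral_const_mul' _ _ ENNReal.ofReal_ne_top,
    ← lintegral_add_left (by fun_prop)]
  have := enorm_integral_le_lintegral_enorm (μ := volume.restrict (Ioi (0:ℝ))) (fun z => K z * f z)
  rw [Real.enorm_eq_ofReal_abs] at this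
  refine this.trans (lintegral_mono_ae ?_)
  filter_upwards [ae_restrict_mem measurableSet_Ioi] with z hz
  have hz0 : (0:ℝ) < z := hz
  rw [Real.enorm_eq_ofReal_abs, ← ENNReal.ofReal_mul h1, ← ENNReal.ofReal_mul h2,
    ← ENNReal.ofReal_add (by positivity) (by positivity), abs_mul]
  apply ENNReal.ofReal_le_ofReal
  have := mul_le_mul_of_nonneg_right (hK z hz0) (abs_nonneg (f z))
  linarith

/-- weighted master bound -/
lemma ker_mm {K : ℝ → ℝ → ℝ} {f : ℝ → ℝ} {q k1 q1 k2 q2 : ℝ} (hKm : Measurable (fun a : ℝ × ℝ => K a.1 a.2))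
    (hf : Measurable f) (h1 : 0 ≤ k1) (h2 : 0 ≤ k2)
    (hK : ∀ z > 0, mm q (fun x => K x z) ≤ ENNReal.ofReal (k1 * z ^ q1 + k2 * z ^ q2)) :
    mm q (fun x => ∫ z in Ioi (0:ℝ), K x z * f z) ≤ ENNReal.ofReal k1 * mm q1 f + ENNReal.ofReal k2 * mm q2 f := by
  have hKm1 : ∀ z, Measurable fun x => K x z := fun z => hKm.comp (measurable_id.prodMk measurable_const)
  calc mm q (fun x => ∫ z in Ioi (0:ℝ), K x z * f z) ≤
        ∫⁻ x in Ioi (0:ℝ), ∫⁻ z in Ioi (0:ℝ), ENNReal.ofReal (x ^ q * |K x z|) * ENNReal.ofReal |f z| := by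
        refine lintegral_mono_ae ?_
        filter_upwards [ae_restrict_mem measurableSet_Ioi] with x hx
        have hx0 : (0:ℝ) < x := hx
        rw [ENNReal.ofReal_mul (by positivity)]
        have := enorm_integral_le_lintegral_enorm (μ := volume.restrict (Ioi (0:ℝ))) (fun z => K x z * f z)
        rw [Real.enorm_eq_ofReal_abs] at this
        refine (mul_le_mul_right this _).trans ?_
        rw [← lintegral_const_mul' _ _ ENNReal.ofReal_ne_top]
        refine lintegral_mono fun z => ?_
        rw [Real.enorm_eq_ofReal_abs, abs_mul, ENNReal.ofReal_mul (abs_nonneg _), ENNReal.ofReal_mul (by positivity), mul_assoc]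
    _ = ∫⁻ z in Ioi (0:ℝ), ∫⁻ x in Ioi (0:ℝ), ENNReal.ofReal (x ^ q * |K x z|) * ENNReal.ofReal |f z| := by
        refine lintegral_lintegral_swap (Measurable.aemeasurable ?_)
        simp only [Function.uncurry_def]
        have := hKm
        fun_prop
    _ ≤ ∫⁻ z in Ioi (0:ℝ), (ENNReal.ofReal k1 * ENNReal.ofReal (z ^ q1 * |f z|) + ENNReal.ofReal k2 * ENNReal.ofReal (z ^ q2 * |f z|)) := by
        refine lintegral_mono_ae ?_
        filter_upwards [ae_restrict_mem measurableSet_Ioi] with z hz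
        have hz0 : (0:ℝ) < z := hz
        rw [lintegral_mul_const' _ _ ENNReal.ofReal_ne_top]
        refine (mul_le_mul_left (hK z hz0) _).trans ?_
        rw [← ENNReal.ofReal_mul h1, ← ENNReal.ofReal_mul h2,
    ← ENNReal.ofReal_add (by positivity) (by positivity), ← ENNReal.ofReal_mul (by positivity)]
        apply ENNReal.ofReal_le_ofReal; apply le_of_eq; ring
    _ = _ := by
        rw [lintegral_add_left (by fun_prop), lintegral_const_mul' _ _ ENNReal.ofReal_ne_top, lintegral_const_mul' _ _ ENNReal.ofReal_ne_top]
        rfl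

/-- time-integral bound, pointwise -/
lemma time_sup {μ F : ℝ → ℝ} {t : ℝ} (ht : 0 ≤ t) :
    ENNReal.ofReal |∫ s in (0:ℝ)..t, μ s * F s| ≤ ∫⁻ s in Ioc 0 t, ENNReal.ofReal |μ s| * ENNReal.ofReal |F s| := by
  rw [intervalIntegral.integral_of_le ht]
  have := enorm_integral_le_lintegral_enorm (μ := volume.restrict (Ioc (0:ℝ) t)) (fun s => μ s * F s)
  rw [Real.enorm_eq_ofReal_abs] at this
  refine this.trans (lintegral_mono fun s => ?_)
  rw [Real.enorm_eq_ofReal_abs, abs_mul, ENNReal.ofReal_mul (abs_nonneg _)]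

lemma time_mm {μ : ℝ → ℝ} {F : ℝ → ℝ → ℝ} {t q : ℝ} (ht : 0 ≤ t) (hμ : Measurable μ)
    (hF : Measurable (fun a : ℝ × ℝ => F a.1 a.2)) :
    mm q (fun x => ∫ s in (0:ℝ)..t, μ s * F s x) ≤ ∫⁻ s in Ioc 0 t, ENNReal.ofReal |μ s| * mm q (F s) := by
  calc mm q (fun x => ∫ s in (0:ℝ)..t, μ s * F s x) ≤
      ∫⁻ x in Ioi (0:ℝ), ∫⁻ s in Ioc 0 t, ENNReal.ofReal |μ s| * ENNReal.ofReal (x ^ q * |F s x|) := by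
        refine lintegral_mono_ae ?_
        filter_upwards [ae_restrict_mem measurableSet_Ioi] with x hx
        have hx0 : (0:ℝ) < x := hx
        rw [ENNReal.ofReal_mul (by positivity)]
        refine (mul_le_mul_right (time_sup (μ := μ) (F := fun s => F s x) ht) _).trans ?_
        rw [← lintegral_const_mul' _ _ ENNReal.ofReal_ne_top]
        refine lintegral_mono fun s => ?_
        rw [ENNReal.ofReal_mul (by positivity), ← mul_assoc, ← mul_assoc, mul_comm (ENNReal.ofReal (x ^ q))]
    _ = ∫⁻ s in Ioc 0 t, ∫⁻ x in Ioi (0:ℝ), ENNReal.ofReal |μ s| * ENNReal.ofReal (x ^ q * |F s x|) := by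
        refine lintegral_lintegral_swap (Measurable.aemeasurable ?_)
        simp only [Function.uncurry_def]
        have h2 : Measurable fun a : ℝ × ℝ => F a.2 a.1 := hF.comp measurable_swap
        fun_prop
    _ = _ := by
        refine lintegral_congr fun s => ?_
        rw [lintegral_const_mul' _ _ ENNReal.ofReal_ne_top]; rfl

/-- time weights -/
lemma lint_rpow {T r : ℝ} (hT : 0 ≤ T) (hr : -1 < r) :
    ∫⁻ s in Ioc 0 T, ENNReal.ofReal (s ^ r) = ENNReal.ofReal (T ^ (r+1) / (r+1)) := by
  have hi : IntervalIntegrable (fun s : ℝ => s ^ r) volume 0 T := intervalIntegral.intervalIntegrable_rpow' hr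
  rw [← ofReal_integral_eq_lintegral_ofReal ((intervalIntegrable_iff_integrableOn_Ioc_of_le hT).1 hi),
    ← intervalIntegral.integral_of_le hT, integral_rpow (Or.inl hr)]
  · rw [Real.zero_rpow (by linarith), sub_zero]
  · filter_upwards [ae_restrict_mem measurableSet_Ioc] with s hs
    exact Real.rpow_nonneg hs.1.le _

lemma lint_rpow_hi {t r : ℝ} (ht : 0 < t) (hr : -1 < r) :
    ∫⁻ s in Ioc (t/2) t, ENNReal.ofReal ((t - s) ^ r) ≤ ENNReal.ofReal (t ^ (r+1) / (r+1)) := by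
  have h2 : ∫⁻ s in Ioc (0:ℝ) t, ENNReal.ofReal (s ^ r) = ∫⁻ s in Ico 0 t, ENNReal.ofReal ((t - s) ^ r) := by
    have := (Measure.measurePreserving_sub_left (volume : Measure ℝ) t).setLIntegral_comp_preimage
      (s := Ioc 0 t) measurableSet_Ioc (f := fun s => ENNReal.ofReal (s ^ r)) (by fun_prop)
    rw [← this]
    congr 2
    ext s; simp
  rw [← lint_rpow ht.le hr, h2, setLIntegral_congr Ico_ae_eq_Ioc]
  exact lintegral_mono_set (Ioc_subset_Ioc_left (by linarith))

lemma time_lo {μ : ℝ → ℝ} {X : ℝ → ENNReal} {Cμ B q ε t : ℝ} (hC : 0 ≤ Cμ) (hμ : ∀ s ≥ 0, |μ s| ≤ Cμ / (1 + s)) (hB : 0 ≤ B)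
    (ht : 0 < t) (hε : 0 ≤ ε) (hε1 : ε ≤ 1) (hq : 0 < q + ε)
    (hX : ∀ s, 0 < s → s ≤ t / 2 → X s ≤ ENNReal.ofReal (B * s ^ q)) :
    ∫⁻ s in Ioc 0 (t/2), ENNReal.ofReal |μ s| * X s ≤ ENNReal.ofReal (Cμ / (q + ε) * B * t ^ (q + ε)) := by
  calc _ ≤ ∫⁻ s in Ioc 0 (t/2), ENNReal.ofReal (Cμ * B) * ENNReal.ofReal (s ^ (q + ε - 1)) := by
        refine lintegral_mono_ae ?_
        filter_upwards [ae_restrict_mem measurableSet_Ioc] with s hs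
        have hs0 : 0 < s := hs.1
        have h1 : 1 / (1 + s) ≤ s ^ (ε - 1) := by
          rw [div_le_iff₀ (by linarith)]
          rcases le_total s 1 with h | h
          · have : 1 ≤ s ^ (ε - 1) := Real.one_le_rpow_of_pos_of_le_one_of_nonpos hs0 h (by linarith)
            nlinarith
          · have e : s ^ (ε - 1) * s = s ^ ε := by
              rw [← Real.rpow_add_one hs0.ne']; congr 1; ring
            have : 1 ≤ s ^ ε := Real.one_le_rpow h hε
            nlinarith [Real.rpow_pos_of_pos hs0 (ε - 1)]
        calc ENNReal.ofReal |μ s| * X s ≤ ENNReal.ofReal (Cμ * s ^ (ε - 1)) * ENNReal.ofReal (B * s ^ q) := by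
              gcongr
              · refine (hμ s hs0.le).trans ?_
                rw [div_eq_mul_one_div]; gcongr
              · exact hX s hs0 hs.2
          _ = _ := by
              rw [← ENNReal.ofReal_mul (by positivity), ← ENNReal.ofReal_mul (by positivity), ← rpa hs0 (show (ε - 1) + q = q + ε - 1 by ring)]
              congr 1; ring
    _ = ENNReal.ofReal (Cμ * B) * ENNReal.ofReal ((t/2) ^ (q + ε - 1 + 1) / (q + ε - 1 + 1)) := by
        rw [lintegral_const_mul' _ _ ENNReal.ofReal_ne_top, lint_rpow (by linarith) (by linarith)]
    _ ≤ _ := by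
        rw [← ENNReal.ofReal_mul (by positivity)]
        apply ENNReal.ofReal_le_ofReal
        rw [sub_add_cancel]
        have : (t/2) ^ (q + ε) ≤ t ^ (q + ε) := Real.rpow_le_rpow (by positivity) (by linarith) hq.le
        calc _ ≤ Cμ * B * (t ^ (q + ε) / (q + ε)) := by gcongr
          _ = _ := by field_simp

lemma time_tail {μ : ℝ → ℝ} {X : ℝ → ENNReal} {Cμ B q T : ℝ} (hC : 0 ≤ Cμ) (hμ : ∀ s ≥ 0, |μ s| ≤ Cμ / (1 + s)) (hB : 0 ≤ B)
    (hT : 0 < T) (hq : 0 < q) (hX : ∀ s, T < s → X s ≤ ENNReal.ofReal (B * s ^ (-q))) :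
    ∫⁻ s in Ioi T, ENNReal.ofReal |μ s| * X s ≤ ENNReal.ofReal (Cμ / q * B * T ^ (-q)) := by
  calc _ ≤ ∫⁻ s in Ioi T, ENNReal.ofReal (Cμ * B) * ENNReal.ofReal (s ^ (-q - 1)) := by
        refine lintegral_mono_ae ?_
        filter_upwards [ae_restrict_mem measurableSet_Ioi] with s hs
        have hs0 : 0 < s := hT.trans hs
        calc ENNReal.ofReal |μ s| * X s ≤ ENNReal.ofReal (Cμ * s ^ (-1:ℝ)) * ENNReal.ofReal (B * s ^ (-q)) := by
              gcongr
              · refine (hμ s hs0.le).trans ?_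
                rw [Real.rpow_neg_one, div_eq_mul_inv]; gcongr; linarith
              · exact hX s hs
          _ = _ := by
              rw [← ENNReal.ofReal_mul (by positivity), ← ENNReal.ofReal_mul (by positivity), ← rpa hs0 (show (-1) + -q = -q - 1 by ring)]
              congr 1; ring
    _ = ENNReal.ofReal (Cμ * B) * ENNReal.ofReal (T ^ (-q) / q) := by
        rw [lintegral_const_mul' _ _ ENNReal.ofReal_ne_top,
          ← ofReal_integral_eq_lintegral_ofReal (integrableOn_Ioi_rpow_of_lt (by linarith) hT), integral_Ioi_rpow_of_lt (by linarith) hT]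
        · congr 2; rw [sub_add_cancel]; field_simp
        · filter_upwards [ae_restrict_mem measurableSet_Ioi] with s hs
          exact Real.rpow_nonneg (hT.trans hs).le _
    _ = _ := by
        rw [← ENNReal.ofReal_mul (by positivity)]
        congr 1; field_simp

lemma time_all {μ : ℝ → ℝ} {X : ℝ → ENNReal} {Cμ B q : ℝ} (hC : 0 ≤ Cμ) (hμ : ∀ s ≥ 0, |μ s| ≤ Cμ / (1 + s)) (hB : 0 ≤ B)
    (hq : 0 < q) (hq1 : q < 1) (hX : ∀ s, 0 < s → X s ≤ ENNReal.ofReal (B * s ^ (-q))) :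
    ∫⁻ s in Ioi 0, ENNReal.ofReal |μ s| * X s ≤ ENNReal.ofReal (Cμ * (2 / (1 - q) + 1 / q) * B) := by
  rw [show (Ioi (0:ℝ)) = Ioc 0 (2/2) ∪ Ioi (2/2) from (Ioc_union_Ioi_eq_Ioi (by norm_num)).symm]
  refine (lintegral_union_le _ _ _).trans ?_
  have h1 := time_lo (t := 2) (ε := 1) hC hμ hB (by norm_num) (by norm_num) le_rfl (by linarith) (fun s hs _ => hX s hs)
  have h2 := time_tail (T := 2/2) hC hμ hB (by norm_num) hq (fun s hs => hX s (by linarith))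
  refine (add_le_add h1 h2).trans ?_
  have h1q : 0 < 1 - q := by linarith
  have h1q' : 0 < -q + 1 := by linarith
  rw [← ENNReal.ofReal_add (by positivity) (by positivity)]
  apply ENNReal.ofReal_le_ofReal
  have h3 : (2:ℝ) ^ (-q + 1) ≤ 2 := by
    calc (2:ℝ) ^ (-q + 1) ≤ 2 ^ (1:ℝ) := Real.rpow_le_rpow_of_exponent_le (by norm_num) (by linarith)
      _ = 2 := by norm_num
  rw [show (2:ℝ)/2 = 1 by norm_num, Real.one_rpow]
  calc _ ≤ Cμ / (-q + 1) * B * 2 + Cμ / q * B * 1 := by gcongr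
    _ = _ := by rw [show -q + 1 = 1 - q by ring]; field_simp

lemma time_lo' {μ : ℝ → ℝ} {X : ℝ → ENNReal} {Cμ B q t : ℝ} (hC : 0 ≤ Cμ) (hμ : ∀ s ≥ 0, |μ s| ≤ Cμ / (1 + s)) (hB : 0 ≤ B)
    (hq : 0 < q) (hq1 : q < 1) (hX : ∀ s, 0 < s → s ≤ t / 2 → X s ≤ ENNReal.ofReal (B * s ^ (-q))) :
    ∫⁻ s in Ioc 0 (t/2), ENNReal.ofReal |μ s| * X s ≤ ENNReal.ofReal (Cμ * (2 / (1 - q) + 1 / q) * B) := by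
  have := time_all (X := fun s => if s ≤ t / 2 then X s else 0) hC hμ hB hq hq1 (fun s hs => by
    by_cases h : s ≤ t / 2
    · simp only [h, if_true]; exact hX s hs h
    · simp only [h, if_false]; exact zero_le)
  refine le_trans ?_ this
  refine le_trans ?_ (lintegral_mono_set (Ioc_subset_Ioi_self : Ioc 0 (t/2) ⊆ Ioi 0))
  refine lintegral_mono_ae ?_
  filter_upwards [ae_restrict_mem measurableSet_Ioc] with s hs
  simp only [hs.2, if_true, le_refl]

lemma time_hi {μ : ℝ → ℝ} {X : ℝ → ENNReal} {Cμ B q t : ℝ} (hC : 0 ≤ Cμ) (hμ : ∀ s ≥ 0, |μ s| ≤ Cμ / (1 + s)) (hB : 0 ≤ B)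
    (ht : 0 < t) (hq : -1 < q) (hX : ∀ s, t / 2 < s → s < t → X s ≤ ENNReal.ofReal (B * (t - s) ^ q)) :
    ∫⁻ s in Ioc (t/2) t, ENNReal.ofReal |μ s| * X s ≤ ENNReal.ofReal (2 * Cμ / (q + 1) * B * t ^ q) := by
  have hq1 : 0 < q + 1 := by linarith
  calc _ ≤ ∫⁻ s in Ioc (t/2) t, ENNReal.ofReal (2 * Cμ * t⁻¹ * B) * ENNReal.ofReal ((t - s) ^ q) := by
        refine lintegral_mono_ae ?_
        filter_upwards [ae_restrict_mem measurableSet_Ioc, ae_restrict_of_ae (Measure.ae_ne volume t)] with s hs hne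
        have hs0 : 0 < s := by linarith [hs.1]
        have hst : s < t := lt_of_le_of_ne hs.2 hne
        have hst' : 0 < t - s := by linarith
        calc ENNReal.ofReal |μ s| * X s ≤ ENNReal.ofReal (2 * Cμ * t⁻¹) * ENNReal.ofReal (B * (t - s) ^ q) := by
              gcongr
              · refine (hμ s hs0.le).trans ?_
                rw [div_le_iff₀ (by linarith)]
                have e : 2 * Cμ * t⁻¹ * (1 + s) = Cμ * ((2 * (1 + s)) * t⁻¹) := by ring
                rw [e]
                have : 1 ≤ (2 * (1 + s)) * t⁻¹ := by
                  rw [← div_eq_mul_inv, one_le_div ht]; linarith [hs.1]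
                nlinarith
              · exact hX s hs.1 hst
          _ = _ := by
              rw [← ENNReal.ofReal_mul (by positivity), ← ENNReal.ofReal_mul (by positivity)]
              congr 1; ring
    _ ≤ ENNReal.ofReal (2 * Cμ * t⁻¹ * B) * ENNReal.ofReal (t ^ (q+1) / (q+1)) := by
        rw [lintegral_const_mul' _ _ ENNReal.ofReal_ne_top]
        gcongr
        exact lint_rpow_hi ht hq
    _ = _ := by
        rw [← ENNReal.ofReal_mul (by positivity)]
        congr 1
        rw [Real.rpow_add_one ht.ne']
        field_simp

lemma split_half {f : ℝ → ENNReal} {t : ℝ} (ht : 0 < t) : ∫⁻ s in Ioc 0 t, f s =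
    (∫⁻ s in Ioc 0 (t/2), f s) + ∫⁻ s in Ioc (t/2) t, f s := by
  rw [← Ioc_union_Ioc_eq_Ioc (show (0:ℝ) ≤ t/2 by linarith) (show t/2 ≤ t by linarith),
    lintegral_union measurableSet_Ioc (Ioc_disjoint_Ioc_of_le le_rfl)]

structure Sys (κ Cμ W : ℝ) (w0 μ : ℝ → ℝ) (w : ℝ → ℝ → ℝ) : Prop where
  κ0 : 0 < κ
  κ1 : κ < 1/2
  hC : 0 ≤ Cμ
  hW : 0 ≤ W
  μm : Measurable μ
  μb : ∀ s ≥ 0, |μ s| ≤ Cμ / (1 + s)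
  w0m : Measurable w0
  wm : Measurable (fun a : ℝ × ℝ => w a.1 a.2)
  w00 : mm 0 w0 ≤ ENNReal.ofReal W
  w01 : mm 1 w0 ≤ ENNReal.ofReal W
  w0p : mm (1 + 2 * κ) w0 ≤ ENNReal.ofReal W
  w0n : ∀ z > 0, 0 ≤ w0 z
  wn : ∀ s z, 0 ≤ w s z
  duh : ∀ t > 0, ∀ x > 0, w t x = (∫ z in Ioi (0:ℝ), pk t x z * w0 z) +
    ∫ s in (0:ℝ)..t, μ s * ∫ z in Ioi (0:ℝ), Dk (t - s) x z * w s z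
  A0 : ∀ s > 0, mm 0 (w s) ≤ ENNReal.ofReal W
  As : ∀ s > 0, ∀ z > 0, w s z ≤ W * s ^ (-1/2:ℝ)
  Ap : ∀ s > 0, mm (1 + 2 * κ) (w s) ≤ ENNReal.ofReal (W * (1 + s ^ (1/2 + κ)))

lemma ofR2 {k1 k2 b1 b2 : ℝ} {m1 m2 : ENNReal} (hk1 : 0 ≤ k1) (hk2 : 0 ≤ k2) (hb1 : 0 ≤ b1) (hb2 : 0 ≤ b2)
    (h1 : m1 ≤ ENNReal.ofReal b1) (h2 : m2 ≤ ENNReal.ofReal b2) :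
    ENNReal.ofReal k1 * m1 + ENNReal.ofReal k2 * m2 ≤ ENNReal.ofReal (k1 * b1 + k2 * b2) := by
  rw [ENNReal.ofReal_add (by positivity) (by positivity), ENNReal.ofReal_mul hk1, ENNReal.ofReal_mul hk2]
  gcongr

lemma ofR_add_le {m1 m2 : ENNReal} {b1 b2 : ℝ} (hb1 : 0 ≤ b1) (hb2 : 0 ≤ b2)
    (h1 : m1 ≤ ENNReal.ofReal b1) (h2 : m2 ≤ ENNReal.ofReal b2) : m1 + m2 ≤ ENNReal.ofReal (b1 + b2) := by
  rw [ENNReal.ofReal_add hb1 hb2]; exact add_le_add h1 h2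

lemma lint_split {μ : ℝ → ℝ} {S : Set ℝ} {X Y Z : ℝ → ENNReal} (hS : MeasurableSet S) (hμ : Measurable μ) (hY : Measurable Y)
    (h : ∀ s ∈ S, X s ≤ Y s + Z s) : ∫⁻ s in S, ENNReal.ofReal |μ s| * X s ≤
      (∫⁻ s in S, ENNReal.ofReal |μ s| * Y s) + ∫⁻ s in S, ENNReal.ofReal |μ s| * Z s := by
  rw [← lintegral_add_left (by fun_prop)]
  refine lintegral_mono_ae ?_
  filter_upwards [ae_restrict_mem hS] with s hs
  rw [← mul_add]; gcongr; exact h s hs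

lemma meas_inner {K : ℝ → ℝ → ℝ → ℝ} {f : ℝ → ℝ → ℝ} (hK : Measurable fun a : (ℝ × ℝ) × ℝ => K a.1.1 a.1.2 a.2)
    (hf : Measurable fun a : ℝ × ℝ => f a.1 a.2) :
    Measurable fun a : ℝ × ℝ => ∫ z in Ioi (0:ℝ), K a.1 a.2 z * f a.1 z := by
  have h2 : Measurable fun a : (ℝ × ℝ) × ℝ => f a.1.1 a.2 := hf.comp (measurable_fst.fst.prodMk measurable_snd)
  exact (StronglyMeasurable.integral_prod_right (f := fun (a : ℝ × ℝ) z => K a.1 a.2 z * f a.1 z)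
    (Measurable.stronglyMeasurable (by simp only [Function.uncurry_def]; exact hK.mul h2))).measurable

lemma meas_slice {f : ℝ → ℝ → ℝ} (hf : Measurable fun a : ℝ × ℝ => f a.1 a.2) (s : ℝ) : Measurable (f s) :=
  hf.comp (measurable_const.prodMk measurable_id)

lemma meas_Dk (t : ℝ) : Measurable fun a : (ℝ × ℝ) × ℝ => Dk (t - a.1.1) a.1.2 a.2 := by fun_prop

section
variable {κ Cμ W : ℝ} {w0 μ : ℝ → ℝ} {w : ℝ → ℝ → ℝ}

lemma Dk_mm {f : ℝ → ℝ} (hf : Measurable f) {q τ : ℝ} (hq : 0 ≤ q) (hτ : 0 < τ) :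
    mm q (fun x => ∫ z in Ioi (0:ℝ), Dk τ x z * f z) ≤ ENNReal.ofReal (10 * cE q * τ ^ ((q-1)/2)) * mm 0 f +
      ENNReal.ofReal (10 * cE q * τ ^ (-1/2:ℝ)) * mm q f := by
  have c := cE_pos hq
  refine ker_mm (by fun_prop) hf (by positivity) (by positivity) fun z hz => ?_
  refine (Dk_Lp hq hτ hz.le).trans ?_
  apply ENNReal.ofReal_le_ofReal; rw [Real.rpow_zero]; apply le_of_eq; ring

lemma Sys.mm_duh (S : Sys κ Cμ W w0 μ w) {q t : ℝ} (ht : 0 < t) :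
    mm q (w t) ≤ mm q (fun x => ∫ z in Ioi (0:ℝ), pk t x z * w0 z) +
      ((∫⁻ s in Ioc 0 (t/2), ENNReal.ofReal |μ s| * mm q (fun x => ∫ z in Ioi (0:ℝ), Dk (t - s) x z * w s z)) +
      ∫⁻ s in Ioc (t/2) t, ENNReal.ofReal |μ s| * mm q (fun x => ∫ z in Ioi (0:ℝ), Dk (t - s) x z * w s z)) := by
  rw [← split_half ht, mm_congr (S.duh t ht)]
  have h0 := S.w0m
  refine (mm_add_le ?_).trans (add_le_add_right (time_mm (F := fun s x => ∫ z in Ioi (0:ℝ), Dk (t - s) x z * w s z) ht.le S.μm (meas_inner (K := fun s x z => Dk (t - s) x z) (meas_Dk t) S.wm)) _)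
  exact (StronglyMeasurable.integral_prod_right (f := fun (x : ℝ) z => pk t x z * w0 z)
    (Measurable.stronglyMeasurable (by simp only [Function.uncurry_def]; fun_prop))).measurable

lemma Sys.a_init (S : Sys κ Cμ W w0 μ w) {t : ℝ} (ht : 0 < t) :
    mm 0 (fun x => ∫ z in Ioi (0:ℝ), pk t x z * w0 z) ≤ ENNReal.ofReal (40 * cE 0 * W * t ^ (-1/2:ℝ)) := by
  have c := cE_pos (le_refl (0:ℝ))
  have hW := S.hW
  refine (ker_mm (k1 := 40 * cE 0 * t ^ (-1/2:ℝ)) (q1 := 1) (k2 := 0) (q2 := 0) (by fun_prop) S.w0m (by positivity) le_rfl fun z hz => ?_).trans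
    ((ofR2 (by positivity) le_rfl hW hW S.w01 S.w00).trans ?_)
  · refine (pk_L0 ht hz.le).trans ?_
    apply ENNReal.ofReal_le_ofReal; rw [Real.rpow_one]; apply le_of_eq; ring
  · apply ENNReal.ofReal_le_ofReal; apply le_of_eq; ring

lemma half_rpow2 {t s r : ℝ} (ht : 0 < t) (hs : s ≤ t / 2) (hr : r ≤ 0) (hr2 : -2 ≤ r) : (t - s) ^ r ≤ 4 * t ^ r := by
  refine (half_rpow ht (by linarith) hr).trans ?_
  gcongr
  calc (2:ℝ) ^ (-r) ≤ 2 ^ (2:ℝ) := Real.rpow_le_rpow_of_exponent_le (by norm_num) (by linarith)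
    _ = 4 := by norm_num

lemma Sys.C1a (S : Sys κ Cμ W w0 μ w) : ∃ C ≥ 0, ∀ t > 0, mm 0 (w t) ≤ ENNReal.ofReal (C * t ^ (-1/4:ℝ)) := by
  have c := cE_pos (le_refl (0:ℝ))
  have hW := S.hW; have hC := S.hC
  refine ⟨W + 40 * cE 0 * W + Cμ / (0+1/4) * (80 * cE 0 * W) + 2 * Cμ / (-1/2+1) * (20 * cE 0 * W), by norm_num; positivity, fun t ht => ?_⟩
  rcases le_total t 1 with h1 | h1
  · refine (S.A0 t ht).trans (ENNReal.ofReal_le_ofReal ?_)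
    have h2 : 1 ≤ t ^ (-1/4:ℝ) := Real.one_le_rpow_of_pos_of_le_one_of_nonpos ht h1 (by norm_num)
    have h3 : 0 ≤ 40 * cE 0 * W + Cμ / (0+1/4) * (80 * cE 0 * W) + 2 * Cμ / (-1/2+1) * (20 * cE 0 * W) := by norm_num; positivity
    nlinarith
  · have X : ∀ s, 0 < s → s < t → mm 0 (fun x => ∫ z in Ioi (0:ℝ), Dk (t - s) x z * w s z) ≤ ENNReal.ofReal (20 * cE 0 * W * (t - s) ^ (-1/2:ℝ)) := by
      intro s hs hst
      have h4 : 0 < t - s := by linarith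
      refine (Dk_mm (meas_slice S.wm s) le_rfl h4).trans ?_
      refine (ofR2 (by positivity) (by positivity) hW hW (S.A0 s hs) (S.A0 s hs)).trans ?_
      apply ENNReal.ofReal_le_ofReal; rw [show ((0:ℝ)-1)/2 = -1/2 by norm_num]; apply le_of_eq; ring
    refine (S.mm_duh ht).trans ?_
    have L := time_lo (q := 0) (ε := 1/4) (B := 80 * cE 0 * W * t ^ (-1/2:ℝ)) hC S.μb (by positivity) ht (by norm_num) (by norm_num) (by norm_num)
      (fun s hs hs2 => (X s hs (by linarith)).trans (ENNReal.ofReal_le_ofReal (by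
        rw [Real.rpow_zero, mul_one]
        have := half_rpow2 ht hs2 (r := -1/2) (by norm_num) (by norm_num)
        calc _ ≤ 20 * cE 0 * W * (4 * t ^ (-1/2:ℝ)) := by gcongr
          _ = _ := by ring)))
    have H := time_hi (q := -1/2) (B := 20 * cE 0 * W) hC S.μb (by positivity) ht (by norm_num) (fun s hs hs2 => X s (by linarith) hs2)
    refine (ofR_add_le (by positivity) (by norm_num; positivity) (S.a_init ht) (ofR_add_le (by norm_num; positivity) (by norm_num; positivity) L H)).trans ?_
    apply ENNReal.ofReal_le_ofReal
    have e : t ^ (-1/2:ℝ) ≤ t ^ (-1/4:ℝ) := Real.rpow_le_rpow_of_exponent_le h1 (by norm_num)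
    have e2 : t ^ (-1/2:ℝ) * t ^ (0 + 1/4:ℝ) = t ^ (-1/4:ℝ) := rpa ht (by norm_num)
    have e0 : 0 ≤ t ^ (-1/4:ℝ) := by positivity
    calc _ = 40 * cE 0 * W * t ^ (-1/2:ℝ) + (Cμ / (0 + 1/4) * (80 * cE 0 * W) * (t ^ (-1/2:ℝ) * t ^ (0 + 1/4:ℝ)) + 2 * Cμ / (-1/2+1) * (20 * cE 0 * W) * t ^ (-1/2:ℝ)) := by ring
      _ ≤ 40 * cE 0 * W * t ^ (-1/4:ℝ) + (Cμ / (0 + 1/4) * (80 * cE 0 * W) * (t ^ (-1/4:ℝ)) + 2 * Cμ / (-1/2+1) * (20 * cE 0 * W) * t ^ (-1/4:ℝ)) := by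
        have : (0:ℝ) ≤ 2 * Cμ / (-1/2+1) := by norm_num; positivity
        rw [e2]; gcongr
      _ ≤ _ := by nlinarith

lemma Sys.C1 (S : Sys κ Cμ W w0 μ w) : ∃ C ≥ 0, ∀ t > 0, mm 0 (w t) ≤ ENNReal.ofReal (C * t ^ (-1/2:ℝ)) := by
  obtain ⟨A, hA, hAb⟩ := S.C1a
  have c := cE_pos (le_refl (0:ℝ))
  have hW := S.hW; have hC := S.hC
  refine ⟨W + 40 * cE 0 * W + Cμ * (2 / (1 - 1/4) + 1 / (1/4)) * (80 * cE 0 * A) + 2 * Cμ / (-1/2+1) * (80 * cE 0 * A), by norm_num; positivity, fun t ht => ?_⟩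
  rcases le_total t 1 with h1 | h1
  · refine (S.A0 t ht).trans (ENNReal.ofReal_le_ofReal ?_)
    have h2 : 1 ≤ t ^ (-1/2:ℝ) := Real.one_le_rpow_of_pos_of_le_one_of_nonpos ht h1 (by norm_num)
    have h3 : 0 ≤ 40 * cE 0 * W + Cμ * (2 / (1 - 1/4) + 1 / (1/4)) * (80 * cE 0 * A) + 2 * Cμ / (-1/2+1) * (80 * cE 0 * A) := by norm_num; positivity
    nlinarith
  · have X : ∀ s, 0 < s → s < t → mm 0 (fun x => ∫ z in Ioi (0:ℝ), Dk (t - s) x z * w s z) ≤ ENNReal.ofReal (20 * cE 0 * A * s ^ (-1/4:ℝ) * (t - s) ^ (-1/2:ℝ)) := by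
      intro s hs hst
      have h4 : 0 < t - s := by linarith
      refine (Dk_mm (meas_slice S.wm s) le_rfl h4).trans ?_
      refine (ofR2 (by positivity) (by positivity) (by positivity) (by positivity) (hAb s hs) (hAb s hs)).trans ?_
      apply ENNReal.ofReal_le_ofReal; rw [show ((0:ℝ)-1)/2 = -1/2 by norm_num]; apply le_of_eq; ring
    refine (S.mm_duh ht).trans ?_
    have L := time_lo' (q := 1/4) (t := t) (B := 80 * cE 0 * A * t ^ (-1/2:ℝ)) hC S.μb (by positivity) (by norm_num) (by norm_num)
      (fun s hs hs2 => (X s hs (by linarith)).trans (ENNReal.ofReal_le_ofReal (by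
        have := half_rpow2 ht hs2 (r := -1/2) (by norm_num) (by norm_num)
        calc _ ≤ 20 * cE 0 * A * s ^ (-1/4:ℝ) * (4 * t ^ (-1/2:ℝ)) := by gcongr
          _ = _ := by rw [show -(1/4:ℝ) = -1/4 by norm_num]; ring)))
    have H := time_hi (q := -1/2) (t := t) (B := 80 * cE 0 * A) hC S.μb (by positivity) ht (by norm_num) (fun s hs hs2 => (X s (by linarith) hs2).trans 
      (ENNReal.ofReal_le_ofReal (by
        have h5 : s ^ (-1/4:ℝ) ≤ 4 := by
          calc s ^ (-1/4:ℝ) ≤ (1/2) ^ (-1/4:ℝ) := Real.rpow_le_rpow_of_nonpos (by norm_num) (by linarith) (by norm_num)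
            _ ≤ (1/2) ^ (-2:ℝ) := Real.rpow_le_rpow_of_exponent_ge (by norm_num) (by norm_num) (by norm_num)
            _ = 4 := by rw [Real.rpow_neg (by norm_num)]; norm_num
        have : 0 < t - s := by linarith
        calc _ ≤ 20 * cE 0 * A * 4 * (t - s) ^ (-1/2:ℝ) := by gcongr
          _ = _ := by ring)))
    refine (ofR_add_le (by positivity) (by norm_num; positivity) (S.a_init ht) (ofR_add_le (by norm_num; positivity) (by norm_num; positivity) L H)).trans ?_
    apply ENNReal.ofReal_le_ofReal
    have e0 : 0 ≤ W * t ^ (-1/2:ℝ) := by positivity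
    nlinarith

lemma Sys.C2 (S : Sys κ Cμ W w0 μ w) : ∃ C ≥ 0, ∀ t > 0, ∀ x > 0, w t x ≤ C * t ^ (-1:ℝ) := by
  obtain ⟨A, hA, hAb⟩ := S.C1a
  have hW := S.hW; have hC := S.hC
  refine ⟨20 * W + Cμ * (2 / (1 - 1/4) + 1 / (1/4)) * (80 * A) + 2 * Cμ / (-1/2+1) * (160 * (4 * W)), by norm_num; positivity, fun t ht x hx => ?_⟩
  have h0 : ENNReal.ofReal |∫ z in Ioi (0:ℝ), pk t x z * w0 z| ≤ ENNReal.ofReal (20 * W * t ^ (-1:ℝ)) := by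
    refine (ker_sup (k1 := 20 * t ^ (-1:ℝ)) (q1 := 1) (k2 := 0) (q2 := 0) S.w0m (by positivity) le_rfl fun z hz => ?_).trans
      ((ofR2 (by positivity) le_rfl hW hW S.w01 S.w00).trans ?_)
    · refine (pk_lin ht hz.le).trans (le_of_eq ?_); rw [Real.rpow_one]; ring
    · apply ENNReal.ofReal_le_ofReal; apply le_of_eq; ring
  have L := time_lo' (q := 1/4) (t := t) (B := 80 * A * t ^ (-1:ℝ)) (X := fun s => ENNReal.ofReal |∫ z in Ioi (0:ℝ), Dk (t - s) x z * w s z|) hC S.μb (by positivity) (by norm_num) (by norm_num)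
    (fun s hs hs2 => by
      refine (ker_sup (k1 := 20 * (t - s) ^ (-1:ℝ)) (q1 := 0) (k2 := 0) (q2 := 0) (meas_slice S.wm s) (by have : 0 < t - s := by linarith
                                                                                                          positivity) le_rfl fun z hz => ?_).trans
        ((ofR2 (by have : 0 < t - s := by linarith
                   positivity) le_rfl (by positivity) (by positivity) (hAb s hs) (hAb s hs)).trans ?_)
      · simpa using Dk_sup (by linarith) x z
      · apply ENNReal.ofReal_le_ofReal
        have := half_rpow2 ht hs2 (r := -1) (by norm_num) (by norm_num)
        rw [show -(1/4:ℝ) = -1/4 by norm_num]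
        calc _ ≤ 20 * (4 * t ^ (-1:ℝ)) * (A * s ^ (-1/4:ℝ)) + 0 * (A * s ^ (-1/4:ℝ)) := by gcongr
          _ = _ := by ring)
  have H := time_hi (q := -1/2) (t := t) (B := 160 * (4 * W) * t ^ (-1/2:ℝ)) (X := fun s => ENNReal.ofReal |∫ z in Ioi (0:ℝ), Dk (t - s) x z * w s z|) hC S.μb (by positivity) ht (by norm_num) (fun s hs hs2 => by
      apply ENNReal.ofReal_le_ofReal
      have hτ : 0 < t - s := by linarith
      have h5 : ∀ z > 0, w s z ≤ 4 * W * t ^ (-1/2:ℝ) := by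
        intro z hz
        refine (S.As s (by linarith) z hz).trans ?_
        have := half_rpow2 ht (s := t - s) (by linarith) (r := -1/2) (by norm_num) (by norm_num)
        rw [sub_sub_cancel] at this
        calc _ ≤ W * (4 * t ^ (-1/2:ℝ)) := by gcongr
          _ = _ := by ring
      rw [← Real.norm_eq_abs]
      refine (norm_integral_le_of_norm_le (g := fun z => (4 * W * t ^ (-1/2:ℝ)) * |Dk (t - s) x z|) ?_ ?_).trans ?_
      · exact ((integrable_Dk hτ x).abs.const_mul _).integrableOn
      · filter_upwards [ae_restrict_mem measurableSet_Ioi] with z hz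
        rw [Real.norm_eq_abs, abs_mul, mul_comm, abs_of_nonneg (S.wn s z)]
        gcongr; exact h5 z hz
      · rw [integral_const_mul]
        have : ∫ z in Ioi (0:ℝ), |Dk (t - s) x z| ≤ 160 * (t - s) ^ (-1/2:ℝ) :=
          (setIntegral_le_integral (integrable_Dk hτ x).abs (Eventually.of_forall fun z => abs_nonneg _)).trans (int_abs_Dk hτ x)
        calc _ ≤ (4 * W * t ^ (-1/2:ℝ)) * (160 * (t - s) ^ (-1/2:ℝ)) := by gcongr
          _ = _ := by ring)
  have T := time_sup (μ := μ) (F := fun s => ∫ z in Ioi (0:ℝ), Dk (t - s) x z * w s z) ht.le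
  rw [split_half ht] at T
  have hb : ENNReal.ofReal (w t x) ≤ ENNReal.ofReal (20 * W * t ^ (-1:ℝ) + (Cμ * (2 / (1 - 1/4) + 1 / (1/4)) * (80 * A * t ^ (-1:ℝ)) + 2 * Cμ / (-1/2+1) * (160 * (4 * W) * t ^ (-1/2:ℝ)) * t ^ (-1/2:ℝ))) := by
    refine le_trans ?_ (ofR_add_le (by positivity) (by norm_num; positivity) h0 (T.trans (ofR_add_le (by norm_num; positivity) (by norm_num; positivity) L H)))
    rw [← ENNReal.ofReal_add (abs_nonneg _) (abs_nonneg _), S.duh t ht x hx]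
    apply ENNReal.ofReal_le_ofReal
    exact add_le_add (le_abs_self _) (le_abs_self _)
  rw [ENNReal.ofReal_le_ofReal_iff (by norm_num; positivity)] at hb
  refine hb.trans (le_of_eq ?_)
  have e : t ^ (-1/2:ℝ) * t ^ (-1/2:ℝ) = t ^ (-1:ℝ) := rpa ht (by norm_num)
  linear_combination (2 * Cμ / (-1/2+1) * (160 * (4 * W))) * e
end

/-- uniform power bound for `t ≥ 1` -/
def Bd {ι : Type} (X : ι → ℝ → ENNReal) (q : ℝ) : Prop := ∃ C ≥ 0, ∀ i, ∀ t ≥ 1, X i t ≤ ENNReal.ofReal (C * t ^ q)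

section
variable {ι : Type}

lemma Bd.mono {X : ι → ℝ → ENNReal} {q q' : ℝ} (h : Bd X q) (hq : q ≤ q') : Bd X q' := by
  obtain ⟨C, hC, h⟩ := h
  exact ⟨C, hC, fun i t ht => (h i t ht).trans (ENNReal.ofReal_le_ofReal (mul_le_mul_of_nonneg_left (Real.rpow_le_rpow_of_exponent_le ht hq) hC))⟩

lemma Bd.le {X Y : ι → ℝ → ENNReal} {q : ℝ} (h : Bd Y q) (hX : ∀ i, ∀ t ≥ 1, X i t ≤ Y i t) : Bd X q := by
  obtain ⟨C, hC, h⟩ := h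
  exact ⟨C, hC, fun i t ht => (hX i t ht).trans (h i t ht)⟩

lemma Bd.add {X Y : ι → ℝ → ENNReal} {q : ℝ} (h : Bd X q) (h' : Bd Y q) : Bd (fun i t => X i t + Y i t) q := by
  obtain ⟨C, hC, h⟩ := h
  obtain ⟨C', hC', h'⟩ := h'
  refine ⟨C + C', by positivity, fun i t ht => ?_⟩
  have : 0 ≤ t ^ q := by positivity
  rw [add_mul]
  exact ofR_add_le (by positivity) (by positivity) (h i t ht) (h' i t ht)

lemma Bd.mul {X Y : ι → ℝ → ENNReal} {q q' r : ℝ} (h : Bd X q) (h' : Bd Y q') (hr : q + q' = r) : Bd (fun i t => X i t * Y i t) r := by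
  obtain ⟨C, hC, h⟩ := h
  obtain ⟨C', hC', h'⟩ := h'
  refine ⟨C * C', by positivity, fun i t ht => ?_⟩
  have ht0 : 0 < t := by linarith
  refine (mul_le_mul' (h i t ht) (h' i t ht)).trans (le_of_eq ?_)
  rw [← ENNReal.ofReal_mul (by positivity), ← rpa ht0 hr]; congr 1; ring

lemma Bd.of {X : ι → ℝ → ENNReal} {q C : ℝ} (hC : 0 ≤ C) (h : ∀ i, ∀ t ≥ 1, X i t ≤ ENNReal.ofReal (C * t ^ q)) : Bd X q := ⟨C, hC, h⟩

lemma Bd.split {X Y Z : ι → ℝ → ℝ → ENNReal} {S : ℝ → Set ℝ} {μ : ℝ → ℝ} {q : ℝ} (hS : ∀ t, MeasurableSet (S t)) (hμ : Measurable μ)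
    (hY : ∀ i t, Measurable (Y i t)) (h : ∀ i, ∀ t ≥ 1, ∀ s ∈ S t, X i t s ≤ Y i t s + Z i t s)
    (h1 : Bd (fun i t => ∫⁻ s in S t, ENNReal.ofReal |μ s| * Y i t s) q) (h2 : Bd (fun i t => ∫⁻ s in S t, ENNReal.ofReal |μ s| * Z i t s) q) :
    Bd (fun i t => ∫⁻ s in S t, ENNReal.ofReal |μ s| * X i t s) q :=
  (h1.add h2).le fun i t ht => lint_split (hS t) hμ (hY i t) (h i t ht)

lemma Bd.split_hi {X Y Z : ι → ℝ → ℝ → ENNReal} {μ : ℝ → ℝ} {q : ℝ} (hμ : Measurable μ)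
    (hY : ∀ i t, Measurable (Y i t)) (h : ∀ i, ∀ t ≥ 1, ∀ s, t / 2 < s → s < t → X i t s ≤ Y i t s + Z i t s)
    (h1 : Bd (fun i t => ∫⁻ s in Ioc (t/2) t, ENNReal.ofReal |μ s| * Y i t s) q) (h2 : Bd (fun i t => ∫⁻ s in Ioc (t/2) t, ENNReal.ofReal |μ s| * Z i t s) q) :
    Bd (fun i t => ∫⁻ s in Ioc (t/2) t, ENNReal.ofReal |μ s| * X i t s) q := by
  refine (h1.add h2).le fun i t ht => ?_
  rw [setLIntegral_congr Ioo_ae_eq_Ioc.symm, setLIntegral_congr Ioo_ae_eq_Ioc.symm, setLIntegral_congr Ioo_ae_eq_Ioc.symm]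
  exact lint_split measurableSet_Ioo hμ (hY i t) fun s hs => h i t ht s hs.1 hs.2

variable {μ : ℝ → ℝ} {Cμ : ℝ}

lemma Bd.lo {X : ι → ℝ → ℝ → ENNReal} {B r q ε r' : ℝ} (hC : 0 ≤ Cμ) (hμ : ∀ s ≥ 0, |μ s| ≤ Cμ / (1 + s)) (hB : 0 ≤ B) (hε : 0 ≤ ε) (hε1 : ε ≤ 1) (hq : 0 < q + ε)
    (hr : r + (q + ε) ≤ r') (hX : ∀ i, ∀ t ≥ 1, ∀ s, 0 < s → s ≤ t / 2 → X i t s ≤ ENNReal.ofReal (B * t ^ r * s ^ q)) :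
    Bd (fun i t => ∫⁻ s in Ioc 0 (t/2), ENNReal.ofReal |μ s| * X i t s) r' := by
  refine Bd.mono (q := r + (q + ε)) ⟨Cμ / (q + ε) * B, by positivity, fun i t ht => ?_⟩ hr
  have ht0 : 0 < t := by linarith
  refine (time_lo hC hμ (by positivity) ht0 hε hε1 hq (hX i t ht)).trans (ENNReal.ofReal_le_ofReal (le_of_eq ?_))
  rw [← rpa ht0 (show r + (q + ε) = r + (q + ε) from rfl)]; ring

lemma Bd.lo' {X : ι → ℝ → ℝ → ENNReal} {B r q r' : ℝ} (hC : 0 ≤ Cμ) (hμ : ∀ s ≥ 0, |μ s| ≤ Cμ / (1 + s)) (hB : 0 ≤ B) (hq : 0 < q) (hq1 : q < 1)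
    (hr : r ≤ r') (hX : ∀ i, ∀ t ≥ 1, ∀ s, 0 < s → s ≤ t / 2 → X i t s ≤ ENNReal.ofReal (B * t ^ r * s ^ (-q))) :
    Bd (fun i t => ∫⁻ s in Ioc 0 (t/2), ENNReal.ofReal |μ s| * X i t s) r' := by
  have : 0 < 1 - q := by linarith
  refine Bd.mono (q := r) ⟨Cμ * (2 / (1 - q) + 1 / q) * B, by positivity, fun i t ht => ?_⟩ hr
  have ht0 : 0 < t := by linarith
  refine (time_lo' hC hμ (by positivity) hq hq1 (hX i t ht)).trans (ENNReal.ofReal_le_ofReal (le_of_eq ?_))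
  ring

lemma Bd.hi {X : ι → ℝ → ℝ → ENNReal} {B r q r' : ℝ} (hC : 0 ≤ Cμ) (hμ : ∀ s ≥ 0, |μ s| ≤ Cμ / (1 + s)) (hB : 0 ≤ B) (hq : -1 < q)
    (hr : r + q ≤ r') (hX : ∀ i, ∀ t ≥ 1, ∀ s, t / 2 < s → s < t → X i t s ≤ ENNReal.ofReal (B * t ^ r * (t - s) ^ q)) :
    Bd (fun i t => ∫⁻ s in Ioc (t/2) t, ENNReal.ofReal |μ s| * X i t s) r' := by
  have : 0 < q + 1 := by linarith
  refine Bd.mono (q := r + q) ⟨2 * Cμ / (q + 1) * B, by positivity, fun i t ht => ?_⟩ hr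
  have ht0 : 0 < t := by linarith
  refine (time_hi hC hμ (by positivity) ht0 hq (hX i t ht)).trans (ENNReal.ofReal_le_ofReal (le_of_eq ?_))
  rw [← rpa ht0 (show r + q = r + q from rfl)]; ring

lemma Bd.tail {X : ι → ℝ → ℝ → ENNReal} {B r q r' : ℝ} (hC : 0 ≤ Cμ) (hμ : ∀ s ≥ 0, |μ s| ≤ Cμ / (1 + s)) (hB : 0 ≤ B) (hq : 0 < q) (hq2 : q ≤ 2)
    (hr : r - q ≤ r') (hX : ∀ i, ∀ t ≥ 1, ∀ s, t / 2 < s → X i t s ≤ ENNReal.ofReal (B * t ^ r * s ^ (-q))) :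
    Bd (fun i t => ∫⁻ s in Ioi (t/2), ENNReal.ofReal |μ s| * X i t s) r' := by
  refine Bd.mono (q := r - q) ⟨Cμ / q * B * 4, by positivity, fun i t ht => ?_⟩ hr
  have ht0 : 0 < t := by linarith
  refine (time_tail hC hμ (by positivity) (by linarith) hq (hX i t ht)).trans (ENNReal.ofReal_le_ofReal ?_)
  have := half_rpow2 ht0 (s := t / 2) le_rfl (r := -q) (by linarith) (by linarith)
  rw [show t - t / 2 = t / 2 by ring] at this
  calc _ ≤ Cμ / q * (B * t ^ r) * (4 * t ^ (-q)) := by gcongr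
    _ = _ := by rw [← rpa ht0 (show r + -q = r - q by ring)]; ring
end

lemma hi_s {t s r : ℝ} (ht : 0 < t) (hs : t / 2 < s) (hr : r ≤ 0) (hr2 : -2 ≤ r) : s ^ r ≤ 4 * t ^ r := by
  have := half_rpow2 ht (s := t - s) (by linarith) hr hr2
  rwa [sub_sub_cancel] at this

section
variable {κ Cμ W : ℝ} {w0 μ : ℝ → ℝ} {w : ℝ → ℝ → ℝ}

lemma Sys.C3 (S : Sys κ Cμ W w0 μ w) : ∃ C ≥ 0, ∀ s > 0, mm (1 + 2 * κ) (w s) ≤ ENNReal.ofReal (C * (1 + s ^ κ)) := by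
  have hκ := S.κ0; have hκ1 := S.κ1; have hC := S.hC; have hW := S.hW
  obtain ⟨A, hA, hAb⟩ := S.C1
  have hp : 0 ≤ 1 + 2 * κ := by linarith
  have c := cE_pos hp
  have D : ∀ t s, 0 < s → s < t → mm (1+2*κ) (fun x => ∫ z in Ioi (0:ℝ), Dk (t - s) x z * w s z) ≤ 
      ENNReal.ofReal (10 * cE (1+2*κ) * (t-s) ^ κ * (A * s ^ (-1/2:ℝ))) + ENNReal.ofReal (10 * cE (1+2*κ) * (t-s) ^ (-1/2:ℝ) * (W * (1 + s ^ (1/2 + κ)))) := by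
    intro t s hs hst
    have h4 : 0 < t - s := by linarith
    refine (Dk_mm (meas_slice S.wm s) hp h4).trans ?_
    rw [show (1 + 2 * κ - 1)/2 = κ by ring, ENNReal.ofReal_mul (q := A * s ^ (-1/2:ℝ)) (by positivity), ENNReal.ofReal_mul (q := W * (1 + s ^ (1/2 + κ))) (by positivity)]
    gcongr
    · exact hAb s hs
    · exact S.Ap s hs
  have key : Bd (fun (_ : Unit) t => mm (1+2*κ) (w t)) κ := by
    refine Bd.le (Y := fun _ t => mm (1+2*κ) (fun x => ∫ z in Ioi (0:ℝ), pk t x z * w0 z) +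
      ((∫⁻ s in Ioc 0 (t/2), ENNReal.ofReal |μ s| * mm (1+2*κ) (fun x => ∫ z in Ioi (0:ℝ), Dk (t - s) x z * w s z)) +
      ∫⁻ s in Ioc (t/2) t, ENNReal.ofReal |μ s| * mm (1+2*κ) (fun x => ∫ z in Ioi (0:ℝ), Dk (t - s) x z * w s z)))
      (Bd.add ?_ (Bd.add ?_ ?_)) (fun _ t ht => S.mm_duh (by linarith))
    · refine Bd.of (C := 80 * cE (1+2*κ) * W) (by positivity) fun _ t ht => ?_
      have ht0 : 0 < t := by linarith
      refine (ker_mm (k1 := 40 * cE (1+2*κ)) (q1 := 1+2*κ) (k2 := 40 * cE (1+2*κ) * t ^ κ) (q2 := 1) (by fun_prop) S.w0m (by positivity) (by positivity) fun z hz => ?_).trans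
        ((ofR2 (by positivity) (by positivity) hW hW S.w0p S.w01).trans ?_)
      · refine (pk_Lp (by linarith) ht0 hz.le).trans ?_
        apply ENNReal.ofReal_le_ofReal; rw [Real.rpow_one, show (1 + 2 * κ - 1)/2 = κ by ring]; apply le_of_eq; ring
      · apply ENNReal.ofReal_le_ofReal
        have : 1 ≤ t ^ κ := Real.one_le_rpow ht hκ.le
        have h2 : 0 ≤ cE (1+2*κ) * W := by positivity
        nlinarith
    · refine Bd.split (Y := fun _ t s => ENNReal.ofReal (10 * cE (1+2*κ) * (t-s) ^ κ * (A * s ^ (-1/2:ℝ)))) (fun t => measurableSet_Ioc) S.μm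
        (fun i t => by fun_prop) (fun _ t ht s hs => D t s hs.1 (by linarith [hs.2])) ?_ ?_
      · refine Bd.lo' (B := 10 * cE (1+2*κ) * A) (r := κ) (q := 1/2) hC S.μb (by positivity) (by norm_num) (by norm_num) le_rfl fun _ t ht s hs hs2 => ?_
        apply ENNReal.ofReal_le_ofReal
        have : (t - s) ^ κ ≤ t ^ κ := Real.rpow_le_rpow (by linarith) (by linarith) hκ.le
        rw [show -(1/2:ℝ) = -1/2 by norm_num]
        calc _ ≤ 10 * cE (1+2*κ) * t ^ κ * (A * s ^ (-1/2:ℝ)) := by gcongr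
          _ = _ := by ring
      · refine Bd.split (Y := fun _ t s => ENNReal.ofReal (40 * cE (1+2*κ) * W * t ^ (-1/2:ℝ) * s ^ (0:ℝ))) (Z := fun _ t s => ENNReal.ofReal (40 * cE (1+2*κ) * W * t ^ (-1/2:ℝ) * s ^ (1/2+κ))) (fun t => measurableSet_Ioc) S.μm
          (fun i t => by fun_prop) (fun _ t ht s hs => ?_) ?_ ?_
        · have hs0 := hs.1
          have ht0 : 0 < t := by linarith
          rw [← ENNReal.ofReal_add (by positivity) (by positivity)]
          apply ENNReal.ofReal_le_ofReal
          have := half_rpow2 ht0 hs.2 (r := -1/2) (by norm_num) (by norm_num)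
          calc _ ≤ 10 * cE (1+2*κ) * (4 * t ^ (-1/2:ℝ)) * (W * (1 + s ^ (1/2 + κ))) := by gcongr
            _ = _ := by rw [Real.rpow_zero]; ring
        · exact Bd.lo (q := 0) (ε := 1/2) hC S.μb (by positivity) (by norm_num) (by norm_num) (by norm_num) (by linarith) fun _ t ht s hs hs2 => le_rfl
        · exact Bd.lo (q := 1/2+κ) (ε := 0) hC S.μb (by positivity) (by norm_num) (by norm_num) (by linarith) (by linarith) fun _ t ht s hs hs2 => le_rfl
    · refine Bd.split_hi (Y := fun _ t s => ENNReal.ofReal (10 * cE (1+2*κ) * (t-s) ^ κ * (A * s ^ (-1/2:ℝ)))) S.μm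
        (fun i t => by fun_prop) (fun _ t ht s hs hs2 => D t s (by linarith) hs2) ?_ ?_
      · refine Bd.hi (B := 40 * cE (1+2*κ) * A) (r := -1/2) (q := κ) hC S.μb (by positivity) (by linarith) (by linarith) fun _ t ht s hs hs2 => ?_
        apply ENNReal.ofReal_le_ofReal
        have := hi_s (by linarith) hs (r := -1/2) (by norm_num) (by norm_num)
        have : 0 < t - s := by linarith
        calc _ ≤ 10 * cE (1+2*κ) * (t - s) ^ κ * (A * (4 * t ^ (-1/2:ℝ))) := by gcongr
          _ = _ := by ring
      · refine Bd.hi (B := 20 * cE (1+2*κ) * W) (r := 1/2+κ) (q := -1/2) hC S.μb (by positivity) (by linarith) (by linarith) fun _ t ht s hs hs2 => ?_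
        apply ENNReal.ofReal_le_ofReal
        have h1 : s ^ (1/2+κ) ≤ t ^ (1/2+κ) := Real.rpow_le_rpow (by linarith) (by linarith) (by linarith)
        have h2 : 1 ≤ t ^ (1/2+κ) := Real.one_le_rpow ht (by linarith)
        have : 0 < t - s := by linarith
        calc _ ≤ 10 * cE (1+2*κ) * (t - s) ^ (-1/2:ℝ) * (W * (t ^ (1/2+κ) + t ^ (1/2+κ))) := by gcongr
          _ = _ := by ring
  obtain ⟨C, hC0, h⟩ := key
  refine ⟨C + 2 * W, by positivity, fun s hs => ?_⟩
  have e : 0 ≤ s ^ κ := by positivity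
  rcases le_total s 1 with h1 | h1
  · refine (S.Ap s hs).trans (ENNReal.ofReal_le_ofReal ?_)
    have : s ^ (1/2+κ) ≤ 1 := Real.rpow_le_one hs.le h1 (by linarith)
    nlinarith [mul_nonneg hC0 e, mul_nonneg hW e, mul_le_mul_of_nonneg_left this hW]
  · refine (h () s h1).trans (ENNReal.ofReal_le_ofReal ?_)
    nlinarith [mul_nonneg hC0 e, mul_nonneg hW e]
end

structure Mu (Cμ : ℝ) (μ : ℝ → ℝ) : Prop where
  hC : 0 ≤ Cμ
  m : Measurable μ
  b : ∀ s ≥ 0, |μ s| ≤ Cμ / (1 + s)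

structure Good (A : ℝ) (f : ℝ → ℝ → ℝ) : Prop where
  hA : 0 ≤ A
  m : Measurable (fun a : ℝ × ℝ => f a.1 a.2)
  f0 : ∀ s > 0, mm 0 (f s) ≤ ENNReal.ofReal (A * s ^ (-1/2:ℝ))
  fs : ∀ s > 0, ∀ z > 0, |f s z| ≤ A * s ^ (-1:ℝ)

lemma mm0_int {f : ℝ → ℝ} {b : ℝ} (hf : Measurable f) (h : mm 0 f ≤ ENNReal.ofReal b) : IntegrableOn f (Ioi 0) := by
  refine ⟨hf.aestronglyMeasurable, ?_⟩
  refine lt_of_le_of_lt ?_ (h.trans_lt ENNReal.ofReal_lt_top)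
  unfold mm
  refine lintegral_mono fun z => ?_
  rw [Real.enorm_eq_ofReal_abs, Real.rpow_zero, one_mul]

lemma mm0_abs {f : ℝ → ℝ} : ENNReal.ofReal |∫ z in Ioi (0:ℝ), f z| ≤ mm 0 f := by
  have := enorm_integral_le_lintegral_enorm (μ := volume.restrict (Ioi (0:ℝ))) f
  rw [Real.enorm_eq_ofReal_abs] at this
  refine this.trans (lintegral_mono fun z => ?_)
  rw [Real.enorm_eq_ofReal_abs, Real.rpow_zero, one_mul]

lemma intOn_of_lint {μ F : ℝ → ℝ} {S : Set ℝ} {b : ℝ} (hμ : Measurable μ) (hF : Measurable F)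
    (h : ∫⁻ s in S, ENNReal.ofReal |μ s| * ENNReal.ofReal |F s| ≤ ENNReal.ofReal b) : IntegrableOn (fun s => μ s * F s) S := by
  refine ⟨(hμ.mul hF).aestronglyMeasurable, ?_⟩
  refine lt_of_le_of_lt ?_ (h.trans_lt ENNReal.ofReal_lt_top)
  refine lintegral_mono fun z => ?_
  rw [Real.enorm_eq_ofReal_abs, abs_mul, ENNReal.ofReal_mul (abs_nonneg _)]

lemma lint_sup {μ F : ℝ → ℝ} {S : Set ℝ} : 
    ENNReal.ofReal |∫ s in S, μ s * F s| ≤ ∫⁻ s in S, ENNReal.ofReal |μ s| * ENNReal.ofReal |F s| := by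
  have := enorm_integral_le_lintegral_enorm (μ := volume.restrict S) (fun s => μ s * F s)
  rw [Real.enorm_eq_ofReal_abs] at this
  refine this.trans (lintegral_mono fun s => ?_)
  rw [Real.enorm_eq_ofReal_abs, abs_mul, ENNReal.ofReal_mul (abs_nonneg _)]

lemma Good.meas_int {A : ℝ} {f : ℝ → ℝ → ℝ} (G : Good A f) : Measurable fun s => ∫ z in Ioi (0:ℝ), f s z :=
  (StronglyMeasurable.integral_prod_right (f := fun (s : ℝ) z => f s z) (Measurable.stronglyMeasurable (by simp only [Function.uncurry_def]; exact G.m))).measurable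

lemma meas_s {F : ℝ → ℝ → ℝ} (hF : Measurable fun a : ℝ × ℝ => F a.1 a.2) (x : ℝ) : Measurable fun s => F s x :=
  hF.comp (measurable_id.prodMk measurable_const)

lemma Good.meas_D {A : ℝ} {f : ℝ → ℝ → ℝ} (G : Good A f) (t x : ℝ) : Measurable fun s => ∫ z in Ioi (0:ℝ), Dk (t - s) x z * f s z :=
  meas_s (F := fun s x => ∫ z in Ioi (0:ℝ), Dk (t - s) x z * f s z) (meas_inner (K := fun s x z => Dk (t - s) x z) (meas_Dk t) G.m) x

/-- sup bound on f times L1 bound of Dk -/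
lemma Dk_hi {f : ℝ → ℝ} {τ x b k : ℝ} (hτ : 0 < τ) (hb : 0 ≤ b) (hf : ∀ z > 0, |f z| ≤ b) (hk : ∫ z in Ioi (0:ℝ), |Dk τ x z| ≤ k) :
    |∫ z in Ioi (0:ℝ), Dk τ x z * f z| ≤ k * b := by
  rw [← Real.norm_eq_abs]
  refine (norm_integral_le_of_norm_le (g := fun z => b * |Dk τ x z|) ?_ ?_).trans ?_
  · exact ((integrable_Dk hτ x).abs.const_mul _).integrableOn
  · filter_upwards [ae_restrict_mem measurableSet_Ioi] with z hz
    rw [Real.norm_eq_abs, abs_mul, mul_comm]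
    gcongr; exact hf z hz
  · rw [integral_const_mul, mul_comm]; gcongr

lemma int_abs_Dk' {τ : ℝ} (hτ : 0 < τ) (x : ℝ) : ∫ z in Ioi (0:ℝ), |Dk τ x z| ≤ 160 * τ ^ (-1/2:ℝ) :=
  (setIntegral_le_integral (integrable_Dk hτ x).abs (Eventually.of_forall fun z => abs_nonneg _)).trans (int_abs_Dk hτ x)

section
variable {A Cμ : ℝ} {f : ℝ → ℝ → ℝ} {μ : ℝ → ℝ}

lemma Good.int_D (G : Good A f) (M : Mu Cμ μ) {t : ℝ} (ht : 0 < t) (x : ℝ) : IntegrableOn (fun s => μ s * ∫ z in Ioi (0:ℝ), Dk (t - s) x z * f s z) (Ioc 0 t) := by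
  have hA := G.hA
  have hC := M.hC
  refine intOn_of_lint (b := Cμ * (2 / (1 - 1/2) + 1 / (1/2)) * (80 * A * t ^ (-1:ℝ)) + 2 * Cμ / (-1/2+1) * (160 * (4 * A) * t ^ (-1:ℝ)) * t ^ (-1/2:ℝ)) M.m (G.meas_D t x) ?_
  rw [split_half ht]
  refine ofR_add_le (by norm_num; positivity) (by norm_num; positivity) ?_ ?_
  · refine time_lo' hC M.b (by positivity) (by norm_num) (by norm_num) fun s hs hs2 => ?_
    have h4 : 0 < t - s := by linarith
    refine (ker_sup (k1 := 20 * (t - s) ^ (-1:ℝ)) (q1 := 0) (k2 := 0) (q2 := 0) (meas_slice G.m s) (by positivity) le_rfl fun z hz => ?_).trans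
        ((ofR2 (by positivity) le_rfl (by positivity) (by positivity) (G.f0 s hs) (G.f0 s hs)).trans ?_)
    · simpa using Dk_sup h4 x z
    · apply ENNReal.ofReal_le_ofReal
      have := half_rpow2 ht hs2 (r := -1) (by norm_num) (by norm_num)
      rw [show -(1/2:ℝ) = -1/2 by norm_num]
      calc _ ≤ 20 * (4 * t ^ (-1:ℝ)) * (A * s ^ (-1/2:ℝ)) + 0 * (A * s ^ (-1/2:ℝ)) := by gcongr
        _ = _ := by ring
  · refine time_hi hC M.b (by positivity) ht (by norm_num) fun s hs hs2 => ?_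
    apply ENNReal.ofReal_le_ofReal
    have h4 : 0 < t - s := by linarith
    have hs0 : 0 < s := by linarith
    refine (Dk_hi h4 (by positivity) (G.fs s hs0) (int_abs_Dk' h4 x)).trans ?_
    have := hi_s ht hs (r := -1) (by norm_num) (by norm_num)
    calc _ ≤ 160 * (t - s) ^ (-1/2:ℝ) * (A * (4 * t ^ (-1:ℝ))) := by gcongr
      _ = _ := by ring

lemma Good.int_f (G : Good A f) (M : Mu Cμ μ) : IntegrableOn (fun s => μ s * ∫ z in Ioi (0:ℝ), f s z) (Ioi 0) := by
  refine intOn_of_lint M.m G.meas_int (time_all (q := 1/2) (B := A) M.hC M.b G.hA (by norm_num) (by norm_num) fun s hs => ?_)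
  refine mm0_abs.trans ((G.f0 s hs).trans (le_of_eq ?_))
  rw [show -(1/2:ℝ) = -1/2 by norm_num]

lemma Good.int_in (G : Good A f) {s : ℝ} (hs : 0 < s) : IntegrableOn (f s) (Ioi 0) := mm0_int (meas_slice G.m s) (G.f0 s hs)

lemma Good.int_Din (G : Good A f) {s τ : ℝ} (hs : 0 < s) (hτ : 0 < τ) (x : ℝ) : IntegrableOn (fun z => Dk τ x z * f s z) (Ioi 0) := by
  refine (G.int_in hs).bdd_mul (c := 20 * τ ^ (-1:ℝ)) (Measurable.aestronglyMeasurable (by fun_prop)) (Eventually.of_forall fun z => ?_)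
  rw [Real.norm_eq_abs]; exact Dk_sup hτ x z

noncomputable def Kc (t s x z : ℝ) : ℝ := Dk (t - s) x z - if s ≤ t / 2 then qk t x else 0

noncomputable def Qop (μ : ℝ → ℝ) (f : ℝ → ℝ → ℝ) (t x : ℝ) : ℝ :=
  (∫ s in (0:ℝ)..t, μ s * ∫ z in Ioi (0:ℝ), Kc t s x z * f s z) - qk t x * ∫ s in Ioi (t/2), μ s * ∫ z in Ioi (0:ℝ), f s z

lemma Good.Qop_eq (G : Good A f) (M : Mu Cμ μ) {t : ℝ} (ht : 0 < t) (x : ℝ) :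
    Qop μ f t x = (∫ s in (0:ℝ)..t, μ s * ∫ z in Ioi (0:ℝ), Dk (t - s) x z * f s z) - qk t x * ∫ s in Ioi 0, μ s * ∫ z in Ioi (0:ℝ), f s z := by
  unfold Qop
  have e1 : (∫ s in (0:ℝ)..t, μ s * ∫ z in Ioi (0:ℝ), Kc t s x z * f s z) = 
      ∫ s in (0:ℝ)..t, (μ s * (∫ z in Ioi (0:ℝ), Dk (t - s) x z * f s z) - (Iic (t/2)).indicator (fun s => qk t x * (μ s * ∫ z in Ioi (0:ℝ), f s z)) s) := by
    refine intervalIntegral.integral_congr_ae ?_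
    filter_upwards [Measure.ae_ne volume t] with s hne hs
    rw [uIoc_of_le ht.le] at hs
    have hst : s < t := lt_of_le_of_ne hs.2 hne
    have h2 : ∫ z in Ioi (0:ℝ), Kc t s x z * f s z = (∫ z in Ioi (0:ℝ), Dk (t - s) x z * f s z) - (if s ≤ t / 2 then qk t x else 0) * ∫ z in Ioi (0:ℝ), f s z := by
      rw [← integral_const_mul, ← integral_sub (G.int_Din hs.1 (by linarith) x) ((G.int_in hs.1).const_mul _)]
      unfold Kc
      exact integral_congr_ae (Eventually.of_forall fun z => sub_mul _ _ _)
    rw [h2]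
    by_cases h : s ≤ t / 2
    · rw [Set.indicator_of_mem (by exact h), if_pos h]; ring
    · rw [Set.indicator_of_notMem (by exact h), if_neg h]; ring
  have iD := G.int_D M ht x
  have iF := G.int_f M
  have iF' : IntegrableOn (fun s => qk t x * (μ s * ∫ z in Ioi (0:ℝ), f s z)) (Ioc 0 t) := (iF.mono_set Ioc_subset_Ioi_self).const_mul _
  rw [e1, intervalIntegral.integral_sub ((intervalIntegrable_iff_integrableOn_Ioc_of_le ht.le).2 iD)
    ((intervalIntegrable_iff_integrableOn_Ioc_of_le ht.le).2 (iF'.indicator measurableSet_Iic))]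
  have e2 : (∫ s in (0:ℝ)..t, (Iic (t/2)).indicator (fun s => qk t x * (μ s * ∫ z in Ioi (0:ℝ), f s z)) s) = qk t x * ∫ s in Ioc 0 (t/2), μ s * ∫ z in Ioi (0:ℝ), f s z := by
    rw [intervalIntegral.integral_of_le ht.le, setIntegral_indicator measurableSet_Iic, ← integral_const_mul]
    congr 2
    ext s; simp only [mem_inter_iff, mem_Ioc, mem_Iic]; constructor
    · rintro ⟨⟨h1, h2⟩, h3⟩; exact ⟨h1, h3⟩
    · rintro ⟨h1, h3⟩; exact ⟨⟨h1, by linarith⟩, h3⟩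
  have e3 : (∫ s in Ioi 0, μ s * ∫ z in Ioi (0:ℝ), f s z) = (∫ s in Ioc 0 (t/2), μ s * ∫ z in Ioi (0:ℝ), f s z) + ∫ s in Ioi (t/2), μ s * ∫ z in Ioi (0:ℝ), f s z := by
    rw [← setIntegral_union (Ioc_disjoint_Ioi le_rfl) measurableSet_Ioi (iF.mono_set Ioc_subset_Ioi_self) (iF.mono_set (Ioi_subset_Ioi (by linarith))),
      Ioc_union_Ioi_eq_Ioi (by linarith)]
  rw [e2, e3]; ring

lemma Good.comb {B : ℝ} {g : ℝ → ℝ → ℝ} (G : Good A f) (H : Good B g) (c : ℝ) : Good (A + |c| * B) (fun s z => f s z - c * g s z) := by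
  have hA := G.hA; have hB := H.hA
  refine ⟨by positivity, G.m.sub (H.m.const_mul c), fun s hs => ?_, fun s hs z hz => ?_⟩
  · refine (mm_sub_le (meas_slice G.m s)).trans ?_
    rw [mm_const_mul, add_mul, mul_assoc]
    refine (add_le_add (G.f0 s hs) (mul_le_mul_right (H.f0 s hs) _)).trans (le_of_eq ?_)
    rw [← ENNReal.ofReal_mul (abs_nonneg _), ← ENNReal.ofReal_add (by positivity) (by positivity)]
  · refine (abs_sub _ _).trans ?_
    rw [abs_mul, add_mul, mul_assoc]
    gcongr
    · exact G.fs s hs z hz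
    · exact H.fs s hs z hz

lemma Good.Qop_comb {B : ℝ} {g : ℝ → ℝ → ℝ} (G : Good A f) (H : Good B g) (M : Mu Cμ μ) (c : ℝ) {t : ℝ} (ht : 0 < t) (x : ℝ) :
    Qop μ (fun s z => f s z - c * g s z) t x = Qop μ f t x - c * Qop μ g t x := by
  rw [(G.comb H c).Qop_eq M ht, G.Qop_eq M ht, H.Qop_eq M ht]
  have e1 : (∫ s in (0:ℝ)..t, μ s * ∫ z in Ioi (0:ℝ), Dk (t - s) x z * (f s z - c * g s z)) = 
      (∫ s in (0:ℝ)..t, μ s * ∫ z in Ioi (0:ℝ), Dk (t - s) x z * f s z) - c * ∫ s in (0:ℝ)..t, μ s * ∫ z in Ioi (0:ℝ), Dk (t - s) x z * g s z := by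
    rw [← intervalIntegral.integral_const_mul, ← intervalIntegral.integral_sub ((intervalIntegrable_iff_integrableOn_Ioc_of_le ht.le).2 (G.int_D M ht x))
      (((intervalIntegrable_iff_integrableOn_Ioc_of_le ht.le).2 (H.int_D M ht x)).const_mul _)]
    refine intervalIntegral.integral_congr_ae ?_
    filter_upwards [Measure.ae_ne volume t] with s hne hs
    rw [uIoc_of_le ht.le] at hs
    have hst : s < t := lt_of_le_of_ne hs.2 hne
    have : (∫ z in Ioi (0:ℝ), Dk (t - s) x z * (f s z - c * g s z)) = (∫ z in Ioi (0:ℝ), Dk (t - s) x z * f s z) - c * ∫ z in Ioi (0:ℝ), Dk (t - s) x z * g s z := by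
      rw [← integral_const_mul, ← integral_sub (G.int_Din hs.1 (by linarith) x) ((H.int_Din hs.1 (by linarith) x).const_mul _)]
      exact integral_congr_ae (Eventually.of_forall fun z => by ring)
    rw [this]; ring
  have e2 : (∫ s in Ioi 0, μ s * ∫ z in Ioi (0:ℝ), (f s z - c * g s z)) = 
      (∫ s in Ioi 0, μ s * ∫ z in Ioi (0:ℝ), f s z) - c * ∫ s in Ioi 0, μ s * ∫ z in Ioi (0:ℝ), g s z := by
    rw [← integral_const_mul, ← integral_sub (G.int_f M) ((H.int_f M).const_mul _)]
    refine setIntegral_congr_fun measurableSet_Ioi fun s hs => ?_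
    have : (∫ z in Ioi (0:ℝ), (f s z - c * g s z)) = (∫ z in Ioi (0:ℝ), f s z) - c * ∫ z in Ioi (0:ℝ), g s z := by
      rw [← integral_const_mul, ← integral_sub (G.int_in hs) ((H.int_in hs).const_mul _)]
    simp only [this]; ring
  rw [e1, e2]; ring

lemma Good.Qop_mu {C' : ℝ} {μ' : ℝ → ℝ} (G : Good A f) (M : Mu Cμ μ) (M' : Mu C' μ') (M2 : Mu (Cμ + C') (fun s => μ s - μ' s)) {t : ℝ} (ht : 0 < t) (x : ℝ) :
    Qop μ f t x = Qop μ' f t x + Qop (fun s => μ s - μ' s) f t x := by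
  rw [G.Qop_eq M ht, G.Qop_eq M' ht, G.Qop_eq M2 ht]
  have e1 : (∫ s in (0:ℝ)..t, (μ s - μ' s) * ∫ z in Ioi (0:ℝ), Dk (t - s) x z * f s z) = 
      (∫ s in (0:ℝ)..t, μ s * ∫ z in Ioi (0:ℝ), Dk (t - s) x z * f s z) - ∫ s in (0:ℝ)..t, μ' s * ∫ z in Ioi (0:ℝ), Dk (t - s) x z * f s z := by
    rw [← intervalIntegral.integral_sub ((intervalIntegrable_iff_integrableOn_Ioc_of_le ht.le).2 (G.int_D M ht x))
      (((intervalIntegrable_iff_integrableOn_Ioc_of_le ht.le).2 (G.int_D M' ht x)))]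
    exact intervalIntegral.integral_congr fun s _ => sub_mul _ _ _
  have e2 : (∫ s in Ioi 0, (μ s - μ' s) * ∫ z in Ioi (0:ℝ), f s z) = 
      (∫ s in Ioi 0, μ s * ∫ z in Ioi (0:ℝ), f s z) - ∫ s in Ioi 0, μ' s * ∫ z in Ioi (0:ℝ), f s z := by
    rw [← integral_sub (G.int_f M) (G.int_f M')]
    exact integral_congr_ae (Eventually.of_forall fun s => sub_mul _ _ _)
  rw [e1, e2]; ring

lemma meas_Kc (t : ℝ) : Measurable fun a : (ℝ × ℝ) × ℝ => Kc t a.1.1 a.1.2 a.2 := by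
  unfold Kc
  refine (meas_Dk t).sub (Measurable.ite (measurableSet_le (f := fun a : (ℝ × ℝ) × ℝ => a.1.1) (g := fun _ => t / 2) (by fun_prop) (by fun_prop)) (by fun_prop) measurable_const)

lemma Kc_lo {t s x z : ℝ} (h : s ≤ t / 2) : Kc t s x z = K3 (t - s) x z + (qk (t - s) x - qk t x) := by
  unfold Kc K3; rw [if_pos h]; ring

lemma Kc_hi {t s x z : ℝ} (h : t / 2 < s) : Kc t s x z = Dk (t - s) x z := by
  unfold Kc; rw [if_neg (by linarith)]; ring

lemma inner_hi {t s : ℝ} (h : t / 2 < s) : (fun x => ∫ z in Ioi (0:ℝ), Kc t s x z * f s z) = fun x => ∫ z in Ioi (0:ℝ), Dk (t - s) x z * f s z := by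
  funext x; simp only [Kc_hi h]

lemma Qop_sup (hμ : Measurable μ) {t : ℝ} (ht : 0 < t) (x : ℝ) : ENNReal.ofReal |Qop μ f t x| ≤
    ((∫⁻ s in Ioc 0 (t/2), ENNReal.ofReal |μ s| * ENNReal.ofReal |∫ z in Ioi (0:ℝ), Kc t s x z * f s z|) +
    ∫⁻ s in Ioc (t/2) t, ENNReal.ofReal |μ s| * ENNReal.ofReal |∫ z in Ioi (0:ℝ), Dk (t - s) x z * f s z|) +
    ENNReal.ofReal |qk t x| * ∫⁻ s in Ioi (t/2), ENNReal.ofReal |μ s| * mm 0 (f s) := by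
  unfold Qop
  refine (ENNReal.ofReal_le_ofReal (abs_sub _ _)).trans ?_
  rw [ENNReal.ofReal_add (abs_nonneg _) (abs_nonneg _), abs_mul, ENNReal.ofReal_mul (abs_nonneg _)]
  gcongr
  · refine (time_sup (F := fun s => ∫ z in Ioi (0:ℝ), Kc t s x z * f s z) ht.le).trans ?_
    rw [split_half ht]
    refine add_le_add_right (setLIntegral_mono' measurableSet_Ioc fun s hs => ?_) _
    rw [show (∫ z in Ioi (0:ℝ), Kc t s x z * f s z) = ∫ z in Ioi (0:ℝ), Dk (t - s) x z * f s z from congrFun (inner_hi hs.1) x]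
  · refine (lint_sup (μ := μ) (F := fun s => ∫ z in Ioi (0:ℝ), f s z)).trans (lintegral_mono fun s => ?_)
    gcongr; exact mm0_abs

lemma Qop_mm (hμ : Measurable μ) (hf : Measurable (fun a : ℝ × ℝ => f a.1 a.2)) {t : ℝ} (ht : 0 < t) (q : ℝ) : mm q (Qop μ f t) ≤
    ((∫⁻ s in Ioc 0 (t/2), ENNReal.ofReal |μ s| * mm q (fun x => ∫ z in Ioi (0:ℝ), Kc t s x z * f s z)) +
    ∫⁻ s in Ioc (t/2) t, ENNReal.ofReal |μ s| * mm q (fun x => ∫ z in Ioi (0:ℝ), Dk (t - s) x z * f s z)) +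
    mm q (qk t) * ∫⁻ s in Ioi (t/2), ENNReal.ofReal |μ s| * mm 0 (f s) := by
  have hF := meas_inner (K := fun s x z => Kc t s x z) (meas_Kc t) hf
  have e : Qop μ f t = fun x => (∫ s in (0:ℝ)..t, μ s * ∫ z in Ioi (0:ℝ), Kc t s x z * f s z) - (∫ s in Ioi (t/2), μ s * ∫ z in Ioi (0:ℝ), f s z) * qk t x := by
    funext x; unfold Qop; ring
  rw [e]
  refine (mm_sub_le ?_).trans ?_
  · simp only [intervalIntegral.integral_of_le ht.le]
    refine (StronglyMeasurable.integral_prod_right (f := fun (x : ℝ) s => μ s * ∫ z in Ioi (0:ℝ), Kc t s x z * f s z) (Measurable.stronglyMeasurable ?_)).measurable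
    simp only [Function.uncurry_def]
    have h2 := hF.comp (measurable_swap (α := ℝ) (β := ℝ))
    simp only [Function.comp_def, Prod.fst_swap, Prod.snd_swap] at h2
    exact (hμ.comp measurable_snd).mul h2
  rw [mm_const_mul, mul_comm (mm q (qk t))]
  gcongr
  · refine (time_mm (F := fun s x => ∫ z in Ioi (0:ℝ), Kc t s x z * f s z) ht.le hμ hF).trans ?_
    rw [split_half ht]
    refine add_le_add_right (setLIntegral_mono' measurableSet_Ioc fun s hs => ?_) _
    rw [inner_hi hs.1]
  · refine (lint_sup (μ := μ) (F := fun s => ∫ z in Ioi (0:ℝ), f s z)).trans (lintegral_mono fun s => ?_)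
    gcongr; exact mm0_abs
end

lemma half_rpow3 {t s r : ℝ} (ht : 0 < t) (hs : s ≤ t / 2) (hr : r ≤ 0) (hr2 : -3 ≤ r) : (t - s) ^ r ≤ 8 * t ^ r := by
  refine (half_rpow ht (by linarith) hr).trans ?_
  gcongr
  calc (2:ℝ) ^ (-r) ≤ 2 ^ (3:ℝ) := Real.rpow_le_rpow_of_exponent_le (by norm_num) (by linarith)
    _ = 8 := by norm_num

lemma qk_sup {τ : ℝ} (hτ : 0 < τ) (x : ℝ) : |qk τ x| ≤ 20 * τ ^ (-1:ℝ) := by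
  refine (qk_b hτ x).trans ?_
  have := ge_le_one hτ x
  have h : 0 ≤ 20 * τ ^ (-1:ℝ) := by positivity
  nlinarith

lemma good_qk : Good (20 * cE 0 + 20) qk := by
  have c := cE_pos (le_refl (0:ℝ))
  refine ⟨by positivity, by fun_prop, fun s hs => (qk_Lp le_rfl hs).trans (ENNReal.ofReal_le_ofReal ?_), fun s hs z hz => (qk_sup hs z).trans ?_⟩
  · rw [show ((0:ℝ)-1)/2 = -1/2 by norm_num]; gcongr; linarith
  · gcongr; linarith

lemma Kc_sup_lo {f : ℝ → ℝ} (hf : Measurable f) {p t s : ℝ} (hp0 : 0 ≤ p) (hp : p ≤ 2) (ht : 0 < t) (hs : 0 < s) (hst : s ≤ t / 2) (x : ℝ) :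
    ENNReal.ofReal |∫ z in Ioi (0:ℝ), Kc t s x z * f z| ≤ ENNReal.ofReal (480 * t ^ (-1-p/2)) * mm p f + ENNReal.ofReal (80 * s * t ^ (-2:ℝ)) * mm 0 f := by
  refine ker_sup hf (by positivity) (by positivity) fun z hz => ?_
  rw [Kc_lo hst, Real.rpow_zero]
  have h4 : 0 < t - s := by linarith
  refine (abs_add_le _ _).trans ?_
  gcongr
  · refine (K3_sup hp0 hp h4 hz.le).trans ?_
    have := half_rpow2 ht hst (r := -1-p/2) (by linarith) (by linarith)
    calc _ ≤ 120 * ((4 * t ^ (-1-p/2)) * z ^ p) := by gcongr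
      _ = _ := by ring
  · refine (qk_diff_b x ht hs.le hst).trans ?_
    have := ge_le_one ht x
    have h : 0 ≤ 80 * s * t ^ (-2:ℝ) := by positivity
    nlinarith

lemma Kc_x_lo {f : ℝ → ℝ} (hf : Measurable f) {p t s x : ℝ} (hp0 : 0 ≤ p) (hp : p ≤ 2) (ht : 0 < t) (hs : 0 < s) (hst : s ≤ t / 2) (hx : 0 < x) :
    ENNReal.ofReal |∫ z in Ioi (0:ℝ), Kc t s x z * f z| ≤ ENNReal.ofReal (320 * x * t ^ (-3/2-p/2)) * mm p f + ENNReal.ofReal (160 * s * x * t ^ (-5/2:ℝ)) * mm 0 f := by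
  refine ker_sup hf (by positivity) (by positivity) fun z hz => ?_
  rw [Kc_lo hst, Real.rpow_zero, mul_one]
  have h4 : 0 < t - s := by linarith
  refine (abs_add_le _ _).trans ?_
  gcongr
  · refine (K3_xp hp0 hp h4 hx.le hz.le).trans ?_
    have := half_rpow3 ht hst (r := -3/2-p/2) (by linarith) (by linarith)
    calc _ ≤ 40 * x * ((8 * t ^ (-3/2-p/2)) * z ^ p) := by gcongr
      _ = _ := by ring
  · exact qk_diff_x hx.le ht hs.le hst

lemma Kc_mm_lo {f : ℝ → ℝ} (hf : Measurable f) {p t s : ℝ} (hp0 : 0 ≤ p) (hp : p ≤ 2) (ht : 0 < t) (hs : 0 < s) (hst : s ≤ t / 2) :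
    mm p (fun x => ∫ z in Ioi (0:ℝ), Kc t s x z * f z) ≤ ENNReal.ofReal (640 * cE p * t ^ (-1/2:ℝ)) * mm p f + ENNReal.ofReal (80 * cE p * (s * t ^ ((p-3)/2))) * mm 0 f := by
  have c := cE_pos hp0
  have hm : Measurable (fun a : ℝ × ℝ => K3 (t-s) a.1 a.2) := by unfold K3; fun_prop
  simp only [Kc_lo hst]
  refine ker_mm ?_ hf (by positivity) (by positivity) fun z hz => ?_
  · exact hm.add (by fun_prop)
  have h4 : 0 < t - s := by linarith
  refine (mm_add_le (hm.comp (measurable_id.prodMk measurable_const))).trans ?_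
  rw [Real.rpow_zero, mul_one]
  refine ofR_add_le (by positivity) (by positivity) ((K3_Lp hp0 hp h4 hz.le).trans (ENNReal.ofReal_le_ofReal ?_)) (qkdiff_Lp hp0 ht hs.le hst)
  have := half_rpow2 ht hst (r := -1/2) (by norm_num) (by norm_num)
  calc _ ≤ 160 * cE p * (z ^ p * (4 * t ^ (-1/2:ℝ))) := by gcongr
    _ = _ := by ring

noncomputable def Minf (w0 μ : ℝ → ℝ) (w : ℝ → ℝ → ℝ) : ℝ := (∫ z in Ioi (0:ℝ), z * w0 z) + ∫ s in Ioi (0:ℝ), μ s * ∫ z in Ioi (0:ℝ), w s z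

noncomputable def ee (w0 μ : ℝ → ℝ) (w : ℝ → ℝ → ℝ) (s z : ℝ) : ℝ := w s z - Minf w0 μ w * qk s z

lemma mm_int {f K : ℝ → ℝ} {k q b : ℝ} (hf : Measurable f) (hKm : Measurable K) (hk : 0 ≤ k) (hK : ∀ z > 0, |K z| ≤ k * z ^ q) (h : mm q f ≤ ENNReal.ofReal b) : IntegrableOn (fun z => K z * f z) (Ioi 0) := by
  refine ⟨(hKm.mul hf).aestronglyMeasurable, ?_⟩
  have h2 : ENNReal.ofReal k * mm q f < ⊤ := ENNReal.mul_lt_top ENNReal.ofReal_lt_top (h.trans_lt ENNReal.ofReal_lt_top)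
  refine lt_of_le_of_lt ?_ h2
  unfold mm
  rw [← lintegral_const_mul' _ _ ENNReal.ofReal_ne_top]
  refine setLIntegral_mono' measurableSet_Ioi fun z hz => ?_
  rw [Real.enorm_eq_ofReal_abs, abs_mul, ← ENNReal.ofReal_mul hk, ← mul_assoc]
  apply ENNReal.ofReal_le_ofReal
  gcongr; exact hK z hz

section
variable {κ Cμ W : ℝ} {w0 μ : ℝ → ℝ} {w : ℝ → ℝ → ℝ}

lemma Sys.mu (S : Sys κ Cμ W w0 μ w) : Mu Cμ μ := ⟨S.hC, S.μm, S.μb⟩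

lemma Sys.good (S : Sys κ Cμ W w0 μ w) : ∃ A, Good A w := by
  obtain ⟨A, hA, h1⟩ := S.C1
  obtain ⟨B, hB, h2⟩ := S.C2
  refine ⟨A + B, by positivity, S.wm, fun s hs => (h1 s hs).trans (ENNReal.ofReal_le_ofReal ?_), fun s hs z hz => ?_⟩
  · gcongr; linarith
  · rw [abs_of_nonneg (S.wn s z)]; refine (h2 s hs z hz).trans ?_; gcongr; linarith

lemma Sys.e_eq (S : Sys κ Cμ W w0 μ w) {t x : ℝ} (ht : 0 < t) (hx : 0 < x) :
    ee w0 μ w t x = (∫ z in Ioi (0:ℝ), K1 t x z * w0 z) + Qop μ w t x := by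
  obtain ⟨A, G⟩ := S.good
  have hκ := S.κ0; have hκ1 := S.κ1
  rw [G.Qop_eq S.mu ht]
  unfold ee Minf
  have h1 : ∫ z in Ioi (0:ℝ), pk t x z * w0 z = (∫ z in Ioi (0:ℝ), K1 t x z * w0 z) + qk t x * ∫ z in Ioi (0:ℝ), z * w0 z := by
    rw [← integral_const_mul, ← integral_add]
    · refine integral_congr_ae (Eventually.of_forall fun z => ?_)
      simp only [K1]; ring
    · exact mm_int (k := 40 * t ^ (-1/2-(1+2*κ)/2)) (q := 1 + 2 * κ) S.w0m (by unfold K1; fun_prop) (by positivity) (fun z hz => (K1_sup (p := 1 + 2 * κ) (by linarith) (by linarith) ht hz.le).trans (le_of_eq (by ring))) S.w0p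
    · refine Integrable.const_mul ?_ _
      exact mm_int (k := 1) (q := 1) S.w0m measurable_id (by positivity) (fun z hz => by simp [abs_of_pos hz]) S.w01
  rw [S.duh t ht x hx, h1]; ring

lemma Sys.e_good (S : Sys κ Cμ W w0 μ w) : ∃ A, Good A (ee w0 μ w) := by
  obtain ⟨A, G⟩ := S.good
  exact ⟨_, G.comb good_qk (Minf w0 μ w)⟩

lemma Sys.e_sup (S : Sys κ Cμ W w0 μ w) : ∃ C ≥ 0, ∀ t ≥ 1, ∀ x > 0, |ee w0 μ w t x| ≤ C * t ^ (-1-κ) := by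
  obtain ⟨A, G⟩ := S.good
  obtain ⟨C, hC, h3⟩ := S.C3
  have hκ := S.κ0; have hκ1 := S.κ1; have hW := S.hW; have hCμ := S.hC; have hA := G.hA
  have key : Bd (fun (x : Ioi (0:ℝ)) t => ENNReal.ofReal |ee w0 μ w t x|) (-1-κ) := by
    refine Bd.le (Y := fun (x : Ioi (0:ℝ)) t => ENNReal.ofReal |∫ z in Ioi (0:ℝ), K1 t x z * w0 z| + (((∫⁻ s in Ioc 0 (t/2), ENNReal.ofReal |μ s| * ENNReal.ofReal |∫ z in Ioi (0:ℝ), Kc t s x z * w s z|) +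
      ∫⁻ s in Ioc (t/2) t, ENNReal.ofReal |μ s| * ENNReal.ofReal |∫ z in Ioi (0:ℝ), Dk (t - s) x z * w s z|) +
      ENNReal.ofReal |qk t x| * ∫⁻ s in Ioi (t/2), ENNReal.ofReal |μ s| * mm 0 (w s)))
      (Bd.add ?_ (Bd.add (Bd.add ?_ ?_) ?_)) (fun x t ht => ?_)
    · refine Bd.of (C := 40 * W) (by positivity) fun x t ht => ?_
      have ht0 : 0 < t := by linarith
      refine (ker_sup (k1 := 40 * t ^ (-1-κ)) (q1 := 1+2*κ) (k2 := 0) (q2 := 0) S.w0m (by positivity) le_rfl fun z hz => ?_).trans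
        ((ofR2 (by positivity) le_rfl hW hW S.w0p S.w00).trans (ENNReal.ofReal_le_ofReal (le_of_eq (by ring))))
      refine (K1_sup (p := 1+2*κ) (by linarith) (by linarith) ht0 hz.le).trans (le_of_eq ?_)
      rw [show -1/2-(1+2*κ)/2 = -1-κ by ring]; ring
    · refine Bd.split (Y := fun _ t s => ENNReal.ofReal (480 * C * t ^ (-3/2-κ) * s ^ (0:ℝ))) (Z := fun _ t s => ENNReal.ofReal (480 * C * t ^ (-3/2-κ) * s ^ κ) + ENNReal.ofReal (80 * A * t ^ (-2:ℝ) * s ^ (1/2:ℝ))) (fun t => measurableSet_Ioc) S.μm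
          (fun i t => by fun_prop) (fun x t ht s hs => ?_) ?_ (Bd.split (fun t => measurableSet_Ioc) S.μm (fun i t => by fun_prop) (fun _ t ht s hs => le_rfl) ?_ ?_)
      · have hs0 := hs.1
        have ht0 : 0 < t := by linarith
        refine (Kc_sup_lo (meas_slice S.wm s) (p := 1+2*κ) (by linarith) (by linarith) ht0 hs.1 hs.2 x).trans ?_
        refine (ofR2 (by positivity) (by positivity) (by positivity) (by positivity) (h3 s hs0) (G.f0 s hs0)).trans ?_
        rw [← ENNReal.ofReal_add (by positivity) (by positivity), ← ENNReal.ofReal_add (by positivity) (by positivity)]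
        apply ENNReal.ofReal_le_ofReal
        rw [show -1-(1+2*κ)/2 = -3/2-κ by ring, Real.rpow_zero]
        have e : s * s ^ (-1/2:ℝ) = s ^ (1/2:ℝ) := by nth_rewrite 1 [← Real.rpow_one s]; exact rpa hs0 (by norm_num)
        rw [← e]; apply le_of_eq; ring
      · exact Bd.lo (q := 0) (ε := 1/2) hCμ S.μb (by positivity) (by norm_num) (by norm_num) (by norm_num) (by linarith) fun _ t ht s hs hs2 => le_rfl
      · exact Bd.lo (q := κ) (ε := 0) hCμ S.μb (by positivity) (by norm_num) (by norm_num) (by linarith) (by linarith) fun _ t ht s hs hs2 => le_rfl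
      · exact Bd.lo (q := 1/2) (ε := 0) hCμ S.μb (by positivity) (by norm_num) (by norm_num) (by linarith) (by linarith) fun _ t ht s hs hs2 => le_rfl
    · refine Bd.hi (B := 640 * A) (r := -1) (q := -1/2) hCμ S.μb (by positivity) (by norm_num) (by linarith) fun x t ht s hs hs2 => ?_
      apply ENNReal.ofReal_le_ofReal
      have h4 : 0 < t - s := by linarith
      have hs0 : 0 < s := by linarith
      refine (Dk_hi h4 (by positivity) (G.fs s hs0) (int_abs_Dk' h4 x)).trans ?_
      have := hi_s (by linarith) hs (r := -1) (by norm_num) (by norm_num)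
      calc _ ≤ 160 * (t - s) ^ (-1/2:ℝ) * (A * (4 * t ^ (-1:ℝ))) := by gcongr
        _ = _ := by ring
    · refine Bd.mono (q := -1 + (-1/2)) (Bd.mul (q := -1) (q' := -1/2) (Bd.of (C := 20) (by norm_num) fun x t ht => ?_) ?_ rfl) (by linarith)
      · exact ENNReal.ofReal_le_ofReal (qk_sup (by linarith) _)
      · refine Bd.tail (B := A) (r := 0) (q := 1/2) hCμ S.μb hA (by norm_num) (by norm_num) (by norm_num) fun x t ht s hs => ?_
        refine (G.f0 s (by linarith)).trans (le_of_eq ?_)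
        rw [Real.rpow_zero, mul_one, show -(1/2:ℝ) = -1/2 by norm_num]
    · rw [S.e_eq (by linarith) x.2]
      refine (ENNReal.ofReal_le_ofReal (abs_add_le _ _)).trans ?_
      rw [ENNReal.ofReal_add (abs_nonneg _) (abs_nonneg _)]
      gcongr
      exact Qop_sup S.μm (by linarith) x
  obtain ⟨C', hC', h⟩ := key
  refine ⟨C', hC', fun t ht x hx => ?_⟩
  have := h ⟨x, hx⟩ t ht
  rwa [ENNReal.ofReal_le_ofReal_iff (by positivity)] at this

lemma meas_K1w (hw : Measurable w0) (t : ℝ) : Measurable fun x => ∫ z in Ioi (0:ℝ), K1 t x z * w0 z :=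
  (StronglyMeasurable.integral_prod_right (f := fun (x : ℝ) z => K1 t x z * w0 z)
    (Measurable.stronglyMeasurable (by simp only [Function.uncurry_def]; unfold K1; fun_prop))).measurable

lemma Sys.e_mm (S : Sys κ Cμ W w0 μ w) : ∃ C ≥ 0, ∀ t > 0, mm (1+2*κ) (ee w0 μ w t) ≤ ENNReal.ofReal C := by
  obtain ⟨A, G⟩ := S.good
  obtain ⟨C, hC, h3⟩ := S.C3
  have hκ := S.κ0; have hκ1 := S.κ1; have hW := S.hW; have hCμ := S.hC; have hA := G.hA
  have hp : 0 ≤ 1 + 2 * κ := by linarith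
  have c := cE_pos hp
  have key : Bd (fun (_ : Unit) t => mm (1+2*κ) (ee w0 μ w t)) 0 := by
    refine Bd.le (Y := fun _ t => mm (1+2*κ) (fun x => ∫ z in Ioi (0:ℝ), K1 t x z * w0 z) + (((∫⁻ s in Ioc 0 (t/2), ENNReal.ofReal |μ s| * mm (1+2*κ) (fun x => ∫ z in Ioi (0:ℝ), Kc t s x z * w s z)) +
      ∫⁻ s in Ioc (t/2) t, ENNReal.ofReal |μ s| * mm (1+2*κ) (fun x => ∫ z in Ioi (0:ℝ), Dk (t - s) x z * w s z)) +
      mm (1+2*κ) (qk t) * ∫⁻ s in Ioi (t/2), ENNReal.ofReal |μ s| * mm 0 (w s)))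
      (Bd.add ?_ (Bd.add (Bd.add ?_ ?_) ?_)) (fun x t ht => ?_)
    · refine Bd.of (C := 40 * cE (1+2*κ) * W) (by positivity) fun x t ht => ?_
      have ht0 : 0 < t := by linarith
      refine (ker_mm (k1 := 40 * cE (1+2*κ)) (q1 := 1+2*κ) (k2 := 0) (q2 := 0) (by unfold K1; fun_prop) S.w0m (by positivity) le_rfl fun z hz => ?_).trans
        ((ofR2 (by positivity) le_rfl hW hW S.w0p S.w00).trans (ENNReal.ofReal_le_ofReal (le_of_eq (by rw [Real.rpow_zero]; ring))))
      refine (K1_Lp (p := 1+2*κ) (by linarith) (by linarith) ht0 hz.le).trans (ENNReal.ofReal_le_ofReal (le_of_eq ?_))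
      ring
    · refine Bd.split (Y := fun _ t s => ENNReal.ofReal (640 * cE (1+2*κ) * C * t ^ (-1/2:ℝ) * s ^ (0:ℝ))) (Z := fun _ t s => ENNReal.ofReal (640 * cE (1+2*κ) * C * t ^ (-1/2:ℝ) * s ^ κ) + ENNReal.ofReal (80 * cE (1+2*κ) * A * t ^ (κ-1) * s ^ (1/2:ℝ))) (fun t => measurableSet_Ioc) S.μm
          (fun i t => by fun_prop) (fun x t ht s hs => ?_) ?_ (Bd.split (fun t => measurableSet_Ioc) S.μm (fun i t => by fun_prop) (fun _ t ht s hs => le_rfl) ?_ ?_)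
      · have hs0 := hs.1
        have ht0 : 0 < t := by linarith
        refine (Kc_mm_lo (meas_slice S.wm s) hp (by linarith) ht0 hs.1 hs.2).trans ?_
        refine (ofR2 (by positivity) (by positivity) (by positivity) (by positivity) (h3 s hs0) (G.f0 s hs0)).trans ?_
        rw [← ENNReal.ofReal_add (by positivity) (by positivity), ← ENNReal.ofReal_add (by positivity) (by positivity)]
        apply ENNReal.ofReal_le_ofReal
        rw [show (1+2*κ-3)/2 = κ - 1 by ring, Real.rpow_zero]
        have e : s * s ^ (-1/2:ℝ) = s ^ (1/2:ℝ) := by nth_rewrite 1 [← Real.rpow_one s]; exact rpa hs0 (by norm_num)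
        rw [← e]; apply le_of_eq; ring
      · exact Bd.lo (q := 0) (ε := 1/2) hCμ S.μb (by positivity) (by norm_num) (by norm_num) (by norm_num) (by linarith) fun _ t ht s hs hs2 => le_rfl
      · exact Bd.lo (q := κ) (ε := 0) hCμ S.μb (by positivity) (by norm_num) (by norm_num) (by linarith) (by linarith) fun _ t ht s hs hs2 => le_rfl
      · exact Bd.lo (q := 1/2) (ε := 0) hCμ S.μb (by positivity) (by norm_num) (by norm_num) (by linarith) (by linarith) fun _ t ht s hs hs2 => le_rfl
    · refine Bd.split_hi (Y := fun _ t s => ENNReal.ofReal (10 * cE (1+2*κ) * (t-s) ^ κ * (A * s ^ (-1/2:ℝ)))) (Z := fun _ t s => ENNReal.ofReal (10 * cE (1+2*κ) * (t-s) ^ (-1/2:ℝ) * (C * (1 + s ^ κ)))) S.μm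
        (fun i t => by fun_prop) (fun _ t ht s hs hs2 => ?_) ?_ ?_
      · have h4 : 0 < t - s := by linarith
        have hs0 : 0 < s := by linarith
        refine (Dk_mm (meas_slice S.wm s) hp h4).trans ?_
        rw [show (1 + 2 * κ - 1)/2 = κ by ring, ENNReal.ofReal_mul (q := A * s ^ (-1/2:ℝ)) (by positivity), ENNReal.ofReal_mul (q := C * (1 + s ^ κ)) (by positivity)]
        gcongr
        · exact G.f0 s hs0
        · exact h3 s hs0
      · refine Bd.hi (B := 40 * cE (1+2*κ) * A) (r := -1/2) (q := κ) hCμ S.μb (by positivity) (by linarith) (by linarith) fun _ t ht s hs hs2 => ?_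
        apply ENNReal.ofReal_le_ofReal
        have := hi_s (by linarith) hs (r := -1/2) (by norm_num) (by norm_num)
        have : 0 < t - s := by linarith
        calc _ ≤ 10 * cE (1+2*κ) * (t - s) ^ κ * (A * (4 * t ^ (-1/2:ℝ))) := by gcongr
          _ = _ := by ring
      · refine Bd.hi (B := 20 * cE (1+2*κ) * C) (r := κ) (q := -1/2) hCμ S.μb (by positivity) (by linarith) (by linarith) fun _ t ht s hs hs2 => ?_
        apply ENNReal.ofReal_le_ofReal
        have h1 : s ^ κ ≤ t ^ κ := Real.rpow_le_rpow (by linarith) (by linarith) (by linarith)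
        have h2 : 1 ≤ t ^ κ := Real.one_le_rpow ht (by linarith)
        have : 0 < t - s := by linarith
        calc _ ≤ 10 * cE (1+2*κ) * (t - s) ^ (-1/2:ℝ) * (C * (t ^ κ + t ^ κ)) := by gcongr
          _ = _ := by ring
    · refine Bd.mono (q := κ + (-1/2)) (Bd.mul (q := κ) (q' := -1/2) (Bd.of (C := 20 * cE (1+2*κ)) (by positivity) fun x t ht => ?_) ?_ rfl) (by linarith)
      · refine (qk_Lp hp (by linarith)).trans (le_of_eq ?_)
        rw [show (1+2*κ-1)/2 = κ by ring]
      · refine Bd.tail (B := A) (r := 0) (q := 1/2) hCμ S.μb hA (by norm_num) (by norm_num) (by norm_num) fun x t ht s hs => ?_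
        refine (G.f0 s (by linarith)).trans (le_of_eq ?_)
        rw [Real.rpow_zero, mul_one, show -(1/2:ℝ) = -1/2 by norm_num]
    · have ht0 : 0 < t := by linarith
      rw [mm_congr (fun x hx => S.e_eq ht0 hx)]
      refine (mm_add_le (meas_K1w S.w0m t)).trans ?_
      gcongr
      exact Qop_mm S.μm S.wm ht0 _
  obtain ⟨C', hC', h⟩ := key
  refine ⟨C' + 2 * C + |Minf w0 μ w| * (20 * cE (1+2*κ)), by positivity, fun t ht => ?_⟩
  rcases le_total t 1 with h1 | h1
  · unfold ee
    refine (mm_sub_le (meas_slice S.wm t)).trans ?_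
    rw [mm_const_mul]
    have h5 : t ^ κ ≤ 1 := Real.rpow_le_one ht.le h1 hκ.le
    have h6 : ENNReal.ofReal |Minf w0 μ w| * mm (1+2*κ) (qk t) ≤ ENNReal.ofReal (|Minf w0 μ w| * (20 * cE (1+2*κ))) := by
      rw [ENNReal.ofReal_mul (abs_nonneg _)]
      gcongr
      refine (qk_Lp hp ht).trans (ENNReal.ofReal_le_ofReal ?_)
      rw [show (1+2*κ-1)/2 = κ by ring]
      nlinarith
    refine (ofR_add_le (by positivity) (by positivity) (h3 t ht) h6).trans (ENNReal.ofReal_le_ofReal ?_)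
    nlinarith
  · refine (h () t h1).trans (ENNReal.ofReal_le_ofReal ?_)
    rw [Real.rpow_zero, mul_one]
    have : 0 ≤ 2 * C + |Minf w0 μ w| * (20 * cE (1+2*κ)) := by positivity
    linarith

lemma interp {f : ℝ → ℝ} {p b R : ℝ} (hf : Measurable f) (hp : 0 ≤ p) (hR : 0 < R) (hb : 0 ≤ b) (hs : ∀ z > 0, |f z| ≤ b) :
    mm 0 f ≤ ENNReal.ofReal (b * R) + ENNReal.ofReal (R ^ (-p)) * mm p f := by
  unfold mm
  rw [← lintegral_const_mul' _ _ ENNReal.ofReal_ne_top]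
  rw [← Ioc_union_Ioi_eq_Ioi hR.le, lintegral_union measurableSet_Ioi (Ioc_disjoint_Ioi le_rfl)]
  refine add_le_add ?_ ?_
  · calc _ ≤ ∫⁻ z in Ioc 0 R, ENNReal.ofReal b := by
          refine setLIntegral_mono' measurableSet_Ioc fun z hz => ENNReal.ofReal_le_ofReal ?_
          rw [Real.rpow_zero, one_mul]; exact hs z hz.1
      _ = _ := by rw [setLIntegral_const, Real.volume_Ioc, sub_zero, ENNReal.ofReal_mul hb]
  · refine le_trans ?_ (lintegral_mono_set (show Ioi R ⊆ Ioc 0 R ∪ Ioi R from subset_union_right))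
    refine setLIntegral_mono' measurableSet_Ioi fun z hz => ?_
    have hz : R < z := hz
    have hz0 : 0 < z := hR.trans hz
    rw [← ENNReal.ofReal_mul (by positivity), Real.rpow_zero, one_mul, ← mul_assoc]
    apply ENNReal.ofReal_le_ofReal
    have : 1 ≤ R ^ (-p) * z ^ p := by
      rw [Real.rpow_neg hR.le, inv_mul_eq_div, one_le_div (by positivity)]
      exact Real.rpow_le_rpow hR.le hz.le hp
    nlinarith [abs_nonneg (f z)]

lemma Sys.e_m0 (S : Sys κ Cμ W w0 μ w) : ∃ C ≥ 0, ∀ t > 0, mm 0 (ee w0 μ w t) ≤ ENNReal.ofReal (C * t ^ (-1/2-κ)) := by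
  obtain ⟨A, G⟩ := S.e_good
  obtain ⟨C1, hC1, h1⟩ := S.e_sup
  obtain ⟨C2, hC2, h2⟩ := S.e_mm
  have hA := G.hA
  have hκ := S.κ0
  refine ⟨A + C1 + C2, by positivity, fun t ht => ?_⟩
  rcases le_total t 1 with h | h
  · refine (G.f0 t ht).trans (ENNReal.ofReal_le_ofReal ?_)
    have : t ^ (-1/2:ℝ) ≤ t ^ (-1/2-κ) := Real.rpow_le_rpow_of_exponent_ge ht h (by linarith)
    gcongr; linarith
  · refine (interp (p := 1+2*κ) (R := t ^ (1/2:ℝ)) (meas_slice G.m t) (by linarith) (by positivity) (by positivity) (h1 t h)).trans ?_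
    have e1 : t ^ (-1-κ) * t ^ (1/2:ℝ) = t ^ (-1/2-κ) := rpa ht (by ring)
    have e2 : (t ^ (1/2:ℝ)) ^ (-(1+2*κ)) = t ^ (-1/2-κ) := by rw [← Real.rpow_mul ht.le]; congr 1; ring
    rw [mul_assoc, e1, e2]
    refine (add_le_add le_rfl (mul_le_mul_right (h2 t ht) _)).trans ?_
    rw [← ENNReal.ofReal_mul (by positivity), ← ENNReal.ofReal_add (by positivity) (by positivity)]
    apply ENNReal.ofReal_le_ofReal
    have : 0 ≤ A * t ^ (-1/2-κ) := by positivity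
    nlinarith
end

lemma ker1 {K f : ℝ → ℝ} {k q : ℝ} (hf : Measurable f) (h1 : 0 ≤ k) (hK : ∀ z > 0, |K z| ≤ k * z ^ q) :
    ENNReal.ofReal |∫ z in Ioi (0:ℝ), K z * f z| ≤ ENNReal.ofReal k * mm q f := by
  simpa using ker_sup (k2 := 0) (q2 := 0) hf h1 le_rfl (fun z hz => by simpa using hK z hz)

lemma Dk_near {τ : ℝ} (hτ : 0 < τ) {x : ℝ} (z : ℝ) (hx : 0 ≤ x) (hxτ : x ^ 2 ≤ τ) :
    |Dk τ x z| ≤ 40 * x * τ ^ (-3/2 : ℝ) * ge τ z := by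
  rw [show Dk τ x z = gk1 τ (z - x) - gk1 τ (z + x) by
    unfold Dk; rw [← neg_sub z x, gk1_neg, add_comm x z]; ring]
  refine (diff1 (hasDerivAt_gk1 hτ) hx (M := 10 * τ ^ (-3/2 : ℝ) * (2 * ge τ z)) fun y hy => ?_).trans
    (le_of_eq (by ring))
  exact (gk2_bound hτ y).trans (by gcongr; exact exp16_shift hτ hxτ hx hy)

noncomputable def Rem (τ x z : ℝ) : ℝ := Dk τ x z + 2 * x * gk2 τ z

lemma Rem_gen {τ : ℝ} (hτ : 0 < τ) {x z M : ℝ} (hx : 0 ≤ x) (hM : ∀ y, |y - z| ≤ x → |gk4 τ y| ≤ M) :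
    |Rem τ x z| ≤ 2 * x ^ 3 * M := by
  have hM0 : 0 ≤ M := (abs_nonneg _).trans (hM z (by simpa using hx))
  have hd : ∀ u, HasDerivAt (fun u => Rem τ u z) (-(gk2 τ (z - u) + gk2 τ (z + u) - 2 * gk2 τ z)) u := by
    intro u
    have e : (fun u => Rem τ u z) = fun u => gk1 τ (z - u) - gk1 τ (z + u) + 2 * u * gk2 τ z := by
      ext u; unfold Rem Dk; rw [← neg_sub z u, gk1_neg, add_comm u z]; ring
    rw [e]
    have h1 := (hasDerivAt_gk1 hτ (z - u)).comp u ((hasDerivAt_id u).const_sub z)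
    have h2 := (hasDerivAt_gk1 hτ (z + u)).comp u ((hasDerivAt_id u).const_add z)
    have h3 := ((hasDerivAt_id u).const_mul 2).mul_const (gk2 τ z)
    exact ((h1.sub h2).add h3).congr_deriv (by ring)
  have := mvt_bound hx (fun y _ => hd y) (M := 2 * x ^ 2 * M) (fun y hy => by
    rw [abs_neg]
    refine (diff2 (hasDerivAt_gk2 hτ) (hasDerivAt_gk3 hτ) hy.1 (fun u hu => hM u (hu.trans hy.2))).trans ?_
    have := hy.1; have := hy.2
    gcongr)
  have h0 : Rem τ 0 z = 0 := by simp [Rem, Dk, gk1_neg]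
  rw [h0] at this; simp only [sub_zero] at this
  exact this.trans (le_of_eq (by ring))

lemma Rem_near {τ : ℝ} (hτ : 0 < τ) {x : ℝ} (z : ℝ) (hx : 0 ≤ x) (hxτ : x ^ 2 ≤ τ) :
    |Rem τ x z| ≤ 40 * x ^ 3 * τ ^ (-5/2 : ℝ) * ge τ z :=
  (Rem_gen hτ hx (M := 10 * τ ^ (-5/2 : ℝ) * (2 * ge τ z)) fun y hy => 
    (gk4_bound hτ y).trans (by gcongr; exact exp16_shift hτ hxτ hx hy)).trans (le_of_eq (by ring))

lemma Rem_sup {τ : ℝ} (hτ : 0 < τ) {x : ℝ} (z : ℝ) (hx : 0 ≤ x) :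
    |Rem τ x z| ≤ 20 * x ^ 3 * τ ^ (-5/2 : ℝ) :=
  (Rem_gen hτ hx (M := 10 * τ ^ (-5/2 : ℝ)) fun y hy => gks4 hτ y).trans (le_of_eq (by ring))

lemma Dk_far {p τ : ℝ} (hp : 0 ≤ p) (hτ : 0 < τ) {x : ℝ} (hx : 0 < x) (h : τ ≤ x ^ 2) :
    mm p (Dk τ x) ≤ ENNReal.ofReal (20 * cE p * x ^ p * τ ^ (-1/2:ℝ)) := by
  have c := cE_pos hp
  unfold mm
  refine (lint_le (p := p) (c := 10 * τ ^ (-1:ℝ)) (by positivity) (fun z _ => ?_) (ge_mom2 hp hτ hx.le)).trans ?_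
  · refine (Dk_b hτ x z).trans (le_of_eq ?_)
    rw [add_comm z x]; unfold ge; rw [show (x - z) ^ 2 = (z - x) ^ 2 by ring]
  apply ENNReal.ofReal_le_ofReal
  have e : τ ^ (p/2) ≤ x ^ p := by
    calc τ ^ (p/2) ≤ (x ^ 2) ^ (p/2) := by gcongr
      _ = x ^ p := by rw [← Real.rpow_natCast, ← Real.rpow_mul hx.le]; congr 1; push_cast; ring
  rw [← rpa hτ (show p/2 + 1/2 = (p+1)/2 by ring), ← rpa hτ (show (-1:ℝ) + 1/2 = -1/2 by norm_num)]
  calc _ ≤ 10 * τ ^ (-1:ℝ) * (cE p * (x ^ p * τ ^ (1/2:ℝ) + x ^ p * τ ^ (1/2:ℝ))) := by gcongr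
    _ = _ := by ring

lemma pw_far {τ x r r' : ℝ} (hτ : 0 < τ) (hx : 0 < x) (h : τ ≤ x ^ 2) (hr : r' ≤ r) : τ ^ r ≤ x ^ (2*(r-r')) * τ ^ r' := by
  rw [← rpa hτ (show (r - r') + r' = r by ring)]
  gcongr
  calc τ ^ (r-r') ≤ (x ^ 2) ^ (r-r') := by gcongr
    _ = _ := by rw [← Real.rpow_natCast, ← Real.rpow_mul hx.le]; norm_num

lemma pw_near {τ x r r' : ℝ} (hτ : 0 < τ) (hx : 0 < x) (h : x ^ 2 ≤ τ) (hr : r ≤ r') : τ ^ r ≤ x ^ (2*(r-r')) * τ ^ r' := by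
  rw [← rpa hτ (show (r - r') + r' = r by ring)]
  gcongr
  calc τ ^ (r-r') ≤ (x ^ 2) ^ (r-r') := Real.rpow_le_rpow_of_nonpos (by positivity) h (by linarith)
    _ = _ := by rw [← Real.rpow_natCast, ← Real.rpow_mul hx.le]; norm_num

/-- L1 bound of Dk for fixed x -/
lemma Dk_L0x {x ε : ℝ} (hx : 0 < x) (h0 : 0 ≤ ε) (h1 : ε ≤ 1/2) : ∃ C ≥ 0, ∀ τ > 0, mm 0 (Dk τ x) ≤ ENNReal.ofReal (C * τ ^ (-1+ε)) := by
  have c := cE_pos (le_refl (0:ℝ))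
  refine ⟨20 * cE 0 * x ^ (2*(-1/2-(-1+ε))) + 40 * x * cE 0 * x ^ (2*(-1-(-1+ε))), by positivity, fun τ hτ => ?_⟩
  rcases le_total τ (x ^ 2) with h | h
  · refine (Dk_far le_rfl hτ hx h).trans (ENNReal.ofReal_le_ofReal ?_)
    have := pw_far hτ hx h (r := -1/2) (r' := -1+ε) (by linarith)
    rw [Real.rpow_zero, mul_one]
    calc _ ≤ 20 * cE 0 * (x ^ (2*(-1/2-(-1+ε))) * τ ^ (-1+ε)) := by gcongr
      _ ≤ _ := by rw [add_mul, mul_assoc (20 * cE 0)]; exact le_add_of_nonneg_right (by positivity)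
  · unfold mm
    refine (lint_le (p := 0) (c := 40 * x * τ ^ (-3/2:ℝ)) (by positivity) (fun z _ => Dk_near hτ z hx.le h) (ge_mom0 le_rfl hτ)).trans (ENNReal.ofReal_le_ofReal ?_)
    have := pw_near hτ hx h (r := -1) (r' := -1+ε) (by linarith)
    calc _ = 40 * x * cE 0 * τ ^ (-1:ℝ) := by
            rw [← rpa hτ (show (-3/2:ℝ) + (0+1)/2 = -1 by norm_num)]; ring
      _ ≤ 40 * x * cE 0 * (x ^ (2*(-1-(-1+ε))) * τ ^ (-1+ε)) := by gcongr
      _ ≤ _ := by rw [add_mul, mul_assoc (40 * x * cE 0)]; exact le_add_of_nonneg_left (by positivity)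

lemma Dk_L1x {x : ℝ} (hx : 0 < x) : ∃ C ≥ 0, ∀ τ > 0, mm 1 (Dk τ x) ≤ ENNReal.ofReal (C * τ ^ (-1/2:ℝ)) := by
  have c := cE_pos (zero_le_one (α := ℝ))
  refine ⟨40 * cE 1 * x, by positivity, fun τ hτ => ?_⟩
  have hp : 0 < τ ^ (-1/2:ℝ) := by positivity
  rcases le_total τ (x ^ 2) with h | h
  · refine (Dk_far zero_le_one hτ hx h).trans (ENNReal.ofReal_le_ofReal ?_)
    rw [Real.rpow_one]; gcongr; norm_num
  · unfold mm
    refine (lint_le (p := 1) (c := 40 * x * τ ^ (-3/2:ℝ)) (by positivity) (fun z _ => Dk_near hτ z hx.le h) (ge_mom0 zero_le_one hτ)).trans (ENNReal.ofReal_le_ofReal ?_)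
    rw [← rpa hτ (show (-3/2:ℝ) + (1+1)/2 = -1/2 by norm_num)]; apply le_of_eq; ring

lemma Rem_L1x {x ε : ℝ} (hx : 0 < x) (h0 : 0 ≤ ε) (h1 : ε ≤ 1/2) : ∃ C ≥ 0, ∀ τ > 0, mm 1 (Rem τ x) ≤ ENNReal.ofReal (C * τ ^ (-1+ε)) := by
  have c := cE_pos (zero_le_one (α := ℝ))
  obtain ⟨D, hD, hd⟩ := Dk_L1x hx
  refine ⟨(D + 20 * x * cE 1) * x ^ (2*(-1/2-(-1+ε))) + 40 * x ^ 3 * cE 1 * x ^ (2*(-3/2-(-1+ε))), by positivity, fun τ hτ => ?_⟩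
  rcases le_total τ (x ^ 2) with h | h
  · have := pw_far hτ hx h (r := -1/2) (r' := -1+ε) (by linarith)
    unfold Rem
    refine (mm_add_le (by fun_prop)).trans ?_
    refine (ofR_add_le (b2 := 20 * x * cE 1 * τ ^ (-1/2:ℝ)) (by positivity) (by positivity) (hd τ hτ) ?_).trans (ENNReal.ofReal_le_ofReal ?_)
    · unfold mm
      refine (lint_le (p := 1) (c := 20 * x * τ ^ (-3/2:ℝ)) (G := ge τ) (by positivity) (fun z _ => ?_) (ge_mom0 zero_le_one hτ)).trans (ENNReal.ofReal_le_ofReal ?_)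
      · rw [abs_mul, abs_of_pos (by positivity : 0 < 2 * x)]
        have := (gk2_bound hτ z).trans (mul_le_mul_of_nonneg_left (exp16_le_ge hτ z) (by positivity))
        calc _ ≤ 2 * x * (10 * τ ^ (-3/2:ℝ) * ge τ z) := by gcongr
          _ = _ := by ring
      · rw [← rpa hτ (show (-3/2:ℝ) + (1+1)/2 = -1/2 by norm_num)]; apply le_of_eq; ring
    · rw [← add_mul]
      calc _ ≤ (D + 20 * x * cE 1) * (x ^ (2*(-1/2-(-1+ε))) * τ ^ (-1+ε)) := by gcongr
        _ ≤ _ := by rw [add_mul _ _ (τ ^ _), mul_assoc (D + _)]; exact le_add_of_nonneg_right (by positivity)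
  · unfold mm
    refine (lint_le (p := 1) (c := 40 * x ^ 3 * τ ^ (-5/2:ℝ)) (by positivity) (fun z _ => Rem_near hτ z hx.le h) (ge_mom0 zero_le_one hτ)).trans (ENNReal.ofReal_le_ofReal ?_)
    have := pw_near hτ hx h (r := -3/2) (r' := -1+ε) (by linarith)
    calc _ = 40 * x ^ 3 * cE 1 * τ ^ (-3/2:ℝ) := by
            rw [← rpa hτ (show (-5/2:ℝ) + (1+1)/2 = -3/2 by norm_num)]; ring
      _ ≤ 40 * x ^ 3 * cE 1 * (x ^ (2*(-3/2-(-1+ε))) * τ ^ (-1+ε)) := by gcongr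
      _ ≤ _ := by rw [add_mul _ _ (τ ^ _), mul_assoc (40 * x ^ 3 * cE 1)]; exact le_add_of_nonneg_left (by positivity)

lemma qk_lin {s : ℝ} (hs : 0 < s) {z : ℝ} (hz : 0 ≤ z) : |qk s z| ≤ 20 * z * s ^ (-3/2:ℝ) := by
  have := mvt_bound hz (fun y _ => hasDerivAt_gk1 hs y) (fun y _ => gks2 hs y)
  rw [gk1_zero, sub_zero, sub_zero] at this
  unfold qk; rw [abs_mul]; norm_num; linarith

lemma bd_unit {X : ℝ → ℝ} {q : ℝ} (h : Bd (fun (_ : Unit) t => ENNReal.ofReal |X t|) q) : ∃ C ≥ 0, ∀ t ≥ 1, |X t| ≤ C * t ^ q := by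
  obtain ⟨C, hC, h⟩ := h
  refine ⟨C, hC, fun t ht => ?_⟩
  have ht0 : 0 < t := by linarith
  exact (ENNReal.ofReal_le_ofReal_iff (by positivity)).1 (h () t ht)

lemma meas_Dkx (τ x : ℝ) : Measurable (Dk τ x) := by
  have : Measurable fun z => Dk τ x z := by fun_prop
  exact this

section
variable {κ Cμ W : ℝ} {w0 μ : ℝ → ℝ} {w : ℝ → ℝ → ℝ}

lemma Sys.Qe (S : Sys κ Cμ W w0 μ w) {x ε : ℝ} (hx : 0 < x) (hε : 0 < ε) (hε1 : ε ≤ 1/2) :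
    ∃ C ≥ 0, ∀ t ≥ 1, |Qop μ (ee w0 μ w) t x| ≤ C * t ^ (-2-κ+ε) := by
  obtain ⟨A, G⟩ := S.e_good
  obtain ⟨C1, hC1, h1⟩ := S.e_sup
  obtain ⟨C2, hC2, h2⟩ := S.e_mm
  obtain ⟨C3, hC3, h3⟩ := S.e_m0
  obtain ⟨D, hD, hd⟩ := Dk_L0x hx hε.le hε1
  have hκ := S.κ0; have hκ1 := S.κ1; have hCμ := S.hC; have hA := G.hA
  have hs : ∀ s > 0, ∀ z > 0, |ee w0 μ w s z| ≤ (C1 + A) * s ^ (-1-κ) := by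
    intro s hs z hz
    rcases le_total 1 s with h | h
    · refine (h1 s h z hz).trans ?_; gcongr; linarith
    · refine (G.fs s hs z hz).trans ?_
      have := Real.rpow_le_rpow_of_exponent_ge hs h (show -1-κ ≤ -1 by linarith)
      gcongr; linarith
  refine bd_unit (Bd.le (Bd.add (Bd.add ?_ ?_) ?_) (fun _ t ht => Qop_sup S.μm (by linarith) x))
  · refine Bd.split (Y := fun _ t s => ENNReal.ofReal (320 * x * C2 * t ^ (-2-κ) * s ^ (0:ℝ))) (Z := fun _ t s => ENNReal.ofReal (160 * x * C3 * t ^ (-5/2:ℝ) * s ^ (1/2-κ))) (fun t => measurableSet_Ioc) S.μm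
          (fun i t => by fun_prop) (fun _ t ht s hs => ?_) ?_ ?_
    · have hs0 := hs.1
      have ht0 : 0 < t := by linarith
      refine (Kc_x_lo (meas_slice G.m s) (p := 1+2*κ) (by linarith) (by linarith) ht0 hs.1 hs.2 hx).trans ?_
      refine (ofR2 (by positivity) (by positivity) (by positivity) (by positivity) (h2 s hs0) (h3 s hs0)).trans ?_
      rw [← ENNReal.ofReal_add (by positivity) (by positivity)]
      apply ENNReal.ofReal_le_ofReal
      rw [show -3/2-(1+2*κ)/2 = -2-κ by ring, Real.rpow_zero, ← rpa hs0 (show (1:ℝ) + (-1/2-κ) = 1/2-κ by ring), Real.rpow_one]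
      apply le_of_eq; ring
    · exact Bd.lo (q := 0) (ε := ε) hCμ S.μb (by positivity) hε.le (by linarith) (by linarith) (by linarith) fun _ t ht s hs hs2 => le_rfl
    · exact Bd.lo (q := 1/2-κ) (ε := 0) hCμ S.μb (by positivity) le_rfl (by linarith) (by linarith) (by linarith) fun _ t ht s hs hs2 => le_rfl
  · refine Bd.hi (B := (C1 + A) * 4 * D) (r := -1-κ) (q := -1+ε) hCμ S.μb (by positivity) (by linarith) (by linarith) fun _ t ht s hs1 hs2 => ?_
    have h4 : 0 < t - s := by linarith
    have hs0 : 0 < s := by linarith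
    simp only [mul_comm (Dk _ _ _)]
    refine (ker1 (k := (C1 + A) * s ^ (-1-κ)) (q := 0) (meas_Dkx (t-s) x) (by positivity) fun z hz => by simpa using hs s hs0 z hz).trans ?_
    refine (mul_le_mul_right (hd _ h4) _).trans ?_
    rw [← ENNReal.ofReal_mul (by positivity)]
    apply ENNReal.ofReal_le_ofReal
    have := hi_s (by linarith) hs1 (r := -1-κ) (by linarith) (by linarith)
    calc _ ≤ (C1 + A) * (4 * t ^ (-1-κ)) * (D * (t-s) ^ (-1+ε)) := by gcongr
      _ = _ := by ring
  · refine Bd.mul (q := -3/2) (q' := -1/2-κ+ε) (Bd.of (C := 20 * x) (by positivity) fun _ t ht => ENNReal.ofReal_le_ofReal (qk_lin (by linarith) hx.le)) ?_ (by ring)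
    refine Bd.tail (B := C3) (r := 0) (q := 1/2+κ) hCμ S.μb (by positivity) (by linarith) (by linarith) (by linarith) fun _ t ht s hs => ?_
    refine (h3 s (by linarith)).trans (le_of_eq ?_)
    rw [show -1/2-κ = -(1/2+κ) by ring, Real.rpow_zero]; ring_nf
end

lemma Qq_small {μ : ℝ → ℝ} {C η x : ℝ} (hμm : Measurable μ) (hC : 0 ≤ C) (hη : 0 < η) (hη1 : η < 1/2) (hμ : ∀ s ≥ 0, |μ s| ≤ C * (1 + s) ^ (-1-η)) (hx : 0 < x) :
    ∃ C' ≥ 0, ∀ t ≥ 1, |Qop μ qk t x| ≤ C' * t ^ (-2-η) := by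
  have c2 := cE_pos (zero_le_two (α := ℝ))
  have c0 := cE_pos (le_refl (0:ℝ))
  obtain ⟨D, hD, hd⟩ := Dk_L1x hx
  have hb : ∀ s ≥ 0, |C / (1 + s)| ≤ C / (1 + s) := fun s hs => (abs_of_nonneg (by positivity)).le
  have hl : ∀ s > 0, ∀ X, ENNReal.ofReal |μ s| * X ≤ ENNReal.ofReal |C / (1 + s)| * (ENNReal.ofReal (s ^ (-η)) * X) := by
    intro s hs X
    rw [← mul_assoc, ← ENNReal.ofReal_mul (abs_nonneg _)]
    gcongr
    refine (hμ s hs.le).trans ?_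
    rw [abs_of_nonneg (by positivity)]
    have h1 : (1+s) ^ (-η) ≤ s ^ (-η) := Real.rpow_le_rpow_of_nonpos hs (by linarith) (by linarith)
    calc _ = C / (1 + s) * (1 + s) ^ (-η) := by
          rw [← rpa (show 0 < 1 + s by linarith) (show (-1:ℝ) + -η = -1-η by ring), Real.rpow_neg_one]; ring
      _ ≤ _ := by gcongr
  refine bd_unit (Bd.le (Bd.add (Bd.add ?_ ?_) ?_) (fun _ t ht => (Qop_sup hμm (by linarith) x).trans (add_le_add (add_le_add (setLIntegral_mono' measurableSet_Ioc fun s hs => hl s hs.1 _) (setLIntegral_mono' measurableSet_Ioc fun s hs => hl s (by linarith [hs.1]) _)) (mul_le_mul_right (setLIntegral_mono' measurableSet_Ioi fun s (hs : t / 2 < s) => hl s (by linarith) _) _))))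
  · refine Bd.lo (B := 320 * x * (20 * cE 2) + 160 * x * (20 * cE 0)) (r := -5/2) (q := 1/2-η) (ε := 0) (μ := fun s => C / (1+s)) hC hb (by positivity) le_rfl (by linarith) (by linarith) (by linarith) fun _ t ht s hs hs2 => ?_
    have ht0 : 0 < t := by linarith
    refine (mul_le_mul_right (Kc_x_lo (meas_slice good_qk.m s) (p := 2) (by linarith) (by linarith) ht0 hs hs2 hx) _).trans ?_
    refine (mul_le_mul_right (ofR2 (by positivity) (by positivity) (by positivity) (by positivity) (qk_Lp zero_le_two hs) (qk_Lp le_rfl hs)) _).trans ?_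
    rw [← ENNReal.ofReal_mul (by positivity)]
    apply ENNReal.ofReal_le_ofReal
    have e : s ^ (((0:ℝ)-1)/2) * s = s ^ (1/2:ℝ) := by
      nth_rewrite 2 [← Real.rpow_one s]; exact rpa hs (by norm_num)
    rw [show (-3/2-2/2:ℝ) = -5/2 by norm_num, ← rpa hs (show (1/2:ℝ) + -η = 1/2-η by ring), ← e, show ((2:ℝ)-1)/2 = ((0:ℝ)-1)/2 + 1 by norm_num, Real.rpow_add_one hs.ne']
    apply le_of_eq; ring
  · refine Bd.hi (B := 20 * D * 4) (r := -3/2-η) (q := -1/2) (μ := fun s => C / (1+s)) hC hb (by positivity) (by norm_num) (by linarith) fun _ t ht s hs1 hs2 => ?_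
    have h4 : 0 < t - s := by linarith
    have hs0 : 0 < s := by linarith
    simp only [mul_comm (Dk _ _ _)]
    refine (mul_le_mul_right (ker1 (k := 20 * s ^ (-3/2:ℝ)) (q := 1) (meas_Dkx (t-s) x) (by positivity) fun z hz => (qk_lin hs0 (le_of_lt hz)).trans (le_of_eq (by rw [Real.rpow_one]; ring))) _).trans ?_
    refine (mul_le_mul_right (mul_le_mul_right (hd _ h4) _) _).trans ?_
    rw [← ENNReal.ofReal_mul (by positivity), ← ENNReal.ofReal_mul (by positivity)]
    apply ENNReal.ofReal_le_ofReal
    have := hi_s (by linarith) hs1 (r := -3/2-η) (by linarith) (by linarith)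
    calc _ = 20 * s ^ (-3/2-η) * (D * (t-s) ^ (-1/2:ℝ)) := by rw [← rpa hs0 (show (-3/2:ℝ) + -η = -3/2-η by ring)]; ring
      _ ≤ 20 * (4 * t ^ (-3/2-η)) * (D * (t-s) ^ (-1/2:ℝ)) := by gcongr
      _ = _ := by ring
  · refine Bd.mul (q := -3/2) (q' := -1/2-η) (Bd.of (C := 20 * x) (by positivity) fun _ t ht => ENNReal.ofReal_le_ofReal (qk_lin (by linarith) hx.le)) ?_ (by ring)
    refine Bd.tail (B := 20 * cE 0) (r := 0) (q := 1/2+η) (μ := fun s => C / (1+s)) hC hb (by positivity) (by linarith) (by linarith) (by linarith) fun _ t ht s hs => ?_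
    have hs0 : 0 < s := by linarith
    refine (mul_le_mul_right (qk_Lp le_rfl hs0) _).trans (le_of_eq ?_)
    rw [← ENNReal.ofReal_mul (by positivity), ← rpa hs0 (show ((0:ℝ)-1)/2 + -η = -(1/2+η) by ring), Real.rpow_zero]; ring_nf

lemma gm1 {c : ℝ} (hc : 0 < c) : ∫ z in Ioi (0:ℝ), z * Real.exp (-(c * z ^ 2)) = 1 / (2 * c) := by
  have := integral_rpow_mul_exp_neg_mul_rpow (p := 2) (q := 1) (b := c) (by norm_num) (by norm_num) hc
  simp only [Real.rpow_one, Real.rpow_two, neg_mul] at this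
  rw [this]; norm_num [Real.rpow_neg_one]

lemma gm3 {c : ℝ} (hc : 0 < c) : ∫ z in Ioi (0:ℝ), z ^ 3 * Real.exp (-(c * z ^ 2)) = 1 / (2 * c ^ 2) := by
  have := integral_rpow_mul_exp_neg_mul_rpow (p := 2) (q := 3) (b := c) (by norm_num) (by norm_num) hc
  have e : ∀ z : ℝ, z ^ (3:ℝ) = z ^ 3 := fun z => by norm_cast
  simp only [e, Real.rpow_two, neg_mul] at this
  rw [this]
  have h2 : Real.Gamma 2 = 1 := Real.Gamma_two
  norm_num [Real.rpow_neg hc.le, h2]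

lemma gmi {c : ℝ} (hc : 0 < c) (n : ℕ) : IntegrableOn (fun z => z ^ n * Real.exp (-(c * z ^ 2))) (Ioi 0) := by
  have := integrableOn_rpow_mul_exp_neg_mul_rpow (p := 2) (s := n) (b := c) (by linarith [n.cast_nonneg (α := ℝ)]) (by norm_num) hc
  simpa [Real.rpow_two] using this

lemma gg_prod {s τ : ℝ} (hs : 0 < s) (hτ : 0 < τ) (z : ℝ) : gk τ z * gk s z = 1 / (4 * π * √(s * τ)) * Real.exp (-((s + τ) / (4 * s * τ) * z ^ 2)) := by
  unfold gk
  have e1 : √(4*π*τ) * √(4*π*s) = 4 * π * √(s*τ) := by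
    rw [← Real.sqrt_mul (by positivity), show 4*π*τ*(4*π*s) = (4*π)^2 * (s*τ) by ring, Real.sqrt_mul (by positivity), Real.sqrt_sq (by positivity)]
  calc _ = (√(4*π*τ) * √(4*π*s))⁻¹ * (Real.exp (-(z ^ 2 / (4 * τ))) * Real.exp (-(z ^ 2 / (4 * s)))) := by rw [mul_inv]; ring
    _ = _ := by
      rw [e1, ← Real.exp_add, one_div]; congr 2
      field_simp; ring

lemma gg_eq {s τ : ℝ} (hs : 0 < s) (hτ : 0 < τ) (z : ℝ) : gk2 τ z * qk s z = 
    1 / (4 * π * √(s * τ)) * (1 / (4 * τ ^ 2 * s)) * (z ^ 3 * Real.exp (-((s + τ) / (4 * s * τ) * z ^ 2))) - 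
    1 / (4 * π * √(s * τ)) * (1 / (2 * τ * s)) * (z ^ 1 * Real.exp (-((s + τ) / (4 * s * τ) * z ^ 2))) := by
  have := gg_prod hs hτ z
  have e : gk2 τ z * qk s z = (z^2/(4*τ^2) - 1/(2*τ)) * (z / s) * (gk τ z * gk s z) := by
    unfold gk2 qk gk1; ring
  rw [e, this]; field_simp

lemma gg_int {s τ : ℝ} (hs : 0 < s) (hτ : 0 < τ) : IntegrableOn (fun z => gk2 τ z * qk s z) (Ioi 0) := by
  simp only [gg_eq hs hτ]
  exact ((gmi (by positivity) 3).const_mul _).sub ((gmi (by positivity) 1).const_mul _)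

lemma gg_val {s τ : ℝ} (hs : 0 < s) (hτ : 0 < τ) : ∫ z in Ioi (0:ℝ), gk2 τ z * qk s z = 
    -(1 - 2 * s / (s + τ)) / (4 * π * (s + τ) * √(s * τ)) := by
  simp only [gg_eq hs hτ]
  rw [integral_sub ((gmi (by positivity) 3).const_mul _) ((gmi (by positivity) 1).const_mul _), integral_const_mul, integral_const_mul,
    gm3 (by positivity)]
  simp only [pow_one]
  rw [gm1 (by positivity)]
  have : 0 < √(s*τ) := by positivity
  field_simp; ring

lemma qk_mass {s : ℝ} (hs : 0 < s) : ∫ z in Ioi (0:ℝ), qk s z = 1 / √(π * s) := by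
  have e : ∀ z, qk s z = (√(4*π*s))⁻¹ / s * (z * Real.exp (-(1 / (4 * s) * z ^ 2))) := by
    intro z; unfold qk gk1 gk
    rw [show -(1 / (4 * s) * z ^ 2) = -(z ^ 2 / (4 * s)) by ring]; ring
  simp only [e]
  rw [integral_const_mul, gm1 (by positivity), show 4 * π * s = 2 ^ 2 * (π * s) by ring, Real.sqrt_mul (by positivity), Real.sqrt_sq (by norm_num)]
  have : 0 < √(π*s) := by positivity
  field_simp; norm_num

noncomputable def mtil (s : ℝ) : ℝ := if 1 ≤ s then 3 / (2 * s) else 0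

lemma Mu_mtil : Mu 3 mtil := by
  refine ⟨by norm_num, Measurable.ite (measurableSet_le measurable_const measurable_id) (by fun_prop) measurable_const, fun s hs => ?_⟩
  unfold mtil
  split_ifs with h
  · rw [abs_of_nonneg (by positivity), div_le_div_iff₀ (by positivity) (by positivity)]; nlinarith
  · simp; positivity

lemma mtil_mass : ∫ s in Ioi (0:ℝ), mtil s * ∫ z in Ioi (0:ℝ), qk s z = 3 / √π := by
  have e : ∀ s ∈ Ioi (0:ℝ), mtil s * ∫ z in Ioi (0:ℝ), qk s z = (Ici (1:ℝ)).indicator (fun s => 3 / (2 * √π) * s ^ (-3/2:ℝ)) s := by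
    intro s hs
    have hs0 : (0:ℝ) < s := hs
    unfold mtil
    simp only [indicator, mem_Ici]
    split_ifs with h
    · rw [qk_mass hs0, Real.sqrt_mul (by positivity)]
      have : s ^ (-3/2:ℝ) = 1 / (s * √s) := by
        rw [Real.sqrt_eq_rpow, show (-3/2:ℝ) = -(1 + 1/2) by norm_num, Real.rpow_neg hs0.le, Real.rpow_add hs0, Real.rpow_one]; exact (one_div _).symm
      rw [this]
      have : 0 < √s := by positivity
      field_simp
    · simp
  rw [setIntegral_congr_fun measurableSet_Ioi e, setIntegral_indicator measurableSet_Ici,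
    show Ioi (0:ℝ) ∩ Ici 1 = Ici 1 from inter_eq_right.2 fun y (hy : 1 ≤ y) => show (0:ℝ) < y by linarith, integral_Ici_eq_integral_Ioi, integral_const_mul,
    integral_Ioi_rpow_of_lt (by norm_num) (by norm_num)]
  have : 0 < √π := by positivity
  norm_num; field_simp

noncomputable def Ff (t s : ℝ) : ℝ := (1 - 2 * s / t) / (s * √(s * (t - s)))

lemma Ff_meas (t : ℝ) : Measurable (Ff t) := by unfold Ff; fun_prop

lemma Ff_int {t : ℝ} (ht : 1 ≤ t) : IntervalIntegrable (Ff t) volume 1 t := by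
  have h1 : IntervalIntegrable (fun s : ℝ => (t - s) ^ (-1/2:ℝ)) volume 1 t := by
    have := (intervalIntegral.intervalIntegrable_rpow' (a := t - 1) (b := 0) (r := -1/2) (by norm_num)).comp_sub_left t
    simpa using this
  refine h1.mono_fun ((Ff_meas t).aestronglyMeasurable) ?_
  rw [uIoc_of_le ht]
  filter_upwards [ae_restrict_mem measurableSet_Ioc] with s hs
  rcases hs.2.eq_or_lt with h | h
  · subst h; simp [Ff]
  have hτ : 0 < t - s := by linarith
  have hs1 := hs.1
  have ht0 : 0 < t := by linarith
  rw [Real.norm_eq_abs, Real.norm_eq_abs, abs_of_nonneg (a := (t - s) ^ (-1/2:ℝ)) (by positivity)]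
  unfold Ff
  rw [abs_div, abs_of_nonneg (a := s * √(s * (t - s))) (by positivity), show (-1/2:ℝ) = -(1/2) by norm_num, Real.rpow_neg hτ.le, ← Real.sqrt_eq_rpow, ← one_div]
  have e : |1 - 2 * s / t| ≤ 1 := by
    have : s / t ≤ 1 := by rw [div_le_one ht0]; exact h.le
    have : 0 ≤ s / t := by positivity
    rw [abs_le]; constructor <;> rw [mul_div_assoc] <;> linarith
  have e2 : √(t - s) ≤ √(s * (t-s)) := Real.sqrt_le_sqrt (by nlinarith)
  have e3 : 0 < √(t-s) := by positivity
  apply div_le_div₀ (by norm_num) e e3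
  nlinarith

lemma Ff_val {t : ℝ} (ht : 1 ≤ t) : ∫ s in (1:ℝ)..t, Ff t s = 2 / t * √(t - 1) - 4 / t * Real.arctan √(t - 1) := by
  have ht0 : 0 < t := by linarith
  have := intervalIntegral.integral_eq_sub_of_hasDerivAt_of_le (f := fun s => -(2/t) * √((t - s)/s) + 4/t * Real.arctan √((t-s)/s)) (f' := Ff t) ht ?_ ?_ (Ff_int ht)
  · rw [this]; simp; ring
  · have : ContinuousOn (fun s => √((t-s)/s)) (Icc 1 t) := by
      apply ContinuousOn.sqrt
      exact ContinuousOn.div (by fun_prop) (by fun_prop) fun s hs => by linarith [hs.1]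
    exact (this.const_smul (-(2/t))).add ((Real.continuous_arctan.comp_continuousOn this).const_smul (4/t))
  · intro s hs
    have hs0 : 0 < s := by linarith [hs.1]
    have hτ : 0 < t - s := by linarith [hs.2]
    have h0 : HasDerivAt (fun s => (t - s)/s) (((-1) * s - (t - s) * 1) / s ^ 2) s :=
      ((hasDerivAt_id s).const_sub t).div (hasDerivAt_id s) hs0.ne'
    have h1 := h0.sqrt (by positivity)
    refine ((h1.const_mul (-(2/t))).add (h1.arctan.const_mul (4/t))).congr_deriv ?_
    have e : √((t-s)/s) = √(s * (t-s)) / s := by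
      rw [show (t-s)/s = s * (t - s) / s ^ 2 by field_simp, Real.sqrt_div (by positivity), Real.sqrt_sq hs0.le]
    rw [e]
    have h3 : √(s * (t-s)) ^ 2 = s * (t - s) := Real.sq_sqrt (by positivity)
    have h4 : 0 < √(s * (t-s)) := by positivity
    set u := √(s * (t-s)) with hu
    unfold Ff
    rw [← hu]
    have h5 : 1 + (u / s) ^ 2 = t / s := by rw [div_pow, h3]; field_simp; ring
    rw [h5]; field_simp; ring

lemma Dk_split {t s x : ℝ} (hs : 0 < s) (hst : s < t) : ∫ z in Ioi (0:ℝ), Dk (t - s) x z * qk s z =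
    (∫ z in Ioi (0:ℝ), Rem (t - s) x z * qk s z) + x * (s / (2 * π * t) * Ff t s) := by
  have hτ : 0 < t - s := by linarith
  have h1 := good_qk.int_Din hs hτ x
  have h2 := gg_int hs hτ
  have h3 : ∫ z in Ioi (0:ℝ), Rem (t - s) x z * qk s z = (∫ z in Ioi (0:ℝ), Dk (t - s) x z * qk s z) + 2 * x * ∫ z in Ioi (0:ℝ), gk2 (t - s) z * qk s z := by
    rw [← integral_const_mul, ← integral_add h1 (h2.const_mul _)]
    refine integral_congr_ae (Eventually.of_forall fun z => ?_)
    simp only [Rem]; ring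
  rw [h3, gg_val hs hτ, show s + (t - s) = t by ring]
  have : 0 < √(s * (t - s)) := by positivity
  have : 0 < t := by linarith
  unfold Ff; field_simp; ring

lemma main_split {t x : ℝ} (ht : 1 ≤ t) : ∫ s in (0:ℝ)..t, mtil s * ∫ z in Ioi (0:ℝ), Dk (t - s) x z * qk s z = 
    (∫ s in (0:ℝ)..t, mtil s * ∫ z in Ioi (0:ℝ), Rem (t - s) x z * qk s z) + x * (3 / (4 * π * t)) * ∫ s in (1:ℝ)..t, Ff t s := by
  have ht0 : 0 < t := by linarith
  have h1 := good_qk.int_D Mu_mtil ht0 x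
  have h2 := (intervalIntegrable_iff_integrableOn_Ioc_of_le ht).1 (Ff_int ht)
  have e0 : Ioc 0 t ∩ Ioi (1:ℝ) = Ioc 1 t := by ext y; simp only [mem_inter_iff, mem_Ioc, mem_Ioi]; constructor <;> intro h <;> refine ⟨?_, ?_⟩ <;> first | linarith [h.1, h.2] | linarith [h.1.2] | exact ⟨by linarith [h.1], h.2⟩
  have h3 : IntegrableOn ((Ioi (1:ℝ)).indicator (Ff t)) (Ioc 0 t) := by
    rw [integrableOn_indicator_iff measurableSet_Ioi, inter_comm, e0]; exact h2
  have h4 : ∫ s in (1:ℝ)..t, Ff t s = ∫ s in Ioc 0 t, (Ioi (1:ℝ)).indicator (Ff t) s := by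
    rw [intervalIntegral.integral_of_le ht, setIntegral_indicator measurableSet_Ioi, e0]
  rw [h4, intervalIntegral.integral_of_le ht0.le, intervalIntegral.integral_of_le ht0.le, ← integral_const_mul]
  have h5 : ∀ᵐ s ∂volume.restrict (Ioc 0 t), mtil s * (∫ z in Ioi (0:ℝ), Rem (t - s) x z * qk s z) = 
      mtil s * (∫ z in Ioi (0:ℝ), Dk (t - s) x z * qk s z) - x * (3 / (4 * π * t)) * (Ioi (1:ℝ)).indicator (Ff t) s := by
    filter_upwards [ae_restrict_mem measurableSet_Ioc, ae_restrict_of_ae (Measure.ae_ne volume t), ae_restrict_of_ae (Measure.ae_ne volume 1)] with s hs hst hs1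
    have hs0 := hs.1
    rw [Dk_split hs.1 (lt_of_le_of_ne hs.2 hst)]
    unfold mtil
    simp only [indicator, mem_Ioi]
    by_cases h : 1 ≤ s
    · rw [if_pos h, if_pos (lt_of_le_of_ne h (Ne.symm hs1))]; field_simp; ring
    · rw [if_neg h, if_neg (by linarith)]; ring
  rw [integral_congr_ae h5, integral_sub h1 (h3.const_mul _)]; ring

lemma Rem_time {x ε : ℝ} (hx : 0 < x) (hε : 0 < ε) (hε1 : ε ≤ 1/2) : ∃ C ≥ 0, ∀ t ≥ 1,
    |∫ s in (0:ℝ)..t, mtil s * ∫ z in Ioi (0:ℝ), Rem (t - s) x z * qk s z| ≤ C * t ^ (-5/2+ε) := by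
  obtain ⟨D, hD, hd⟩ := Rem_L1x hx hε.le hε1
  have c0 := cE_pos (le_refl (0:ℝ))
  have M := Mu_mtil
  refine bd_unit (Bd.le (Bd.add ?_ ?_) (fun _ t ht => (time_sup (F := fun s => ∫ z in Ioi (0:ℝ), Rem (t - s) x z * qk s z) (by linarith)).trans (split_half (by linarith)).le))
  · refine Bd.lo' (B := 20 * x ^ 3 * 8 * (20 * cE 0)) (r := -5/2) (q := 1/2) M.hC M.b (by positivity) (by norm_num) (by norm_num) (by linarith) fun _ t ht s hs hs2 => ?_
    have h4 : 0 < t - s := by linarith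
    refine (ker1 (k := 20 * x ^ 3 * (t-s) ^ (-5/2:ℝ)) (q := 0) (meas_slice good_qk.m s) (by positivity) fun z hz => by simpa using Rem_sup h4 z hx.le).trans ?_
    refine (mul_le_mul_right (qk_Lp le_rfl hs) _).trans ?_
    rw [← ENNReal.ofReal_mul (by positivity)]
    apply ENNReal.ofReal_le_ofReal
    have := half_rpow3 (by linarith) hs2 (r := -5/2) (by norm_num) (by norm_num)
    rw [show ((0:ℝ)-1)/2 = -(1/2) by norm_num]
    calc _ ≤ 20 * x ^ 3 * (8 * t ^ (-5/2:ℝ)) * (20 * cE 0 * s ^ (-(1/2:ℝ))) := by gcongr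
      _ = _ := by ring
  · refine Bd.hi (B := 20 * D * 4) (r := -3/2) (q := -1+ε) M.hC M.b (by positivity) (by linarith) (by linarith) fun _ t ht s hs1 hs2 => ?_
    have h4 : 0 < t - s := by linarith
    have hs0 : 0 < s := by linarith
    simp only [mul_comm (Rem _ _ _)]
    refine (ker1 (k := 20 * s ^ (-3/2:ℝ)) (q := 1) (f := Rem (t-s) x) ?_ (by positivity) fun z hz => (qk_lin hs0 (le_of_lt hz)).trans (le_of_eq (by rw [Real.rpow_one]; ring))).trans ?_
    · have : Measurable fun z => Rem (t-s) x z := by unfold Rem; fun_prop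
      exact this
    refine (mul_le_mul_right (hd _ h4) _).trans ?_
    rw [← ENNReal.ofReal_mul (by positivity)]
    apply ENNReal.ofReal_le_ofReal
    have := hi_s (by linarith) hs1 (r := -3/2) (by norm_num) (by norm_num)
    calc _ ≤ 20 * (4 * t ^ (-3/2:ℝ)) * (D * (t-s) ^ (-1+ε)) := by gcongr
      _ = _ := by ring

lemma rp32 {t : ℝ} (ht : 0 < t) : t ^ (-3/2:ℝ) = 1 / (t * √t) := by
  rw [Real.sqrt_eq_rpow, show (-3/2:ℝ) = -(1 + 1/2) by norm_num, Real.rpow_neg ht.le, Real.rpow_add ht, Real.rpow_one]; exact (one_div _).symm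
lemma rp52 {t : ℝ} (ht : 0 < t) : t ^ (-5/2:ℝ) = 1 / (t ^ 2 * √t) := by
  rw [← rpa ht (show (-3/2:ℝ) + (-1) = -5/2 by norm_num), rp32 ht, Real.rpow_neg_one]; field_simp
lemma rp2 {t : ℝ} (ht : 0 < t) : t ^ (-2:ℝ) = 1 / t ^ 2 := by
  rw [Real.rpow_neg ht.le, Real.rpow_two, one_div]

lemma qk_fix {x : ℝ} (hx : 0 < x) {t : ℝ} (ht : 0 < t) : |qk t x - x / (2 * √π) * t ^ (-3/2:ℝ)| ≤ x ^ 3 * t ^ (-5/2:ℝ) := by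
  have hs : 0 < √t := by positivity
  have hp : 1 ≤ √π := by rw [Real.one_le_sqrt]; linarith [Real.pi_gt_three]
  have e : qk t x - x / (2 * √π) * t ^ (-3/2:ℝ) = -(x / (2 * √π * t * √t)) * (1 - Real.exp (-(x ^ 2 / (4 * t)))) := by
    unfold qk gk1 gk
    rw [rp32 ht, show 4 * π * t = 2 ^ 2 * (π * t) by ring, Real.sqrt_mul (by positivity), Real.sqrt_sq (by norm_num), Real.sqrt_mul (by positivity)]
    field_simp; ring
  have h1 : 0 ≤ 1 - Real.exp (-(x ^ 2 / (4 * t))) := by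
    have : Real.exp (-(x ^ 2 / (4 * t))) ≤ 1 := Real.exp_le_one_iff.2 (by rw [neg_nonpos]; positivity)
    linarith
  have h2 : 1 - Real.exp (-(x ^ 2 / (4 * t))) ≤ x ^ 2 / (4 * t) := by linarith [Real.add_one_le_exp (-(x ^ 2 / (4 * t)))]
  rw [e, abs_mul, abs_neg, abs_of_nonneg h1, abs_of_nonneg (by positivity), rp52 ht]
  calc _ ≤ x / (2 * 1 * t * √t) * (x ^ 2 / t) := by
        gcongr
        refine h2.trans ?_
        gcongr; linarith
    _ ≤ _ := by rw [div_mul_div_comm, mul_one_div, div_le_div_iff₀ (by positivity) (by positivity)]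
                have : 0 ≤ x ^ 3 * (t ^ 2 * √t) := by positivity
                nlinarith

lemma arctan_le {u : ℝ} (hu : 0 ≤ u) : Real.arctan u ≤ u := by
  have := Real.le_tan (Real.arctan_nonneg.2 hu) (Real.arctan_lt_pi_div_two u)
  rwa [Real.tan_arctan] at this

lemma Qq_main {x ε : ℝ} (hx : 0 < x) (hε : 0 < ε) (hε1 : ε ≤ 1/2) : ∃ C ≥ 0, ∀ t ≥ 2,
    |Qop mtil qk t x + 3 / 2 * x * t ^ (-2:ℝ)| ≤ C * t ^ (-5/2+ε) := by
  obtain ⟨C1, hC1, h1⟩ := Rem_time hx hε hε1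
  have hp : 1 ≤ √π := by rw [Real.one_le_sqrt]; linarith [Real.pi_gt_three]
  refine ⟨C1 + 3 * x ^ 3 + 5 * x, by positivity, fun t ht => ?_⟩
  have ht0 : 0 < t := by linarith
  have hst : 0 < √t := by positivity
  have hsq : √t ^ 2 = t := Real.sq_sqrt ht0.le
  have hspi : √π ^ 2 = π := Real.sq_sqrt Real.pi_pos.le
  have hp3 := Real.pi_gt_three
  rw [good_qk.Qop_eq Mu_mtil ht0, mtil_mass, main_split (by linarith), Ff_val (by linarith)]
  set Q1 := ∫ s in (0:ℝ)..t, mtil s * ∫ z in Ioi (0:ℝ), Rem (t - s) x z * qk s z with hQ1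
  set u := √(t-1) with hu
  have hu1 : 1 ≤ u := by rw [hu, Real.one_le_sqrt]; linarith
  have husq : u ^ 2 = t - 1 := Real.sq_sqrt (by linarith)
  have hut : u ≤ √t := Real.sqrt_le_sqrt (by linarith)
  have hui : √t ≤ 2 * u := by nlinarith
  have hat := Real.arctan_inv_of_pos (show 0 < u by linarith)
  have hal := arctan_le (show 0 ≤ u⁻¹ by positivity)
  have ha0 := Real.arctan_nonneg.2 (show 0 ≤ u⁻¹ by positivity)
  set y := Real.arctan u⁻¹ with hy
  have ey : Real.arctan u = π / 2 - y := by linarith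
  set d := qk t x - x / (2 * √π) * t ^ (-3/2:ℝ) with hd
  have hdb := qk_fix hx ht0
  rw [← hd] at hdb
  have eq : qk t x = d + x / (2 * √π) * t ^ (-3/2:ℝ) := by rw [hd]; ring
  have key : Q1 + x * (3 / (4 * π * t)) * (2 / t * u - 4 / t * Real.arctan u) - qk t x * (3 / √π) + 3 / 2 * x * t ^ (-2:ℝ)
      = Q1 - d * (3 / √π) + x * (3 / (2 * π * t ^ 2)) * (2 * y - (√t - u)) := by
    rw [ey, eq, rp32 ht0, rp2 ht0]
    have e2 : x / (2 * √π) * (1 / (t * √t)) * (3 / √π) = x * (3 / (2 * π * t ^ 2)) * √t := by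
      field_simp; rw [hsq, hspi]; ring
    rw [add_mul, e2]; field_simp; ring
  rw [key]
  have b1 := h1 t (by linarith)
  have b2 : |d * (3 / √π)| ≤ x ^ 3 * t ^ (-5/2:ℝ) * 3 := by
    rw [abs_mul, abs_of_pos (show 0 < 3 / √π by positivity)]
    gcongr
    rw [div_le_iff₀ (by positivity)]; linarith
  have b3 : |x * (3 / (2 * π * t ^ 2)) * (2 * y - (√t - u))| ≤ 5 * x * t ^ (-5/2:ℝ) := by
    rw [abs_mul, abs_of_nonneg (by positivity : 0 ≤ x * (3 / (2 * π * t ^ 2))), rp52 ht0]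
    have c1 : u⁻¹ ≤ 2 / √t := by rw [inv_eq_one_div, div_le_div_iff₀ (by positivity) hst]; linarith
    have c2 : √t - u ≤ 1 / √t := by rw [le_div_iff₀ hst]; nlinarith
    have c3 : |2 * y - (√t - u)| ≤ 5 / √t := by
      have q1 : 2 / √t = 2 * (1 / √t) := by ring
      have q2 : 5 / √t = 5 * (1 / √t) := by ring
      rw [abs_le]; constructor <;> linarith
    have c4 : 3 / (2 * π * t ^ 2) ≤ 1 / t ^ 2 := by rw [div_le_div_iff₀ (by positivity) (by positivity)]; nlinarith [sq_nonneg t]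
    calc _ ≤ x * (1 / t ^ 2) * (5 / √t) := by gcongr
      _ = _ := by field_simp
  have b4 : t ^ (-5/2:ℝ) ≤ t ^ (-5/2+ε) := Real.rpow_le_rpow_of_exponent_le (by linarith) (by linarith)
  refine (abs_add_le _ _).trans ?_
  refine (add_le_add_left (abs_sub _ _) _).trans ?_
  calc _ ≤ C1 * t ^ (-5/2+ε) + x ^ 3 * t ^ (-5/2+ε) * 3 + 5 * x * t ^ (-5/2+ε) := by
        refine add_le_add (add_le_add b1 (b2.trans ?_)) (b3.trans ?_) <;> gcongr
    _ = _ := by ring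

lemma gk3_ab {τ : ℝ} (hτ : 0 < τ) (y : ℝ) : |gk3 τ y| ≤ 10 * |y| * τ ^ (-5/2 : ℝ) := by
  rcases le_total 0 y with h | h
  · rw [abs_of_nonneg h]; exact gk3_x hτ h
  · rw [abs_of_nonpos h, ← abs_neg, ← gk3_neg]; exact gk3_x hτ (by linarith)

lemma pk_exp {τ : ℝ} (hτ : 0 < τ) {x z : ℝ} (hx : 0 ≤ x) (hz : 0 ≤ z) :
    |pk τ x z - x * qk τ z| ≤ 20 * x ^ 3 * (z + x) * τ ^ (-5/2:ℝ) := by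
  have hd : ∀ u, HasDerivAt (fun u => pk τ u z - u * qk τ z) (-(gk1 τ (z - u) + gk1 τ (z + u) - 2 * gk1 τ z)) u := by
    intro u
    have e : (fun u => pk τ u z - u * qk τ z) = fun u => gk τ (z - u) - gk τ (z + u) + 2 * u * gk1 τ z := by
      ext u; unfold pk qk; rw [← neg_sub z u, gk_neg, add_comm u z]; ring
    rw [e]
    have h1 := (hasDerivAt_gk hτ (z - u)).comp u ((hasDerivAt_id u).const_sub z)
    have h2 := (hasDerivAt_gk hτ (z + u)).comp u ((hasDerivAt_id u).const_add z)
    have h3 := ((hasDerivAt_id u).const_mul 2).mul_const (gk1 τ z)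
    exact ((h1.sub h2).add h3).congr_deriv (by ring)
  have := mvt_bound hx (fun y _ => hd y) (M := 2 * x ^ 2 * (10 * (z + x) * τ ^ (-5/2:ℝ))) (fun y hy => by
    rw [abs_neg]
    refine (diff2 (M := 10 * (z + x) * τ ^ (-5/2:ℝ)) (hasDerivAt_gk1 hτ) (hasDerivAt_gk2 hτ) hy.1 (fun u hu => (gk3_ab hτ u).trans ?_)).trans ?_
    · gcongr
      have := hy.2
      rw [abs_le] at hu ⊢; constructor <;> linarith [hu.1, hu.2]
    have := hy.1; have := hy.2
    gcongr)
  have h0 : pk τ 0 z - 0 * qk τ z = 0 := by simp [pk, gk_neg]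
  rw [h0] at this; simp only [sub_zero] at this
  exact this.trans (le_of_eq (by ring))

lemma qk_form {t : ℝ} (ht : 0 < t) (z : ℝ) : qk t z = z / (2 * √π) * t ^ (-3/2:ℝ) * Real.exp (-(z ^ 2 / (4 * t))) := by
  rw [rp32 ht]; unfold qk gk1 gk
  rw [show 4 * π * t = 2 ^ 2 * (π * t) by ring, Real.sqrt_mul (by norm_num), Real.sqrt_sq (by norm_num), Real.sqrt_mul pi_pos.le]
  have := Real.sqrt_pos.2 ht; have := Real.sqrt_pos.2 pi_pos
  field_simp

lemma K1_exp {t : ℝ} (ht : 0 < t) {x z : ℝ} (hx : 0 < x) (hz : 0 ≤ z) :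
    |K1 t x z + x / (2 * √π) * t ^ (-3/2:ℝ) * (z * (1 - Real.exp (-(z ^ 2 / (4 * t)))))| ≤ (21 * x ^ 3 * z + 20 * x ^ 4) * t ^ (-5/2:ℝ) := by
  have h1 := pk_exp ht hx.le hz
  have h2 := mul_le_mul_of_nonneg_left (qk_fix hx ht) hz
  rw [← abs_of_nonneg hz, ← abs_mul, abs_of_nonneg hz] at h2
  have e : K1 t x z + x / (2 * √π) * t ^ (-3/2:ℝ) * (z * (1 - Real.exp (-(z ^ 2 / (4 * t))))) =
      (pk t x z - x * qk t z) - z * (qk t x - x / (2 * √π) * t ^ (-3/2:ℝ)) := by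
    rw [qk_form ht z]; unfold K1; ring
  rw [e]
  refine (abs_sub _ _).trans ((add_le_add h1 h2).trans (le_of_eq (by ring)))

lemma om_le {c z : ℝ} (hc : 0 ≤ c) : 0 ≤ 1 - Real.exp (-(c * z ^ 2)) ∧ 1 - Real.exp (-(c * z ^ 2)) ≤ 1 ∧ 1 - Real.exp (-(c * z ^ 2)) ≤ c * z ^ 2 := by
  have h := Real.add_one_le_exp (-(c * z ^ 2))
  have h2 : Real.exp (-(c * z ^ 2)) ≤ 1 := Real.exp_le_one_iff.2 (by have : 0 ≤ c * z ^ 2 := by positivity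
                                                                     linarith)
  have h3 := Real.exp_pos (-(c * z ^ 2))
  refine ⟨?_, ?_, ?_⟩ <;> linarith

lemma gam_intble {c ν : ℝ} (hc : 0 < c) (h1 : -4 < ν) (h2 : ν < -2) :
    IntegrableOn (fun z => z ^ (ν + 1) * (1 - Real.exp (-(c * z ^ 2)))) (Ioi 0) := by
  have i1 : IntegrableOn (fun z : ℝ => c * z ^ (ν + 3)) (Ioc 0 1) :=
    ((intervalIntegrable_iff_integrableOn_Ioc_of_le zero_le_one).1 (intervalIntegral.intervalIntegrable_rpow' (by linarith))).const_mul c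
  have i2 : IntegrableOn (fun z : ℝ => z ^ (ν + 1)) (Ioi 1) := integrableOn_Ioi_rpow_of_lt (by linarith) one_pos
  rw [← Ioc_union_Ioi_eq_Ioi zero_le_one]
  refine IntegrableOn.union (i1.mono' (Measurable.aestronglyMeasurable (by fun_prop)) ?_) (i2.mono' (Measurable.aestronglyMeasurable (by fun_prop)) ?_)
  · filter_upwards [ae_restrict_mem measurableSet_Ioc] with z hz
    have hz0 := hz.1
    obtain ⟨o1, o2, o3⟩ := om_le (z := z) hc.le
    rw [Real.norm_eq_abs, abs_of_nonneg (by positivity), show ν + 3 = (ν + 1) + 2 by ring, Real.rpow_add hz0 (ν + 1), Real.rpow_two]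
    calc _ ≤ z ^ (ν + 1) * (c * z ^ 2) := by gcongr
      _ = _ := by ring
  · filter_upwards [ae_restrict_mem measurableSet_Ioi] with z hz
    have hz0 : 0 < z := lt_trans one_pos hz
    obtain ⟨o1, o2, o3⟩ := om_le (z := z) hc.le
    rw [Real.norm_eq_abs, abs_of_nonneg (by positivity)]
    exact mul_le_of_le_one_right (by positivity) o2

lemma gam_val {c ν : ℝ} (hc : 0 < c) (h1 : -4 < ν) (h2 : ν < -2) :
    ∫ z in Ioi (0:ℝ), z ^ (ν + 1) * (1 - Real.exp (-(c * z ^ 2))) = -(1/2) * c ^ (-(ν/2+1)) * Real.Gamma (ν/2+1) := by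
  have hn : ν + 2 ≠ 0 := by linarith
  have i1 := gam_intble hc h1 h2
  have i2 := integrableOn_rpow_mul_exp_neg_mul_rpow (s := ν + 3) (p := 2) (b := c) (by linarith) (by norm_num) hc
  have v2 := integral_rpow_mul_exp_neg_mul_rpow (q := ν + 3) (p := 2) (b := c) (by norm_num) (by linarith) hc
  have e2 : ∀ z : ℝ, z ^ (ν + 3) * Real.exp (-c * z ^ (2:ℝ)) = z ^ (ν + 3) * Real.exp (-(c * z ^ 2)) := by
    intro z; norm_num
  simp only [e2] at i2 v2
  have key := integral_Ioi_of_hasDerivAt_of_tendsto (a := 0) (m := 0) (f := fun z => z ^ (ν + 2) / (ν + 2) * (1 - Real.exp (-(c * z ^ 2))))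
    (f' := fun z => z ^ (ν + 1) * (1 - Real.exp (-(c * z ^ 2))) + 2 * c / (ν + 2) * (z ^ (ν + 3) * Real.exp (-(c * z ^ 2)))) ?_ ?_ (i1.add (i2.const_mul _)) ?_
  · rw [integral_add i1 (i2.const_mul _), integral_const_mul, v2] at key
    simp only [Real.zero_rpow hn, zero_div, zero_mul, sub_zero] at key
    rw [show (ν + 3 + 1) / 2 = (ν / 2 + 1) + 1 by ring, Real.Gamma_add_one (by intro h; apply hn; linarith)] at key
    rw [show -(ν + 3 + 1) / 2 = -(ν/2+1) - 1 by ring, Real.rpow_sub_one hc.ne'] at key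
    have : 2 * c / (ν + 2) * (c ^ (-(ν / 2 + 1)) / c * (1 / 2) * ((ν / 2 + 1) * Real.Gamma (ν / 2 + 1))) = (1/2) * c ^ (-(ν/2+1)) * Real.Gamma (ν/2+1) := by
      field_simp
    linarith
  · have hb : ∀ z ∈ Ici (0:ℝ), ‖z ^ (ν + 2) / (ν + 2) * (1 - Real.exp (-(c * z ^ 2)))‖ ≤ c / |ν + 2| * z ^ (ν + 4) := by
      intro z hz
      rcases (mem_Ici.1 hz).eq_or_lt with h | h
      · rw [← h]; simp [Real.zero_rpow hn, Real.zero_rpow (show ν + 4 ≠ 0 by linarith)]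
      · obtain ⟨o1, o2, o3⟩ := om_le (z := z) hc.le
        rw [Real.norm_eq_abs, abs_mul, abs_div, abs_of_nonneg o1, abs_of_nonneg (a := z ^ (ν + 2)) (by positivity), show ν + 4 = (ν + 2) + 2 by ring, Real.rpow_add h (ν + 2), Real.rpow_two]
        calc _ ≤ z ^ (ν + 2) / |ν + 2| * (c * z ^ 2) := by gcongr
          _ = _ := by ring
    unfold ContinuousWithinAt
    simp only [Real.zero_rpow hn, zero_div, zero_mul]
    refine squeeze_zero_norm' (eventually_nhdsWithin_of_forall hb) ?_
    have hcn : Continuous fun z : ℝ => c / |ν + 2| * z ^ (ν + 4) := continuous_const.mul (Real.continuous_rpow_const (by linarith))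
    have := (hcn.tendsto 0).mono_left (nhdsWithin_le_nhds (s := Ici 0))
    simpa [Real.zero_rpow (show ν + 4 ≠ 0 by linarith)] using this
  · intro z hz
    have hz0 : (0:ℝ) < z := hz
    have d1 := (Real.hasDerivAt_rpow_const (x := z) (p := ν + 2) (Or.inl hz0.ne')).div_const (ν + 2)
    have d2 := (((((hasDerivAt_id z).pow 2).const_mul c).neg).exp).const_sub 1
    refine (d1.mul d2).congr_deriv ?_
    have e3 : z ^ (ν + 3) = z ^ (ν + 2) * z := by rw [← Real.rpow_add_one hz0.ne']; congr 1; ring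
    simp only [id, Pi.pow_apply, Pi.neg_apply] 
    rw [e3, show ν + 2 - 1 = ν + 1 by ring]; field_simp; norm_num; ring
  · have h0 : Tendsto (fun z : ℝ => 1 / |ν + 2| * z ^ (ν + 2)) atTop (nhds 0) := by
      have := (tendsto_rpow_neg_atTop (y := -(ν + 2)) (by linarith)).const_mul (1 / |ν + 2|)
      simpa using this
    refine squeeze_zero_norm' ?_ h0
    filter_upwards [eventually_gt_atTop 0] with z hz
    obtain ⟨o1, o2, o3⟩ := om_le (z := z) hc.le
    rw [Real.norm_eq_abs, abs_mul, abs_div, abs_of_nonneg o1, abs_of_nonneg (a := z ^ (ν + 2)) (by positivity)]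
    calc _ ≤ z ^ (ν + 2) / |ν + 2| * 1 := by gcongr
      _ = _ := by ring

lemma gam_t {t ν : ℝ} (ht : 0 < t) (h1 : -4 < ν) (h2 : ν < -2) :
    ∫ z in Ioi (0:ℝ), z ^ (ν + 1) * (1 - Real.exp (-(z ^ 2 / (4 * t)))) = -(2 ^ (ν + 1) * Real.Gamma (ν/2+1) * t ^ (1 + ν/2)) := by
  have := gam_val (c := 1 / (4 * t)) (by positivity) h1 h2
  simp only [one_div_mul_eq_div] at this
  rw [this, one_div (4 * t), Real.inv_rpow (by positivity), ← Real.rpow_neg (by positivity), neg_neg, Real.mul_rpow (by norm_num) ht.le,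
    show (4:ℝ) = 2 ^ (2:ℝ) by norm_num, ← Real.rpow_mul (by norm_num), show (2:ℝ) * (ν/2+1) = (ν + 1) + 1 by ring, Real.rpow_add_one (by norm_num), add_comm 1]
  ring

lemma Gam_neg {ν : ℝ} (h1 : -4 < ν) (h2 : ν < -2) : Real.Gamma (ν/2+1) < 0 := by
  have h := Real.Gamma_add_one (s := ν/2+1) (by linarith)
  have := Real.Gamma_pos_of_pos (s := ν/2+1+1) (by linarith)
  by_contra hh
  push Not at hh
  nlinarith

lemma J_bd {w0 : ℝ → ℝ} {W A ν δ L t : ℝ} (hm : Measurable w0) (hW : 0 ≤ W) (h1m : mm 1 w0 ≤ ENNReal.ofReal W) (hn : ∀ z > 0, 0 ≤ w0 z)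
    (hA : 0 < A) (h1 : -4 < ν) (h2 : ν < -2) (hδ : 0 < δ) (hL : 0 < L) (hLz : ∀ z ≥ L, |w0 z - A * z ^ ν| ≤ δ * z ^ ν) (ht : 0 < t) :
    |(∫ z in Ioi (0:ℝ), z * (1 - Real.exp (-(z ^ 2 / (4 * t)))) * w0 z) + A * (2 ^ (ν + 1) * Real.Gamma (ν/2+1) * t ^ (1 + ν/2))| ≤
      δ * (-(2 ^ (ν + 1) * Real.Gamma (ν/2+1) * t ^ (1 + ν/2))) + (∫ z in Ioi (0:ℝ), (Ioc 0 L).indicator (fun z => L ^ 2 * (z * w0 z) + A * z ^ (ν + 3)) z) * t⁻¹ := by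
  have hv := gam_t ht h1 h2
  have ig := gam_intble (c := 1 / (4 * t)) (by positivity) h1 h2
  simp only [one_div_mul_eq_div] at ig
  have om : ∀ z, 0 ≤ 1 - Real.exp (-(z ^ 2 / (4 * t))) ∧ 1 - Real.exp (-(z ^ 2 / (4 * t))) ≤ 1 ∧ 1 - Real.exp (-(z ^ 2 / (4 * t))) ≤ z ^ 2 / (4 * t) := by
    intro z
    have := om_le (c := 1 / (4 * t)) (z := z) (by positivity)
    simpa only [one_div_mul_eq_div] using this
  have iz : IntegrableOn (fun z => z * w0 z) (Ioi 0) := mm_int (k := 1) (q := 1) hm measurable_id zero_le_one (fun z hz => by simp [abs_of_pos hz]) h1m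
  have iJ : IntegrableOn (fun z => z * (1 - Real.exp (-(z ^ 2 / (4 * t)))) * w0 z) (Ioi 0) := by
    refine mm_int (k := 1) (q := 1) hm (by fun_prop) zero_le_one (fun z hz => ?_) h1m
    obtain ⟨o1, o2, o3⟩ := om z
    rw [abs_of_nonneg (by positivity)]; simpa using mul_le_of_le_one_right hz.le o2
  have ii : IntegrableOn ((Ioc 0 L).indicator (fun z => L ^ 2 * (z * w0 z) + A * z ^ (ν + 3))) (Ioi 0) := by
    rw [integrableOn_indicator_iff measurableSet_Ioc]
    exact (IntegrableOn.mono_set (iz.const_mul (L ^ 2)) inter_subset_right).add (IntegrableOn.mono_set (((intervalIntegrable_iff_integrableOn_Ioc_of_le hL.le).1 (intervalIntegral.intervalIntegrable_rpow' (by linarith))).const_mul A) inter_subset_left)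
  have e : (∫ z in Ioi (0:ℝ), z * (1 - Real.exp (-(z ^ 2 / (4 * t)))) * w0 z) + A * (2 ^ (ν + 1) * Real.Gamma (ν/2+1) * t ^ (1 + ν/2)) =
      ∫ z in Ioi (0:ℝ), (z * (1 - Real.exp (-(z ^ 2 / (4 * t)))) * w0 z - A * (z ^ (ν + 1) * (1 - Real.exp (-(z ^ 2 / (4 * t)))))) := by
    rw [integral_sub iJ (ig.const_mul A), integral_const_mul, hv]; ring
  rw [e, ← hv, ← integral_const_mul, ← integral_mul_const, ← integral_add (ig.const_mul δ) (ii.mul_const _), ← Real.norm_eq_abs]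
  refine norm_integral_le_of_norm_le ((ig.const_mul δ).add (ii.mul_const _)) ?_
  filter_upwards [ae_restrict_mem measurableSet_Ioi] with z hz
  have hz0 : 0 < z := hz
  obtain ⟨o1, o2, o3⟩ := om z
  have hw := hn z hz
  have e1 : z ^ (ν + 1) = z * z ^ ν := by rw [Real.rpow_add_one hz0.ne']; ring
  have e3 : z ^ (ν + 3) = z ^ 3 * z ^ ν := by rw [Real.rpow_add hz0]; norm_num; ring
  have e2 : z * (1 - Real.exp (-(z ^ 2 / (4 * t)))) * w0 z - A * (z ^ (ν + 1) * (1 - Real.exp (-(z ^ 2 / (4 * t))))) = 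
     z * (1 - Real.exp (-(z ^ 2 / (4 * t)))) * (w0 z - A * z ^ ν) := by rw [e1]; ring
  rw [e2, Real.norm_eq_abs, abs_mul, abs_of_nonneg (a := z * _) (by positivity)]
  by_cases hzL : z ≤ L
  · rw [indicator_of_mem (show z ∈ Ioc 0 L from ⟨hz0, hzL⟩)]
    have ha : |w0 z - A * z ^ ν| ≤ w0 z + A * z ^ ν := by
      refine (abs_sub _ _).trans (le_of_eq ?_)
      rw [abs_of_nonneg hw, abs_of_nonneg (by positivity)]
    have h3 : z ^ 2 / (4 * t) ≤ z ^ 2 * t⁻¹ := by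
      rw [div_eq_mul_inv]; gcongr; linarith
    calc _ ≤ z * (z ^ 2 * t⁻¹) * (w0 z + A * z ^ ν) := by gcongr; exact o3.trans h3
      _ = (z ^ 2 * (z * w0 z) + A * z ^ (ν + 3)) * t⁻¹ := by rw [e3]; ring
      _ ≤ (L ^ 2 * (z * w0 z) + A * z ^ (ν + 3)) * t⁻¹ := by gcongr
      _ ≤ _ := le_add_of_nonneg_left (by positivity)
  · rw [indicator_of_notMem (fun h => hzL h.2), zero_mul, add_zero]
    push Not at hzL
    calc _ ≤ z * (1 - Real.exp (-(z ^ 2 / (4 * t)))) * (δ * z ^ ν) := by gcongr; exact hLz z hzL.le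
      _ = _ := by rw [e1]; ring

/-- `t^a ≤ δ t^b` eventually when `a<b` -/
lemma pow_ev {a b C δ : ℝ} (h : a < b) (hδ : 0 < δ) : ∀ᶠ t : ℝ in atTop, C * t ^ a ≤ δ * t ^ b := by
  have := (tendsto_rpow_neg_atTop (y := b - a) (by linarith)).const_mul C
  rw [mul_zero] at this
  filter_upwards [this.eventually (gt_mem_nhds hδ), eventually_gt_atTop 0] with t h1 ht
  calc C * t ^ a = (C * t ^ (-(b - a))) * t ^ b := by rw [mul_assoc, ← Real.rpow_add ht]; congr 2; ring
    _ ≤ _ := by gcongr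

lemma T1 {w0 : ℝ → ℝ} {W A ν x δ : ℝ} (hm : Measurable w0) (hW : 0 ≤ W) (h0m : mm 0 w0 ≤ ENNReal.ofReal W) (h1m : mm 1 w0 ≤ ENNReal.ofReal W) (hn : ∀ z > 0, 0 ≤ w0 z)
    (hA : 0 < A) (h1 : -4 < ν) (h2 : ν < -2) (hl : ∀ δ > 0, ∃ L > 0, ∀ z ≥ L, |w0 z - A * z ^ ν| ≤ δ * z ^ ν) (hx : 0 < x) (hδ : 0 < δ) :
    ∀ᶠ t in atTop, |(∫ z in Ioi (0:ℝ), K1 t x z * w0 z) - x / (2 * √π) * t ^ (-3/2:ℝ) * (A * (2 ^ (ν + 1) * Real.Gamma (ν/2+1) * t ^ (1 + ν/2)))| ≤ δ * (t ^ (-3/2:ℝ) * t ^ (1 + ν/2)) := by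
  have hG := Gam_neg h1 h2
  have hp := Real.sqrt_pos.2 pi_pos
  set G := -(2 ^ (ν + 1) * Real.Gamma (ν/2+1)) with hGd
  have hG0 : 0 < G := by rw [hGd, neg_pos]; exact mul_neg_of_pos_of_neg (by positivity) hG
  set c := x / (2 * √π) with hcd
  have hc : 0 < c := by positivity
  obtain ⟨L, hL, hLz⟩ := hl (δ / (3 * c * G)) (by positivity)
  set D := ∫ z in Ioi (0:ℝ), (Ioc 0 L).indicator (fun z => L ^ 2 * (z * w0 z) + A * z ^ (ν + 3)) z with hD
  set E := ((21 * x ^ 3) * ∫ z in Ioi (0:ℝ), z * w0 z) + 20 * x ^ 4 * ∫ z in Ioi (0:ℝ), w0 z with hE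
  have iz : IntegrableOn (fun z => z * w0 z) (Ioi 0) := mm_int (k := 1) (q := 1) hm measurable_id zero_le_one (fun z hz => by simp [abs_of_pos hz]) h1m
  have i0 := mm0_int hm h0m
  filter_upwards [pow_ev (a := -1) (b := 1 + ν/2) (C := D) (δ := δ / (3 * c)) (by linarith) (by positivity),
    pow_ev (a := -1) (b := 1 + ν/2) (C := E) (δ := δ / 3) (by linarith) (by positivity), eventually_gt_atTop 0] with t e1 e2 ht
  have hJ := J_bd hm hW h1m hn hA h1 h2 (by positivity) hL hLz ht
  rw [← hD] at hJ
  rw [Real.rpow_neg_one] at e1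
  have iJ : IntegrableOn (fun z => z * (1 - Real.exp (-(z ^ 2 / (4 * t)))) * w0 z) (Ioi 0) := by
    refine mm_int (k := 1) (q := 1) hm (by fun_prop) zero_le_one (fun z hz => ?_) h1m
    have := om_le (c := 1 / (4 * t)) (z := z) (by positivity)
    simp only [one_div_mul_eq_div] at this
    obtain ⟨o1, o2, o3⟩ := this
    rw [abs_of_nonneg (by positivity)]; simpa using mul_le_of_le_one_right hz.le o2
  have iE : IntegrableOn (fun z => (21 * x ^ 3) * (z * w0 z) + 20 * x ^ 4 * w0 z) (Ioi 0) := (iz.const_mul _).add (i0.const_mul _)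
  have ptw : ∀ z > 0, |K1 t x z * w0 z + c * t ^ (-3/2:ℝ) * (z * (1 - Real.exp (-(z ^ 2 / (4 * t)))) * w0 z)| ≤ ((21 * x ^ 3) * (z * w0 z) + 20 * x ^ 4 * w0 z) * t ^ (-5/2:ℝ) := by
    intro z hz
    have := mul_le_mul_of_nonneg_right (K1_exp ht hx hz.le) (hn z hz)
    rw [← abs_of_nonneg (hn z hz), ← abs_mul, abs_of_nonneg (hn z hz)] at this
    refine le_trans (le_of_eq ?_) (this.trans (le_of_eq ?_)) 
    · congr 1; ring
    · ring
  have isum : IntegrableOn (fun z => K1 t x z * w0 z + c * t ^ (-3/2:ℝ) * (z * (1 - Real.exp (-(z ^ 2 / (4 * t)))) * w0 z)) (Ioi 0) := by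
    refine (iE.mul_const (t ^ (-5/2:ℝ))).mono' (Measurable.aestronglyMeasurable (by unfold K1; fun_prop)) ?_
    filter_upwards [ae_restrict_mem measurableSet_Ioi] with z hz using ptw z hz
  have iK : IntegrableOn (fun z => K1 t x z * w0 z) (Ioi 0) := by
    have := isum.sub (iJ.const_mul (c * t ^ (-3/2:ℝ)))
    refine this.congr (Eventually.of_forall fun z => ?_)
    simp
  have hK : |(∫ z in Ioi (0:ℝ), K1 t x z * w0 z) + c * t ^ (-3/2:ℝ) * ∫ z in Ioi (0:ℝ), z * (1 - Real.exp (-(z ^ 2 / (4 * t)))) * w0 z| ≤ E * t ^ (-5/2:ℝ) := by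
    rw [← integral_const_mul, ← integral_add iK (iJ.const_mul _), hE, ← integral_const_mul, ← integral_const_mul, ← integral_add (iz.const_mul _) (i0.const_mul _), ← integral_mul_const, ← Real.norm_eq_abs]
    refine norm_integral_le_of_norm_le (iE.mul_const _) ?_
    filter_upwards [ae_restrict_mem measurableSet_Ioi] with z hz using ptw z hz
  set J := ∫ z in Ioi (0:ℝ), z * (1 - Real.exp (-(z ^ 2 / (4 * t)))) * w0 z
  set I := ∫ z in Ioi (0:ℝ), K1 t x z * w0 z
  set T := t ^ (1 + ν/2)
  have hT : 0 < T := by positivity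
  have h32 : (0:ℝ) < t ^ (-3/2:ℝ) := by positivity
  have e5 : t ^ (-5/2:ℝ) = t ^ (-3/2:ℝ) * t ^ (-1:ℝ) := (rpa ht (by norm_num)).symm
  have k1 : I - c * t ^ (-3/2:ℝ) * (A * (2 ^ (ν + 1) * Real.Gamma (ν/2+1) * T)) = (I + c * t ^ (-3/2:ℝ) * J) - c * t ^ (-3/2:ℝ) * (J + A * (2 ^ (ν + 1) * Real.Gamma (ν/2+1) * T)) := by ring
  rw [k1]
  refine (abs_sub _ _).trans ?_
  rw [abs_mul, abs_of_pos (show 0 < c * t ^ (-3/2:ℝ) by positivity)]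
  have k2 : |J + A * (2 ^ (ν + 1) * Real.Gamma (ν/2+1) * T)| ≤ δ / (3 * c) * T + δ / (3 * c) * T := by
    refine hJ.trans (add_le_add (le_of_eq ?_) e1)
    rw [show -(2 ^ (ν + 1) * Real.Gamma (ν/2+1) * T) = G * T by rw [hGd]; ring]; field_simp
  calc _ ≤ E * t ^ (-5/2:ℝ) + c * t ^ (-3/2:ℝ) * (δ / (3 * c) * T + δ / (3 * c) * T) := by gcongr
    _ = t ^ (-3/2:ℝ) * (E * t ^ (-1:ℝ)) + t ^ (-3/2:ℝ) * (2 * δ / 3 * T) := by rw [e5]; field_simp; ring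
    _ ≤ t ^ (-3/2:ℝ) * (δ / 3 * T) + t ^ (-3/2:ℝ) * (2 * δ / 3 * T) := by gcongr
    _ = _ := by ring

section
variable {κ Cμ W : ℝ} {w0 μ : ℝ → ℝ} {w : ℝ → ℝ → ℝ}

lemma Sys.Minf_mono {C' W' : ℝ} {w0' μ' : ℝ → ℝ} {w' : ℝ → ℝ → ℝ} (S : Sys κ Cμ W w0 μ w) (S' : Sys κ C' W' w0' μ' w')
    (h : ∀ t ≥ 1, ∀ x > 0, w' t x ≤ w t x) : Minf w0' μ' w' ≤ Minf w0 μ w := by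
  by_contra hh
  push Not at hh
  obtain ⟨C1, hC1, h1⟩ := S.e_sup
  obtain ⟨C2, hC2, h2⟩ := S'.e_sup
  set D := Minf w0' μ' w' - Minf w0 μ w with hD
  have hD0 : 0 < D := by linarith
  set c := 1 / (2 * √π) * Real.exp (-(1/4)) with hc
  have hc0 : 0 < c := by positivity
  obtain ⟨t, ht, ht1⟩ := ((pow_ev (a := -1-κ) (b := -1) (C := C1 + C2) (δ := D * c / 2) (by linarith [S.κ0]) (by positivity)).and (eventually_ge_atTop 1)).exists
  have ht0 : 0 < t := by linarith
  have hs : 0 < √t := by positivity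
  have e : qk t (√t) = c * t ^ (-1:ℝ) := by
    rw [qk_form ht0, Real.sq_sqrt ht0.le, rp32 ht0, hc, Real.rpow_neg_one, show t / (4 * t) = 1/4 by field_simp]
    field_simp
  have a1 := abs_le.1 (h1 t ht1 _ hs)
  have a2 := abs_le.1 (h2 t ht1 _ hs)
  have a3 := h t ht1 _ hs
  unfold ee at a1 a2
  rw [e] at a1 a2
  have : 0 < D * c * t ^ (-1:ℝ) := by positivity
  have e2 : D * c * t ^ (-1:ℝ) = Minf w0' μ' w' * (c * t ^ (-1:ℝ)) - Minf w0 μ w * (c * t ^ (-1:ℝ)) := by rw [hD]; ring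
  have e3 : (C1 + C2) * t ^ (-1-κ) = C1 * t ^ (-1-κ) + C2 * t ^ (-1-κ) := by ring
  linarith [a1.1, a1.2, a2.1, a2.2]

lemma Sys.Minf_pos (S : Sys κ Cμ W w0 μ w) {T L : ℝ} (hT : 0 ≤ T) (hμ : ∀ s > T, 0 ≤ μ s) (hL : T * Cμ < L)
    (h0 : ∀ z > 0, z < L → w0 z = 0) (hw : ∀ s > 0, ∫ z in Ioi (0:ℝ), w s z ≤ ∫ z in Ioi (0:ℝ), w0 z) (hp : 0 < ∫ z in Ioi (0:ℝ), w0 z) : 0 < Minf w0 μ w := by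
  obtain ⟨A, G⟩ := S.good
  set I := ∫ z in Ioi (0:ℝ), w0 z with hI
  have hi := G.int_f S.mu
  have iz : IntegrableOn (fun z => z * w0 z) (Ioi 0) := mm_int (k := 1) (q := 1) S.w0m measurable_id zero_le_one (fun z hz => by simp [abs_of_pos hz]) S.w01
  have i0 := mm0_int S.w0m S.w00
  have h1 : L * I ≤ ∫ z in Ioi (0:ℝ), z * w0 z := by
    rw [hI, ← integral_const_mul]
    refine setIntegral_mono_on (i0.const_mul _) iz measurableSet_Ioi fun z hz => ?_
    have hz0 : 0 < z := hz
    by_cases h : z < L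
    · rw [h0 z hz0 h]; simp
    · push Not at h
      have := S.w0n z hz0
      gcongr
  have h2 : -(T * Cμ * I) ≤ ∫ s in Ioi (0:ℝ), μ s * ∫ z in Ioi (0:ℝ), w s z := by
    rw [show (∫ s in Ioi (0:ℝ), μ s * ∫ z in Ioi (0:ℝ), w s z) = ∫ s in Ioc 0 T ∪ Ioi T, μ s * ∫ z in Ioi (0:ℝ), w s z by rw [Ioc_union_Ioi_eq_Ioi hT], setIntegral_union (Ioc_disjoint_Ioi le_rfl) measurableSet_Ioi (hi.mono_set Ioc_subset_Ioi_self) (hi.mono_set (Ioi_subset_Ioi hT))]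
    have p1 : 0 ≤ ∫ s in Ioi T, μ s * ∫ z in Ioi (0:ℝ), w s z :=
      setIntegral_nonneg measurableSet_Ioi fun s hs => mul_nonneg (hμ s hs) (integral_nonneg fun z => S.wn s z)
    have p2 : |∫ s in Ioc 0 T, μ s * ∫ z in Ioi (0:ℝ), w s z| ≤ Cμ * I * T := by
      rw [← Real.norm_eq_abs]
      have := norm_setIntegral_le_of_norm_le_const (μ := volume) (s := Ioc 0 T) (C := Cμ * I) (f := fun s => μ s * ∫ z in Ioi (0:ℝ), w s z) (by simp) (fun s hs => ?_)
      · simpa [hT] using this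
      · have hC := S.hC
        have := hs.1
        rw [norm_mul, Real.norm_eq_abs, Real.norm_eq_abs, abs_of_nonneg (a := ∫ z in Ioi (0:ℝ), w s z) (integral_nonneg fun z => S.wn s z)]
        gcongr
        · exact integral_nonneg fun z => S.wn s z
        · exact (S.μb s hs.1.le).trans (div_le_self S.hC (by linarith))
        · exact hw s hs.1
    have := (abs_le.1 p2).1
    linarith
  have : 0 < (L - T * Cμ) * I := mul_pos (by linarith) hp
  unfold Minf
  linarith

lemma Sys.expand (S : Sys κ Cμ W w0 μ w) {A ν η Cd x : ℝ} (hA : 0 < A) (h1 : -4 < ν) (h2 : ν < -2)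
    (hl : ∀ δ > 0, ∃ L > 0, ∀ z ≥ L, |w0 z - A * z ^ ν| ≤ δ * z ^ ν) (hκ : -(1 + ν/2) - 1/2 < κ)
    (hη : 0 < η) (hη1 : η < 1/2) (hCd : 0 ≤ Cd) (hμ : ∀ s ≥ 0, |μ s - mtil s| ≤ Cd * (1 + s) ^ (-1-η)) (hx : 0 < x) :
    ∃ C ≥ 0, ∀ δ > 0, ∀ᶠ t in atTop, |w t x - x * t ^ (-3/2:ℝ) * (Minf w0 μ w / (2 * √π) * (1 - 3 * √π / √t) + A / (2 * √π) * (2 ^ (ν + 1) * Real.Gamma (ν/2+1)) * t ^ (1 + ν/2))| ≤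
      t ^ (-3/2:ℝ) * (δ * t ^ (1 + ν/2) + C * t ^ (-(1/2)-η)) := by
  obtain ⟨Aw, G⟩ := S.good
  set M := Minf w0 μ w with hM
  set ε1 := min (1/2) ((κ + 1/2 + (1 + ν/2))/2) with he1
  have q1 : 0 < ε1 := lt_min (by norm_num) (by linarith)
  have q2 : ε1 ≤ (κ + 1/2 + (1 + ν/2))/2 := min_le_right _ _
  set ε2 := min (1/2) ((2 + ν/2)/2) with he2
  have q3 : 0 < ε2 := lt_min (by norm_num) (by linarith)
  have q4 : ε2 ≤ (2 + ν/2)/2 := min_le_right _ _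
  obtain ⟨Ca, hCa, ha⟩ := S.Qe hx q1 (min_le_left _ _)
  obtain ⟨Cb, hCb, hb⟩ := Qq_main hx q3 (min_le_left _ _)
  obtain ⟨Cc, hCc, hc⟩ := Qq_small (μ := fun s => μ s - mtil s) (S.μm.sub Mu_mtil.m) hCd hη hη1 hμ hx
  have M2 : Mu (Cμ + 3) (fun s => μ s - mtil s) := ⟨by linarith [S.hC], S.μm.sub Mu_mtil.m, fun s hs => by
    refine (abs_sub _ _).trans ((add_le_add (S.μb s hs) (Mu_mtil.b s hs)).trans (le_of_eq (by ring)))⟩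
  refine ⟨|M| * Cc, by positivity, fun δ hδ => ?_⟩
  filter_upwards [eventually_ge_atTop 2, T1 (δ := δ/4) S.w0m S.hW S.w00 S.w01 S.w0n hA h1 h2 hl hx (by positivity),
    pow_ev (a := -2-κ+ε1) (b := -3/2+(1+ν/2)) (C := Ca) (δ := δ/4) (by linarith) (by positivity),
    pow_ev (a := -5/2+ε2) (b := -3/2+(1+ν/2)) (C := |M| * Cb) (δ := δ/4) (by linarith) (by positivity),
    pow_ev (a := -5/2) (b := -3/2+(1+ν/2)) (C := |M| * x ^ 3) (δ := δ/4) (by linarith) (by positivity)] with t ht t1 p1 p2 p3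
  have ht0 : 0 < t := by linarith
  have e1 := S.e_eq ht0 hx
  have e2 : Qop μ (ee w0 μ w) t x = Qop μ w t x - M * Qop μ qk t x := G.Qop_comb good_qk S.mu M ht0 x
  have e3 := good_qk.Qop_mu S.mu Mu_mtil M2 ht0 x
  have f1 := qk_fix hx ht0
  have f2 := ha t (by linarith)
  have f3 := hb t ht
  have f4 := hc t (by linarith)
  have key : w t x - x * t ^ (-3/2:ℝ) * (M / (2 * √π) * (1 - 3 * √π / √t) + A / (2 * √π) * (2 ^ (ν + 1) * Real.Gamma (ν/2+1)) * t ^ (1 + ν/2)) =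
      ((∫ z in Ioi (0:ℝ), K1 t x z * w0 z) - x / (2 * √π) * t ^ (-3/2:ℝ) * (A * (2 ^ (ν + 1) * Real.Gamma (ν/2+1) * t ^ (1 + ν/2)))) +
      M * (qk t x - x / (2 * √π) * t ^ (-3/2:ℝ)) + Qop μ (ee w0 μ w) t x + M * (Qop mtil qk t x + 3 / 2 * x * t ^ (-2:ℝ)) + M * Qop (fun s => μ s - mtil s) qk t x := by
    have e4 : w t x = ee w0 μ w t x + M * qk t x := by unfold ee; ring
    have e5 : x * t ^ (-3/2:ℝ) * (M / (2 * √π) * (1 - 3 * √π / √t)) = M * (x / (2 * √π) * t ^ (-3/2:ℝ)) - M * (3/2 * x * t ^ (-2:ℝ)) := by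
      have hs : t = √t ^ 2 := (Real.sq_sqrt ht0.le).symm
      have hs0 : 0 < √t := by positivity
      have hp0 : 0 < √π := Real.sqrt_pos.2 pi_pos
      rw [rp32 ht0, rp2 ht0]; set s := √t; rw [hs]; field_simp
    rw [e4, e1, e2, mul_add, e5, e3]
    ring
  rw [key]
  have g1 : |M * (qk t x - x / (2 * √π) * t ^ (-3/2:ℝ))| ≤ δ/4 * t ^ (-3/2+(1+ν/2)) := by
    rw [abs_mul]; exact (mul_le_mul_of_nonneg_left f1 (abs_nonneg M)).trans (by rw [← mul_assoc]; exact p3)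
  have g3 : |M * (Qop mtil qk t x + 3 / 2 * x * t ^ (-2:ℝ))| ≤ δ/4 * t ^ (-3/2+(1+ν/2)) := by
    rw [abs_mul]; exact (mul_le_mul_of_nonneg_left f3 (abs_nonneg M)).trans (by rw [← mul_assoc]; exact p2)
  have g4 : |M * Qop (fun s => μ s - mtil s) qk t x| ≤ |M| * Cc * t ^ (-2-η) := by
    rw [abs_mul, mul_assoc]; gcongr
  rw [mul_add (t ^ (-3/2:ℝ)), show t ^ (-3/2:ℝ) * (δ * t ^ (1 + ν/2)) = δ * (t ^ (-3/2:ℝ) * t ^ (1 + ν/2)) by ring,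
    show t ^ (-3/2:ℝ) * (|M| * Cc * t ^ (-(1/2)-η)) = |M| * Cc * (t ^ (-3/2:ℝ) * t ^ (-(1/2)-η)) by ring, rpa ht0 (show -3/2 + (-(1/2)-η) = -2-η by ring)]
  rw [← rpa ht0 (rfl : (-3/2:ℝ) + (1+ν/2) = _)] at p1 g1 g3
  refine (abs_add_le _ _).trans ((add_le_add ((abs_add_le _ _).trans (add_le_add ((abs_add_le _ _).trans (add_le_add ((abs_add_le _ _).trans (add_le_add t1 g1)) (f2.trans p1))) g3)) g4).trans (le_of_eq (by ring)))
end

lemma rder {r r1 r2 : ℝ → ℝ} {T C η : ℝ} (hη : 0 < η) (hT : 1 ≤ T) (hC : 0 ≤ C)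
    (h1 : ∀ t ≥ T, HasDerivAt r (r1 t) t) (h2 : ∀ t ≥ T, HasDerivAt r1 (r2 t) t)
    (h3 : ∀ t ≥ T, |r2 t| ≤ C * t ^ (-2-η)) (hr : Tendsto r atTop (nhds 0)) :
    ∀ t ≥ T, r1 t ≤ C * t ^ (-1-η) := by
  have hd : ∀ t ≥ T, HasDerivAt (fun t => r1 t - C * t ^ (-1-η)) (r2 t - C * ((-1-η) * t ^ (-1-η-1))) t := fun t ht =>
    (h2 t ht).sub ((Real.hasDerivAt_rpow_const (Or.inl (by linarith))).const_mul C)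
  have hmono : MonotoneOn (fun t => r1 t - C * t ^ (-1-η)) (Ici T) := by
    refine monotoneOn_of_hasDerivWithinAt_nonneg (f' := fun t => r2 t - C * ((-1-η) * t ^ (-1-η-1))) (convex_Ici T) (fun t ht => (hd t ht).continuousAt.continuousWithinAt)
      (fun t ht => (hd t (interior_subset ht)).hasDerivWithinAt) (fun t ht => ?_)
    have ht := interior_subset ht
    have ht0 : 0 < t := by have : T ≤ t := ht; linarith
    have a := neg_abs_le (r2 t)
    have b := h3 t ht
    have e : -1-η-1 = -2-η := by ring
    have c : 0 ≤ C * (η * t ^ (-2-η)) := by positivity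
    rw [e]; nlinarith
  intro t ht
  by_contra hcon
  push Not at hcon
  set ε := r1 t - C * t ^ (-1-η) with hε
  have hε0 : 0 < ε := by rw [hε]; linarith
  have hge : ∀ u ≥ t, ε ≤ r1 u := fun u hu => by
    have := hmono ht (ht.trans hu) hu
    have h0 : 0 < u := by linarith
    have : 0 ≤ C * u ^ (-1-η) := by positivity
    simp only at *; linarith
  have hs : Tendsto (fun u => r (u+1) - r u) atTop (nhds 0) := by
    simpa using (hr.comp (tendsto_atTop_add_const_right _ (1:ℝ) tendsto_id)).sub hr
  obtain ⟨u, hu1, hu2⟩ := ((hs.eventually (gt_mem_nhds hε0)).and (eventually_ge_atTop t)).exists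
  obtain ⟨c, hc, hc2⟩ := exists_hasDerivAt_eq_slope r r1 (show u < u+1 by linarith)
    (fun y hy => (h1 y (by linarith [hy.1])).continuousAt.continuousWithinAt) (fun y hy => h1 y (by linarith [hy.1]))
  have := hge c (by linarith [hc.1])
  rw [hc2] at this
  simp at this; linarith

lemma gk_mm0 {s : ℝ} (hs : 0 < s) (c y : ℝ) : mm 0 (fun x => gk s (x + c - y)) ≤ 1 := by
  have h1 : ∫⁻ x, ENNReal.ofReal (gk s (x + c - y)) = 1 := by
    rw [← ofReal_integral_eq_lintegral_ofReal, integral_gk_shift hs, ENNReal.ofReal_one]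
    · have := (integrable_gk hs).comp_add_right (c - y)
      simpa [add_sub_assoc] using this
    · exact Eventually.of_forall fun x => gk_nonneg _ _
  rw [← h1]
  refine le_trans ?_ (setLIntegral_le_lintegral (Ioi 0) _)
  refine lintegral_mono fun x => ?_
  rw [Real.rpow_zero, one_mul, abs_of_nonneg (gk_nonneg _ _)]

lemma gk_mmp {s p : ℝ} (hs : 0 < s) (hp : 0 ≤ p) (c : ℝ) {y : ℝ} (hy : 0 < y) : mm p (fun x => gk s (x + c - y)) ≤
    ENNReal.ofReal (10 * cE p * 2 ^ p * y ^ p + 10 * cE p * (s ^ (p/2) + 2 ^ p * |c| ^ p) * y ^ (0:ℝ)) := by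
  have hc := cE_pos hp
  have hge : ∀ u, 0 ≤ ge s u := fun u => by unfold ge; positivity
  have h := lint_le (K := fun x => gk s (x + c - y)) (p := p) (c := 10 * s ^ (-1/2:ℝ)) (by positivity) (fun x hx => by
    refine (gkb hs _).trans (mul_le_mul_of_nonneg_left (b := ge s (x + c - y)) (c := ge s (x - |y - c|) + ge s (x + |y - c|)) ?_ (by positivity))
    rcases le_total 0 (y - c) with h | h
    · rw [abs_of_nonneg h, show x + c - y = x - (y - c) by ring]; linarith [hge (x + (y - c))]
    · rw [abs_of_nonpos h, show x + c - y = x + -(y - c) by ring]; linarith [hge (x - -(y - c))]) (ge_mom2 hp hs (abs_nonneg (y - c)))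
  refine h.trans (ENNReal.ofReal_le_ofReal ?_)
  have e1 : s ^ (-1/2:ℝ) * s ^ ((p+1)/2) = s ^ (p/2) := by rw [← Real.rpow_add hs]; congr 1; ring
  have e2 : s ^ (-1/2:ℝ) * s ^ (1/2:ℝ) = 1 := by rw [← Real.rpow_add hs]; norm_num
  have e3 : |y - c| ^ p ≤ 2 ^ p * (y ^ p + |c| ^ p) :=
    le_trans (Real.rpow_le_rpow (abs_nonneg _) (by simpa [abs_of_pos hy] using abs_sub y c) hp) (add_rpow_le hy.le (abs_nonneg c) hp)
  calc 10 * s ^ (-1/2:ℝ) * (cE p * (s ^ ((p+1)/2) + |y - c| ^ p * s ^ (1/2:ℝ))) =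
      10 * cE p * (s ^ (-1/2:ℝ) * s ^ ((p+1)/2) + |y - c| ^ p * (s ^ (-1/2:ℝ) * s ^ (1/2:ℝ))) := by ring
    _ = 10 * cE p * (s ^ (p/2) + |y - c| ^ p) := by rw [e1, e2, mul_one]
    _ ≤ 10 * cE p * (s ^ (p/2) + 2 ^ p * (y ^ p + |c| ^ p)) := by gcongr
    _ = _ := by rw [Real.rpow_zero]; ring

section
variable {Ω : Type*} [MeasurableSpace Ω] {P : Measure Ω} [IsProbabilityMeasure P] {B : ℝ → Ω → ℝ}
    (hB : IsBrownianMotion P B) {h0 m μ : ℝ → ℝ} (hm0 : m 0 = 0) (hm : Continuous m)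
    (hmeas : Measurable h0) {C : ℝ} (hC : ∀ x, |h0 x| ≤ C) (hn : ∀ x, 0 ≤ h0 x)
include hB hm0 hm hmeas hC hn

lemma wI_mm0 (hi : IntegrableOn (fun z => Real.exp z * h0 z) (Ioi 0)) {s : ℝ} (hs : 0 < s) :
    mm 0 (wI P B h0 m s) ≤ mm 0 (fun z => Real.exp z * h0 z) := by
  have h1 : ∀ z > 0, |wI P B h0 m s z| ≤ |∫ y in Ioi (0:ℝ), gk s (z + (m s - 2 * s) - y) * (Real.exp y * h0 y)| := fun z hz => by
    rw [abs_of_nonneg (wI_nonneg hn s z)]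
    exact (wI_free hB hm0 hm hmeas hC hn hi hs z).trans (le_abs_self _)
  refine (mm_mono h1).trans ?_
  have := ker_mm (K := fun x z => gk s (x + (m s - 2 * s) - z)) (f := fun z => Real.exp z * h0 z) (q := 0) (k1 := 1) (q1 := 0) (k2 := 0) (q2 := 0)
    (by fun_prop) (by fun_prop) zero_le_one le_rfl (fun z hz => by simpa using gk_mm0 hs (m s - 2 * s) z)
  simpa using this

lemma mkSys {κ Cμ Cl : ℝ} (hκ : 0 < κ) (hκ1 : κ < 1/2) (hCμ : 0 ≤ Cμ) (hCl : 0 ≤ Cl)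
    (hl : ∀ s, HasDerivAt (fun u => m u - 2 * u) (-μ s) s) (hμ : Continuous μ)
    (hμb : ∀ s ≥ 0, |μ s| ≤ Cμ / (1 + s)) (hlb : ∀ s > 0, |m s - 2 * s| ≤ Cl * (1 + s ^ (1/2:ℝ)))
    (f0 : mm 0 (fun z => Real.exp z * h0 z) ≠ ⊤) (f1 : mm 1 (fun z => Real.exp z * h0 z) ≠ ⊤)
    (fp : mm (1 + 2 * κ) (fun z => Real.exp z * h0 z) ≠ ⊤) :
    ∃ W, Sys κ Cμ W (fun z => Real.exp z * h0 z) μ (wI P B h0 m) := by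
  set w0 : ℝ → ℝ := fun z => Real.exp z * h0 z with hw0
  have hw0m : Measurable w0 := by fun_prop
  have hw0n : ∀ z, 0 ≤ w0 z := fun z => mul_nonneg (Real.exp_pos _).le (hn z)
  set W0 := (mm 0 w0).toReal + (mm 1 w0).toReal + (mm (1 + 2 * κ) w0).toReal with hW0
  have n0 : 0 ≤ (mm 0 w0).toReal := ENNReal.toReal_nonneg
  have n1 : 0 ≤ (mm 1 w0).toReal := ENNReal.toReal_nonneg
  have np : 0 ≤ (mm (1 + 2 * κ) w0).toReal := ENNReal.toReal_nonneg
  have g0 : mm 0 w0 ≤ ENNReal.ofReal W0 := ENNReal.le_ofReal_iff_toReal_le f0 (by positivity) |>.2 (by linarith)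
  have g1 : mm 1 w0 ≤ ENNReal.ofReal W0 := ENNReal.le_ofReal_iff_toReal_le f1 (by positivity) |>.2 (by linarith)
  have gp : mm (1 + 2 * κ) w0 ≤ ENNReal.ofReal W0 := ENNReal.le_ofReal_iff_toReal_le fp (by positivity) |>.2 (by linarith)
  have hW0n : 0 ≤ W0 := by positivity
  have hi : IntegrableOn w0 (Ioi 0) := mm0_int hw0m g0
  have hIntg : ∫ z in Ioi (0:ℝ), w0 z ≤ W0 := by
    have := (mm0_abs (f := w0)).trans g0
    exact (le_abs_self _).trans ((ENNReal.ofReal_le_ofReal_iff hW0n).1 this)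
  set p := 1 + 2 * κ with hp
  have hp0 : 0 ≤ p := by positivity
  have hc := cE_pos hp0
  set D := 10 * cE p * (2 ^ p + 1 + 2 ^ p * (Cl ^ p * 2 ^ p)) with hD
  have hD0 : 0 ≤ D := by positivity
  have hWW : W0 ≤ W0 * (1 + D) := by nlinarith [mul_nonneg hW0n hD0]
  have hle := ENNReal.ofReal_le_ofReal hWW
  refine ⟨W0 * (1 + D), hκ, hκ1, hCμ, by positivity, hμ.measurable, hμb, hw0m, wI_meas hB hm0 hm hmeas hC, g0.trans hle, g1.trans hle, gp.trans hle,
    fun z _ => hw0n z, wI_nonneg hn, fun t ht x hx => duhamel hB hm0 hmeas hC hn hi hl hμ ht hx,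
    fun s hs => (wI_mm0 hB hm0 hm hmeas hC hn hi hs).trans (g0.trans hle), fun s hs z hz => ?_, fun s hs => ?_⟩
  · refine (wI_free hB hm0 hm hmeas hC hn hi hs z).trans ((free_le hs _ hw0m hw0n hi).trans ?_)
    rw [mul_comm]; gcongr; exact hIntg.trans hWW
  · have h1 : ∀ z > 0, |wI P B h0 m s z| ≤ |∫ y in Ioi (0:ℝ), gk s (z + (m s - 2 * s) - y) * (Real.exp y * h0 y)| := fun z hz => by
      rw [abs_of_nonneg (wI_nonneg hn s z)]
      exact (wI_free hB hm0 hm hmeas hC hn hi hs z).trans (le_abs_self _)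
    refine (mm_mono h1).trans ?_
    refine (ker_mm (K := fun x z => gk s (x + (m s - 2 * s) - z)) (f := w0) (q := p) (k1 := 10 * cE p * 2 ^ p) (q1 := p)
      (k2 := 10 * cE p * (s ^ (p/2) + 2 ^ p * |m s - 2 * s| ^ p)) (q2 := 0)
      (by fun_prop) hw0m (by positivity) (by positivity) (fun z hz => gk_mmp hs hp0 _ hz)).trans ?_
    refine (ofR2 (by positivity) (by positivity) hW0n hW0n gp g0).trans (ENNReal.ofReal_le_ofReal ?_)
    have e : s ^ (1/2 + κ) = s ^ (p/2) := by congr 1; rw [hp]; ring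
    rw [e]
    have e2 : |m s - 2 * s| ^ p ≤ Cl ^ p * (2 ^ p * (1 + s ^ (p/2))) := by
      refine (Real.rpow_le_rpow (abs_nonneg _) (hlb s hs) hp0).trans ?_
      rw [Real.mul_rpow hCl (by positivity)]
      gcongr
      refine (add_rpow_le zero_le_one (by positivity) hp0).trans (le_of_eq ?_)
      rw [Real.one_rpow, ← Real.rpow_mul hs.le, show 1/2 * p = p/2 by ring]
    have q0 : 0 ≤ s ^ (p/2) := by positivity
    have q1 : (0:ℝ) ≤ 2 ^ p := by positivity
    calc 10 * cE p * 2 ^ p * W0 + 10 * cE p * (s ^ (p/2) + 2 ^ p * |m s - 2 * s| ^ p) * W0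
        ≤ 10 * cE p * 2 ^ p * W0 + 10 * cE p * (s ^ (p/2) + 2 ^ p * (Cl ^ p * (2 ^ p * (1 + s ^ (p/2))))) * W0 := by gcongr
      _ ≤ 10 * cE p * (2 ^ p * (1 + s ^ (p/2))) * W0 + 10 * cE p * ((1 + s ^ (p/2)) + 2 ^ p * (Cl ^ p * (2 ^ p * (1 + s ^ (p/2))))) * W0 := by
          gcongr
          · nlinarith
          · linarith
      _ = W0 * D * (1 + s ^ (p/2)) := by rw [hD]; ring
      _ ≤ _ := by gcongr; linarith

lemma wI_mass (hi : IntegrableOn (fun z => Real.exp z * h0 z) (Ioi 0)) {s : ℝ} (hs : 0 < s) :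
    ∫ z in Ioi (0:ℝ), wI P B h0 m s z ≤ ∫ z in Ioi (0:ℝ), Real.exp z * h0 z := by
  have hw0n : ∀ z, 0 ≤ Real.exp z * h0 z := fun z => mul_nonneg (Real.exp_pos _).le (hn z)
  have h1 := (mm0_abs (f := wI P B h0 m s)).trans (wI_mm0 hB hm0 hm hmeas hC hn hi hs)
  have h2 : mm 0 (fun z => Real.exp z * h0 z) = ENNReal.ofReal (∫ z in Ioi (0:ℝ), Real.exp z * h0 z) := by
    rw [ofReal_integral_eq_lintegral_ofReal hi (Eventually.of_forall hw0n)]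
    unfold mm
    refine lintegral_congr fun z => ?_
    rw [Real.rpow_zero, one_mul, abs_of_nonneg (hw0n z)]
  rw [h2, ENNReal.ofReal_le_ofReal_iff (integral_nonneg hw0n)] at h1
  exact (le_abs_self _).trans h1

lemma wI_mono {h0' : ℝ → ℝ} (hmeas' : Measurable h0') {C' : ℝ} (hC' : ∀ x, |h0' x| ≤ C') (hn' : ∀ x, 0 ≤ h0' x)
    (hle : ∀ x, h0' x ≤ h0 x) (hi : IntegrableOn (fun z => Real.exp z * h0 z) (Ioi 0)) {s z : ℝ} (hs : 0 < s) (hz : 0 < z) :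
    wI P B h0' m s z ≤ wI P B h0 m s z := by
  refine le_of_tendsto_of_tendsto (wI_tendsto hB hm0 hm hmeas' hC' hs one_pos hz.ne') (wI_tendsto hB hm0 hm hmeas hC hs one_pos hz.ne')
    (Eventually.of_forall fun n => ?_)
  have hlm : Measurable (fun u => m u - 2 * u) := by have := hm.measurable; fun_prop
  have hwm : Measurable (fun z => Real.exp z * h0 z) := by fun_prop
  have hd : (0:ℝ) < 1 / (n + 1) := by positivity
  have hw' : ∀ z, 0 ≤ Real.exp z * h0' z := fun z => mul_nonneg (Real.exp_pos _).le (hn' z)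
  have step : ∀ (k : ℕ) (τ c : ℝ), 0 < τ → (∀ y, vk (fun u => m u - 2 * u) (fun z => Real.exp z * h0' z) (1 / (n + 1)) k y ≤
      vk (fun u => m u - 2 * u) (fun z => Real.exp z * h0 z) (1 / (n + 1)) k y) →
      (∫ y in Ioi (0:ℝ), gk τ (c - y) * vk (fun u => m u - 2 * u) (fun z => Real.exp z * h0' z) (1 / (n + 1)) k y) ≤
      ∫ y in Ioi (0:ℝ), gk τ (c - y) * vk (fun u => m u - 2 * u) (fun z => Real.exp z * h0 z) (1 / (n + 1)) k y := by
    intro k τ c hτ hk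
    refine integral_mono_of_nonneg (Eventually.of_forall fun y => mul_nonneg (gk_nonneg _ _) (vk_nonneg hw' k y)) ?_
      (Eventually.of_forall fun y => mul_le_mul_of_nonneg_left (hk y) (gk_nonneg _ _))
    refine (vk_intOn hlm hwm hi hd k).bdd_mul (c := τ ^ (-1/2:ℝ)) (Measurable.aestronglyMeasurable (by fun_prop)) (Eventually.of_forall fun y => ?_)
    rw [Real.norm_eq_abs, abs_of_nonneg (gk_nonneg _ _)]; exact gk_le_rpow hτ _
  have hvk : ∀ k y, vk (fun u => m u - 2 * u) (fun z => Real.exp z * h0' z) (1 / (n + 1)) k y ≤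
      vk (fun u => m u - 2 * u) (fun z => Real.exp z * h0 z) (1 / (n + 1)) k y := by
    intro k
    induction k with
    | zero => exact fun y => mul_le_mul_of_nonneg_left (hle y) (Real.exp_pos _).le
    | succ k ih => exact fun y => step k _ _ (sub_pos.2 (step_pos hd k)) ih
  exact step _ _ _ (sub_pos.2 (kidx_lt hd hs)) (hvk _)
end

lemma w0_mom {w0 : ℝ → ℝ} {L D E ν q : ℝ} (hm : Measurable w0) (hL : 0 < L) (hq : 0 ≤ q) (hν : ν + q < -1)
    (h1 : ∀ z > 0, z ≤ L → |w0 z| ≤ D) (h2 : ∀ z ≥ L, |w0 z| ≤ E * z ^ ν) : mm q w0 ≠ ⊤ := by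
  have hi : IntegrableOn (fun z => z ^ q * |w0 z|) (Ioi 0) := by
    rw [← Ioc_union_Ioi_eq_Ioi hL.le]
    refine IntegrableOn.union ?_ ?_
    · refine Measure.integrableOn_of_bounded (M := L ^ q * D) (by simp) (Measurable.aestronglyMeasurable (by fun_prop)) ?_
      filter_upwards [ae_restrict_mem measurableSet_Ioc] with z hz
      have hz0 := hz.1
      rw [Real.norm_eq_abs, abs_mul, abs_abs, abs_of_nonneg (by positivity)]
      exact mul_le_mul (Real.rpow_le_rpow hz0.le hz.2 hq) (h1 z hz.1 hz.2) (abs_nonneg _) (by positivity)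
    · refine ((integrableOn_Ioi_rpow_of_lt hν hL).const_mul E).mono' (Measurable.aestronglyMeasurable (by fun_prop)) ?_
      filter_upwards [ae_restrict_mem measurableSet_Ioi] with z hz
      have hz0 : 0 < z := hL.trans hz
      rw [Real.norm_eq_abs, abs_mul, abs_abs, abs_of_nonneg (by positivity), Real.rpow_add hz0]
      calc z ^ q * |w0 z| ≤ z ^ q * (E * z ^ ν) := by gcongr; exact h2 z (le_of_lt hz)
        _ = _ := by ring
  have := hi.hasFiniteIntegral
  unfold HasFiniteIntegral at this
  refine ne_of_lt (lt_of_le_of_lt (le_of_eq ?_) this)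
  unfold mm
  refine setLIntegral_congr_fun measurableSet_Ioi fun z hz => ?_
  have hz0 : 0 < z := hz
  simp only
  rw [Real.enorm_eq_ofReal_abs, abs_mul, abs_abs, abs_of_nonneg (a := z ^ q) (by positivity)]

lemma bdry {m r : ℝ → ℝ} {a η : ℝ} (hη : 0 < η) (hmC2 : ContDiff ℝ 2 m)
    (hm_eq : ∀ t, m t = 2 * t - (3/2) * Real.log (t + 1) + a + r t) (hrlim : Tendsto r atTop (nhds 0))
    (hr'' : (fun t => deriv (deriv r) t) =O[atTop] fun t => t ^ (-2 - η)) :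
    ∃ μ : ℝ → ℝ, Continuous μ ∧ (∀ s, HasDerivAt (fun u => m u - 2 * u) (-μ s) s) ∧ (∃ Cl ≥ 0, ∀ s > 0, |m s - 2 * s| ≤ Cl * (1 + s ^ (1/2:ℝ))) ∧
      (∃ Cμ ≥ 0, ∀ s ≥ 0, |μ s| ≤ Cμ / (1 + s)) ∧ (∃ T ≥ 0, ∀ s > T, 0 ≤ μ s) ∧
      ∀ η1 > 0, η1 ≤ η → η1 ≤ 1 → ∃ Cd ≥ 0, ∀ s ≥ 0, |μ s - mtil s| ≤ Cd * (1 + s) ^ (-1-η1) := by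
  have hmd : Differentiable ℝ m := hmC2.differentiable (by norm_num)
  have hdm : ContDiff ℝ 1 (deriv m) := ((contDiff_succ_iff_deriv (n := 1)).1 (by simpa [one_add_one_eq_two] using hmC2)).2.2
  have hdd : Differentiable ℝ (deriv m) := hdm.differentiable (by norm_num)
  have hdc : Continuous (deriv m) := hdm.continuous
  obtain ⟨C', hC'⟩ := hr''.bound
  obtain ⟨T0, hT0⟩ := eventually_atTop.1 (hC'.and (hrlim.eventually (Metric.ball_mem_nhds 0 one_pos)))
  set T := max T0 1 with hT
  have hT1 : 1 ≤ T := le_max_right _ _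
  set C := max C' 0 with hCdef
  have hC0 : 0 ≤ C := le_max_right _ _
  set r1 : ℝ → ℝ := fun t => deriv m t - 2 + 3/2 * (t+1)⁻¹ with hr1
  have hre : r = fun t => m t - 2 * t + 3/2 * Real.log (t+1) - a := by ext t; rw [hm_eq t]; ring
  have d1 : ∀ t > -1, HasDerivAt r (r1 t) t := fun t ht => by
    rw [hre]
    have := ((Real.hasDerivAt_log (x := t + 1) (by linarith)).comp t ((hasDerivAt_id t).add_const 1)).const_mul (3/2)
    exact ((((hmd t).hasDerivAt.sub ((hasDerivAt_id t).const_mul 2)).add this).sub_const a).congr_deriv (by simp [hr1])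
  have d2 : ∀ t > -1, HasDerivAt r1 (deriv (deriv r) t) t := fun t ht => by
    have e : deriv r =ᶠ[nhds t] r1 := by
      filter_upwards [Ioi_mem_nhds ht] with u hu using (d1 u hu).deriv
    rw [e.deriv_eq]
    refine DifferentiableAt.hasDerivAt ?_
    have : t + 1 ≠ 0 := by linarith
    have h1 := hdd t
    exact (h1.sub_const 2).add (DifferentiableAt.const_mul (DifferentiableAt.fun_inv (h := fun t : ℝ => t + 1) (z := t) (by fun_prop) this) _)
  have d3 : ∀ t ≥ T, |deriv (deriv r) t| ≤ C * t ^ (-2-η) := fun t ht => by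
    have := (hT0 t ((le_max_left _ _).trans ht)).1
    have ht0 : 0 < t := by linarith
    rw [Real.norm_eq_abs, Real.norm_eq_abs, abs_of_nonneg (a := t ^ (-2-η)) (by positivity)] at this
    refine this.trans ?_
    gcongr; exact le_max_left _ _
  have b1 := rder hη hT1 hC0 (fun t ht => d1 t (by linarith)) (fun t ht => d2 t (by linarith)) d3 hrlim
  have b2 := rder hη hT1 hC0 (fun t ht => (d1 t (by linarith)).neg) (fun t ht => (d2 t (by linarith)).neg) (by simpa using d3) (neg_zero (G := ℝ) ▸ hrlim.neg)
  have b3 : ∀ t ≥ T, |r1 t| ≤ C * t ^ (-1-η) := fun t ht => abs_le.2 ⟨by linarith [b2 t ht], b1 t ht⟩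
  set μ : ℝ → ℝ := fun s => 2 - deriv m s with hμ
  have hμc : Continuous μ := by fun_prop
  have hμe : ∀ s, μ s = 3/2 * (s+1)⁻¹ - r1 s := fun s => by simp only [hμ, hr1]; ring
  obtain ⟨K1, hK1⟩ := (isCompact_Icc (a := (0:ℝ)) (b := T)).exists_bound_of_continuousOn hμc.continuousOn
  obtain ⟨K2, hK2⟩ := (isCompact_Icc (a := (0:ℝ)) (b := T)).exists_bound_of_continuousOn (f := fun s => m s - 2 * s) (by have := hmd.continuous; fun_prop)
  have hK1n : 0 ≤ K1 := (norm_nonneg _).trans (hK1 0 ⟨le_rfl, by linarith⟩)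
  have hK2n : 0 ≤ K2 := (norm_nonneg _).trans (hK2 0 ⟨le_rfl, by linarith⟩)
  refine ⟨μ, hμc, fun s => ((hmd s).hasDerivAt.sub ((hasDerivAt_id s).const_mul 2)).congr_deriv (by simp [hμ]), ⟨K2 + 3 + |a| + 1, by positivity, fun s hs => ?_⟩,
    ⟨K1 * (1 + T) + (3/2 + 2 * C), by positivity, fun s hs => ?_⟩, ?_, fun η1 h0 h1 h2 => ?_⟩
  · have hs2 : 0 ≤ s ^ (1/2:ℝ) := by positivity
    have ha := abs_nonneg a
    rcases le_total s T with h | h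
    · have := hK2 s ⟨hs.le, h⟩
      rw [Real.norm_eq_abs] at this; nlinarith
    · have h3 := (hT0 s ((le_max_left _ _).trans h)).2
      rw [dist_zero_right, Real.norm_eq_abs] at h3
      have h4 : Real.log (s+1) ≤ 2 * s ^ (1/2:ℝ) := by
        have e : s + 1 ≤ (1 + s ^ (1/2:ℝ))^2 := by
          have : s ^ (1/2:ℝ) * s ^ (1/2:ℝ) = s := by rw [← Real.rpow_add hs]; norm_num
          nlinarith
        have := (Real.log_le_log (by linarith) e)
        rw [Real.log_pow] at this
        have := Real.log_le_sub_one_of_pos (show 0 < 1 + s ^ (1/2:ℝ) by positivity)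
        push_cast at *; linarith
      have h5 : 0 ≤ Real.log (s+1) := Real.log_nonneg (by linarith)
      have h6 := abs_lt.1 h3
      have h7 := neg_abs_le a
      have h8 := le_abs_self a
      rw [hm_eq s]
      refine abs_le.2 ⟨?_, ?_⟩ <;> nlinarith
  · rw [le_div_iff₀ (by linarith)]
    rcases le_total s T with h | h
    · have := hK1 s ⟨hs, h⟩
      rw [Real.norm_eq_abs] at this
      have h2 : |μ s| * (1 + s) ≤ K1 * (1 + T) := by gcongr
      linarith
    · have hs0 : 0 < s := by linarith
      have hT' : 0 ≤ K1 * (1 + T) := by positivity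
      rw [hμe s]
      have e1 : |3/2 * (s+1)⁻¹ - r1 s| ≤ 3/2 * (s+1)⁻¹ + C * s ^ (-1-η) :=
        (abs_sub _ _).trans (add_le_add (le_of_eq (abs_of_nonneg (by positivity))) (b3 s h))
      have e2 : s ^ (-1-η) ≤ s⁻¹ := by
        rw [← Real.rpow_neg_one]; exact Real.rpow_le_rpow_of_exponent_le (by linarith) (by linarith)
      calc |3/2 * (s+1)⁻¹ - r1 s| * (1 + s) ≤ (3/2 * (s+1)⁻¹ + C * s⁻¹) * (1 + s) := by
            gcongr; exact e1.trans (by gcongr)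
        _ = 3/2 + C * (1 + s⁻¹) := by field_simp; ring
        _ ≤ 3/2 + C * 2 := by
            have : s⁻¹ ≤ 1 := inv_le_one_of_one_le₀ (by linarith)
            gcongr; linarith
        _ ≤ _ := by linarith
  · obtain ⟨T1, h⟩ := eventually_atTop.1 (pow_ev (C := C) (show -1-η < -1 by linarith) (show (0:ℝ) < 3/4 by norm_num))
    refine ⟨max T T1, by positivity, fun s hs => ?_⟩
    have hsT : T < s := (le_max_left _ _).trans_lt hs
    have h1 := h s ((le_max_right _ _).trans hs.le)
    have h2 := (abs_le.1 (b3 s hsT.le)).2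
    have h3 : 3/4 * s ^ (-1:ℝ) ≤ 3/2 * (s+1)⁻¹ := by
      rw [Real.rpow_neg_one]
      have : (2 * s)⁻¹ ≤ (s+1)⁻¹ := inv_anti₀ (by linarith) (by linarith)
      rw [mul_inv] at this; linarith
    rw [hμe s]; linarith
  · have hTp : 0 ≤ (K1 + 3/2) * (1 + T) ^ (1+η1) := by positivity
    refine ⟨(K1 + 3/2) * (1 + T) ^ (1+η1) + (3 + C * 2 ^ (1 + η1)), by positivity, fun s hs => ?_⟩
    have hs1 : 0 < 1 + s := by linarith
    rcases le_total s T with h | h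
    · have e1 : |μ s - mtil s| ≤ K1 + 3/2 := by
        refine (abs_sub _ _).trans (add_le_add (by simpa using hK1 s ⟨hs, h⟩) ?_)
        unfold mtil; split_ifs with hh
        · rw [abs_of_nonneg (by positivity), div_le_div_iff₀ (by positivity) (by norm_num)]; linarith
        · norm_num
      have e2 : 1 ≤ (1 + T) ^ (1+η1) * (1 + s) ^ (-1-η1) := by
        have : (1 + s) ^ (1+η1) ≤ (1 + T) ^ (1+η1) := by gcongr
        calc (1:ℝ) = (1 + s) ^ (1+η1) * (1 + s) ^ (-1-η1) := by rw [← Real.rpow_add hs1]; ring_nf; simp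
          _ ≤ _ := by gcongr
      have e3 : 0 ≤ (3 + C * 2 ^ (1 + η1)) * (1 + s) ^ (-1-η1) := by positivity
      calc |μ s - mtil s| ≤ (K1 + 3/2) * 1 := by linarith
        _ ≤ (K1 + 3/2) * ((1 + T) ^ (1+η1) * (1 + s) ^ (-1-η1)) := by gcongr
        _ ≤ _ := by rw [add_mul _ (3 + C * 2 ^ (1 + η1))]; linarith
    · have hs0 : 0 < s := by linarith
      have e0 : s ^ (-1-η1) ≤ 2 ^ (1+η1) * (1 + s) ^ (-1-η1) := by
        have : (1 + s) ^ (1+η1) ≤ (2 * s) ^ (1+η1) := by gcongr; linarith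
        rw [Real.mul_rpow (by norm_num) hs0.le] at this
        rw [show -1-η1 = -(1+η1) by ring, Real.rpow_neg hs0.le, Real.rpow_neg hs1.le, ← div_eq_mul_inv, ← one_div, div_le_div_iff₀ (by positivity) (by positivity)]
        linarith
      have e1 : |r1 s| ≤ C * (2 ^ (1+η1) * (1 + s) ^ (-1-η1)) := by
        refine (b3 s h).trans ?_
        gcongr
        exact (Real.rpow_le_rpow_of_exponent_le (by linarith) (by linarith)).trans e0
      have e2 : |3/2 * (s+1)⁻¹ - mtil s| ≤ 3 * (1 + s) ^ (-1-η1) := by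
        unfold mtil; rw [if_pos (by linarith)]
        have : 3/2 * (s+1)⁻¹ - 3 / (2 * s) = -(3 / (2 * s * (1 + s))) := by field_simp; ring
        rw [this, abs_neg, abs_of_nonneg (by positivity)]
        have h5 : 3 / (2 * s * (1 + s)) ≤ 3 * (1 + s) ^ (-2:ℝ) := by
          rw [Real.rpow_neg hs1.le, ← div_eq_mul_inv]
          gcongr
          rw [show (2:ℝ) = ((2:ℕ):ℝ) by norm_num, Real.rpow_natCast]; push_cast; nlinarith
        refine h5.trans ?_
        gcongr
        · linarith
        · linarith
      have e3 : μ s - mtil s = (3/2 * (s+1)⁻¹ - mtil s) - r1 s := by rw [hμe]; ring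
      have e4 : 0 ≤ (K1 + 3/2) * (1 + T) ^ (1+η1) * (1 + s) ^ (-1-η1) := by positivity
      rw [e3]
      refine (abs_sub _ _).trans ?_
      rw [add_mul, add_mul]
      linarith

lemma fin_alg {α b k c r u y ρ σ T E ε : ℝ} (hα : 0 ≤ α) (hb : 0 ≤ b) (hk : 0 ≤ k) (hc : 0 ≤ c) (hu0 : 0 ≤ u) (hu : u ≤ 1) (hT : 0 ≤ T)
    (hy : u ^ 2 = y) (hr : |r| ≤ 1) (h1 : |ρ - 1 + r| ≤ r ^ 2) (h2 : |σ - 1| ≤ 3 * y) (hε : 2 * |r| + 9 * y ≤ ε) :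
    |ρ * σ * (α * (1 - k * u) - b * T + c * E) - α * (1 - r - k * u) + b * T| ≤
      α * (1 + 2 * k) * r ^ 2 + α * (9 + 10 * k) * y + b * ε * T + 12 * c * |E| := by
  have hy0 : 0 ≤ y := by rw [← hy]; positivity
  have hy1 : y ≤ 1 := by rw [← hy]; nlinarith
  have hr2 : r ^ 2 ≤ |r| := by rw [← sq_abs]; nlinarith [abs_nonneg r]
  have hρ : |ρ| ≤ 3 := by
    have := abs_add_le (ρ - 1 + r) (1 - r)
    have h := abs_sub (1:ℝ) r
    rw [show ρ - 1 + r + (1 - r) = ρ by ring] at this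
    rw [abs_one] at h; linarith
  set ζ := ρ * σ - 1 + r with hζ
  have hζb : |ζ| ≤ r ^ 2 + 9 * y := by
    have e : ζ = (ρ - 1 + r) + ρ * (σ - 1) := by rw [hζ]; ring
    rw [e]
    refine (abs_add_le _ _).trans (add_le_add h1 ?_)
    rw [abs_mul]
    calc |ρ| * |σ - 1| ≤ 3 * (3 * y) := by gcongr
      _ = 9 * y := by ring
  have hd : |ρ * σ - 1| ≤ ε := by
    have e : ρ * σ - 1 = ζ - r := by rw [hζ]; ring
    rw [e]; have := abs_sub ζ r; linarith
  have hρσ : |ρ * σ| ≤ 12 := by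
    rw [abs_mul]
    have : |σ| ≤ 4 := by
      have := abs_add_le (σ - 1) 1
      rw [sub_add_cancel, abs_one] at this; linarith
    calc |ρ| * |σ| ≤ 3 * 4 := by gcongr
      _ = 12 := by norm_num
  have hru : |r| * u ≤ r ^ 2 + y := by rw [← hy, ← sq_abs r]; nlinarith [sq_nonneg (|r| - u), sq_nonneg (|r|), sq_nonneg u]
  have e : ρ * σ * (α * (1 - k * u) - b * T + c * E) - α * (1 - r - k * u) + b * T =
      α * (k * (r * u)) + α * (ζ * (1 - k * u)) - b * T * (ρ * σ - 1) + c * (ρ * σ * E) := by rw [hζ]; ring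
  rw [e]
  have t1 : |α * (k * (r * u))| ≤ α * (k * (r ^ 2 + y)) := by
    rw [abs_mul, abs_mul, abs_mul, abs_of_nonneg hα, abs_of_nonneg hk, abs_of_nonneg hu0]; gcongr
  have t2 : |α * (ζ * (1 - k * u))| ≤ α * ((r ^ 2 + 9 * y) * (1 + k)) := by
    rw [abs_mul, abs_mul, abs_of_nonneg hα]
    have : |1 - k * u| ≤ 1 + k := by
      have : 0 ≤ k * u := by positivity
      have : k * u ≤ k := by nlinarith
      exact abs_le.2 ⟨by linarith, by linarith⟩
    gcongr
  have t3 : |b * T * (ρ * σ - 1)| ≤ b * T * ε := by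
    rw [abs_mul, abs_of_nonneg (by positivity)]; gcongr
  have t4 : |c * (ρ * σ * E)| ≤ c * (12 * |E|) := by
    rw [abs_mul, abs_mul, abs_of_nonneg hc]; gcongr
  have s1 := abs_add_le (α * (k * (r * u)) + α * (ζ * (1 - k * u)) - b * T * (ρ * σ - 1)) (c * (ρ * σ * E))
  have s2 := abs_sub (α * (k * (r * u)) + α * (ζ * (1 - k * u))) (b * T * (ρ * σ - 1))
  have s3 := abs_add_le (α * (k * (r * u))) (α * (ζ * (1 - k * u)))
  linarith

lemma fin_sig {t : ℝ} (ht : 1 ≤ t) : |(t+1) ^ (3/2:ℝ) * t ^ (-3/2:ℝ) - 1| ≤ 3 * t⁻¹ := by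
  have ht0 : 0 < t := by linarith
  have hi : t⁻¹ ≤ 1 := inv_le_one_of_one_le₀ ht
  have hi0 : 0 < t⁻¹ := by positivity
  have e : (t+1) ^ (3/2:ℝ) * t ^ (-3/2:ℝ) = (1 + t⁻¹) ^ (3/2:ℝ) := by
    rw [show (-3/2:ℝ) = -(3/2) by norm_num, Real.rpow_neg ht0.le, ← Real.inv_rpow ht0.le, ← Real.mul_rpow (by positivity) (by positivity)]
    congr 1; field_simp
  have h1 : 1 ≤ (1 + t⁻¹) ^ (3/2:ℝ) := Real.one_le_rpow (by linarith) (by norm_num)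
  have h2 : (1 + t⁻¹) ^ (3/2:ℝ) ≤ (1 + t⁻¹) ^ (2:ℝ) := Real.rpow_le_rpow_of_exponent_le (by linarith) (by norm_num)
  rw [show (2:ℝ) = ((2:ℕ):ℝ) by norm_num, Real.rpow_natCast] at h2
  rw [e, abs_of_nonneg (by linarith)]; push_cast at h2; nlinarith

set_option maxHeartbeats 2000000 in
theorem stmt5 {Ω : Type*} [MeasurableSpace Ω] (P : Measure Ω) [IsProbabilityMeasure P]
    (B : ℝ → Ω → ℝ) (hB : IsBrownianMotion P B)
    (ν A : ℝ) (hν₁ : -4 < ν) (hν₂ : ν < -2) (hA : 0 < A)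
    (h₀ : ℝ → ℝ) (h₀meas : Measurable h₀) (h₀bdd : ∃ C, ∀ x, |h₀ x| ≤ C)
    (h₀nn : ∀ x, 0 ≤ h₀ x) (h₀ne : ¬ (h₀ =ᵐ[volume] 0))
    (h₀asym : Tendsto (fun x => h₀ x / (A * x ^ ν * Real.exp (-x))) atTop (nhds 1))
    (a η : ℝ) (hη : 0 < η)
    (m r : ℝ → ℝ) (hmC2 : ContDiff ℝ 2 m)
    (hm_eq : ∀ t, m t = 2 * t - (3/2) * Real.log (t + 1) + a + r t)
    (hr0 : r 0 = -a) (hrlim : Tendsto r atTop (nhds 0))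
    (hr'' : (fun t => deriv (deriv r) t) =O[atTop] fun t => t ^ (-2 - η))
    (b : ℝ)
    (hb_def : b = -(A * Real.exp (-a) / (2 * Real.sqrt π)) * 2 ^ (ν + 1) *
      Real.Gamma (ν/2 + 1)) :
    0 < b ∧
    ∃ α > 0, ∀ x ≥ 0, ∃ R : ℝ → ℝ,
      (∀ t > 0, fkppSol P B h₀ m (m t + x) t =
        x * Real.exp (-x) *
          (α * (1 - r t - 3 * Real.sqrt π / Real.sqrt t) - b * t ^ (1 + ν/2) + R t)) ∧
      ∀ δ > 0, ∃ C > 0, ∃ t₀ : ℝ, ∀ t ≥ t₀,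
        |R t| ≤ δ * t ^ (1 + ν/2) + C * (t ^ (-(1/2) - η) + r t ^ 2) := by
  have hG := Gam_neg hν₁ hν₂
  have hπ : 0 < √π := Real.sqrt_pos.2 Real.pi_pos
  have hbpos : 0 < b := by
    rw [hb_def]
    have : 0 < A * Real.exp (-a) / (2 * √π) * 2 ^ (ν + 1) := by positivity
    nlinarith
  refine ⟨hbpos, ?_⟩
  obtain ⟨C0, hC0⟩ := h₀bdd
  have hC0n : 0 ≤ C0 := (abs_nonneg _).trans (hC0 0)
  have hm0 : m 0 = 0 := by rw [hm_eq 0, hr0]; simp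
  have hm : Continuous m := hmC2.continuous
  obtain ⟨μ, hμc, hμd, ⟨Cl, hCl, hlb⟩, ⟨Cμ, hCμ, hμb⟩, ⟨T, hT, hμT⟩, hdiff⟩ := bdry hη hmC2 hm_eq hrlim hr''
  set κ := -(1 + ν/2)/2 with hκd
  have hκ0 : 0 < κ := by rw [hκd]; linarith
  have hκ1 : κ < 1/2 := by rw [hκd]; linarith
  set w0 : ℝ → ℝ := fun z => Real.exp z * h₀ z with hw0
  have hw0m : Measurable w0 := by fun_prop
  have hw0n : ∀ z, 0 ≤ w0 z := fun z => mul_nonneg (Real.exp_pos _).le (h₀nn z)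
  have hl : ∀ δ > 0, ∃ L > 0, ∀ z ≥ L, |w0 z - A * z ^ ν| ≤ δ * z ^ ν := by
    intro δ hδ
    obtain ⟨L, hL⟩ := eventually_atTop.1 (h₀asym.eventually (Metric.ball_mem_nhds 1 (show 0 < δ / A by positivity)))
    refine ⟨max L 1, by positivity, fun z hz => ?_⟩
    have hz0 : 0 < z := by linarith [le_max_right L 1]
    have h := hL z ((le_max_left _ _).trans hz)
    rw [Real.dist_eq] at h
    have hzν : 0 < z ^ ν := by positivity
    have e : w0 z - A * z ^ ν = A * z ^ ν * (h₀ z / (A * z ^ ν * Real.exp (-z)) - 1) := by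
      simp only [hw0]; rw [Real.exp_neg]; field_simp
    rw [e, abs_mul, abs_of_pos (by positivity)]
    calc A * z ^ ν * |h₀ z / (A * z ^ ν * Real.exp (-z)) - 1| ≤ A * z ^ ν * (δ / A) := by gcongr
      _ = _ := by field_simp
  obtain ⟨L0, hL0, hL0b⟩ := hl (A/2) (by positivity)
  have mom : ∀ q, 0 ≤ q → ν + q < -1 → mm q w0 ≠ ⊤ := fun q hq hq1 =>
    w0_mom (L := L0) (D := Real.exp L0 * C0) (E := 2 * A) hw0m hL0 hq hq1 (fun z hz hzL => by
      rw [abs_of_nonneg (hw0n z)]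
      exact mul_le_mul (Real.exp_le_exp.2 hzL) ((le_abs_self _).trans (hC0 z)) (h₀nn z) (Real.exp_pos _).le) (fun z hz => by
      have h := (abs_le.1 (hL0b z hz)).2
      have : 0 < z ^ ν := Real.rpow_pos_of_pos (by linarith) _
      rw [abs_of_nonneg (hw0n z)]; nlinarith)
  have f0 := mom 0 le_rfl (by linarith)
  have f1 := mom 1 zero_le_one (by linarith)
  have fp := mom (1 + 2 * κ) (by positivity) (by rw [hκd]; linarith)
  obtain ⟨W, S⟩ := mkSys hB hm0 hm h₀meas hC0 h₀nn hκ0 hκ1 hCμ hCl hμd hμc hμb hlb f0 f1 fp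
  have hi : IntegrableOn w0 (Ioi 0) := mm0_int hw0m S.w00
  -- positivity of the limit mass
  have hMpos : 0 < Minf w0 μ (wI P B h₀ m) := by
    set L := T * Cμ + 1 with hLd
    have hLp : 0 < L := by positivity
    set h1 : ℝ → ℝ := (Ici L).indicator h₀ with hh1
    have h1m : Measurable h1 := h₀meas.indicator measurableSet_Ici
    have h1n : ∀ x, 0 ≤ h1 x := fun x => indicator_nonneg (fun _ _ => h₀nn _) x
    have h1le : ∀ x, h1 x ≤ h₀ x := fun x => indicator_le_self' (fun _ _ => h₀nn _) x
    have h1C : ∀ x, |h1 x| ≤ C0 := fun x => by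
      rw [abs_of_nonneg (h1n x)]; exact (h1le x).trans ((le_abs_self _).trans (hC0 x))
    have hw1n : ∀ z, 0 ≤ Real.exp z * h1 z := fun z => mul_nonneg (Real.exp_pos _).le (h1n z)
    have hmm : ∀ q, mm q (fun z => Real.exp z * h1 z) ≤ mm q w0 := fun q => mm_mono fun z _ => by
      rw [abs_of_nonneg (hw1n z), abs_of_nonneg (hw0n z)]
      exact mul_le_mul_of_nonneg_left (h1le z) (Real.exp_pos _).le
    obtain ⟨W1, S1⟩ := mkSys hB hm0 hm h1m h1C h1n hκ0 hκ1 hCμ hCl hμd hμc hμb hlb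
      (ne_top_of_le_ne_top f0 (hmm 0)) (ne_top_of_le_ne_top f1 (hmm 1)) (ne_top_of_le_ne_top fp (hmm _))
    have hi1 : IntegrableOn (fun z => Real.exp z * h1 z) (Ioi 0) := mm0_int (by fun_prop) S1.w00
    refine lt_of_lt_of_le (S1.Minf_pos (L := L) hT hμT (by linarith) (fun z hz hzL => ?_) (fun s hs => wI_mass hB hm0 hm h1m h1C h1n hi1 hs) ?_)
      (S.Minf_mono S1 fun t ht x hx => wI_mono hB hm0 hm h₀meas hC0 h₀nn h1m h1C h1n h1le hi (by linarith) hx)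
    · simp only [hh1]; rw [indicator_of_notMem (by simpa using hzL), mul_zero]
    · rw [setIntegral_pos_iff_support_of_nonneg_ae (Eventually.of_forall hw1n) hi1]
      refine lt_of_lt_of_le (by simp : (0:ENNReal) < volume (Ioi (max L L0))) (measure_mono fun z hz => ?_)
      have hz1 : L < z := (le_max_left _ _).trans_lt hz
      have hz2 : L0 < z := (le_max_right _ _).trans_lt hz
      refine ⟨?_, hLp.trans hz1⟩
      rw [Function.mem_support]
      have h := (abs_le.1 (hL0b z hz2.le)).1
      have : 0 < z ^ ν := Real.rpow_pos_of_pos (by linarith) _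
      have h3 : 0 < w0 z := by nlinarith
      have h4 : h1 z = h₀ z := indicator_of_mem (show z ∈ Ici L from hz1.le) _
      rw [h4]; exact h3.ne'
  set M := Minf w0 μ (wI P B h₀ m) with hM
  set α := Real.exp (-a) * M / (2 * √π) with hα
  have hαp : 0 < α := by positivity
  refine ⟨α, hαp, fun x hx => ?_⟩
  rcases hx.lt_or_eq with hx | hx
  swap
  · refine ⟨0, fun t ht => ?_, fun δ hδ => ⟨1, one_pos, 1, fun t ht => ?_⟩⟩
    · rw [← hx, fkpp_nonpos hB ht.le le_rfl]; simp
    · have : 0 < t := by linarith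
      simp only [Pi.zero_apply, abs_zero]; positivity
  refine ⟨fun t => fkppSol P B h₀ m (m t + x) t / (x * Real.exp (-x)) - α * (1 - r t - 3 * √π / √t) + b * t ^ (1 + ν/2), fun t ht => ?_, fun δ hδ => ?_⟩
  · have := Real.exp_pos (-x)
    field_simp; ring
  set η1 := min η κ with hη1
  have hη10 : 0 < η1 := lt_min hη hκ0
  have hη1κ : η1 ≤ κ := min_le_right _ _
  obtain ⟨Cd, hCd, hdb⟩ := hdiff η1 hη10 (min_le_left _ _) (by linarith)
  obtain ⟨C1, hC1, hexp⟩ := S.expand hA hν₁ hν₂ hl (by rw [hκd]; linarith) hη10 (by linarith) hCd hdb hx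
  set c := Real.exp (-a) with hc
  have hc0 : 0 < c := Real.exp_pos _
  set k := 3 * √π with hk
  have hk0 : 0 < k := by positivity
  refine ⟨α * (1 + 2 * k) + 12 * c / x * C1, by positivity, ?_⟩
  have E1 := hexp (δ / 4 * x / (12 * c)) (by positivity)
  have E2 := pow_ev (C := α * (9 + 10 * k)) (show (-1:ℝ) < 1 + ν/2 by linarith) (show 0 < δ / 4 by positivity)
  have E3 := pow_ev (C := 12 * c / x * C1) (show -(1/2) - κ < 1 + ν/2 by rw [hκd]; linarith) (show 0 < δ / 4 by positivity)
  have E4 : ∀ᶠ t in atTop, 2 * |r t| + 9 * t⁻¹ < δ / (4 * b) := by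
    have h1 : Tendsto (fun t => 2 * |r t| + 9 * t⁻¹) atTop (nhds (2 * |0| + 9 * 0)) :=
      (hrlim.abs.const_mul 2).add (tendsto_inv_atTop_zero.const_mul 9)
    refine h1.eventually (gt_mem_nhds ?_)
    simp; positivity
  have E5 : ∀ᶠ t in atTop, |r t| < 1 := by
    have := hrlim.abs; rw [abs_zero] at this
    exact this.eventually (gt_mem_nhds one_pos)
  obtain ⟨t0, ht0⟩ := eventually_atTop.1 (E1.and (E2.and (E3.and (E4.and (E5.and (eventually_ge_atTop 1))))))
  refine ⟨t0, fun t ht => ?_⟩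
  obtain ⟨a1, a2, a3, a4, a5, a6⟩ := ht0 t ht
  have htp : 0 < t := by linarith
  set Tt := t ^ (1 + ν/2) with hTt
  have hTt0 : 0 < Tt := by positivity
  set Q := M / (2 * √π) * (1 - 3 * √π / √t) + A / (2 * √π) * (2 ^ (ν + 1) * Real.Gamma (ν/2+1)) * Tt with hQ
  set w := wI P B h₀ m t x with hw
  have hq0 : 0 < t ^ (-3/2:ℝ) := by positivity
  set E := (w - x * t ^ (-3/2:ℝ) * Q) / (x * t ^ (-3/2:ℝ)) with hE
  have hwE : w = x * t ^ (-3/2:ℝ) * (Q + E) := by rw [hE]; field_simp; ring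
  have hEb : |E| ≤ (δ / 4 * x / (12 * c) * Tt + C1 * t ^ (-(1/2)-η1)) / x := by
    rw [hE, abs_div, abs_of_pos (a := x * t ^ (-3/2:ℝ)) (by positivity), div_le_div_iff₀ (by positivity) hx]
    calc _ ≤ t ^ (-3/2:ℝ) * (δ / 4 * x / (12 * c) * Tt + C1 * t ^ (-(1/2)-η1)) * x := by gcongr
      _ = _ := by ring
  have hexpm : Real.exp (-(m t - 2 * t)) = (t+1) ^ (3/2:ℝ) * c * Real.exp (-r t) := by
    rw [hm_eq t, Real.rpow_def_of_pos (by linarith), hc, ← Real.exp_add, ← Real.exp_add]; congr 1; ring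
  have hf : fkppSol P B h₀ m (m t + x) t / (x * Real.exp (-x)) =
      Real.exp (-r t) * ((t+1) ^ (3/2:ℝ) * t ^ (-3/2:ℝ)) * (α * (1 - k * (√t)⁻¹) - b * Tt + c * E) := by
    have e1 : w = Real.exp (x + m t - 2 * t) * fkppSol P B h₀ m (m t + x) t := by
      rw [hw]; unfold wI wsol; rw [if_pos ⟨htp, hx⟩]
    have e2 : fkppSol P B h₀ m (m t + x) t = Real.exp (-x) * (Real.exp (-(m t - 2 * t)) * w) := by
      rw [e1, ← mul_assoc, ← mul_assoc, ← Real.exp_add, ← Real.exp_add]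
      rw [show -x + -(m t - 2 * t) + (x + m t - 2 * t) = 0 by ring, Real.exp_zero, one_mul]
    have e3 : c * Q = α * (1 - k * (√t)⁻¹) - b * Tt := by
      rw [hQ, hα, hb_def, hk]; ring
    rw [e2, hexpm, hwE, ← e3]
    have := Real.exp_pos (-x)
    field_simp
  have hmain := fin_alg (α := α) (b := b) (k := k) (c := c) (r := r t) (u := (√t)⁻¹) (y := t⁻¹) (ρ := Real.exp (-r t))
    (σ := (t+1) ^ (3/2:ℝ) * t ^ (-3/2:ℝ)) (T := Tt) (E := E) (ε := δ / (4 * b)) hαp.le hbpos.le hk0.le hc0.le (by positivity)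
    (inv_le_one_of_one_le₀ (Real.one_le_sqrt.2 a6)) hTt0.le (by rw [inv_pow, Real.sq_sqrt htp.le]) a5.le
    (by have := Real.abs_exp_sub_one_sub_id_le (x := -r t) (by rw [abs_neg]; exact a5.le)
        simpa [sub_neg_eq_add] using this) (fin_sig a6) a4.le
  simp only
  rw [hf, div_eq_mul_inv (3 * √π) √t]
  refine hmain.trans ?_
  have g1 : t ^ (-(1/2)-η1) ≤ t ^ (-(1/2)-η) + t ^ (-(1/2)-κ) := by
    have p1 : 0 < t ^ (-(1/2)-η) := by positivity
    have p2 : 0 < t ^ (-(1/2)-κ) := by positivity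
    rcases min_choice η κ with h | h <;> rw [hη1, h] <;> linarith
  rw [Real.rpow_neg_one] at a2
  have g2 : 12 * c * |E| ≤ δ / 4 * Tt + 12 * c / x * C1 * (t ^ (-(1/2)-η) + t ^ (-(1/2)-κ)) := by
    calc 12 * c * |E| ≤ 12 * c * ((δ / 4 * x / (12 * c) * Tt + C1 * (t ^ (-(1/2)-η) + t ^ (-(1/2)-κ))) / x) := by
          gcongr; exact hEb.trans (by gcongr)
      _ = _ := by field_simp
  have g3 : b * (δ / (4 * b)) * Tt = δ / 4 * Tt := by field_simp
  have g4 : 0 ≤ 12 * c / x * C1 * r t ^ 2 := by positivity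
  have g5 : 0 ≤ α * (1 + 2 * k) * t ^ (-(1/2)-η) := by positivity
  rw [g3]
  nlinarith
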